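/- For every cubic field K there exists an entire function L : ℂ → ℂ such that L(s)·ζ(s) = ζ_K(s) for all s with Re(s) > 1, and this L satisfies the functional equation: setting L_∞(s) := (π^{-s/2}·Γ(s/2))² if Δ(K) > 0 and L_∞(s) := 2·(2π)^{-s}·Γ(s) if Δ(K) < 0, one has |Δ(K)|^{s/2}·L_∞(s)·L(s) = |Δ(K)|^{(1−s)/2}·L_∞(1−s)·L(1−s) for all s with 0 < Re(s) < 1. -/

import Mathlib

open scoped Classical
noncomputable section

open Complex

/-- The Dedekind zeta series of a number field `K`: `∑ N(I)^{-s}` over nonzero ideals `I`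
of the ring of integers, convergent for `Re s > 1`. -/
def dedekindSeries (K : Type*) [Field K] [NumberField K] (s : ℂ) : ℂ :=
  ∑' I : {I : Ideal (NumberField.RingOfIntegers K) // I ≠ ⊥},
    (Ideal.absNorm I.1 : ℂ) ^ (-s)

/-- The archimedean factor of `L(s,ρ_K)`: `Γ_ℝ(s)² = (π^{-s/2}Γ(s/2))²` if `Δ(K) > 0`,
and `Γ_ℂ(s) = 2(2π)^{-s}Γ(s)` if `Δ(K) < 0`. -/
def LInfty (K : Type*) [Field K] [NumberField K] (s : ℂ) : ℂ :=
  if 0 < NumberField.discr K then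
    ((Real.pi : ℂ) ^ (-s / 2) * Complex.Gamma (s / 2)) ^ 2
  else
    2 * (2 * (Real.pi : ℂ)) ^ (-s) * Complex.Gamma s

open MeasureTheory Set in
/-- Multi-dimensional unfolding over unit boxes. -/
lemma hasSum_integral_unitBox {ι : Type*} [Fintype ι] (G : (ι → ℝ) → ℂ) (hG : Integrable G) :
    HasSum (fun n : ι → ℤ => ∫ x in {x : ι → ℝ | ∀ i, x i ∈ Ioc (0 : ℝ) (0 + 1)},
      G (x + fun i => (n i : ℝ))) (∫ x, G x) := by
  let S : (ι → ℤ) → Set (ι → ℝ) := fun n => {x | ∀ i, x i ∈ Ioc (n i : ℝ) (n i + 1)}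
  have hS : ∀ n, MeasurableSet (S n) := fun n => MeasurableSet.univ_pi' fun i => measurableSet_Ioc
  have hdis : Pairwise (Function.onFun Disjoint S) := by
    intro m n hmn
    rw [Function.onFun, Set.disjoint_left]
    intro x hx hy
    apply hmn
    ext i
    have h1 := hx i
    have h2 := hy i
    have e1 : ⌈x i⌉ = m i + 1 := by rw [Int.ceil_eq_iff]; push_cast; constructor <;> linarith [h1.1, h1.2]
    have e2 : ⌈x i⌉ = n i + 1 := by rw [Int.ceil_eq_iff]; push_cast; constructor <;> linarith [h2.1, h2.2]
    omega
  have hU : (⋃ n, S n) = univ := by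
    ext x
    simp only [mem_iUnion, mem_univ, iff_true]
    refine ⟨fun i => ⌈x i⌉ - 1, fun i => ?_⟩
    push_cast
    constructor <;> linarith [Int.ceil_lt_add_one (x i), Int.le_ceil (x i)]
  have := hasSum_integral_iUnion (f := G) (μ := volume) hS hdis (by rw [hU]; exact hG.integrableOn)
  rw [hU, Measure.restrict_univ] at this
  rw [show (fun n : ι → ℤ => ∫ x in {x : ι → ℝ | ∀ i, x i ∈ Ioc (0 : ℝ) (0 + 1)},
      G (x + fun i => (n i : ℝ))) = fun n => ∫ x in S n, G x from ?_]
  · exact this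
  funext n
  have hmp := measurePreserving_add_right (volume : Measure (ι → ℝ)) (fun i => (n i : ℝ))
  have he := (MeasurableEquiv.addRight (fun i => (n i : ℝ))).measurableEmbedding
  have := hmp.setIntegral_preimage_emb he G (S n)
  rw [← this]
  congr 2
  ext x
  simp only [mem_ofPred_eq, mem_preimage, S, Pi.add_apply, mem_Ioc]
  refine forall_congr' fun i => ?_
  constructor <;> rintro ⟨h1, h2⟩ <;> constructor <;> linarith

open MeasureTheory Set in
lemma integrable_of_translate_bound {ι : Type*} [Fintype ι] (f : (ι → ℝ) → ℂ) (hf : Continuous f)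
    (u : (ι → ℤ) → ℝ) (hu : Summable u)
    (hb : ∀ n : ι → ℤ, ∀ x : ι → ℝ, ‖x‖ ≤ 1 → ‖f (x + fun i => (n i : ℝ))‖ ≤ u n) :
    Integrable f := by
  let S : (ι → ℤ) → Set (ι → ℝ) := fun n => {x | ∀ i, x i ∈ Icc (n i : ℝ) (n i + 1)}
  have hS : ∀ n, S n = Icc (fun i => (n i : ℝ)) (fun i => (n i : ℝ) + 1) := by
    intro n; ext x; simp only [S, mem_ofPred_eq, mem_Icc, Pi.le_def]
    exact ⟨fun h => ⟨fun i => (h i).1, fun i => (h i).2⟩, fun h i => ⟨h.1 i, h.2 i⟩⟩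
  have hU : (⋃ n, S n) = univ := by
    ext x
    simp only [mem_iUnion, mem_univ, iff_true]
    refine ⟨fun i => ⌊x i⌋, fun i => ?_⟩
    constructor <;> linarith [Int.floor_le (x i), Int.lt_floor_add_one (x i)]
  have hb' : ∀ n, ∀ x ∈ S n, ‖f x‖ ≤ u n := by
    intro n x hx
    have := hb n (x - fun i => (n i : ℝ)) ?_
    · simpa using this
    · rw [pi_norm_le_iff_of_nonneg zero_le_one]
      intro i
      rw [Real.norm_eq_abs, abs_le]
      have := hx i
      simp only [Pi.sub_apply]
      constructor <;> linarith [this.1, this.2]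
  have hvol : ∀ n, volume (S n) = 1 := by
    intro n; rw [hS, Real.volume_Icc_pi]; simp
  rw [← integrableOn_univ, ← hU]
  apply integrableOn_iUnion_of_summable_integral_norm
  · intro n; rw [hS]; exact hf.continuousOn.integrableOn_Icc
  · refine Summable.of_nonneg_of_le (fun n => integral_nonneg fun x => norm_nonneg _) (fun n => ?_) hu
    have hm : MeasurableSet (S n) := by rw [hS]; exact measurableSet_Icc
    calc ∫ x in S n, ‖f x‖ ≤ ∫ x in S n, u n := by
          apply setIntegral_mono_on _ _ hm (hb' n)
          · rw [hS]; exact hf.norm.continuousOn.integrableOn_Icc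
          · rw [hS]; exact continuousOn_const.integrableOn_Icc
      _ = u n := by simp [measureReal_def, hvol]

open MeasureTheory Set UnitAddTorus in
/-- Multi-dimensional Poisson summation. -/
theorem poisson_pi {ι : Type*} [Fintype ι] (f : (ι → ℝ) → ℂ) (hf : Continuous f)
    (hb : ∀ R : ℝ, ∃ u : (ι → ℤ) → ℝ, Summable u ∧
      ∀ n : ι → ℤ, ∀ x : ι → ℝ, ‖x‖ ≤ R → ‖f (x + fun i => (n i : ℝ))‖ ≤ u n)
    (hs : Summable fun k : ι → ℤ => ∫ x : ι → ℝ, mFourier (-k) (fun i => (x i : UnitAddCircle)) * f x)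
    (z : ι → ℝ) :
    HasSum (fun k : ι → ℤ => (∫ x : ι → ℝ, mFourier (-k) (fun i => (x i : UnitAddCircle)) * f x) *
      mFourier k (fun i => (z i : UnitAddCircle))) (∑' n : ι → ℤ, f (z + fun i => (n i : ℝ))) := by
  have hfi : Integrable f := by
    obtain ⟨u, hu, h⟩ := hb 1
    exact integrable_of_translate_bound f hf u hu h
  let p : (ι → ℝ) → UnitAddTorus ι := fun x i => (x i : UnitAddCircle)
  have hpq : IsOpenQuotientMap p := IsOpenQuotientMap.piMap fun i => QuotientAddGroup.isOpenQuotientMap_mk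
  let F0 : (ι → ℝ) → ℂ := fun z => ∑' n : ι → ℤ, f (z + fun i => (n i : ℝ))
  have hF0c : Continuous F0 := by
    rw [continuous_iff_continuousAt]
    intro x
    obtain ⟨u, hu, h⟩ := hb (‖x‖ + 1)
    have : ContinuousOn F0 (Metric.ball 0 (‖x‖ + 1)) := by
      refine continuousOn_tsum (fun n => ?_) hu (fun n y hy => h n y ?_)
      · exact (hf.comp (continuous_id.add continuous_const)).continuousOn
      · simpa using (mem_ball_zero_iff.mp hy).le
    exact this.continuousAt (Metric.isOpen_ball.mem_nhds (by simp))
  have hper : ∀ x y, p x = p y → F0 x = F0 y := by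
    intro x y hxy
    have : ∀ i, ∃ m : ℤ, x i = y i + m := by
      intro i
      have := congrFun hxy i
      simp only [p] at this
      rw [← sub_eq_zero, ← AddCircle.coe_sub, AddCircle.coe_eq_zero_iff] at this
      obtain ⟨m, hm⟩ := this
      exact ⟨m, by simp at hm; linarith⟩
    choose m hm using this
    have hx : x = y + fun i => (m i : ℝ) := funext hm
    simp only [F0]
    rw [← (Equiv.addLeft m).tsum_eq (fun n : ι → ℤ => f (y + fun i => (n i : ℝ)))]
    refine tsum_congr fun n => ?_
    congr 1
    rw [hx]
    ext i
    simp [add_assoc]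
  let F : C(UnitAddTorus ι, ℂ) :=
    ⟨fun t => F0 (Function.surjInv hpq.surjective t), by
      rw [hpq.isQuotientMap.continuous_iff]
      convert hF0c using 1
      ext x
      exact hper _ _ (Function.surjInv_eq hpq.surjective (p x))⟩
  have hFp : ∀ x, F (p x) = F0 x := fun x => hper _ _ (Function.surjInv_eq hpq.surjective (p x))
  have hmper : ∀ (k : ι → ℤ) (x : ι → ℝ) (n : ι → ℤ), p (x + fun i => (n i : ℝ)) = p x := by
    intro k x n
    ext i
    simp only [p, Pi.add_apply, AddCircle.coe_add, add_eq_left, AddCircle.coe_eq_zero_iff]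
    exact ⟨n i, by simp⟩
  have hcoef : ∀ k, mFourierCoeff F k = ∫ x : ι → ℝ, mFourier (-k) (p x) * f x := by
    intro k
    rw [mFourierCoeff_eq_integral F k 0]
    have hGi : Integrable fun x => mFourier (-k) (p x) * f x := by
      refine hfi.bdd_mul (c := 1) ?_ ?_
      · exact ((mFourier (-k)).continuous.comp hpq.continuous).aestronglyMeasurable
      · refine Filter.Eventually.of_forall fun x => ?_
        exact ((mFourier (-k)).norm_coe_le_norm _).trans mFourier_norm.le
    have h1 := hasSum_integral_unitBox _ hGi
    rw [← h1.tsum_eq]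
    obtain ⟨u, hu, h⟩ := hb 1
    have hbx : ∀ x ∈ {x : ι → ℝ | ∀ i, x i ∈ Ioc (0 : ℝ) (0 + 1)}, ‖x‖ ≤ 1 := by
      intro x hx
      rw [pi_norm_le_iff_of_nonneg zero_le_one]
      intro i
      rw [Real.norm_eq_abs, abs_le]
      constructor <;> linarith [(hx i).1, (hx i).2]
    have hB : MeasurableSet {x : ι → ℝ | ∀ i, x i ∈ Ioc (0 : ℝ) (0 + 1)} :=
      MeasurableSet.univ_pi' fun i => measurableSet_Ioc
    have hBv : volume {x : ι → ℝ | ∀ i, x i ∈ Ioc (0 : ℝ) (0 + 1)} = 1 := by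
      have : {x : ι → ℝ | ∀ i, x i ∈ Ioc (0 : ℝ) (0 + 1)} = univ.pi fun _ => Ioc (0 : ℝ) (0 + 1) := by
        ext; simp
      rw [this, volume_pi_pi]; simp
    have h2 : HasSum (fun n : ι → ℤ => ∫ x in {x : ι → ℝ | ∀ i, x i ∈ Ioc (0 : ℝ) (0 + 1)},
        mFourier (-k) (p x) * f (x + fun i => (n i : ℝ)))
        (∫ x in {x : ι → ℝ | ∀ i, x i ∈ Ioc (0 : ℝ) (0 + 1)},
          ∑' n : ι → ℤ, mFourier (-k) (p x) * f (x + fun i => (n i : ℝ))) := by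
      have h_int : ∀ n : ι → ℤ, Integrable (fun x => mFourier (-k) (p x) * f (x + fun i => (n i : ℝ)))
          (volume.restrict {x : ι → ℝ | ∀ i, x i ∈ Ioc (0 : ℝ) (0 + 1)}) := by
        intro n
        have := hGi.comp_add_right (fun i => (n i : ℝ))
        simp only [hmper k] at this
        exact this.integrableOn
      apply hasSum_integral_of_summable_integral_norm h_int
      refine Summable.of_nonneg_of_le (fun n => integral_nonneg fun x => norm_nonneg _) (fun n => ?_) hu
      calc _ ≤ ∫ x in {x : ι → ℝ | ∀ i, x i ∈ Ioc (0 : ℝ) (0 + 1)}, u n := by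
            apply setIntegral_mono_on (h_int n).norm _ hB
            · intro x hx
              rw [norm_mul]
              have h1 : ‖mFourier (-k) (p x)‖ ≤ 1 :=
                ((mFourier (-k)).norm_coe_le_norm _).trans mFourier_norm.le
              have h2 := h n x (hbx x hx)
              nlinarith [norm_nonneg (f (x + fun i => (n i : ℝ))), norm_nonneg (mFourier (-k) (p x))]
            · apply integrableOn_const
              · rw [hBv]; simp
              · simp
        _ = u n := by
          rw [setIntegral_const, measureReal_def, hBv]; simp
    simp only [hmper k]
    rw [h2.tsum_eq]
    simp only [Pi.zero_apply]
    refine setIntegral_congr_fun hB fun x _ => ?_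
    change mFourier (-k) (p x) • F (p x) = _
    rw [hFp, smul_eq_mul, tsum_mul_left]
  have hsum : Summable (mFourierCoeff F) := by
    convert hs using 2 with k
    exact hcoef k
  have := hasSum_mFourier_series_apply_of_summable hsum (p z)
  rw [hFp] at this
  convert this using 2 with k
  rw [hcoef, smul_eq_mul]

lemma summable_int_pi_norm_rpow {ι : Type*} [Fintype ι] (r : ℝ) (hr : r < -(Fintype.card ι : ℝ)) :
    Summable fun m : ι → ℤ => ‖fun i => (m i : ℝ)‖ ^ r := by
  let b := Pi.basisFun ℝ ι
  let L := Submodule.span ℤ (Set.range b)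
  let bL := b.restrictScalars ℤ
  have h := ZLattice.summable_norm_rpow L r (by
    rw [Module.finrank_eq_card_basis bL]; exact hr)
  rw [← bL.equivFun.symm.toEquiv.summable_iff] at h
  refine h.congr fun m => ?_
  simp only [Function.comp_apply]
  congr 1
  rw [Submodule.coe_norm]
  congr 1
  ext i
  simp [Module.Basis.equivFun_symm_apply, bL, b, Pi.basisFun_apply, Finset.sum_apply, Pi.single_apply]

lemma summable_int_pi_exp_neg_norm_sq {ι : Type*} [Fintype ι] {c : ℝ} (hc : 0 < c) :
    Summable fun m : ι → ℤ => Real.exp (-c * ‖fun i => (m i : ℝ)‖ ^ 2) := by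
  let N : ℕ := Fintype.card ι + 1
  have h := summable_int_pi_norm_rpow (ι := ι) (-(2 * N : ℝ)) (by simp [N]; linarith [Nat.cast_nonneg (α := ℝ) (Fintype.card ι)])
  have h1 : Filter.Tendsto (fun x : ℝ => x ^ N * Real.exp (-c * x)) Filter.atTop (nhds 0) := by
    simpa using tendsto_rpow_mul_exp_neg_mul_atTop_nhds_zero N c hc
  have hbd : ∃ C, ∀ x : ℝ, 0 ≤ x → x ^ N * Real.exp (-c * x) ≤ C := by
    obtain ⟨X, hX⟩ := Filter.eventually_atTop.mp (h1.eventually_lt_const zero_lt_one)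
    obtain ⟨C, hC⟩ := (isCompact_Icc (a := (0:ℝ)) (b := X)).exists_bound_of_continuousOn
      (f := fun x : ℝ => x ^ N * Real.exp (-c * x)) (by fun_prop)
    refine ⟨max C 1, fun x hx => ?_⟩
    by_cases hxX : x ≤ X
    · exact (le_abs_self _).trans ((hC x ⟨hx, hxX⟩).trans (le_max_left _ _))
    · exact (hX x (not_le.mp hxX).le).le.trans (le_max_right _ _)
  obtain ⟨C, hC⟩ := hbd
  have h0 : Summable fun m : ι → ℤ => C * ‖fun i => (m i : ℝ)‖ ^ (-(2 * N : ℝ)) + if m = 0 then 1 else 0 :=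
    (h.mul_left C).add (summable_of_hasFiniteSupport ((Set.finite_singleton (0 : ι → ℤ)).subset (by
      intro m hm; by_contra h; simp_all)))
  refine Summable.of_nonneg_of_le (fun m => (Real.exp_pos _).le) (fun m => ?_) h0
  by_cases hm : m = 0
  · subst hm
    have : (fun i : ι => (((0 : ι → ℤ) i : ℤ) : ℝ)) = 0 := by ext; simp
    simp only [this, norm_zero]
    have : (-(2 * N : ℝ)) ≠ 0 := by simp [N]; positivity
    rw [Real.zero_rpow this]; simp
  · have hpos : 0 < ‖fun i => (m i : ℝ)‖ := by
      rw [norm_pos_iff]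
      contrapose! hm
      ext i
      simpa using congrFun hm i
    have := hC (‖fun i => (m i : ℝ)‖ ^ 2) (by positivity)
    rw [if_neg hm, add_zero, Real.rpow_neg hpos.le, ← div_eq_mul_inv, le_div_iff₀ (by positivity)]
    have e : ‖fun i => (m i : ℝ)‖ ^ (2 * N : ℝ) = (‖fun i => (m i : ℝ)‖ ^ 2) ^ N := by
      rw [← pow_mul, ← Real.rpow_natCast]; push_cast; rfl
    rw [e, mul_comm]
    exact this

lemma mFourier_coe_eq_cexp {ι : Type*} [Fintype ι] (k : ι → ℤ) (x : ι → ℝ) :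
    UnitAddTorus.mFourier k (fun i => (x i : UnitAddCircle)) =
      cexp (2 * Real.pi * I * ∑ i, (k i : ℂ) * x i) := by
  simp only [UnitAddTorus.mFourier, ContinuousMap.coe_mk, fourier_coe_apply]
  rw [← Complex.exp_sum, Finset.mul_sum]
  congr 1
  refine Finset.sum_congr rfl fun i _ => ?_
  push_cast; ring

open Matrix in
lemma exists_norm_sq_le_quad {ι : Type*} [Fintype ι] {A : Matrix ι ι ℝ} (hA : A.PosDef) :
    ∃ c > 0, ∀ x : ι → ℝ, c * ‖x‖ ^ 2 ≤ x ⬝ᵥ A *ᵥ x := by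
  have hcont : Continuous fun x : ι → ℝ => x ⬝ᵥ A *ᵥ x := by
    simp only [dotProduct, mulVec]; fun_prop
  by_cases hι : Nonempty ι
  swap
  · refine ⟨1, one_pos, fun x => ?_⟩
    rw [not_nonempty_iff] at hι
    have : x = 0 := Subsingleton.elim _ _
    simp [this]
  obtain ⟨x0, hx0, hmin⟩ := (isCompact_sphere (0 : ι → ℝ) 1).exists_isMinOn
    (NormedSpace.sphere_nonempty.mpr zero_le_one) hcont.continuousOn
  have hx0' : x0 ≠ 0 := by rintro rfl; simp at hx0
  refine ⟨_, by simpa using hA.dotProduct_mulVec_pos hx0', fun x => ?_⟩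
  by_cases hx : x = 0
  · simp [hx]
  have hn : 0 < ‖x‖ := norm_pos_iff.mpr hx
  have := hmin (show ‖x‖⁻¹ • x ∈ Metric.sphere (0 : ι → ℝ) 1 by
    simp [norm_smul, hn.ne'])
  simp only [Set.mem_ofPred_eq, smul_dotProduct, mulVec_smul, dotProduct_smul, smul_eq_mul] at this
  calc _ ≤ ‖x‖⁻¹ * (‖x‖⁻¹ * x ⬝ᵥ A *ᵥ x) * ‖x‖ ^ 2 := by gcongr
    _ = _ := by field_simp

open Matrix MeasureTheory MatrixOrder in
/-- Fourier transform of a multivariate Gaussian. -/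
lemma integral_gaussian_quad {ι : Type*} [Fintype ι] {A : Matrix ι ι ℝ} (hA : A.PosDef) (k : ι → ℝ) :
    ∫ x : ι → ℝ, cexp (2 * Real.pi * I * ∑ i, (-(k i) : ℂ) * x i) *
      cexp (-Real.pi * ((x ⬝ᵥ A *ᵥ x : ℝ) : ℂ)) =
    ((Real.sqrt A.det)⁻¹ : ℝ) * cexp (-Real.pi * ((k ⬝ᵥ A⁻¹ *ᵥ k : ℝ) : ℂ)) := by
  obtain ⟨S, hS⟩ : ∃ S : Matrix ι ι ℝ, A = Sᵀ * S := by
    obtain ⟨S, hS, -, h⟩ := CFC.exists_sqrt_of_isSelfAdjoint_of_quasispectrumRestricts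
      hA.posSemidef.isHermitian (QuasispectrumRestricts.nnreal_of_nonneg hA.posSemidef.nonneg)
    refine ⟨S, ?_⟩
    rw [← h, ← conjTranspose_eq_transpose_of_trivial, ← star_eq_conjTranspose, hS.star_eq]
    
  have hdet : A.det = S.det ^ 2 := by rw [hS, det_mul, det_transpose, sq]
  have hdS : S.det ≠ 0 := by
    have := hA.det_pos
    rw [hdet] at this
    exact fun h => by simp [h] at this
  have hSu : IsUnit S.det := isUnit_iff_ne_zero.mpr hdS
  have hsq : Real.sqrt A.det = |S.det| := by rw [hdet, Real.sqrt_sq_eq_abs]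
  have hQ : ∀ x, x ⬝ᵥ A *ᵥ x = ∑ i, (S *ᵥ x) i ^ 2 := by
    intro x
    rw [hS, ← mulVec_mulVec, dotProduct_mulVec, vecMul_transpose]
    simp [dotProduct, sq]
  let l := (S⁻¹)ᵀ *ᵥ k
  have hl : ∀ x, ∑ i, k i * x i = ∑ i, l i * (S *ᵥ x) i := by
    intro x
    change k ⬝ᵥ x = l ⬝ᵥ (S *ᵥ x)
    simp only [l]
    rw [dotProduct_mulVec, mulVec_transpose, vecMul_vecMul, nonsing_inv_mul _ hSu, vecMul_one]
  have hQ' : k ⬝ᵥ A⁻¹ *ᵥ k = ∑ i, l i ^ 2 := by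
    rw [hS, Matrix.mul_inv_rev, ← mulVec_mulVec, dotProduct_mulVec, ← mulVec_transpose]
    simp [dotProduct, sq, l, transpose_nonsing_inv]
  let G : (ι → ℝ) → ℂ := fun y => cexp (-(Real.pi : ℂ) * ∑ i, (y i : ℂ) ^ 2 + ∑ i, (-2 * Real.pi * I * l i) * y i)
  have h_int : ∀ x : ι → ℝ, cexp (2 * Real.pi * I * ∑ i, (-(k i) : ℂ) * x i) *
      cexp (-Real.pi * ((x ⬝ᵥ A *ᵥ x : ℝ) : ℂ)) = G (Matrix.toLin' S x) := by
    intro x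
    simp only [G]
    rw [← Complex.exp_add, hQ]
    congr 1
    have := congrArg (fun r : ℝ => (r : ℂ)) (hl x)
    push_cast at this
    simp only [toLin'_apply]
    push_cast
    rw [add_comm]
    congr 1
    simp only [neg_mul, Finset.sum_neg_distrib, mul_assoc, ← Finset.mul_sum]
    rw [this]; ring
  simp_rw [h_int]
  have hmap := Real.map_matrix_volume_pi_eq_smul_volume_pi hdS
  have he : MeasurableEmbedding (Matrix.toLin' S) := by
    have hinj : Function.Injective (Matrix.toLin' S) := by
      rw [← LinearMap.ker_eq_bot, ← LinearMap.isUnit_iff_ker_eq_bot, LinearMap.isUnit_iff_isUnit_det]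
      simpa using hSu
    exact (LinearMap.continuous_of_finiteDimensional _).measurableEmbedding hinj
  rw [← he.integral_map (μ := volume), hmap, integral_smul_measure]
  simp only [G]
  rw [GaussianFourier.integral_cexp_neg_mul_sum_add (by simpa using Real.pi_pos)]
  rw [div_self (by exact_mod_cast Real.pi_ne_zero), one_cpow, one_mul, ENNReal.toReal_ofReal (abs_nonneg _), abs_inv,
    hsq, hQ', Complex.real_smul]
  congr 2
  simp only [mul_pow, ← Finset.mul_sum]
  push_cast
  have : (Real.pi : ℂ) ≠ 0 := by exact_mod_cast Real.pi_ne_zero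
  field_simp
  rw [I_sq]; ring

open Matrix in
lemma theta_shift_hasSum {ι : Type*} [Fintype ι] {A : Matrix ι ι ℝ} (hA : A.PosDef) (z : ι → ℝ) :
    HasSum (fun k : ι → ℤ => ((Real.sqrt A.det)⁻¹ : ℝ) *
        cexp (-Real.pi * (((fun i => (k i : ℝ)) ⬝ᵥ A⁻¹ *ᵥ (fun i => (k i : ℝ)) : ℝ) : ℂ)) *
        cexp (2 * Real.pi * I * ∑ i, (k i : ℂ) * z i))
      (∑' m : ι → ℤ, cexp (-Real.pi * (((z + fun i => (m i : ℝ)) ⬝ᵥ A *ᵥ (z + fun i => (m i : ℝ)) : ℝ) : ℂ))) := by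
  have hI : ∀ k : ι → ℤ, ∫ x : ι → ℝ, UnitAddTorus.mFourier (-k) (fun i => (x i : UnitAddCircle)) *
      cexp (-Real.pi * ((x ⬝ᵥ A *ᵥ x : ℝ) : ℂ)) = ((Real.sqrt A.det)⁻¹ : ℝ) *
        cexp (-Real.pi * (((fun i => (k i : ℝ)) ⬝ᵥ A⁻¹ *ᵥ (fun i => (k i : ℝ)) : ℝ) : ℂ)) := by
    intro k
    rw [← integral_gaussian_quad hA]
    congr 1
    ext x
    rw [mFourier_coe_eq_cexp]
    simp
  obtain ⟨c, hc, hcA⟩ := exists_norm_sq_le_quad hA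
  obtain ⟨c', hc', hcA'⟩ := exists_norm_sq_le_quad hA.inv
  have hnorm : ∀ r : ℝ, ‖cexp (-Real.pi * (r : ℂ))‖ = Real.exp (-Real.pi * r) := by
    intro r
    rw [Complex.norm_exp]; congr 1
    rw [← ofReal_neg, ← ofReal_mul, ofReal_re]
  have := poisson_pi (fun x : ι → ℝ => cexp (-Real.pi * ((x ⬝ᵥ A *ᵥ x : ℝ) : ℂ))) ?_ ?_ ?_ z
  · simp only [hI] at this
    simpa only [mFourier_coe_eq_cexp] using this
  · simp only [dotProduct, mulVec]; fun_prop
  · intro R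
    refine ⟨fun m => Real.exp (Real.pi * c * R ^ 2) * Real.exp (-(Real.pi * c / 2) * ‖fun i => (m i : ℝ)‖ ^ 2), ?_, ?_⟩
    · exact (summable_int_pi_exp_neg_norm_sq (by positivity)).mul_left _
    · intro m x hx
      simp only
      rw [hnorm, ← Real.exp_add, Real.exp_le_exp]
      have h1 := hcA (x + fun i => (m i : ℝ))
      set y : ι → ℝ := fun i => (m i : ℝ)
      have h2 : ‖y‖ ≤ ‖x + y‖ + R := by
        calc ‖y‖ = ‖(x + y) - x‖ := by simp
          _ ≤ _ := (norm_sub_le _ _).trans (by gcongr)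
      have h3 : ‖y‖ ^ 2 ≤ 2 * ‖x + y‖ ^ 2 + 2 * R ^ 2 := by
        nlinarith [norm_nonneg y, norm_nonneg (x + y), norm_nonneg x, sq_nonneg (‖x + y‖ - R)]
      have h4 : Real.pi * (c * ‖y‖ ^ 2) ≤ Real.pi * (c * (2 * ‖x + y‖ ^ 2 + 2 * R ^ 2)) := by gcongr
      have h5 : Real.pi * (c * ‖x + y‖ ^ 2) ≤ Real.pi * ((x + y) ⬝ᵥ A *ᵥ (x + y)) := by gcongr
      nlinarith
  · simp only [hI]
    refine Summable.mul_left _ (Summable.of_norm ?_)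
    refine Summable.of_nonneg_of_le (fun m => norm_nonneg _) (fun m => ?_)
      (summable_int_pi_exp_neg_norm_sq (c := Real.pi * c') (by positivity))
    rw [hnorm, Real.exp_le_exp]
    have := hcA' (fun i => (m i : ℝ))
    have h5 : Real.pi * (c' * ‖fun i => (m i : ℝ)‖ ^ 2) ≤ Real.pi * _ := mul_le_mul_of_nonneg_left this Real.pi_pos.le
    linarith

/-- The finite Fourier transform of a function on `ι → ℤ` of period `M`. -/
def finFourier {ι : Type*} [Fintype ι] (M : ℕ) (φ : (ι → ℤ) → ℂ) (k : ι → ℤ) : ℂ :=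
  ∑ r : ι → Fin M, φ (fun i => ((r i : ℕ) : ℤ)) * cexp (2 * Real.pi * I * ∑ i, (k i : ℂ) * (((r i : ℕ) : ℝ) / M : ℝ))

lemma norm_finFourier_le {ι : Type*} [Fintype ι] (M : ℕ) (φ : (ι → ℤ) → ℂ) (k : ι → ℤ) :
    ‖finFourier M φ k‖ ≤ ∑ r : ι → Fin M, ‖φ (fun i => ((r i : ℕ) : ℤ))‖ := by
  refine (norm_sum_le _ _).trans (Finset.sum_le_sum fun r _ => ?_)
  rw [norm_mul]
  refine mul_le_of_le_one_right (norm_nonneg _) (le_of_eq ?_)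
  have : (2 * Real.pi * I * ∑ i, (k i : ℂ) * (((r i : ℕ) : ℝ) / M : ℝ)) =
      ((2 * Real.pi * ∑ i, (k i : ℝ) * (((r i : ℕ) : ℝ) / M : ℝ) : ℝ) : ℂ) * I := by
    push_cast; ring
  rw [this, norm_exp_ofReal_mul_I]

lemma finFourier_one {ι : Type*} [Fintype ι] (φ : (ι → ℤ) → ℂ) (k : ι → ℤ) :
    finFourier 1 φ k = φ 0 := by
  simp [finFourier]; rfl

/-- The bijection writing an integer vector as a residue plus a multiple of `M`. -/
def piDivMod (ι : Type*) (M : ℕ) [NeZero M] : (ι → ℤ) ≃ (ι → ℤ) × (ι → Fin M) :=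
  (Equiv.piCongrRight fun _ => Int.divModEquiv M).trans (Equiv.arrowProdEquivProdArrow _ _ _)

lemma piDivMod_symm_apply {ι : Type*} (M : ℕ) [NeZero M] (l : ι → ℤ) (r : ι → Fin M) :
    (piDivMod ι M).symm (l, r) = fun i => ((r i : ℕ) : ℤ) + M * l i := by
  ext i
  change (Int.divModEquiv M).symm (l i, r i) = _
  simp [Int.divModEquiv]; ring

open Matrix in
/-- Theta inversion with a periodic weight. -/
theorem theta_periodic {ι : Type*} [Fintype ι] {A : Matrix ι ι ℝ} (hA : A.PosDef) (M : ℕ) [NeZero M]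
    (φ : (ι → ℤ) → ℂ) (hφ : ∀ m l : ι → ℤ, φ (m + (M : ℤ) • l) = φ m) :
    ∑' m : ι → ℤ, φ m * cexp (-Real.pi * (((fun i => (m i : ℝ)) ⬝ᵥ A *ᵥ (fun i => (m i : ℝ)) : ℝ) : ℂ)) =
    (((M : ℝ) ^ Fintype.card ι * Real.sqrt A.det)⁻¹ : ℝ) * ∑' k : ι → ℤ, finFourier M φ k *
      cexp (-Real.pi * ((((fun i => (k i : ℝ)) ⬝ᵥ A⁻¹ *ᵥ (fun i => (k i : ℝ))) / (M : ℝ) ^ 2 : ℝ) : ℂ)) := by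
  have hM : (0 : ℝ) < M := by exact_mod_cast Nat.pos_of_ne_zero (NeZero.ne M)
  have hA2 : (((M : ℝ) ^ 2) • A).PosDef := hA.smul (by positivity)
  obtain ⟨c, hc, hcA⟩ := exists_norm_sq_le_quad hA
  have hnorm : ∀ r : ℝ, ‖cexp (-Real.pi * (r : ℂ))‖ = Real.exp (-Real.pi * r) := by
    intro r
    rw [Complex.norm_exp]; congr 1
    rw [← ofReal_neg, ← ofReal_mul, ofReal_re]
  have hred : ∀ (l : ι → ℤ) (r : ι → Fin M), φ ((piDivMod ι M).symm (l, r)) = φ fun i => ((r i : ℕ) : ℤ) := by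
    intro l r
    rw [piDivMod_symm_apply, ← hφ (fun i => ((r i : ℕ) : ℤ)) l]
    rfl
  have hsum : Summable fun m : ι → ℤ => φ m * cexp (-Real.pi * (((fun i => (m i : ℝ)) ⬝ᵥ A *ᵥ (fun i => (m i : ℝ)) : ℝ) : ℂ)) := by
    refine Summable.of_norm (Summable.of_nonneg_of_le (fun m => norm_nonneg _) (fun m => ?_)
      ((summable_int_pi_exp_neg_norm_sq (c := Real.pi * c) (by positivity)).mul_left
        (∑ r : ι → Fin M, ‖φ (fun i => ((r i : ℕ) : ℤ))‖)))
    rw [norm_mul, hnorm]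
    refine mul_le_mul ?_ (Real.exp_le_exp.mpr ?_) (Real.exp_pos _).le (Finset.sum_nonneg fun _ _ => norm_nonneg _)
    · obtain ⟨⟨l, r⟩, rfl⟩ := (piDivMod ι M).symm.surjective m
      rw [hred]
      exact Finset.single_le_sum (f := fun r : ι → Fin M => ‖φ (fun i => ((r i : ℕ) : ℤ))‖)
        (fun _ _ => norm_nonneg _) (Finset.mem_univ r)
    · have := hcA (fun i => (m i : ℝ))
      have h5 : Real.pi * (c * ‖fun i => (m i : ℝ)‖ ^ 2) ≤ Real.pi * _ := mul_le_mul_of_nonneg_left this Real.pi_pos.le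
      linarith
  let e := (Equiv.prodComm (ι → Fin M) (ι → ℤ)).trans (piDivMod ι M).symm
  have he : ∀ r l, e (r, l) = (piDivMod ι M).symm (l, r) := fun r l => rfl
  rw [← e.summable_iff] at hsum
  rw [← e.tsum_eq]
  erw [hsum.tsum_prod]
  rw [tsum_fintype]
  simp only [Function.comp_apply, he, hred, tsum_mul_left]
  have hvec : ∀ (r : ι → Fin M) (l : ι → ℤ), (fun i => (((piDivMod ι M).symm (l, r) i : ℤ) : ℝ)) =
      (M : ℝ) • ((fun i => ((r i : ℕ) : ℝ) / M) + fun i => (l i : ℝ)) := by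
    intro r l
    rw [piDivMod_symm_apply]
    ext i
    simp only [Pi.smul_apply, Pi.add_apply, smul_eq_mul]
    push_cast
    field_simp
  have hq : ∀ x : ι → ℝ, ((M : ℝ) • x) ⬝ᵥ A *ᵥ ((M : ℝ) • x) = x ⬝ᵥ (((M : ℝ) ^ 2) • A) *ᵥ x := by
    intro x
    simp only [smul_dotProduct, mulVec_smul, dotProduct_smul, smul_mulVec, smul_eq_mul]
    ring
  simp only [hvec, hq]
  have hT := fun r : ι → Fin M => theta_shift_hasSum hA2 (fun i => ((r i : ℕ) : ℝ) / M)
  have hT2 := hasSum_sum (s := Finset.univ) fun r _ => (hT r).mul_left (φ fun i => ((r i : ℕ) : ℤ))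
  rw [← hT2.tsum_eq, ← tsum_mul_left]
  refine tsum_congr fun k => ?_
  have hdet : Real.sqrt (((M : ℝ) ^ 2) • A).det = (M : ℝ) ^ Fintype.card ι * Real.sqrt A.det := by
    rw [det_smul, Real.sqrt_mul (by positivity), ← pow_mul, mul_comm 2, pow_mul, Real.sqrt_sq (by positivity)]
  have hinv : (((M : ℝ) ^ 2) • A)⁻¹ = ((M : ℝ) ^ 2)⁻¹ • A⁻¹ := by
    have := inv_smul' (A := A) (Units.mk0 ((M : ℝ) ^ 2) (by positivity)) (isUnit_iff_ne_zero.mpr hA.det_pos.ne')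
    exact this
  rw [finFourier, Finset.sum_mul, Finset.mul_sum]
  refine Finset.sum_congr rfl fun r _ => ?_
  rw [hdet, hinv, smul_mulVec, dotProduct_smul, smul_eq_mul, div_eq_inv_mul]
  ring

open NumberField in
/-- The infinite place under a complex embedding (as a `ℚ`-algebra map). -/
abbrev placeOf {K : Type*} [Field K] [NumberField K] (σ : K →ₐ[ℚ] ℂ) : InfinitePlace K :=
  InfinitePlace.mk (σ : K →+* ℂ)

open NumberField in
lemma sum_placeOf {K : Type*} [Field K] [NumberField K] {E : Type*} [AddCommMonoid E]
    (F : InfinitePlace K → E) : ∑ σ : K →ₐ[ℚ] ℂ, F (placeOf σ) = ∑ w, w.mult • F w := by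
  rw [← Fintype.sum_equiv (RingHom.equivRatAlgHom (R := K) (S := ℂ)) (fun f => F (InfinitePlace.mk f))
      (fun φ => F (placeOf φ)) fun _ => by rfl]
  rw [← Finset.sum_fiberwise Finset.univ InfinitePlace.mk]
  refine Finset.sum_congr rfl fun w _ => ?_
  rw [Finset.sum_congr rfl (g := fun _ => F w)]
  · rw [Finset.sum_const, InfinitePlace.card_filter_mk_eq]
  · intro φ hφ
    rw [(Finset.mem_filter.mp hφ).2]

open NumberField in
lemma norm_eq_placeOf {K : Type*} [Field K] [NumberField K] (σ : K →ₐ[ℚ] ℂ) (x : K) :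
    ‖σ x‖ = placeOf σ x := rfl

open NumberField in
/-- The twisted trace form on a number field. -/
def heckeQ {K : Type*} [Field K] [NumberField K] (l : InfinitePlace K → ℝ) (x : K) : ℝ :=
  ∑ w, (w.mult : ℝ) * (Real.exp (l w) * w x ^ 2)

open NumberField in
/-- The Gram matrix of the twisted trace form. -/
def heckeGram {K : Type*} [Field K] [NumberField K] {ι : Type*} (b : ι → K)
    (l : InfinitePlace K → ℝ) : Matrix ι ι ℝ :=
  fun i j => ∑ σ : K →ₐ[ℚ] ℂ, Real.exp (l (placeOf σ)) * ((starRingEnd ℂ (σ (b i)) * σ (b j)).re)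

open NumberField in
/-- Complex conjugation acting on embeddings. -/
def conjEmb (K : Type*) [Field K] [NumberField K] : (K →ₐ[ℚ] ℂ) ≃ (K →ₐ[ℚ] ℂ) where
  toFun σ := ((Complex.conjAe.restrictScalars ℚ : ℂ ≃ₐ[ℚ] ℂ) : ℂ →ₐ[ℚ] ℂ).comp σ
  invFun σ := ((Complex.conjAe.restrictScalars ℚ : ℂ ≃ₐ[ℚ] ℂ) : ℂ →ₐ[ℚ] ℂ).comp σ
  left_inv σ := by ext; simp
  right_inv σ := by ext; simp

lemma conjEmb_apply {K : Type*} [Field K] [NumberField K] (σ : K →ₐ[ℚ] ℂ) (x : K) :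
    conjEmb K σ x = starRingEnd ℂ (σ x) := rfl

open NumberField in
lemma placeOf_conjEmb {K : Type*} [Field K] [NumberField K] (σ : K →ₐ[ℚ] ℂ) :
    placeOf (conjEmb K σ) = placeOf σ := by
  ext x
  rw [← norm_eq_placeOf, ← norm_eq_placeOf, conjEmb_apply, RCLike.norm_conj]

open NumberField in
lemma heckeGram_ofReal {K : Type*} [Field K] [NumberField K] {ι : Type*} (b : ι → K)
    (l : InfinitePlace K → ℝ) (i j : ι) : (heckeGram b l i j : ℂ) =
      ∑ σ : K →ₐ[ℚ] ℂ, Real.exp (l (placeOf σ)) * (starRingEnd ℂ (σ (b i)) * σ (b j)) := by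
  set S := ∑ σ : K →ₐ[ℚ] ℂ, (Real.exp (l (placeOf σ)) : ℂ) * (starRingEnd ℂ (σ (b i)) * σ (b j)) with hS
  have hc : starRingEnd ℂ S = S := by
    rw [hS, map_sum]
    refine Fintype.sum_equiv (conjEmb K) _ _ fun σ => ?_
    rw [map_mul, Complex.conj_ofReal, placeOf_conjEmb, conjEmb_apply, conjEmb_apply, map_mul]
  have hre : heckeGram b l i j = S.re := by
    rw [hS, Complex.re_sum, heckeGram]
    refine Finset.sum_congr rfl fun σ _ => ?_
    rw [Complex.re_ofReal_mul]
  rw [hre]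
  exact (Complex.conj_eq_iff_re.mp hc)

open NumberField Matrix in
lemma heckeGram_quad {K : Type*} [Field K] [NumberField K] {ι : Type*} [Fintype ι] (b : ι → K)
    (l : InfinitePlace K → ℝ) (x : ι → ℝ) : x ⬝ᵥ heckeGram b l *ᵥ x =
      ∑ σ : K →ₐ[ℚ] ℂ, Real.exp (l (placeOf σ)) * ‖∑ i, (x i : ℂ) * σ (b i)‖ ^ 2 := by
  have : ∀ σ : K →ₐ[ℚ] ℂ, ‖∑ i, (x i : ℂ) * σ (b i)‖ ^ 2 =
      ∑ i, ∑ j, x i * (x j * ((starRingEnd ℂ (σ (b i)) * σ (b j)).re)) := by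
    intro σ
    have h : ((‖∑ i, (x i : ℂ) * σ (b i)‖ ^ 2 : ℝ) : ℂ) =
        ∑ i, ∑ j, ((x i : ℂ) * (x j * (starRingEnd ℂ (σ (b i)) * σ (b j)))) := by
      rw [← Complex.normSq_eq_norm_sq, Complex.normSq_eq_conj_mul_self, map_sum, Finset.sum_mul_sum]
      refine Finset.sum_congr rfl fun i _ => Finset.sum_congr rfl fun j _ => ?_
      simp only [map_mul, Complex.conj_ofReal]
      ring
    have h2 := congrArg Complex.re h
    rw [ofReal_re] at h2
    rw [h2]
    simp only [Complex.re_sum, Complex.re_ofReal_mul]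
  simp_rw [this, Finset.mul_sum]
  simp only [dotProduct, mulVec, heckeGram, Finset.sum_mul, Finset.mul_sum]
  symm
  rw [Finset.sum_comm]
  refine Finset.sum_congr rfl fun i _ => ?_
  rw [Finset.sum_comm]
  refine Finset.sum_congr rfl fun j _ => Finset.sum_congr rfl fun σ _ => ?_
  ring

open NumberField Matrix in
lemma heckeGram_quad_int {K : Type*} [Field K] [NumberField K] {ι : Type*} [Fintype ι] (b : ι → K)
    (l : InfinitePlace K → ℝ) (m : ι → ℤ) :
    (fun i => (m i : ℝ)) ⬝ᵥ heckeGram b l *ᵥ (fun i => (m i : ℝ)) = heckeQ l (∑ i, m i • b i) := by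
  rw [heckeGram_quad, heckeQ]
  simp only [← nsmul_eq_mul]
  rw [← sum_placeOf (fun w => Real.exp (l w) * w (∑ i, m i • b i) ^ 2)]
  refine Finset.sum_congr rfl fun σ _ => ?_
  rw [← norm_eq_placeOf, map_sum]
  simp

lemma exists_embEquiv {K : Type*} [Field K] [NumberField K] {ι : Type*} [Fintype ι]
    (b : Module.Basis ι ℚ K) : Nonempty (ι ≃ (K →ₐ[ℚ] ℂ)) := by
  rw [← Fintype.card_eq, AlgHom.card, Module.finrank_eq_card_basis b]

open NumberField Matrix in
lemma heckeGram_map {K : Type*} [Field K] [NumberField K] {ι : Type*} [Fintype ι] (b : ι → K)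
    (l : InfinitePlace K → ℝ) (e : ι ≃ (K →ₐ[ℚ] ℂ)) :
    (heckeGram b l).map (algebraMap ℝ ℂ) =
      (Algebra.embeddingsMatrixReindex ℚ ℂ b e).map (starRingEnd ℂ) *
        diagonal (fun i => (Real.exp (l (placeOf (e i))) : ℂ)) * (Algebra.embeddingsMatrixReindex ℚ ℂ b e)ᵀ := by
  ext i j
  rw [Matrix.map_apply, coe_algebraMap, heckeGram_ofReal, Matrix.mul_apply]
  simp only [mul_diagonal, Matrix.map_apply, transpose_apply, Algebra.embeddingsMatrixReindex, reindex_apply,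
    submatrix_apply, Algebra.embeddingsMatrix_apply, Equiv.refl_symm, Equiv.refl_apply, Equiv.symm_symm]
  symm
  refine Fintype.sum_equiv e _ _ fun k => ?_
  ring

open NumberField Matrix in
lemma heckeGram_map' {K : Type*} [Field K] [NumberField K] {ι : Type*} [Fintype ι] (b : ι → K)
    (l : InfinitePlace K → ℝ) (e : ι ≃ (K →ₐ[ℚ] ℂ)) :
    (heckeGram b l).map (algebraMap ℝ ℂ) =
      (Algebra.embeddingsMatrixReindex ℚ ℂ b e) *
        diagonal (fun i => (Real.exp (l (placeOf (e i))) : ℂ)) *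
        ((Algebra.embeddingsMatrixReindex ℚ ℂ b e).map (starRingEnd ℂ))ᵀ := by
  have h := congrArg (fun A => A.map (starRingEnd ℂ)) (heckeGram_map b l e)
  simp only [Matrix.map_mul] at h
  convert h using 1
  · ext i j; simp
  · congr 2
    · ext i j; simp
    · ext i j; by_cases hij : i = j
      · subst hij; simp [← Complex.exp_conj]
      · simp [hij]

open NumberField Matrix in
lemma heckeGram_det {K : Type*} [Field K] [NumberField K] {ι : Type*} [Fintype ι] (b : Module.Basis ι ℚ K)
    (l : InfinitePlace K → ℝ) (hl : ∑ w, (w.mult : ℝ) * l w = 0) :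
    (heckeGram b l).det = |((Algebra.discr ℚ b : ℚ) : ℝ)| := by
  obtain ⟨e⟩ := exists_embEquiv b
  have h := congrArg Matrix.det (heckeGram_map b l e)
  have h1 : ((heckeGram b l).map (algebraMap ℝ ℂ)).det = ((heckeGram b l).det : ℂ) :=
    ((algebraMap ℝ ℂ).map_det _).symm
  have h2 : ((Algebra.embeddingsMatrixReindex ℚ ℂ b e).map (starRingEnd ℂ)).det =
    starRingEnd ℂ (Algebra.embeddingsMatrixReindex ℚ ℂ b e).det := ((starRingEnd ℂ).map_det _).symm
  have h3 : ∏ i, (Real.exp (l (placeOf (e i))) : ℂ) = 1 := by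
    rw [← ofReal_prod, ← Real.exp_sum, Fintype.sum_equiv e _ (fun σ => l (placeOf σ)) (fun _ => rfl), sum_placeOf]
    simp [hl]
  rw [det_mul, det_mul, det_transpose, det_diagonal, h1, h2, h3, mul_one, ← Complex.normSq_eq_conj_mul_self] at h
  have h4 := Algebra.discr_eq_det_embeddingsMatrixReindex_pow_two ℚ ℂ b e
  have h5 := congrArg (fun z : ℂ => ‖z‖) h4
  simp only [norm_pow, eq_ratCast] at h5
  rw [Complex.ofReal_inj] at h
  rw [h, Complex.normSq_eq_norm_sq, ← h5, ← Complex.norm_ratCast]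

open NumberField Matrix in
lemma heckeGram_mul_dual {K : Type*} [Field K] [NumberField K] {ι : Type*} [Fintype ι] (b : Module.Basis ι ℚ K)
    (b' : ι → K) (hb : ∀ i j, Algebra.trace ℚ K (b i * b' j) = if i = j then 1 else 0)
    (l : InfinitePlace K → ℝ) : heckeGram b l * heckeGram b' (-l) = 1 := by
  obtain ⟨e⟩ := exists_embEquiv b
  set E := Algebra.embeddingsMatrixReindex ℚ ℂ b e
  set E' := Algebra.embeddingsMatrixReindex ℚ ℂ b' e
  have h1 : E * E'ᵀ = 1 := by
    ext i j
    rw [Matrix.mul_apply]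
    simp only [E, E', transpose_apply, Algebra.embeddingsMatrixReindex, reindex_apply,
      submatrix_apply, Algebra.embeddingsMatrix_apply, Equiv.refl_symm, Equiv.refl_apply, Equiv.symm_symm]
    rw [Fintype.sum_equiv e _ (fun σ => σ (b i) * σ (b' j)) (fun _ => rfl)]
    simp only [← map_mul]
    rw [← trace_eq_sum_embeddings ℂ, hb, one_apply]
    split_ifs <;> simp
  have h2 : Eᵀ * E' = 1 := by
    rw [← transpose_inj, transpose_mul, transpose_transpose, transpose_one]
    exact mul_eq_one_comm.mp h1
  have h3 : E.map (starRingEnd ℂ) * (E'.map (starRingEnd ℂ))ᵀ = 1 := by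
    have := congrArg (fun A => A.map (starRingEnd ℂ)) h1
    simp only [Matrix.map_mul] at this
    rw [← transpose_map, this]; simp
  have h4 : diagonal (fun i => (Real.exp (l (placeOf (e i))) : ℂ)) *
      diagonal (fun i => (Real.exp ((-l) (placeOf (e i))) : ℂ)) = 1 := by
    rw [diagonal_mul_diagonal, ← diagonal_one]
    congr 1; ext i
    rw [← ofReal_mul, ← Real.exp_add]; simp
  have hinj : Function.Injective (fun A : Matrix ι ι ℝ => A.map (algebraMap ℝ ℂ)) :=
    Matrix.map_injective (algebraMap ℝ ℂ).injective
  apply hinj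
  simp only [Matrix.map_mul]
  rw [heckeGram_map b l e, heckeGram_map' b' (-l) e]
  calc _ = E.map (starRingEnd ℂ) * diagonal (fun i => (Real.exp (l (placeOf (e i))) : ℂ)) * (Eᵀ * E') *
        (diagonal (fun i => (Real.exp ((-l) (placeOf (e i))) : ℂ)) * (E'.map (starRingEnd ℂ))ᵀ) := by
        simp only [Matrix.mul_assoc]; rfl
    _ = E.map (starRingEnd ℂ) * (diagonal (fun i => (Real.exp (l (placeOf (e i))) : ℂ)) *
        diagonal (fun i => (Real.exp ((-l) (placeOf (e i))) : ℂ))) * (E'.map (starRingEnd ℂ))ᵀ := by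
        rw [h2, Matrix.mul_one]; simp only [Matrix.mul_assoc]
    _ = _ := by rw [h4, Matrix.mul_one, h3]; simp

open NumberField Matrix in
lemma heckeGram_posDef {K : Type*} [Field K] [NumberField K] {ι : Type*} [Fintype ι] (b : Module.Basis ι ℚ K)
    (l : InfinitePlace K → ℝ) : (heckeGram b l).PosDef := by
  refine PosDef.of_dotProduct_mulVec_pos ?_ fun x hx => ?_
  · ext i j
    simp only [conjTranspose_apply, star_trivial, heckeGram]
    refine Finset.sum_congr rfl fun σ _ => ?_
    congr 1
    simp; ring
  · rw [star_trivial, heckeGram_quad]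
    obtain ⟨e⟩ := exists_embEquiv b
    have hdet : (Algebra.embeddingsMatrixReindex ℚ ℂ b e).det ≠ 0 := by
      intro h
      have h4 := Algebra.discr_eq_det_embeddingsMatrixReindex_pow_two ℚ ℂ b e
      rw [h] at h4
      exact Algebra.discr_not_zero_of_basis ℚ b (by simpa using h4)
    have hne : ∃ σ : K →ₐ[ℚ] ℂ, ∑ i, (x i : ℂ) * σ (b i) ≠ 0 := by
      by_contra! hcon
      apply hx
      have : (fun i => (x i : ℂ)) = 0 := by
        apply eq_zero_of_vecMul_eq_zero hdet
        ext j
        simpa [vecMul, dotProduct, Algebra.embeddingsMatrixReindex] using hcon (e j)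
      ext i
      simpa using congrFun this i
    obtain ⟨σ, hσ⟩ := hne
    refine Finset.sum_pos' (fun _ _ => by positivity) ⟨σ, Finset.mem_univ _, ?_⟩
    positivity

open NumberField Matrix in
/-- Theta inversion for the twisted trace forms of a number field. -/
theorem heckeTheta_inversion {K : Type*} [Field K] [NumberField K] {ι : Type*} [Fintype ι] (b : Module.Basis ι ℚ K)
    (b' : ι → K) (hb : ∀ i j, Algebra.trace ℚ K (b i * b' j) = if i = j then 1 else 0)
    (l : InfinitePlace K → ℝ) (hl : ∑ w, (w.mult : ℝ) * l w = 0) (M : ℕ) [NeZero M]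
    (φ : (ι → ℤ) → ℂ) (hφ : ∀ m l : ι → ℤ, φ (m + (M : ℤ) • l) = φ m) {t : ℝ} (ht : 0 < t) :
    ∑' m : ι → ℤ, φ m * Real.exp (-Real.pi * t * heckeQ l (∑ i, m i • b i)) =
      (((M : ℝ) ^ Fintype.card ι * Real.sqrt |((Algebra.discr ℚ b : ℚ) : ℝ)|)⁻¹ * t ^ (-(Fintype.card ι : ℝ) / 2) : ℝ) *
      ∑' k : ι → ℤ, finFourier M φ k * Real.exp (-Real.pi * (1 / t) * (heckeQ (-l) (∑ i, k i • b' i) / (M : ℝ) ^ 2)) := by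
  have hA := heckeGram_posDef b l
  have hA2 : (t • heckeGram b l).PosDef := hA.smul ht
  have hinv : (t • heckeGram b l)⁻¹ = t⁻¹ • heckeGram b' (-l) := by
    apply inv_eq_right_inv
    rw [smul_mul_smul_comm, mul_inv_cancel₀ ht.ne', one_smul, heckeGram_mul_dual b b' hb]
  have h := theta_periodic hA2 M φ hφ
  simp only [hinv, smul_mulVec, dotProduct_smul, heckeGram_quad_int, smul_eq_mul, det_smul, heckeGram_det b l hl] at h
  have e1 : Real.sqrt (t ^ Fintype.card ι * |((Algebra.discr ℚ b : ℚ) : ℝ)|) =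
      Real.sqrt |((Algebra.discr ℚ b : ℚ) : ℝ)| * (t ^ (-(Fintype.card ι : ℝ) / 2))⁻¹ := by
    rw [Real.sqrt_mul (by positivity), mul_comm, ← Real.rpow_neg ht.le, Real.sqrt_eq_rpow (t ^ _), ← Real.rpow_natCast,
      ← Real.rpow_mul ht.le]
    congr 2; ring
  rw [e1, ← mul_assoc, mul_inv (_ * _), inv_inv] at h
  convert h using 2
  · funext m
    push_cast; congr 2; ring
  · congr 1
    funext k
    push_cast; congr 2; field_simp

section ThetaAverage

open MeasureTheory Set Filter Asymptotics

variable {H : Type*} [MeasurableSpace H] {ι : Type*} [Fintype ι]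

/-- The average of a Gaussian `exp (-π t Q h m)` over a parameter `h`. -/
def gaussAvg (μ : Measure H) (Q : H → (ι → ℤ) → ℝ) (t : ℝ) (m : ι → ℤ) : ℝ :=
  ∫ h, Real.exp (-Real.pi * t * Q h m) ∂μ

/-- A theta series averaged over a measure on the space of quadratic forms. -/
def thetaAvg (μ : Measure H) (Q : H → (ι → ℤ) → ℝ) (φ : (ι → ℤ) → ℂ) (t : ℝ) : ℂ :=
  ∑' m, φ m * gaussAvg μ Q t m

/-- A measurable family of quadratic functions that is uniformly positive. -/
structure IsQuadFamily (μ : Measure H) (Q : H → (ι → ℤ) → ℝ) (c : ℝ) : Prop where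
  pos : 0 < c
  meas : ∀ m, Measurable fun h => Q h m
  zero : ∀ h, Q h 0 = 0
  le : ∀ᵐ h ∂μ, ∀ m, c * ‖fun i => (m i : ℝ)‖ ^ 2 ≤ Q h m

variable {μ : Measure H} {Q : H → (ι → ℤ) → ℝ} {c : ℝ}

theorem one_le_norm_intCast {m : ι → ℤ} (hm : m ≠ 0) : 1 ≤ ‖fun i => (m i : ℝ)‖ := by
  obtain ⟨i, hi⟩ := Function.ne_iff.mp hm
  have h1 : ‖(m i : ℝ)‖ ≤ ‖fun i => (m i : ℝ)‖ := norm_le_pi_norm (fun i => (m i : ℝ)) i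
  refine le_trans ?_ h1
  rw [Real.norm_eq_abs, ← Int.cast_abs]
  exact_mod_cast Int.one_le_abs hi

omit [Fintype ι] in
theorem gaussAvg_nonneg (t : ℝ) (m : ι → ℤ) : 0 ≤ gaussAvg μ Q t m :=
  integral_nonneg fun _ => (Real.exp_pos _).le

theorem IsQuadFamily.exp_le (hQ : IsQuadFamily μ Q c) {t : ℝ} (ht : 0 ≤ t) :
    ∀ᵐ h ∂μ, ∀ m, Real.exp (-Real.pi * t * Q h m) ≤
      Real.exp (-(Real.pi * t * c) * ‖fun i => (m i : ℝ)‖ ^ 2) := by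
  filter_upwards [hQ.le] with h hh m
  apply Real.exp_le_exp.mpr
  have := mul_le_mul_of_nonneg_left (hh m) (mul_nonneg Real.pi_pos.le ht)
  linarith

theorem IsQuadFamily.gaussAvg_zero (hQ : IsQuadFamily μ Q c) (t : ℝ) :
    gaussAvg μ Q t 0 = μ.real univ := by
  simp [gaussAvg, hQ.zero]

variable [IsFiniteMeasure μ]

theorem IsQuadFamily.integrable_exp (hQ : IsQuadFamily μ Q c) {t : ℝ} (ht : 0 ≤ t) (m : ι → ℤ) :
    Integrable (fun h => Real.exp (-Real.pi * t * Q h m)) μ := by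
  refine Integrable.mono' (integrable_const
    (Real.exp (-(Real.pi * t * c) * ‖fun i => (m i : ℝ)‖ ^ 2))) ?_ ?_
  · exact (((hQ.meas m).const_mul _).exp).aestronglyMeasurable
  · filter_upwards [hQ.exp_le ht] with h hh
    rw [Real.norm_eq_abs, abs_of_pos (Real.exp_pos _)]
    exact hh m

theorem IsQuadFamily.gaussAvg_le (hQ : IsQuadFamily μ Q c) {t : ℝ} (ht : 0 ≤ t) (m : ι → ℤ) :
    gaussAvg μ Q t m ≤
      μ.real univ * Real.exp (-(Real.pi * t * c) * ‖fun i => (m i : ℝ)‖ ^ 2) := by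
  have h1 := integral_mono_ae (hQ.integrable_exp ht m) (integrable_const
    (Real.exp (-(Real.pi * t * c) * ‖fun i => (m i : ℝ)‖ ^ 2)))
    (by filter_upwards [hQ.exp_le ht] with h hh using hh m)
  simpa [gaussAvg] using h1

theorem IsQuadFamily.continuousOn_gaussAvg (hQ : IsQuadFamily μ Q c) (m : ι → ℤ) :
    ContinuousOn (fun t => gaussAvg μ Q t m) (Ioi 0) := by
  unfold gaussAvg
  refine continuousOn_of_dominated (bound := fun _ => 1) ?_ ?_ (integrable_const _) ?_
  · intro t _
    exact (((hQ.meas m).const_mul _).exp).aestronglyMeasurable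
  · intro t ht
    filter_upwards [hQ.le] with h hh
    rw [Real.norm_eq_abs, abs_of_pos (Real.exp_pos _), Real.exp_le_one_iff]
    have h0 : 0 ≤ Q h m := le_trans (by have := hQ.pos; positivity) (hh m)
    have : 0 ≤ Real.pi * t * Q h m := mul_nonneg (mul_nonneg Real.pi_pos.le (le_of_lt ht)) h0
    linarith
  · refine Eventually.of_forall fun h => Continuous.continuousOn ?_
    fun_prop

theorem IsQuadFamily.continuousOn_thetaAvg (hQ : IsQuadFamily μ Q c) {φ : (ι → ℤ) → ℂ} {B : ℝ}
    (hφ : ∀ m, ‖φ m‖ ≤ B) : ContinuousOn (thetaAvg μ Q φ) (Ioi 0) := by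
  have hB : 0 ≤ B := (norm_nonneg _).trans (hφ 0)
  intro t ht
  have ht' : 0 < t := ht
  have key : ContinuousOn (thetaAvg μ Q φ) (Ioi (t / 2)) := by
    unfold thetaAvg
    refine continuousOn_tsum (u := fun m => B * (μ.real univ *
      Real.exp (-(Real.pi * (t / 2) * c) * ‖fun i => (m i : ℝ)‖ ^ 2))) ?_ ?_ ?_
    · intro m
      have := (hQ.continuousOn_gaussAvg m).mono (Ioi_subset_Ioi (by linarith : (0:ℝ) ≤ t / 2))
      exact continuousOn_const.mul (Complex.continuous_ofReal.comp_continuousOn this)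
    · exact ((summable_int_pi_exp_neg_norm_sq (by have := hQ.pos; positivity)).mul_left _).mul_left _
    · intro m x hx
      have hx' : t / 2 < x := hx
      rw [norm_mul, Complex.norm_real, Real.norm_eq_abs, abs_of_nonneg (gaussAvg_nonneg _ _)]
      refine mul_le_mul (hφ m) ((hQ.gaussAvg_le (by linarith) m).trans ?_) (gaussAvg_nonneg _ _) hB
      refine mul_le_mul_of_nonneg_left (Real.exp_le_exp.mpr ?_) measureReal_nonneg
      have h2 : Real.pi * (t / 2) * c ≤ Real.pi * x * c := by
        have := hQ.pos
        have := Real.pi_pos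
        gcongr
      have := mul_le_mul_of_nonneg_right h2 (sq_nonneg ‖fun i => (m i : ℝ)‖)
      linarith
  exact (key.continuousAt (Ioi_mem_nhds (by linarith))).continuousWithinAt

theorem IsQuadFamily.locallyIntegrableOn_thetaAvg (hQ : IsQuadFamily μ Q c) {φ : (ι → ℤ) → ℂ}
    {B : ℝ} (hφ : ∀ m, ‖φ m‖ ≤ B) : LocallyIntegrableOn (thetaAvg μ Q φ) (Ioi 0) :=
  (hQ.continuousOn_thetaAvg hφ).locallyIntegrableOn measurableSet_Ioi

theorem IsQuadFamily.summable_norm (hQ : IsQuadFamily μ Q c) {φ : (ι → ℤ) → ℂ} {B : ℝ}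
    (hφ : ∀ m, ‖φ m‖ ≤ B) {t : ℝ} (ht : 0 < t) :
    Summable fun m => ‖φ m * (gaussAvg μ Q t m : ℂ)‖ := by
  refine Summable.of_nonneg_of_le (fun _ => norm_nonneg _) (fun m => ?_)
    (((summable_int_pi_exp_neg_norm_sq (ι := ι) (c := Real.pi * t * c)
      (by have := hQ.pos; positivity)).mul_left (μ.real univ)).mul_left B)
  rw [norm_mul, Complex.norm_real, Real.norm_eq_abs, abs_of_nonneg (gaussAvg_nonneg _ _)]
  exact mul_le_mul (hφ m) (hQ.gaussAvg_le ht.le m) (gaussAvg_nonneg _ _)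
    ((norm_nonneg _).trans (hφ 0))

theorem IsQuadFamily.thetaAvg_sub (hQ : IsQuadFamily μ Q c) {φ : (ι → ℤ) → ℂ} {B : ℝ}
    (hφ : ∀ m, ‖φ m‖ ≤ B) {t : ℝ} (ht : 0 < t) :
    thetaAvg μ Q φ t - φ 0 * μ.real univ =
      ∑' m, if m = 0 then 0 else φ m * gaussAvg μ Q t m := by
  have h1 := (hQ.summable_norm hφ ht).of_norm
  rw [thetaAvg, h1.tsum_eq_add_tsum_ite 0, hQ.gaussAvg_zero, add_sub_cancel_left]

theorem IsQuadFamily.isBigO_thetaAvg (hQ : IsQuadFamily μ Q c) {φ : (ι → ℤ) → ℂ} {B : ℝ}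
    (hφ : ∀ m, ‖φ m‖ ≤ B) (r : ℝ) :
    (fun t => thetaAvg μ Q φ t - φ 0 * μ.real univ) =O[atTop] (fun t : ℝ => t ^ r) := by
  have hc := hQ.pos
  have hB : 0 ≤ B := (norm_nonneg _).trans (hφ 0)
  have hS := summable_int_pi_exp_neg_norm_sq (ι := ι) (c := Real.pi * c) (by positivity)
  set S := ∑' m : ι → ℤ, Real.exp (-(Real.pi * c) * ‖fun i => (m i : ℝ)‖ ^ 2) with hSdef
  refine IsBigO.trans ?_ (isLittleO_exp_neg_mul_rpow_atTop (a := Real.pi * c) (by positivity) r).isBigO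
  refine IsBigO.of_bound (B * (μ.real univ * (Real.exp (Real.pi * c) * S))) ?_
  filter_upwards [eventually_ge_atTop (1 : ℝ)] with t ht
  rw [hQ.thetaAvg_sub hφ (by linarith), Real.norm_eq_abs, abs_of_pos (Real.exp_pos _)]
  have hb : ∀ m : ι → ℤ, ‖(if m = 0 then 0 else φ m * gaussAvg μ Q t m : ℂ)‖ ≤
      (B * (μ.real univ * (Real.exp (Real.pi * c) * Real.exp (-(Real.pi * c) * t)))) *
        Real.exp (-(Real.pi * c) * ‖fun i => (m i : ℝ)‖ ^ 2) := by
    intro m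
    split_ifs with hm
    · rw [norm_zero]; positivity
    · rw [norm_mul, Complex.norm_real, Real.norm_eq_abs, abs_of_nonneg (gaussAvg_nonneg _ _)]
      refine (mul_le_mul (hφ m) (hQ.gaussAvg_le (by linarith) m) (gaussAvg_nonneg _ _) hB).trans ?_
      rw [mul_assoc B, mul_assoc (μ.real univ)]
      refine mul_le_mul_of_nonneg_left (mul_le_mul_of_nonneg_left ?_ measureReal_nonneg) hB
      rw [← Real.exp_add, ← Real.exp_add]
      apply Real.exp_le_exp.mpr
      have h1 : 1 ≤ ‖fun i => (m i : ℝ)‖ ^ 2 := one_le_pow₀ (one_le_norm_intCast hm)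
      have h2 : 0 ≤ Real.pi * c * ((t - 1) * (‖fun i => (m i : ℝ)‖ ^ 2 - 1)) := by
        have : 0 ≤ t - 1 := by linarith
        have : 0 ≤ ‖fun i => (m i : ℝ)‖ ^ 2 - 1 := by linarith
        positivity
      nlinarith
  have h3 := tsum_of_norm_bounded (hS.mul_left _).hasSum hb
  refine h3.trans (le_of_eq ?_)
  rw [tsum_mul_left, ← hSdef]
  ring

theorem IsQuadFamily.thetaAvg_eq_integral (hQ : IsQuadFamily μ Q c) {φ : (ι → ℤ) → ℂ} {B : ℝ}
    (hφ : ∀ m, ‖φ m‖ ≤ B) {t : ℝ} (ht : 0 < t) :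
    thetaAvg μ Q φ t = ∫ h, ∑' m, φ m * Real.exp (-Real.pi * t * Q h m) ∂μ := by
  have h_int : ∀ m, Integrable (fun h => φ m * (Real.exp (-Real.pi * t * Q h m) : ℂ)) μ :=
    fun m => ((hQ.integrable_exp ht.le m).ofReal).const_mul _
  have h1 := hasSum_integral_of_summable_integral_norm h_int ?_
  · rw [← h1.tsum_eq, thetaAvg]
    refine tsum_congr fun m => ?_
    rw [integral_const_mul, integral_complex_ofReal, gaussAvg]
  · refine (hQ.summable_norm hφ ht).congr fun m => ?_
    simp only [norm_mul, Complex.norm_real, Real.norm_eq_abs]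
    rw [integral_const_mul, abs_of_nonneg (gaussAvg_nonneg _ _), gaussAvg]
    simp_rw [abs_of_pos (Real.exp_pos _)]

theorem IsQuadFamily.integrableOn_cpow_mul (hQ : IsQuadFamily μ Q c) {s : ℂ} (hs : 0 < s.re)
    {m : ι → ℤ} (hm : m ≠ 0) :
    Integrable (Function.uncurry fun (t : ℝ) h =>
      (t : ℂ) ^ (s - 1) * (Real.exp (-Real.pi * t * Q h m) : ℂ))
      ((volume.restrict (Ioi (0 : ℝ))).prod μ) := by
  have hc := hQ.pos
  have hn : 0 < Real.pi * c * ‖fun i => (m i : ℝ)‖ ^ 2 := by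
    have := one_le_norm_intCast hm
    have := Real.pi_pos
    positivity
  have h1 : Integrable (fun t : ℝ => t ^ (s.re - 1) *
      Real.exp (-(Real.pi * c * ‖fun i => (m i : ℝ)‖ ^ 2 * t))) (volume.restrict (Ioi (0 : ℝ))) := by
    have h := integrableOn_rpow_mul_exp_neg_mul_rpow (p := 1) (s := s.re - 1) (by linarith) one_pos hn
    refine h.congr_fun (fun t _ => ?_) measurableSet_Ioi
    simp [neg_mul]
  refine Integrable.mono' (h1.comp_fst μ) ?_ ?_
  · refine Measurable.aestronglyMeasurable ?_
    have h2 := hQ.meas m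
    have h3 : Measurable fun p : ℝ × H => Q p.2 m := h2.comp measurable_snd
    exact ((measurable_fst.complex_ofReal).pow_const _).mul
      (((measurable_fst.const_mul (-Real.pi)).mul h3).exp.complex_ofReal)
  · filter_upwards [Measure.quasiMeasurePreserving_fst.ae (ae_restrict_mem measurableSet_Ioi),
      Measure.quasiMeasurePreserving_snd.ae hQ.le] with p hp1 hp2
    have hp1' : 0 < p.1 := hp1
    rw [Function.uncurry, norm_mul, Complex.norm_real, Real.norm_eq_abs, abs_of_pos (Real.exp_pos _),
      Complex.norm_cpow_eq_rpow_re_of_pos hp1', Complex.sub_re, Complex.one_re]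
    refine mul_le_mul_of_nonneg_left (Real.exp_le_exp.mpr ?_) (Real.rpow_nonneg hp1'.le _)
    have := mul_le_mul_of_nonneg_left (hp2 m) (mul_nonneg Real.pi_pos.le hp1'.le)
    linarith

theorem IsQuadFamily.mellin_gaussAvg (hQ : IsQuadFamily μ Q c) {s : ℂ} (hs : 0 < s.re)
    {m : ι → ℤ} (hm : m ≠ 0) :
    mellin (fun t => (gaussAvg μ Q t m : ℂ)) s =
      Complex.Gamma s * (Real.pi : ℂ) ^ (-s) * ∫ h, (Q h m : ℂ) ^ (-s) ∂μ := by
  have hc := hQ.pos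
  have h1 := integral_integral_swap (hQ.integrableOn_cpow_mul hs hm)
  rw [mellin]
  have h2 : ∀ t : ℝ, (t : ℂ) ^ (s - 1) • (gaussAvg μ Q t m : ℂ) =
      ∫ h, (t : ℂ) ^ (s - 1) * (Real.exp (-Real.pi * t * Q h m) : ℂ) ∂μ := by
    intro t
    rw [integral_const_mul, integral_complex_ofReal, gaussAvg, smul_eq_mul]
  simp_rw [h2]
  rw [h1, ← integral_const_mul]
  refine integral_congr_ae ?_
  filter_upwards [hQ.le] with h hh
  have hq : 0 < Q h m := lt_of_lt_of_le (by have := one_le_norm_intCast hm; positivity) (hh m)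
  have h3 := Complex.integral_cpow_mul_exp_neg_mul_Ioi (a := s) (r := Real.pi * Q h m) hs
    (mul_pos Real.pi_pos hq)
  have h4 : ((1 : ℂ) / ((Real.pi : ℂ) * (Q h m : ℂ))) ^ s =
      (Real.pi : ℂ) ^ (-s) * (Q h m : ℂ) ^ (-s) := by
    rw [one_div, ← Complex.ofReal_mul, ← Complex.ofReal_inv, mul_inv, Complex.ofReal_mul,
      Complex.mul_cpow_ofReal_nonneg (by positivity) (by positivity), Complex.ofReal_inv,
      Complex.ofReal_inv, Complex.inv_cpow _ _ (by
        rw [Complex.arg_ofReal_of_nonneg Real.pi_pos.le]; exact Real.pi_ne_zero.symm),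
      Complex.inv_cpow _ _ (by
        rw [Complex.arg_ofReal_of_nonneg hq.le]; exact Real.pi_ne_zero.symm),
      Complex.cpow_neg, Complex.cpow_neg]
  push_cast at h3 ⊢
  rw [h4] at h3
  rw [show Complex.Gamma s * (Real.pi : ℂ) ^ (-s) * (Q h m : ℂ) ^ (-s) =
    (Real.pi : ℂ) ^ (-s) * (Q h m : ℂ) ^ (-s) * Complex.Gamma s by ring, ← h3]
  refine setIntegral_congr_fun measurableSet_Ioi fun t _ => ?_
  congr 2
  ring

theorem IsQuadFamily.norm_cpow_mul_gaussAvg_le (hQ : IsQuadFamily μ Q c) (s : ℂ) {t : ℝ}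
    (ht : 0 < t) (m : ι → ℤ) :
    ‖(t : ℂ) ^ (s - 1) * (gaussAvg μ Q t m : ℂ)‖ ≤ μ.real univ * (t ^ (s.re - 1) *
      Real.exp (-(Real.pi * c * ‖fun i => (m i : ℝ)‖ ^ 2 * t))) := by
  rw [norm_mul, Complex.norm_real, Real.norm_eq_abs, abs_of_nonneg (gaussAvg_nonneg _ _),
    Complex.norm_cpow_eq_rpow_re_of_pos ht, Complex.sub_re, Complex.one_re, mul_left_comm]
  refine mul_le_mul_of_nonneg_left ((hQ.gaussAvg_le ht.le m).trans (le_of_eq ?_))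
    (Real.rpow_nonneg ht.le _)
  congr 2
  ring

theorem IsQuadFamily.hasSum_mellin (hQ : IsQuadFamily μ Q c) {φ : (ι → ℤ) → ℂ} {B : ℝ}
    (hφ : ∀ m, ‖φ m‖ ≤ B) {s : ℂ} (hs0 : 0 < s.re) (hs : (Fintype.card ι : ℝ) / 2 < s.re) :
    HasSum (fun m => if m = 0 then 0 else
        φ m * (Complex.Gamma s * (Real.pi : ℂ) ^ (-s) * ∫ h, (Q h m : ℂ) ^ (-s) ∂μ))
      (mellin (fun t => thetaAvg μ Q φ t - φ 0 * μ.real univ) s) := by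
  have hc := hQ.pos
  have hB : 0 ≤ B := (norm_nonneg _).trans (hφ 0)
  have hpos : ∀ m : ι → ℤ, m ≠ 0 → 0 < Real.pi * c * ‖fun i => (m i : ℝ)‖ ^ 2 := fun m hm => by
    have := one_le_norm_intCast hm
    have := Real.pi_pos
    positivity
  have hint1 : ∀ m : ι → ℤ, m ≠ 0 → IntegrableOn (fun t : ℝ => t ^ (s.re - 1) *
      Real.exp (-(Real.pi * c * ‖fun i => (m i : ℝ)‖ ^ 2 * t))) (Ioi 0) := fun m hm => by
    have h := integrableOn_rpow_mul_exp_neg_mul_rpow (p := 1) (s := s.re - 1) (by linarith) one_pos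
      (hpos m hm)
    refine h.congr_fun (fun t _ => ?_) measurableSet_Ioi
    simp [neg_mul]
  let F : (ι → ℤ) → ℝ → ℂ := fun m t => if m = 0 then 0 else
    φ m * ((t : ℂ) ^ (s - 1) * (gaussAvg μ Q t m : ℂ))
  have hmeas : ∀ m, AEStronglyMeasurable (fun t : ℝ => (t : ℂ) ^ (s - 1) * (gaussAvg μ Q t m : ℂ))
      (volume.restrict (Ioi 0)) := fun m => by
    refine ContinuousOn.aestronglyMeasurable ?_ measurableSet_Ioi
    refine ContinuousOn.mul ?_ (Complex.continuous_ofReal.comp_continuousOn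
      (hQ.continuousOn_gaussAvg m))
    intro t ht
    exact (Complex.continuousAt_ofReal_cpow_const _ _ (Or.inr (ne_of_gt ht))).continuousWithinAt
  have h_int : ∀ m, Integrable (F m) (volume.restrict (Ioi 0)) := by
    intro m
    by_cases hm : m = 0
    · simp [F, hm]
    · simp only [F, if_neg hm]
      refine Integrable.const_mul ?_ _
      refine Integrable.mono' ((hint1 m hm).const_mul (μ.real univ)) (hmeas m) ?_
      filter_upwards [ae_restrict_mem measurableSet_Ioi] with t ht
      exact hQ.norm_cpow_mul_gaussAvg_le s ht m
  have hsum : Summable fun m => ∫ t in Ioi (0 : ℝ), ‖F m t‖ := by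
    refine Summable.of_nonneg_of_le (fun m => integral_nonneg fun _ => norm_nonneg _) (fun m => ?_)
      ((summable_int_pi_norm_rpow (ι := ι) (-2 * s.re) (by linarith)).mul_left
        (B * (μ.real univ * ((1 / (Real.pi * c)) ^ s.re * Real.Gamma s.re))))
    have hΓ := Real.Gamma_pos_of_pos hs0
    by_cases hm : m = 0
    · simp only [F, if_pos hm, norm_zero, integral_zero]
      positivity
    · have h1 : ∫ t in Ioi (0 : ℝ), ‖F m t‖ ≤ ∫ t in Ioi (0 : ℝ), B * (μ.real univ *
          (t ^ (s.re - 1) * Real.exp (-(Real.pi * c * ‖fun i => (m i : ℝ)‖ ^ 2 * t)))) := by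
        refine setIntegral_mono_on (h_int m).norm (((hint1 m hm).const_mul _).const_mul _)
          measurableSet_Ioi fun t ht => ?_
        simp only [F, if_neg hm]
        rw [norm_mul]
        exact mul_le_mul (hφ m) (hQ.norm_cpow_mul_gaussAvg_le s ht m) (norm_nonneg _) hB
      refine h1.trans (le_of_eq ?_)
      rw [integral_const_mul, integral_const_mul, Real.integral_rpow_mul_exp_neg_mul_Ioi hs0 (hpos m hm)]
      have h2 : (0 : ℝ) ≤ ‖fun i => (m i : ℝ)‖ := norm_nonneg _
      rw [one_div, mul_inv, Real.mul_rpow (by positivity) (by positivity), ← one_div,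
        Real.inv_rpow (by positivity), ← Real.rpow_natCast, ← Real.rpow_mul h2,
        ← Real.rpow_neg h2]
      push_cast
      rw [neg_mul]
      ring
  have key := hasSum_integral_of_summable_integral_norm h_int hsum
  have e1 : (∫ t in Ioi (0 : ℝ), ∑' m, F m t) =
      mellin (fun t => thetaAvg μ Q φ t - φ 0 * μ.real univ) s := by
    rw [mellin]
    refine setIntegral_congr_fun measurableSet_Ioi fun t ht => ?_
    rw [hQ.thetaAvg_sub hφ ht, smul_eq_mul, ← tsum_mul_left]
    refine tsum_congr fun m => ?_
    simp only [F]
    split_ifs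
    · simp
    · ring
  rw [← e1]
  have e2 : (fun m => ∫ t in Ioi (0 : ℝ), F m t) = fun m => if m = 0 then 0 else
      φ m * (Complex.Gamma s * (Real.pi : ℂ) ^ (-s) * ∫ h, (Q h m : ℂ) ^ (-s) ∂μ) := by
    funext m
    by_cases hm : m = 0
    · simp [F, hm]
    · simp only [F, if_neg hm]
      rw [integral_const_mul, ← hQ.mellin_gaussAvg hs0 hm, mellin]
      simp_rw [smul_eq_mul]
  rw [← e2]
  exact key

end ThetaAverage

section HeckeFamily

open NumberField NumberField.Units NumberField.Units.dirichletUnitTheorem MeasureTheory Set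
open Matrix hiding map_zero

variable {K : Type*} [Field K] [NumberField K]

/-- The trace zero weight on the infinite places attached to a point of the logarithmic space. -/
def hvec (h : logSpace K) (w : InfinitePlace K) : ℝ :=
  if hw : w = w₀ then -2 * (∑ v, h v) / w.mult else 2 * h ⟨w, hw⟩ / w.mult

theorem mult_mul_hvec_w₀ (h : logSpace K) :
    ((w₀ : InfinitePlace K).mult : ℝ) * hvec h w₀ = -2 * ∑ v, h v := by
  have : ((w₀ : InfinitePlace K).mult : ℝ) ≠ 0 := InfinitePlace.mult_coe_ne_zero
  rw [hvec, dif_pos rfl]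
  field_simp

theorem mult_mul_hvec (h : logSpace K) (v : {w : InfinitePlace K // w ≠ w₀}) :
    ((v : InfinitePlace K).mult : ℝ) * hvec h v = 2 * h v := by
  have : ((v : InfinitePlace K).mult : ℝ) ≠ 0 := InfinitePlace.mult_coe_ne_zero
  rw [hvec, dif_neg v.2]
  field_simp

theorem sum_mult_mul_hvec (h : logSpace K) : ∑ w, (w.mult : ℝ) * hvec h w = 0 := by
  rw [Fintype.sum_eq_add_sum_subtype_ne _ w₀, mult_mul_hvec_w₀]
  simp_rw [mult_mul_hvec]
  rw [← Finset.mul_sum]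
  ring

theorem hvec_add (h h' : logSpace K) : hvec (h + h') = hvec h + hvec h' := by
  funext w
  simp only [hvec, Pi.add_apply]
  split_ifs
  · rw [Finset.sum_add_distrib]; ring
  · ring

theorem hvec_smul (a : ℝ) (h : logSpace K) : hvec (a • h) = a • hvec h := by
  funext w
  simp only [hvec, Pi.smul_apply, smul_eq_mul]
  split_ifs
  · rw [← Finset.mul_sum]; ring
  · ring

theorem hvec_neg (h : logSpace K) : hvec (-h) = -hvec h := by
  rw [← neg_one_smul ℝ h, hvec_smul, neg_one_smul]

theorem continuous_hvec (w : InfinitePlace K) : Continuous fun h : logSpace K => hvec h w := by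
  unfold hvec
  split_ifs <;> fun_prop

/-- The weights attached to a function on the infinite places whose weighted sum vanishes. -/
theorem exists_hvec_eq {l : InfinitePlace K → ℝ} (hl : ∑ w, (w.mult : ℝ) * l w = 0) :
    hvec (fun v : {w : InfinitePlace K // w ≠ w₀} => (v.1.mult : ℝ) * l v / 2) = l := by
  funext w
  have hm : ∀ w : InfinitePlace K, (w.mult : ℝ) ≠ 0 := fun w => InfinitePlace.mult_coe_ne_zero
  by_cases hw : w = w₀
  · subst hw
    rw [hvec, dif_pos rfl, ← Finset.sum_div]
    rw [Fintype.sum_eq_add_sum_subtype_ne _ w₀] at hl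
    have := hm w₀
    field_simp
    linarith
  · rw [hvec, dif_neg hw]
    have := hm w
    field_simp

theorem exists_abs_hvec_le {S : Set (logSpace K)} (hS : Bornology.IsBounded S) :
    ∃ R, ∀ h ∈ S, ∀ w, |hvec h w| ≤ R := by
  have h1 : Continuous fun h : logSpace K => hvec h := continuous_pi continuous_hvec
  obtain ⟨R, hR⟩ := (hS.isCompact_closure.image h1).isBounded.exists_norm_le
  refine ⟨R, fun h hh w => ?_⟩
  exact (norm_le_pi_norm (hvec h) w).trans (hR _ ⟨h, subset_closure hh, rfl⟩)

theorem heckeQ_zero (l : InfinitePlace K → ℝ) : heckeQ l (0 : K) = 0 := by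
  simp [heckeQ]

theorem heckeQ_pos (l : InfinitePlace K → ℝ) {x : K} (hx : x ≠ 0) : 0 < heckeQ l x := by
  unfold heckeQ
  refine Finset.sum_pos (fun w _ => ?_) Finset.univ_nonempty
  have h1 : 0 < w x := w.pos_iff.mpr hx
  have h2 : (0 : ℝ) < w.mult := by exact_mod_cast w.mult_pos
  positivity

theorem continuous_heckeQ_hvec (x : K) : Continuous fun h : logSpace K => heckeQ (hvec h) x := by
  unfold heckeQ
  refine continuous_finsetSum _ fun w _ => ?_
  have := continuous_hvec w
  fun_prop

theorem exp_neg_mul_heckeQ_le {l : InfinitePlace K → ℝ} {R : ℝ} (hl : ∀ w, |l w| ≤ R) (x : K) :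
    Real.exp (-R) * heckeQ 0 x ≤ heckeQ l x := by
  unfold heckeQ
  rw [Finset.mul_sum]
  refine Finset.sum_le_sum fun w _ => ?_
  rw [mul_left_comm]
  refine mul_le_mul_of_nonneg_left ?_ (Nat.cast_nonneg _)
  simp only [Pi.zero_apply, Real.exp_zero, one_mul]
  exact mul_le_mul_of_nonneg_right (Real.exp_le_exp.mpr (neg_le_of_abs_le (hl w))) (sq_nonneg _)

variable {ι : Type*} [Fintype ι]

/-- The family of quadratic forms on a lattice with basis `b`. -/
def heckeFam (b : ι → K) (a r : ℝ) (h : logSpace K) (m : ι → ℤ) : ℝ :=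
  heckeQ (hvec (a • h)) (∑ i, m i • b i) * r

theorem isQuadFamily_heckeFam (b : Module.Basis ι ℚ K) (a : ℝ) {r : ℝ} (hr : 0 < r)
    {S : Set (logSpace K)} (hS : Bornology.IsBounded S) (hSm : MeasurableSet S) :
    ∃ c, IsQuadFamily (volume.restrict S) (heckeFam b a r) c := by
  obtain ⟨R, hR⟩ := exists_abs_hvec_le hS
  obtain ⟨c, hc, hcA⟩ := exists_norm_sq_le_quad (heckeGram_posDef b 0)
  refine ⟨Real.exp (-(|a| * R)) * c * r, by positivity, fun m => ?_, fun h => ?_, ?_⟩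
  · exact (((continuous_heckeQ_hvec _).comp (continuous_const_smul a)).mul continuous_const).measurable
  · simp [heckeFam, heckeQ_zero]
  · filter_upwards [ae_restrict_mem hSm] with h hh m
    have h1 := hcA fun i => (m i : ℝ)
    rw [heckeGram_quad_int] at h1
    have h2 : Real.exp (-(|a| * R)) * heckeQ 0 (∑ i, m i • b i) ≤
        heckeQ (hvec (a • h)) (∑ i, m i • b i) := by
      refine exp_neg_mul_heckeQ_le (fun w => ?_) _
      rw [hvec_smul, Pi.smul_apply, smul_eq_mul, abs_mul]
      exact mul_le_mul_of_nonneg_left (hR h hh w) (abs_nonneg _)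
    rw [heckeFam]
    have h3 := mul_le_mul_of_nonneg_left h1 (Real.exp_pos (-(|a| * R))).le
    have h4 := mul_le_mul_of_nonneg_right (h3.trans h2) hr.le
    linarith

variable (K) in
/-- A fundamental domain for the unit lattice. -/
def unitDomain : Set (logSpace K) :=
  ZSpan.fundamentalDomain ((basisUnitLattice K).ofZLatticeBasis ℝ (unitLattice K))

theorem isBounded_unitDomain : Bornology.IsBounded (unitDomain K) :=
  ZSpan.fundamentalDomain_isBounded _

theorem measurableSet_unitDomain : MeasurableSet (unitDomain K) :=
  ZSpan.fundamentalDomain_measurableSet _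

theorem isAddFundamentalDomain_unitDomain :
    IsAddFundamentalDomain (unitLattice K) (unitDomain K) volume :=
  ZLattice.isAddFundamentalDomain _ _

instance : IsFiniteMeasure ((volume : Measure (logSpace K)).restrict (unitDomain K)) :=
  ⟨by rw [Measure.restrict_apply_univ]; exact isBounded_unitDomain.measure_lt_top⟩

theorem finFourier_bound (M : ℕ) (φ : (ι → ℤ) → ℂ) :
    ∀ k, ‖finFourier M φ k‖ ≤ ∑ r : ι → Fin M, ‖φ (fun i => ((r i : ℕ) : ℤ))‖ :=
  norm_finFourier_le M φ

/-- The weak functional equation pair given by the averaged theta series of a lattice with a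
periodic weight. -/
def heckePair (b b' : Module.Basis ι ℚ K)
    (hb : ∀ i j, Algebra.trace ℚ K (b i * b' j) = if i = j then 1 else 0)
    (M : ℕ) [NeZero M] (φ : (ι → ℤ) → ℂ) (hφ : ∀ m l : ι → ℤ, φ (m + (M : ℤ) • l) = φ m)
    (B : ℝ) (hB : ∀ m, ‖φ m‖ ≤ B) : WeakFEPair ℂ where
  f := thetaAvg (volume.restrict (unitDomain K)) (heckeFam b 1 1) φ
  g := thetaAvg (volume.restrict (unitDomain K)) (heckeFam b' (-1) ((M : ℝ) ^ 2)⁻¹) (finFourier M φ)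
  k := (Fintype.card ι : ℝ) / 2
  ε := (((M : ℝ) ^ Fintype.card ι * Real.sqrt |((Algebra.discr ℚ b : ℚ) : ℝ)|)⁻¹ : ℝ)
  f₀ := φ 0 * (volume.restrict (unitDomain K)).real univ
  g₀ := finFourier M φ 0 * (volume.restrict (unitDomain K)).real univ
  hf_int := by
    obtain ⟨c, hc⟩ := isQuadFamily_heckeFam b 1 one_pos isBounded_unitDomain measurableSet_unitDomain
    exact hc.locallyIntegrableOn_thetaAvg hB
  hg_int := by
    have hM : (0 : ℝ) < M := by exact_mod_cast Nat.pos_of_ne_zero (NeZero.ne M)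
    obtain ⟨c, hc⟩ := isQuadFamily_heckeFam b' (-1) (inv_pos.mpr (pow_pos hM 2))
      isBounded_unitDomain measurableSet_unitDomain
    exact hc.locallyIntegrableOn_thetaAvg (finFourier_bound M φ)
  hk := by
    have : Nonempty ι := b.index_nonempty
    have : 0 < Fintype.card ι := Fintype.card_pos
    positivity
  hε := by
    have hM : (M : ℝ) ≠ 0 := by exact_mod_cast NeZero.ne M
    have h1 : ((Algebra.discr ℚ b : ℚ) : ℝ) ≠ 0 := by
      exact_mod_cast Algebra.discr_not_zero_of_basis ℚ b
    have h2 : Real.sqrt |((Algebra.discr ℚ b : ℚ) : ℝ)| ≠ 0 :=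
      (Real.sqrt_pos.mpr (abs_pos.mpr h1)).ne'
    exact_mod_cast inv_ne_zero (mul_ne_zero (pow_ne_zero _ hM) h2)
  h_feq := by
    intro t ht
    have ht' : 0 < t := ht
    have hM : (0 : ℝ) < M := by exact_mod_cast Nat.pos_of_ne_zero (NeZero.ne M)
    obtain ⟨c, hc⟩ := isQuadFamily_heckeFam b 1 one_pos isBounded_unitDomain measurableSet_unitDomain
    obtain ⟨c', hc'⟩ := isQuadFamily_heckeFam b' (-1) (inv_pos.mpr (pow_pos hM 2))
      isBounded_unitDomain measurableSet_unitDomain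
    rw [hc.thetaAvg_eq_integral hB (one_div_pos.mpr ht'),
      hc'.thetaAvg_eq_integral (finFourier_bound M φ) ht', smul_eq_mul, ← integral_const_mul]
    refine integral_congr_ae (Filter.Eventually.of_forall fun h => ?_)
    have key := heckeTheta_inversion b b' hb (hvec h) (sum_mult_mul_hvec h) M φ hφ
      (one_div_pos.mpr ht')
    simp only [heckeFam, one_smul, mul_one, neg_one_smul, hvec_neg, ← div_eq_mul_inv]
    rw [one_div_one_div] at key
    have e : (1 / t) ^ (-(Fintype.card ι : ℝ) / 2) = t ^ ((Fintype.card ι : ℝ) / 2) := by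
      rw [one_div, Real.inv_rpow ht'.le, ← Real.rpow_neg ht'.le, neg_div, neg_neg]
    rw [e, ofReal_mul] at key
    exact key
  hf_top := by
    intro r
    obtain ⟨c, hc⟩ := isQuadFamily_heckeFam b 1 one_pos isBounded_unitDomain measurableSet_unitDomain
    exact hc.isBigO_thetaAvg hB r
  hg_top := by
    intro r
    have hM : (0 : ℝ) < M := by exact_mod_cast Nat.pos_of_ne_zero (NeZero.ne M)
    obtain ⟨c, hc⟩ := isQuadFamily_heckeFam b' (-1) (inv_pos.mpr (pow_pos hM 2))
      isBounded_unitDomain measurableSet_unitDomain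
    exact hc.isBigO_thetaAvg (finFourier_bound M φ) r

end HeckeFamily

section ArchimedeanIntegral

open NumberField NumberField.Units NumberField.Units.dirichletUnitTheorem MeasureTheory Set

theorem integrable_exp_mul_exp_neg_exp {z : ℂ} (hz : 0 < z.re) {κ : ℝ} (hκ : 0 < κ) :
    Integrable (fun y : ℝ => cexp (z * y) * (Real.exp (-(κ * Real.exp y)) : ℂ)) ∧
      ∫ y : ℝ, cexp (z * y) * (Real.exp (-(κ * Real.exp y)) : ℂ) =
        Complex.Gamma z * (κ : ℂ) ^ (-z) := by
  have himg : Real.exp '' univ = Ioi 0 := by rw [Set.image_univ, Real.range_exp]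
  have hd : ∀ x ∈ univ, HasDerivWithinAt Real.exp (Real.exp x) univ x :=
    fun x _ => (Real.hasDerivAt_exp x).hasDerivWithinAt
  have hinj : Set.InjOn Real.exp univ := Real.exp_injective.injOn
  let g : ℝ → ℂ := fun t => (t : ℂ) ^ (z - 1) * cexp (-(κ * t))
  have e : (fun y : ℝ => |Real.exp y| • g (Real.exp y)) =
      fun y : ℝ => cexp (z * y) * (Real.exp (-(κ * Real.exp y)) : ℂ) := by
    funext y
    simp only [g]
    rw [abs_of_pos (Real.exp_pos _), Complex.real_smul, ← mul_assoc]
    congr 1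
    · rw [Complex.ofReal_exp, Complex.cpow_def_of_ne_zero (Complex.exp_ne_zero _),
        ← Complex.ofReal_exp, ← Complex.ofReal_log (Real.exp_pos _).le, Real.log_exp,
        Complex.ofReal_exp, ← Complex.exp_add]
      congr 1; ring
    · push_cast; rfl
  have hg : IntegrableOn g (Ioi 0) := by
    have h1 := Complex.GammaIntegral_convergent hz
    have h2 : IntegrableOn (fun t : ℝ => t ^ (z.re - 1) * Real.exp (-κ * t ^ (1 : ℝ))) (Ioi 0) :=
      integrableOn_rpow_mul_exp_neg_mul_rpow (by linarith) one_pos hκ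
    refine Integrable.mono' h2 ?_ ?_
    · refine ContinuousOn.aestronglyMeasurable ?_ measurableSet_Ioi
      refine ContinuousOn.mul (fun t ht => ?_) (by fun_prop)
      exact (Complex.continuousAt_ofReal_cpow_const _ _ (Or.inr (ne_of_gt ht))).continuousWithinAt
    · filter_upwards [ae_restrict_mem measurableSet_Ioi] with t ht
      have ht' : 0 < t := ht
      simp only [g]
      rw [norm_mul, Complex.norm_cpow_eq_rpow_re_of_pos ht', Complex.norm_exp]
      simp
  have h1 := (integrableOn_image_iff_integrableOn_abs_deriv_smul MeasurableSet.univ hd hinj g)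
  have h2 := (integral_image_eq_integral_abs_deriv_smul MeasurableSet.univ hd hinj g)
  rw [himg, e] at h1 h2
  rw [integrableOn_univ] at h1
  rw [setIntegral_univ] at h2
  refine ⟨h1.mp hg, ?_⟩
  rw [← h2, Complex.integral_cpow_mul_exp_neg_mul_Ioi hz hκ, mul_comm, one_div, Complex.inv_cpow _ _ (by
    rw [Complex.arg_ofReal_of_nonneg hκ.le]; exact Real.pi_ne_zero.symm), Complex.cpow_neg]

variable (K : Type*) [Field K] [NumberField K]

/-- The space of weights on the infinite places, split into its mean and its trace zero part. -/
def meanSplit : (ℝ × logSpace K) ≃L[ℝ] (InfinitePlace K → ℝ) :=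
  LinearEquiv.toContinuousLinearEquiv
  { toFun := fun p w => p.1 + hvec p.2 w
    map_add' := fun p q => by
      funext w
      simp only [Prod.fst_add, Prod.snd_add, hvec_add, Pi.add_apply]
      ring
    map_smul' := fun a p => by
      funext w
      simp only [Prod.smul_fst, Prod.smul_snd, hvec_smul, Pi.smul_apply, smul_eq_mul,
        RingHom.id_apply]
      ring
    invFun := fun y => ((∑ w, (w.mult : ℝ) * y w) / Module.finrank ℚ K,
      fun v => (v.1.mult : ℝ) * (y v - (∑ w, (w.mult : ℝ) * y w) / Module.finrank ℚ K) / 2)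
    left_inv := fun p => by
      have hn : (Module.finrank ℚ K : ℝ) ≠ 0 := by exact_mod_cast Module.finrank_pos.ne'
      have h1 : ∑ w : InfinitePlace K, (w.mult : ℝ) * (p.1 + hvec p.2 w) =
          Module.finrank ℚ K * p.1 := by
        simp_rw [mul_add]
        rw [Finset.sum_add_distrib, sum_mult_mul_hvec, add_zero, ← Finset.sum_mul,
          ← InfinitePlace.sum_mult_eq]
        push_cast; rfl
      beta_reduce
      rw [h1, mul_div_cancel_left₀ _ hn]
      refine Prod.ext rfl ?_
      funext v
      simp only [add_sub_cancel_left, mult_mul_hvec]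
      ring
    right_inv := fun y => by
      have hn : (Module.finrank ℚ K : ℝ) ≠ 0 := by exact_mod_cast Module.finrank_pos.ne'
      set τ := (∑ w : InfinitePlace K, (w.mult : ℝ) * y w) / Module.finrank ℚ K with hτ
      have h1 : ∑ w : InfinitePlace K, (w.mult : ℝ) * (y w - τ) = 0 := by
        simp_rw [mul_sub]
        rw [Finset.sum_sub_distrib, ← Finset.sum_mul, ← Nat.cast_sum, InfinitePlace.sum_mult_eq, hτ]
        field_simp
        ring
      have h2 := exists_hvec_eq h1
      funext w
      have h3 := congrFun h2 w
      simp only at h3 ⊢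
      rw [h3]; ring }

variable {K}

theorem meanSplit_apply (p : ℝ × logSpace K) (w : InfinitePlace K) :
    meanSplit K p w = p.1 + hvec p.2 w := rfl

instance isAddHaarMeasure_map_meanSplit :
    (Measure.map (meanSplit K) (volume : Measure (ℝ × logSpace K))).IsAddHaarMeasure := by
  have : (volume : Measure (ℝ × logSpace K)).IsAddHaarMeasure :=
    inferInstanceAs ((volume : Measure ℝ).prod (volume : Measure (logSpace K))).IsAddHaarMeasure
  exact (meanSplit K).isAddHaarMeasure_map volume

variable (K) in
/-- The Haar measure scaling factor of `meanSplit`. -/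
def meanScale : ℝ :=
  ((Measure.map (meanSplit K) volume).addHaarScalarFactor
    (volume : Measure (InfinitePlace K → ℝ)) : ℝ)

theorem meanScale_pos : 0 < meanScale K := by
  have := Measure.addHaarScalarFactor_pos_of_isAddHaarMeasure
    (Measure.map (meanSplit K) volume) (volume : Measure (InfinitePlace K → ℝ))
  exact_mod_cast this

theorem map_meanSplit : Measure.map (meanSplit K) volume =
    ENNReal.ofReal (meanScale K) • (volume : Measure (InfinitePlace K → ℝ)) := by
  have := Measure.isAddLeftInvariant_eq_smul (Measure.map (meanSplit K) volume)
    (volume : Measure (InfinitePlace K → ℝ))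
  rw [meanScale, ENNReal.ofReal_coe_nnreal]
  exact this

variable (K) in
/-- The product of local gamma integrals, up to the scaling of Haar measure. -/
def archGamma (s : ℂ) : ℂ :=
  meanScale K * ∏ w : InfinitePlace K,
    (Complex.Gamma (w.mult * s / 2) * ((w.mult * Real.pi : ℝ) : ℂ) ^ (-(w.mult * s / 2)))

theorem integral_heckeQ_one {s : ℂ} (hs : 0 < s.re) :
    Integrable (fun h : logSpace K =>
        (heckeQ (hvec h) (1 : K) : ℂ) ^ (-(Module.finrank ℚ K * s / 2))) ∧
      Complex.Gamma (Module.finrank ℚ K * s / 2) * (Real.pi : ℂ) ^ (-(Module.finrank ℚ K * s / 2)) *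
        ∫ h : logSpace K, (heckeQ (hvec h) (1 : K) : ℂ) ^ (-(Module.finrank ℚ K * s / 2)) =
      archGamma K s := by
  have hn : (0 : ℝ) < Module.finrank ℚ K := by exact_mod_cast Module.finrank_pos
  have hm : ∀ w : InfinitePlace K, (0 : ℝ) < w.mult := fun w => by exact_mod_cast w.mult_pos
  set n := Module.finrank ℚ K with hndef
  have hz : 0 < ((n : ℂ) * s / 2).re := by
    have : ((n : ℂ) * s / 2).re = n * s.re / 2 := by simp
    rw [this]; positivity
  have hzw : ∀ w : InfinitePlace K, 0 < ((w.mult : ℂ) * s / 2).re := fun w => by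
    have : ((w.mult : ℂ) * s / 2).re = w.mult * s.re / 2 := by simp
    rw [this]; have := hm w; positivity
  let G : (InfinitePlace K → ℝ) → ℂ := fun y => ∏ w : InfinitePlace K,
    (cexp ((w.mult * s / 2) * y w) * (Real.exp (-(w.mult * Real.pi * Real.exp (y w))) : ℂ))
  have hloc := fun w : InfinitePlace K =>
    integrable_exp_mul_exp_neg_exp (hzw w) (mul_pos (hm w) Real.pi_pos)
  have hGint : Integrable G := Integrable.fintype_prod fun w => (hloc w).1
  have hGval : ∫ y, G y = ∏ w : InfinitePlace K, (Complex.Gamma (w.mult * s / 2) *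
      ((w.mult * Real.pi : ℝ) : ℂ) ^ (-(w.mult * s / 2))) := by
    rw [integral_fintype_prod_volume_eq_prod (fun (w : InfinitePlace K) (y : ℝ) =>
      cexp ((w.mult * s / 2) * y) * (Real.exp (-(w.mult * Real.pi * Real.exp y)) : ℂ))]
    exact Finset.prod_congr rfl fun w _ => (hloc w).2
  have hemb : MeasurableEmbedding (meanSplit K) :=
    (meanSplit K).toHomeomorph.measurableEmbedding
  have hGL : Integrable (G ∘ meanSplit K) (volume : Measure (ℝ × logSpace K)) := by
    rw [← hemb.integrable_map_iff, map_meanSplit]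
    exact hGint.smul_measure ENNReal.ofReal_ne_top
  have hGLval : ∫ p : ℝ × logSpace K, G (meanSplit K p) = archGamma K s := by
    rw [← hemb.integral_map, map_meanSplit, integral_smul_measure, hGval, archGamma,
      ENNReal.toReal_ofReal meanScale_pos.le, Complex.real_smul]
  have hGform : ∀ τ (h : logSpace K), G (meanSplit K (τ, h)) =
      cexp (n * s / 2 * τ) *
        (Real.exp (-(Real.pi * heckeQ (hvec h) (1 : K) * Real.exp τ)) : ℂ) := by
    intro τ h
    simp only [G, meanSplit_apply]
    rw [Finset.prod_mul_distrib, ← Complex.exp_sum, ← Complex.ofReal_prod, ← Real.exp_sum]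
    congr 2
    · have h1 := sum_mult_mul_hvec h
      have h2 : (∑ w : InfinitePlace K, (w.mult : ℂ) * (hvec h w : ℂ)) = 0 := by exact_mod_cast h1
      have h3 : ((∑ w : InfinitePlace K, w.mult : ℕ) : ℂ) = n := by
        rw [InfinitePlace.sum_mult_eq]
      push_cast at h3
      have h4 : ∀ w : InfinitePlace K, (w.mult : ℂ) * s / 2 * ((τ + hvec h w : ℝ) : ℂ) =
          (w.mult : ℂ) * (s / 2 * τ) + ((w.mult : ℂ) * (hvec h w : ℂ)) * (s / 2) := by
        intro w; push_cast; ring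
      simp_rw [h4]
      rw [Finset.sum_add_distrib, ← Finset.sum_mul, ← Finset.sum_mul, h2, h3]
      ring
    · congr 1
      rw [heckeQ, Finset.mul_sum, Finset.sum_mul, ← Finset.sum_neg_distrib]
      refine Finset.sum_congr rfl fun w _ => ?_
      rw [Real.exp_add, map_one]
      ring
  have hinner : ∀ h : logSpace K, ∫ τ, G (meanSplit K (τ, h)) =
      Complex.Gamma (n * s / 2) * (Real.pi : ℂ) ^ (-(n * s / 2)) *
        (heckeQ (hvec h) (1 : K) : ℂ) ^ (-(n * s / 2)) := by
    intro h
    have hq := heckeQ_pos (hvec h) (one_ne_zero (α := K))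
    simp_rw [hGform]
    rw [(integrable_exp_mul_exp_neg_exp hz (mul_pos Real.pi_pos hq)).2, Complex.ofReal_mul,
      Complex.mul_cpow_ofReal_nonneg Real.pi_pos.le hq.le, mul_assoc]
  have hne : Complex.Gamma (n * s / 2) * (Real.pi : ℂ) ^ (-(n * s / 2)) ≠ 0 := by
    refine mul_ne_zero (Complex.Gamma_ne_zero_of_re_pos hz) ?_
    rw [Complex.cpow_def_of_ne_zero (by exact_mod_cast Real.pi_ne_zero)]
    exact Complex.exp_ne_zero _
  have hprod : (volume : Measure (ℝ × logSpace K)) = (volume : Measure ℝ).prod volume := rfl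
  rw [hprod] at hGL hGLval
  constructor
  · have h1 := hGL.integral_prod_right
    simp only [Function.comp_apply] at h1
    simp_rw [hinner] at h1
    have h2 := h1.const_mul (Complex.Gamma (n * s / 2) * (Real.pi : ℂ) ^ (-(n * s / 2)))⁻¹
    refine h2.congr (Filter.Eventually.of_forall fun h => ?_)
    exact inv_mul_cancel_left₀ hne _
  · rw [← integral_const_mul, ← hGLval]
    simp_rw [← hinner]
    exact (integral_prod_symm _ hGL).symm

end ArchimedeanIntegral

section UnitUnfolding

open NumberField NumberField.Units NumberField.Units.dirichletUnitTheorem MeasureTheory Set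

variable {K : Type*} [Field K] [NumberField K]

theorem heckeQ_congr_mul {x y : K} {l l' : InfinitePlace K → ℝ} {c : ℝ}
    (h : ∀ w, Real.exp (l w) * w x ^ 2 = c * (Real.exp (l' w) * w y ^ 2)) :
    heckeQ l x = c * heckeQ l' y := by
  unfold heckeQ
  rw [Finset.mul_sum]
  refine Finset.sum_congr rfl fun w _ => ?_
  rw [h w]; ring

theorem hvec_logEmbedding (u : (𝓞 K)ˣ) (w : InfinitePlace K) :
    hvec (logEmbedding K (Additive.ofMul u)) w = 2 * Real.log (w (u : K)) := by
  have h1 : ∑ w : InfinitePlace K, (w.mult : ℝ) * (2 * Real.log (w (u : K))) = 0 := by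
    have h := Units.sum_mult_mul_log u
    calc _ = 2 * ∑ w : InfinitePlace K, (w.mult : ℝ) * Real.log (w (u : K)) := by
          rw [Finset.mul_sum]; exact Finset.sum_congr rfl fun w _ => by ring
      _ = 0 := by rw [h, mul_zero]
  have h2 := congrFun (exists_hvec_eq h1) w
  rw [← h2]
  congr 1
  funext v
  rw [logEmbedding_component]
  ring

theorem exp_log_sq {a : ℝ} (ha : 0 < a) : Real.exp (2 * Real.log a) = a ^ 2 := by
  rw [two_mul, Real.exp_add, Real.exp_log ha, sq]

theorem heckeQ_unit_mul (u : (𝓞 K)ˣ) (x : K) (h : logSpace K) :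
    heckeQ (hvec h) ((u : K) * x) =
      heckeQ (hvec (h + logEmbedding K (Additive.ofMul u))) x := by
  rw [← one_mul (heckeQ (hvec (h + _)) x)]
  refine heckeQ_congr_mul fun w => ?_
  rw [hvec_add, Pi.add_apply, hvec_logEmbedding, Real.exp_add, exp_log_sq (Units.pos_at_place u w),
    map_mul]
  ring

theorem exists_heckeQ_eq {x : K} (hx : x ≠ 0) : ∃ h₀ : logSpace K, ∀ h : logSpace K,
    heckeQ (hvec h) x = (|(Algebra.norm ℚ x : ℝ)|) ^ (2 / (Module.finrank ℚ K : ℝ)) *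
      heckeQ (hvec (h + h₀)) 1 := by
  have hn : (0 : ℝ) < Module.finrank ℚ K := by exact_mod_cast Module.finrank_pos
  have hN : 0 < |(Algebra.norm ℚ x : ℝ)| := by
    rw [abs_pos]; exact_mod_cast Algebra.norm_ne_zero_iff.mpr hx
  have hw : ∀ w : InfinitePlace K, 0 < w x := fun w => w.pos_iff.mpr hx
  set L := Real.log |(Algebra.norm ℚ x : ℝ)| / Module.finrank ℚ K with hL
  have h1 : ∑ w : InfinitePlace K, (w.mult : ℝ) * (2 * Real.log (w x) - 2 * L) = 0 := by
    have h2 : ∑ w : InfinitePlace K, (w.mult : ℝ) * Real.log (w x) =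
        Real.log |(Algebra.norm ℚ x : ℝ)| := by
      have h3 := InfinitePlace.prod_eq_abs_norm x
      push_cast at h3
      rw [← h3, Real.log_prod fun w _ => (pow_pos (hw w) _).ne']
      simp_rw [Real.log_pow]
    have h4 : ∑ w : InfinitePlace K, (w.mult : ℝ) = Module.finrank ℚ K := by
      rw [← InfinitePlace.sum_mult_eq]; push_cast; rfl
    calc _ = 2 * ∑ w : InfinitePlace K, (w.mult : ℝ) * Real.log (w x) -
          (∑ w : InfinitePlace K, (w.mult : ℝ)) * (2 * L) := by
          rw [Finset.mul_sum, Finset.sum_mul, ← Finset.sum_sub_distrib]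
          exact Finset.sum_congr rfl fun w _ => by ring
      _ = 0 := by
          rw [h2, h4, hL]; field_simp; ring
  refine ⟨fun v : {w : InfinitePlace K // w ≠ w₀} =>
    (v.1.mult : ℝ) * (2 * Real.log (v.1 x) - 2 * L) / 2, fun h => heckeQ_congr_mul fun w => ?_⟩
  · rw [hvec_add, exists_hvec_eq h1, Pi.add_apply, map_one]
    have h5 : |(Algebra.norm ℚ x : ℝ)| ^ (2 / (Module.finrank ℚ K : ℝ)) = Real.exp (2 * L) := by
      rw [Real.rpow_def_of_pos hN, hL]; congr 1; ring
    rw [h5, ← exp_log_sq (hw w), one_pow, mul_one, ← Real.exp_add, ← Real.exp_add]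
    congr 1; ring

theorem integral_heckeQ {x : K} (hx : x ≠ 0) {s : ℂ} (hs : 0 < s.re) :
    Integrable (fun h : logSpace K =>
        (heckeQ (hvec h) x : ℂ) ^ (-(Module.finrank ℚ K * s / 2))) ∧
      Complex.Gamma (Module.finrank ℚ K * s / 2) * (Real.pi : ℂ) ^ (-(Module.finrank ℚ K * s / 2)) *
        ∫ h : logSpace K, (heckeQ (hvec h) x : ℂ) ^ (-(Module.finrank ℚ K * s / 2)) =
      archGamma K s * ((|(Algebra.norm ℚ x : ℝ)| : ℝ) : ℂ) ^ (-s) := by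
  obtain ⟨h₀, hh₀⟩ := exists_heckeQ_eq hx
  obtain ⟨h1, h2⟩ := integral_heckeQ_one (K := K) hs
  have hn : (0 : ℝ) < Module.finrank ℚ K := by exact_mod_cast Module.finrank_pos
  set n := Module.finrank ℚ K
  have hN : 0 < |(Algebra.norm ℚ x : ℝ)| := by
    rw [abs_pos]; exact_mod_cast Algebra.norm_ne_zero_iff.mpr hx
  have key : (fun h : logSpace K => (heckeQ (hvec h) x : ℂ) ^ (-(n * s / 2))) = fun h =>
      ((|(Algebra.norm ℚ x : ℝ)| : ℝ) : ℂ) ^ (-s) *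
        (heckeQ (hvec (h + h₀)) (1 : K) : ℂ) ^ (-(n * s / 2)) := by
    funext h
    rw [hh₀, Complex.ofReal_mul, Complex.mul_cpow_ofReal_nonneg (by positivity)
      (heckeQ_pos _ one_ne_zero).le]
    congr 1
    have hN' : ((|(Algebra.norm ℚ x : ℝ)| : ℝ) : ℂ) ≠ 0 := by exact_mod_cast hN.ne'
    have hn' : (n : ℂ) ≠ 0 := by exact_mod_cast hn.ne'
    rw [Complex.cpow_def_of_ne_zero (by exact_mod_cast (Real.rpow_pos_of_pos hN _).ne'),
      Complex.cpow_def_of_ne_zero hN', ← Complex.ofReal_log (by positivity),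
      ← Complex.ofReal_log hN.le, Real.log_rpow hN]
    congr 1
    push_cast
    field_simp
  rw [key]
  constructor
  · exact (h1.comp_add_right h₀).const_mul _
  · rw [integral_const_mul, integral_add_right_eq_self
      (fun h => (heckeQ (hvec h) (1 : K) : ℂ) ^ (-(n * s / 2))), ← h2]
    ring

instance vaddInvariantMeasure_unitLattice :
    VAddInvariantMeasure (unitLattice K) (logSpace K) volume :=
  inferInstanceAs (VAddInvariantMeasure (unitLattice K).toAddSubgroup (logSpace K) volume)

open scoped Pointwise in
theorem hasSum_unitLattice_setIntegral {F : logSpace K → ℂ} (hF : Integrable F) :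
    HasSum (fun g : unitLattice K => ∫ h in unitDomain K, F (h + (g : logSpace K)))
      (∫ h, F h) := by
  have h2 := (isAddFundamentalDomain_unitDomain (K := K)).sum_restrict
  have h3 := hasSum_integral_measure (f := F)
    (μ := fun g : unitLattice K => volume.restrict (g +ᵥ unitDomain K)) (by rwa [h2])
  rw [h2] at h3
  refine (congrArg (HasSum · _) (funext fun g => ?_)).mp h3
  have h4 := (measurePreserving_add_right (volume : Measure (logSpace K))
    (g : logSpace K)).setIntegral_image_emb (MeasurableEquiv.addRight _).measurableEmbedding F
    (unitDomain K)
  refine Eq.trans ?_ h4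
  congr 3
  ext y
  simp only [mem_image, mem_vadd_set, Submodule.vadd_def, vadd_eq_add, add_comm]

theorem groupEquivQuotientProdSubgroup_fst {G : Type*} [Group G] (T : Subgroup G) (u : G) :
    (Subgroup.groupEquivQuotientProdSubgroup (s := T) u).1 = (u : G ⧸ T) := rfl

theorem hasSum_of_hasSum_quotient {G : Type*} [Group G] (T : Subgroup G) [Finite T]
    {f : G ⧸ T → ℂ} {a : ℂ} (hf : HasSum f a) : HasSum (fun g : G => f g) (Nat.card T * a) := by
  have h6 : HasSum (fun _ : T => (1 : ℂ)) (Nat.card T : ℂ) := by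
    have : Fintype T := Fintype.ofFinite _
    have := hasSum_fintype (fun _ : T => (1 : ℂ))
    simpa [Nat.card_eq_fintype_card] using this
  have h7 := HasSum.mul (f := f) (g := fun _ : T => (1 : ℂ)) hf h6
    (summable_mul_of_summable_norm (f := f) (g := fun _ : T => (1 : ℂ)) hf.summable.norm
      h6.summable.norm)
  rw [mul_comm]
  have h8 := ((Subgroup.groupEquivQuotientProdSubgroup (s := T)).hasSum_iff
    (f := fun p : (G ⧸ T) × T => f p.1 * 1)).mpr h7
  have h9 : ((fun p : (G ⧸ T) × T => f p.1 * 1) ∘ Subgroup.groupEquivQuotientProdSubgroup) =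
      fun u : G => f u := by
    funext u
    rw [Function.comp_apply, mul_one, groupEquivQuotientProdSubgroup_fst]
  rwa [h9] at h8

/-- Unfolding an integral over the logarithmic space along the units. -/
theorem hasSum_units_setIntegral {F : logSpace K → ℂ} (hF : Integrable F) :
    HasSum (fun u : (𝓞 K)ˣ => ∫ h in unitDomain K, F (h + logEmbedding K (Additive.ofMul u)))
      (torsionOrder K * ∫ h, F h) := by
  have h1 := hasSum_unitLattice_setIntegral hF
  let e := (logEmbeddingEquiv K).toEquiv
  have h5 : HasSum (fun q : (𝓞 K)ˣ ⧸ torsion K => ∫ h in unitDomain K,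
      F (h + logEmbeddingEquiv K (Additive.ofMul q))) (∫ h, F h) :=
    (e.hasSum_iff (f := fun g : unitLattice K => ∫ h in unitDomain K, F (h + g))).mpr h1
  exact hasSum_of_hasSum_quotient (torsion K) h5

theorem hasSum_units_heckeQ {x : K} (hx : x ≠ 0) {s : ℂ} (hs : 0 < s.re) :
    HasSum (fun u : (𝓞 K)ˣ => Complex.Gamma (Module.finrank ℚ K * s / 2) *
        (Real.pi : ℂ) ^ (-(Module.finrank ℚ K * s / 2)) * ∫ h in unitDomain K,
          (heckeQ (hvec h) ((u : K) * x) : ℂ) ^ (-(Module.finrank ℚ K * s / 2)))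
      (torsionOrder K * (archGamma K s * ((|(Algebra.norm ℚ x : ℝ)| : ℝ) : ℂ) ^ (-s))) := by
  obtain ⟨h1, h2⟩ := integral_heckeQ hx hs
  have h3 := (hasSum_units_setIntegral h1).mul_left (Complex.Gamma (Module.finrank ℚ K * s / 2) *
        (Real.pi : ℂ) ^ (-(Module.finrank ℚ K * s / 2)))
  rw [← h2]
  simp_rw [heckeQ_unit_mul]
  rw [mul_left_comm] at h3
  exact h3

end UnitUnfolding

section IdealClassSums

open NumberField NumberField.Units NumberField.Units.dirichletUnitTheorem MeasureTheory Set
open scoped nonZeroDivisors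

variable {K : Type*} [Field K] [NumberField K]

theorem hasSum_units_heckeQ_smul {x : K} (hx : x ≠ 0) {s : ℂ} (hs : 0 < s.re) {a : ℝ}
    (ha : a = 1 ∨ a = -1) :
    HasSum (fun u : (𝓞 K)ˣ => Complex.Gamma (Module.finrank ℚ K * s / 2) *
        (Real.pi : ℂ) ^ (-(Module.finrank ℚ K * s / 2)) * ∫ h in unitDomain K,
          (heckeQ (hvec (a • h)) ((u : K) * x) : ℂ) ^ (-(Module.finrank ℚ K * s / 2)))
      (torsionOrder K * (archGamma K s * ((|(Algebra.norm ℚ x : ℝ)| : ℝ) : ℂ) ^ (-s))) := by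
  rcases ha with rfl | rfl
  · simpa only [one_smul] using hasSum_units_heckeQ hx hs
  · obtain ⟨h1, h2⟩ := integral_heckeQ hx hs
    have h3 := (hasSum_units_setIntegral h1.comp_neg).mul_left
      (Complex.Gamma (Module.finrank ℚ K * s / 2) *
        (Real.pi : ℂ) ^ (-(Module.finrank ℚ K * s / 2)))
    rw [integral_neg_eq_self (fun h : logSpace K =>
      (heckeQ (hvec h) x : ℂ) ^ (-(Module.finrank ℚ K * s / 2))), mul_left_comm, h2] at h3
    rw [← (Equiv.inv (𝓞 K)ˣ).hasSum_iff] at h3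
    refine (congrArg (HasSum · _) (funext fun u => ?_)).mp h3
    simp only [Function.comp_apply, Equiv.inv_apply]
    congr 1
    refine integral_congr_ae (Filter.Eventually.of_forall fun h => ?_)
    simp only [heckeQ_unit_mul, ofMul_inv, map_neg, neg_add, neg_neg, neg_smul, one_smul]

theorem exists_mk0_mul_eq_spanSingleton {𝔞 : (FractionalIdeal (𝓞 K)⁰ K)ˣ} {I : (Ideal (𝓞 K))⁰}
    (h : ClassGroup.mk0 I = (ClassGroup.mk K 𝔞)⁻¹) :
    ∃ x : K, x ≠ 0 ∧ ((I : Ideal (𝓞 K)) : FractionalIdeal (𝓞 K)⁰ K) * 𝔞 =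
      FractionalIdeal.spanSingleton (𝓞 K)⁰ x := by
  have h1 : ClassGroup.mk K (FractionalIdeal.mk0 K I * 𝔞) = 1 := by
    rw [map_mul, ClassGroup.mk_mk0, h, inv_mul_cancel]
  obtain ⟨x, hx⟩ := (FractionalIdeal.isPrincipal_iff _).mp (ClassGroup.mk_eq_one_iff.mp h1)
  rw [Units.val_mul, FractionalIdeal.coe_mk0] at hx
  refine ⟨x, ?_, hx⟩
  rintro rfl
  rw [FractionalIdeal.spanSingleton_zero, ← FractionalIdeal.coe_mk0 K I, ← Units.val_mul] at hx
  exact Units.ne_zero _ hx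

theorem exists_mk0_of_mem {𝔞 : (FractionalIdeal (𝓞 K)⁰ K)ˣ} {x : K} (hx : x ≠ 0)
    (hxa : x ∈ (𝔞 : FractionalIdeal (𝓞 K)⁰ K)) :
    ∃ I : (Ideal (𝓞 K))⁰, ClassGroup.mk0 I = (ClassGroup.mk K 𝔞)⁻¹ ∧
      ((I : Ideal (𝓞 K)) : FractionalIdeal (𝓞 K)⁰ K) * 𝔞 =
        FractionalIdeal.spanSingleton (𝓞 K)⁰ x := by
  have h1 : FractionalIdeal.spanSingleton (𝓞 K)⁰ x ≤ 𝔞 :=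
    (FractionalIdeal.spanSingleton_le_iff_mem).mpr hxa
  have h2 : FractionalIdeal.spanSingleton (𝓞 K)⁰ x * ((𝔞⁻¹ : (FractionalIdeal (𝓞 K)⁰ K)ˣ) :
      FractionalIdeal (𝓞 K)⁰ K) ≤ 1 := by
    rw [← Units.mul_inv 𝔞]
    exact mul_le_mul_left h1 _
  obtain ⟨I, hI⟩ := FractionalIdeal.le_one_iff_exists_coeIdeal.mp h2
  have h3 : ((I : Ideal (𝓞 K)) : FractionalIdeal (𝓞 K)⁰ K) * 𝔞 =
      FractionalIdeal.spanSingleton (𝓞 K)⁰ x := by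
    rw [hI, mul_assoc, Units.inv_mul, mul_one]
  have hI0 : I ≠ ⊥ := by
    rintro rfl
    rw [FractionalIdeal.coeIdeal_bot, zero_mul, eq_comm,
      FractionalIdeal.spanSingleton_eq_zero_iff] at h3
    exact hx h3
  refine ⟨⟨I, mem_nonZeroDivisors_of_ne_zero hI0⟩, ?_, h3⟩
  rw [eq_inv_iff_mul_eq_one, ← ClassGroup.mk_mk0 K, ← map_mul, ClassGroup.mk_eq_one_iff,
    FractionalIdeal.isPrincipal_iff]
  exact ⟨x, by rw [Units.val_mul, FractionalIdeal.coe_mk0]; exact h3⟩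

theorem spanSingleton_eq_iff {x y : K} :
    FractionalIdeal.spanSingleton (𝓞 K)⁰ x = FractionalIdeal.spanSingleton (𝓞 K)⁰ y ↔
      ∃ u : (𝓞 K)ˣ, (u : K) * x = y := by
  rw [← FractionalIdeal.coeToSubmodule_inj, FractionalIdeal.coe_spanSingleton,
    FractionalIdeal.coe_spanSingleton, Submodule.span_singleton_eq_span_singleton]
  rfl

/-- The fractional ideal has `b` as a basis over the integers. -/
def IsIdealBasis {ι : Type*} [Fintype ι] (b : Module.Basis ι ℚ K)
    (𝔞 : (FractionalIdeal (𝓞 K)⁰ K)ˣ) : Prop :=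
  ∀ x, x ∈ (𝔞 : FractionalIdeal (𝓞 K)⁰ K) ↔ ∃ m : ι → ℤ, ∑ i, m i • b i = x

variable {ι : Type*} [Fintype ι]

theorem sum_zsmul_basis_injective (b : Module.Basis ι ℚ K) :
    Function.Injective fun m : ι → ℤ => ∑ i, m i • b i := by
  intro m m' h
  have h1 : ∀ m : ι → ℤ, ∑ i, m i • b i = ∑ i, (m i : ℚ) • b i := fun m => by
    simp_rw [Int.cast_smul_eq_zsmul]
  simp only [h1] at h
  have h2 := congrArg b.repr h
  funext i
  have h3 := DFunLike.congr_fun h2 i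
  rw [b.repr_sum_self, b.repr_sum_self] at h3
  exact_mod_cast h3

/-- The Mellin transform of an averaged theta series is a sum over an ideal class. -/
theorem hasSum_mellin_heckeFam (b : Module.Basis ι ℚ K) (𝔞 : (FractionalIdeal (𝓞 K)⁰ K)ˣ)
    (hb : IsIdealBasis b 𝔞) {a : ℝ} (ha : a = 1 ∨ a = -1) (φ : (ι → ℤ) → ℂ) (B : ℝ)
    (hφ : ∀ m, ‖φ m‖ ≤ B) (ψ : (Ideal (𝓞 K))⁰ → ℂ)
    (hψ : ∀ m (I : (Ideal (𝓞 K))⁰), m ≠ 0 → ((I : Ideal (𝓞 K)) : FractionalIdeal (𝓞 K)⁰ K) * 𝔞 =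
      FractionalIdeal.spanSingleton (𝓞 K)⁰ (∑ i, m i • b i) → φ m = ψ I)
    {s : ℂ} (hs : 1 < s.re) :
    HasSum (fun I : {I : (Ideal (𝓞 K))⁰ // ClassGroup.mk0 I = (ClassGroup.mk K 𝔞)⁻¹} =>
        torsionOrder K * archGamma K s *
          (((FractionalIdeal.absNorm (𝔞 : FractionalIdeal (𝓞 K)⁰ K) : ℚ) : ℝ) : ℂ) ^ (-s) *
          (ψ I * (Ideal.absNorm (I.1 : Ideal (𝓞 K)) : ℂ) ^ (-s)))
      (mellin (fun t => thetaAvg (volume.restrict (unitDomain K)) (heckeFam b a 1) φ t -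
        φ 0 * (volume.restrict (unitDomain K)).real univ) (Module.finrank ℚ K * s / 2)) := by
  have hn : (0 : ℝ) < Module.finrank ℚ K := by exact_mod_cast Module.finrank_pos
  have hcard : Fintype.card ι = Module.finrank ℚ K := (Module.finrank_eq_card_basis b).symm
  obtain ⟨c, hc⟩ := isQuadFamily_heckeFam b a one_pos isBounded_unitDomain measurableSet_unitDomain
  set n := Module.finrank ℚ K with hndef
  have hre : ((n : ℂ) * s / 2).re = n * s.re / 2 := by simp
  have hsum := hc.hasSum_mellin hφ (s := n * s / 2) (by rw [hre]; positivity)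
    (by rw [hre, hcard]; nlinarith)
  choose X hX0 hX using fun I : {I : (Ideal (𝓞 K))⁰ // ClassGroup.mk0 I = (ClassGroup.mk K 𝔞)⁻¹} =>
    exists_mk0_mul_eq_spanSingleton I.2
  have hspan : ∀ I (u : (𝓞 K)ˣ), FractionalIdeal.spanSingleton (𝓞 K)⁰ ((u : K) * X I) =
      FractionalIdeal.spanSingleton (𝓞 K)⁰ (X I) := fun I u =>
    (spanSingleton_eq_iff.mpr ⟨u, rfl⟩).symm
  have hle : ∀ I : (Ideal (𝓞 K))⁰, ((I : Ideal (𝓞 K)) : FractionalIdeal (𝓞 K)⁰ K) * 𝔞 ≤ 𝔞 := by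
    intro I
    calc _ ≤ 1 * (𝔞 : FractionalIdeal (𝓞 K)⁰ K) :=
          mul_le_mul_left FractionalIdeal.coeIdeal_le_one _
      _ = 𝔞 := one_mul _
  have hmem : ∀ I (u : (𝓞 K)ˣ), (u : K) * X I ∈ (𝔞 : FractionalIdeal (𝓞 K)⁰ K) := by
    intro I u
    rw [← FractionalIdeal.spanSingleton_le_iff_mem, hspan, ← hX]
    exact hle _
  choose m hm using fun p : {I : (Ideal (𝓞 K))⁰ // ClassGroup.mk0 I = (ClassGroup.mk K 𝔞)⁻¹} ×
    (𝓞 K)ˣ => (hb _).mp (hmem p.1 p.2)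
  have hspan' : ∀ p, FractionalIdeal.spanSingleton (𝓞 K)⁰ (∑ i, m p i • b i) =
      ((p.1.1 : Ideal (𝓞 K)) : FractionalIdeal (𝓞 K)⁰ K) * 𝔞 := fun p => by
    rw [hm, hspan, hX]
  have hminj : Function.Injective m := by
    rintro ⟨I, u⟩ ⟨I', u'⟩ h
    have h1 := hspan' (I, u)
    rw [h, hspan'] at h1
    have h2 := (Units.mul_left_inj 𝔞).mp h1
    have h3 : I' = I := Subtype.ext (Subtype.ext (FractionalIdeal.coeIdeal_injective h2))
    subst h3
    have h4 := hm (I', u)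
    rw [h, hm] at h4
    have h5 := mul_right_cancel₀ (hX0 _) h4
    rw [Prod.mk.injEq]
    exact ⟨rfl, Units.ext (RingOfIntegers.ext h5.symm)⟩
  have hm0 : ∀ p, m p ≠ 0 := by
    intro p h
    have h1 := hm p
    rw [h] at h1
    simp only [Pi.zero_apply, zero_smul, Finset.sum_const_zero] at h1
    exact mul_ne_zero (by simp) (hX0 _) h1.symm
  have hsurj : ∀ k, k ≠ 0 → k ∈ range m := by
    intro k hk
    have hx : ∑ i, k i • b i ≠ 0 := by
      intro h
      refine hk (sum_zsmul_basis_injective b ?_)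
      simpa using h
    obtain ⟨I, hI, hIx⟩ := exists_mk0_of_mem hx ((hb _).mpr ⟨k, rfl⟩)
    have h1 := hX ⟨I, hI⟩
    rw [hIx, eq_comm] at h1
    obtain ⟨u, hu⟩ := spanSingleton_eq_iff.mp h1
    refine ⟨(⟨I, hI⟩, u), sum_zsmul_basis_injective b ?_⟩
    simp only [hm, hu]
  rw [← hminj.hasSum_iff] at hsum
  swap
  · intro k hk
    rw [if_pos]
    by_contra h0
    exact hk (hsurj k h0)
  refine hsum.prod_fiberwise fun I => ?_
  have h1 := (hasSum_units_heckeQ_smul (hX0 I) (s := s) (by linarith) ha).mul_left (ψ I)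
  have hnorm : |(Algebra.norm ℚ (X I) : ℝ)| = (Ideal.absNorm (I.1 : Ideal (𝓞 K)) : ℝ) *
      ((FractionalIdeal.absNorm (𝔞 : FractionalIdeal (𝓞 K)⁰ K) : ℚ) : ℝ) := by
    have h2 := congrArg FractionalIdeal.absNorm (hX I)
    rw [map_mul, FractionalIdeal.coeIdeal_absNorm, FractionalIdeal.absNorm_span_singleton] at h2
    exact_mod_cast h2.symm
  have hnn : (0 : ℝ) ≤ ((FractionalIdeal.absNorm (𝔞 : FractionalIdeal (𝓞 K)⁰ K) : ℚ) : ℝ) := by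
    exact_mod_cast FractionalIdeal.absNorm_nonneg _
  have hval : torsionOrder K * archGamma K s *
          (((FractionalIdeal.absNorm (𝔞 : FractionalIdeal (𝓞 K)⁰ K) : ℚ) : ℝ) : ℂ) ^ (-s) *
          (ψ I * (Ideal.absNorm (I.1 : Ideal (𝓞 K)) : ℂ) ^ (-s)) = ψ I * (torsionOrder K *
      (archGamma K s * ((|(Algebra.norm ℚ (X I) : ℝ)| : ℝ) : ℂ) ^ (-s))) := by
    rw [hnorm, Complex.ofReal_mul, Complex.mul_cpow_ofReal_nonneg (Nat.cast_nonneg _) hnn,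
      Complex.ofReal_natCast]
    ring
  rw [hval]
  refine (congrArg (HasSum · _) (funext fun u => ?_)).mp h1
  rw [Function.comp_apply, if_neg (hm0 _), hψ _ I.1 (hm0 _) (hspan' (I, u)).symm]
  simp only [heckeFam, hm, mul_one, hndef]

end IdealClassSums

/-- Multiplying the Mellin transform of a weak functional equation pair by `z (k - z)` gives entire
functions related by the functional equation. -/
theorem WeakFEPair.exists_entire (P : WeakFEPair ℂ) :
    ∃ W W' : ℂ → ℂ, Differentiable ℂ W ∧ Differentiable ℂ W' ∧
      (∀ z, W (P.k - z) = P.ε * W' z) ∧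
      (∀ z : ℂ, P.k < z.re → W z = z * (P.k - z) * mellin (fun t => P.f t - P.f₀) z) ∧
      (∀ z : ℂ, P.k < z.re → W' z = z * (P.k - z) * mellin (fun t => P.g t - P.g₀) z) := by
  have key : ∀ (Q : WeakFEPair ℂ) (z : ℂ), Q.k < z.re →
      z * (Q.k - z) * Q.Λ₀ z - (Q.k - z) * Q.f₀ - Q.ε * z * Q.g₀ =
        z * (Q.k - z) * mellin (fun t => Q.f t - Q.f₀) z := by
    intro Q z hz
    have h0 : z ≠ 0 := by
      rintro rfl
      exact absurd hz (not_lt.mpr Q.hk.le)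
    have h1 : (Q.k : ℂ) - z ≠ 0 := by
      intro h
      rw [sub_eq_zero] at h
      rw [← h, ofReal_re] at hz
      exact lt_irrefl _ hz
    rw [(Q.hasMellin hz).2, Q.Λ₀_eq, smul_eq_mul, smul_eq_mul]
    field_simp
    ring
  refine ⟨fun z => z * (P.k - z) * P.Λ₀ z - (P.k - z) * P.f₀ - P.ε * z * P.g₀,
    fun z => z * (P.k - z) * P.symm.Λ₀ z - (P.k - z) * P.g₀ - P.ε⁻¹ * z * P.f₀, ?_, ?_, ?_, key P,
    key P.symm⟩
  · have := P.differentiable_Λ₀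
    fun_prop
  · have := P.symm.differentiable_Λ₀
    fun_prop
  · intro z
    simp only [P.functional_equation₀, smul_eq_mul]
    have := P.hε
    field_simp
    ring

section IdealBases

open NumberField NumberField.Units NumberField.Units.dirichletUnitTheorem MeasureTheory Set
open scoped nonZeroDivisors

variable {K : Type*} [Field K] [NumberField K]

theorem isIdealBasis_iff_span {ι : Type*} [Fintype ι] (b : Module.Basis ι ℚ K)
    (𝔞 : (FractionalIdeal (𝓞 K)⁰ K)ˣ) :
    IsIdealBasis b 𝔞 ↔
      ((𝔞 : FractionalIdeal (𝓞 K)⁰ K) : Submodule (𝓞 K) K).restrictScalars ℤ =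
        Submodule.span ℤ (Set.range b) := by
  simp only [IsIdealBasis, SetLike.ext_iff, Submodule.restrictScalars_mem, FractionalIdeal.mem_coe,
    Submodule.mem_span_range_iff_exists_fun]

theorem isIdealBasis_basisOfFractionalIdeal (𝔞 : (FractionalIdeal (𝓞 K)⁰ K)ˣ) :
    IsIdealBasis (basisOfFractionalIdeal K 𝔞) 𝔞 := by
  rw [isIdealBasis_iff_span]
  ext x
  rw [mem_span_basisOfFractionalIdeal]
  rfl

theorem discr_basisOfFractionalIdeal (𝔞 : (FractionalIdeal (𝓞 K)⁰ K)ˣ) :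
    |Algebra.discr ℚ (basisOfFractionalIdeal K 𝔞)| =
      FractionalIdeal.absNorm (𝔞 : FractionalIdeal (𝓞 K)⁰ K) ^ 2 * |(discr K : ℚ)| := by
  have hcard : Fintype.card (Module.Free.ChooseBasisIndex ℤ (𝓞 K)) =
      Fintype.card (Module.Free.ChooseBasisIndex ℤ (𝔞 : FractionalIdeal (𝓞 K)⁰ K)) := by
    rw [← Module.finrank_eq_card_basis (integralBasis K),
      ← Module.finrank_eq_card_basis (basisOfFractionalIdeal K 𝔞)]
  let e := Fintype.equivOfCardEq hcard
  rw [← Algebra.discr_reindex ℚ (basisOfFractionalIdeal K 𝔞) e.symm,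
    ← det_basisOfFractionalIdeal_eq_absNorm K 𝔞 e, coe_discr, sq_abs, ← abs_sq, ← abs_mul,
    Module.Basis.det_apply, ← Algebra.discr_of_matrix_vecMul, Module.Basis.toMatrix_map_vecMul]
  simp

/-- The dual of a fractional ideal with respect to the trace form. -/
def dualUnit (𝔞 : (FractionalIdeal (𝓞 K)⁰ K)ˣ) : (FractionalIdeal (𝓞 K)⁰ K)ˣ :=
  Units.mk0 (FractionalIdeal.dual ℤ ℚ (𝔞 : FractionalIdeal (𝓞 K)⁰ K))
    (FractionalIdeal.dual_ne_zero ℤ ℚ 𝔞.ne_zero)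

theorem isIdealBasis_traceDual {ι : Type*} [Fintype ι] {b : Module.Basis ι ℚ K}
    {𝔞 : (FractionalIdeal (𝓞 K)⁰ K)ˣ} (hb : IsIdealBasis b 𝔞) :
    IsIdealBasis b.traceDual (dualUnit 𝔞) := by
  rw [isIdealBasis_iff_span] at hb ⊢
  rw [← Submodule.traceDual_span_of_basis ℤ _ b hb, dualUnit, Units.val_mk0,
    FractionalIdeal.coe_dual ℤ ℚ 𝔞.ne_zero]

theorem mk_mul_mk_dualUnit (𝔞 : (FractionalIdeal (𝓞 K)⁰ K)ˣ) :
    ClassGroup.mk K 𝔞 * ClassGroup.mk K (dualUnit 𝔞) = ClassGroup.mk K (dualUnit 1) := by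
  rw [← map_mul]
  congr 1
  ext1
  simp only [dualUnit, Units.val_mul, Units.val_mk0, Units.val_one]
  exact FractionalIdeal.self_mul_dual ℤ ℚ 𝔞.ne_zero

theorem absNorm_dualUnit (𝔞 : (FractionalIdeal (𝓞 K)⁰ K)ˣ) :
    FractionalIdeal.absNorm (𝔞 : FractionalIdeal (𝓞 K)⁰ K) *
      FractionalIdeal.absNorm (dualUnit 𝔞 : FractionalIdeal (𝓞 K)⁰ K) * |(discr K : ℚ)| = 1 := by
  have h1 : ((differentIdeal ℤ (𝓞 K) : Ideal (𝓞 K)) : FractionalIdeal (𝓞 K)⁰ K) *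
      FractionalIdeal.dual ℤ ℚ (1 : FractionalIdeal (𝓞 K)⁰ K) = 1 := by
    rw [coeIdeal_differentIdeal ℤ ℚ K (𝓞 K)]
    exact inv_mul_cancel₀ (FractionalIdeal.dual_ne_zero ℤ ℚ one_ne_zero)
  have h2 := congrArg FractionalIdeal.absNorm h1
  rw [map_mul, FractionalIdeal.coeIdeal_absNorm, NumberField.absNorm_differentIdeal K, map_one,
    Nat.cast_natAbs] at h2
  rw [← map_mul, dualUnit, Units.val_mk0, FractionalIdeal.self_mul_dual ℤ ℚ 𝔞.ne_zero, mul_comm]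
  exact_mod_cast h2

end IdealBases

section IdealSeries

open NumberField NumberField.Units NumberField.Units.dirichletUnitTheorem MeasureTheory Set
open scoped nonZeroDivisors

variable {K : Type*} [Field K] [NumberField K]

theorem absNorm_unit_pos (𝔞 : (FractionalIdeal (𝓞 K)⁰ K)ˣ) :
    (0 : ℝ) < ((FractionalIdeal.absNorm (𝔞 : FractionalIdeal (𝓞 K)⁰ K) : ℚ) : ℝ) := by
  have h1 : FractionalIdeal.absNorm (𝔞 : FractionalIdeal (𝓞 K)⁰ K) ≠ 0 := by
    rw [Ne, FractionalIdeal.absNorm_eq_zero_iff]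
    exact 𝔞.ne_zero
  exact_mod_cast (FractionalIdeal.absNorm_nonneg _).lt_of_ne' h1

/-- Turns the Mellin transform of an averaged theta series into a normalised ideal class sum. -/
theorem hasSum_class_of_mellin {ι : Type*} [Fintype ι] (b : Module.Basis ι ℚ K)
    (𝔞 : (FractionalIdeal (𝓞 K)⁰ K)ˣ)
    (hb : IsIdealBasis b 𝔞) {a : ℝ} (ha : a = 1 ∨ a = -1) (φ : (ι → ℤ) → ℂ) (B : ℝ)
    (hφ : ∀ m, ‖φ m‖ ≤ B) (ψ : (Ideal (𝓞 K))⁰ → ℂ)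
    (hψ : ∀ m (I : (Ideal (𝓞 K))⁰), m ≠ 0 → ((I : Ideal (𝓞 K)) : FractionalIdeal (𝓞 K)⁰ K) * 𝔞 =
      FractionalIdeal.spanSingleton (𝓞 K)⁰ (∑ i, m i • b i) → φ m = ψ I)
    (W : ℂ → ℂ) (hW : ∀ z : ℂ, ((Fintype.card ι : ℝ) / 2 : ℝ) < z.re → W z =
      z * (((Fintype.card ι : ℝ) / 2 : ℝ) - z) *
        mellin (fun t => thetaAvg (volume.restrict (unitDomain K)) (heckeFam b a 1) φ t -
        φ 0 * (volume.restrict (unitDomain K)).real univ) z)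
    {s : ℂ} (hs : 1 < s.re) :
    HasSum (fun I : {I : (Ideal (𝓞 K))⁰ // ClassGroup.mk0 I = (ClassGroup.mk K 𝔞)⁻¹} =>
        archGamma K s * (s * (1 - s)) * (ψ I * (Ideal.absNorm (I.1 : Ideal (𝓞 K)) : ℂ) ^ (-s)))
      ((torsionOrder K : ℂ)⁻¹ * ((Module.finrank ℚ K : ℂ) / 2)⁻¹ ^ 2 *
        (((FractionalIdeal.absNorm (𝔞 : FractionalIdeal (𝓞 K)⁰ K) : ℚ) : ℝ) : ℂ) ^ s *
          W (Module.finrank ℚ K * s / 2)) := by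
  have hcard : Fintype.card ι = Module.finrank ℚ K := (Module.finrank_eq_card_basis b).symm
  have hn : (0 : ℝ) < Module.finrank ℚ K := by exact_mod_cast Module.finrank_pos
  have hn' : (Module.finrank ℚ K : ℂ) ≠ 0 := by exact_mod_cast hn.ne'
  have ht : (torsionOrder K : ℂ) ≠ 0 := by exact_mod_cast (torsionOrder_pos K).ne'
  have hN : ((((FractionalIdeal.absNorm (𝔞 : FractionalIdeal (𝓞 K)⁰ K) : ℚ) : ℝ) : ℂ)) ≠ 0 :=
    ofReal_ne_zero.mpr (absNorm_unit_pos 𝔞).ne'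
  rw [hW _ (by rw [hcard]; simp; nlinarith), hcard]
  have h1 := (hasSum_mellin_heckeFam b 𝔞 hb ha φ B hφ ψ hψ hs).mul_left
    ((torsionOrder K : ℂ)⁻¹ * (s * (1 - s)) *
      (((FractionalIdeal.absNorm (𝔞 : FractionalIdeal (𝓞 K)⁰ K) : ℚ) : ℝ) : ℂ) ^ s)
  have h2 : ∀ X : ℂ, (torsionOrder K : ℂ)⁻¹ * ((Module.finrank ℚ K : ℂ) / 2)⁻¹ ^ 2 *
        (((FractionalIdeal.absNorm (𝔞 : FractionalIdeal (𝓞 K)⁰ K) : ℚ) : ℝ) : ℂ) ^ s *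
          (Module.finrank ℚ K * s / 2 * ((((Module.finrank ℚ K : ℕ) : ℝ) / 2 : ℝ) -
            Module.finrank ℚ K * s / 2) * X) = (torsionOrder K : ℂ)⁻¹ * (s * (1 - s)) *
      (((FractionalIdeal.absNorm (𝔞 : FractionalIdeal (𝓞 K)⁰ K) : ℚ) : ℝ) : ℂ) ^ s * X := by
    intro X
    push_cast
    field_simp
  rw [h2]
  refine (congrArg (HasSum · _) (funext fun I => ?_)).mp h1
  rw [cpow_neg _ s]
  have hN' := cpow_ne_zero_iff_of_exponent_ne_zero (x := (((FractionalIdeal.absNorm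
    (𝔞 : FractionalIdeal (𝓞 K)⁰ K) : ℚ) : ℝ) : ℂ)) (y := s) (by rintro rfl; simp at hs; linarith)
  have := hN'.mpr hN
  field_simp

/-- Sums over all nonzero ideals are finite sums of sums over ideal classes. -/
theorem hasSum_of_hasSum_class {f : (Ideal (𝓞 K))⁰ → ℂ} {A : ClassGroup (𝓞 K) → ℂ}
    (e : ClassGroup (𝓞 K) ≃ ClassGroup (𝓞 K))
    (h : ∀ C, HasSum (fun I : {I : (Ideal (𝓞 K))⁰ // ClassGroup.mk0 I = e C} => f I) (A C)) :
    HasSum f (∑ C, A C) := by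
  have h1 : HasSum (fun I => ∑ C, ({I | ClassGroup.mk0 I = e C} : Set (Ideal (𝓞 K))⁰).indicator
      f I) (∑ C, A C) :=
    hasSum_sum fun C _ => (hasSum_subtype_iff_indicator
      (s := ({I | ClassGroup.mk0 I = e C} : Set (Ideal (𝓞 K))⁰))).mp (h C)
  refine (congrArg (HasSum · _) (funext fun I => ?_)).mp h1
  rw [Finset.sum_eq_single (e.symm (ClassGroup.mk0 I))]
  · rw [indicator_of_mem]
    simp
  · intro C _ hC
    refine indicator_of_notMem (fun hI => hC ?_) _
    rw [Set.mem_ofPred_eq] at hI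
    rw [hI, e.symm_apply_apply]
  · simp

theorem exists_mk_eq (C : ClassGroup (𝓞 K)) :
    ∃ 𝔞 : (FractionalIdeal (𝓞 K)⁰ K)ˣ, ClassGroup.mk K 𝔞 = C := by
  obtain ⟨I, rfl⟩ := ClassGroup.mk0_surjective C
  exact ⟨FractionalIdeal.mk0 K I, ClassGroup.mk_mk0 K I⟩

/-- Analytic continuation of Dirichlet series over ideals with weights that are periodic functions
on each ideal class. -/
theorem exists_entire_of_periodic (ψ : (Ideal (𝓞 K))⁰ → ℂ) (M : ℕ) [NeZero M] (B : ℝ)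
    (h : ∀ 𝔞 : (FractionalIdeal (𝓞 K)⁰ K)ˣ, ∃ Ψ : K → ℂ, (∀ x, ‖Ψ x‖ ≤ B) ∧
      (∀ x ∈ (𝔞 : FractionalIdeal (𝓞 K)⁰ K), ∀ y ∈ (𝔞 : FractionalIdeal (𝓞 K)⁰ K),
        Ψ (x + M * y) = Ψ x) ∧
      ∀ x (I : (Ideal (𝓞 K))⁰), x ≠ 0 → ((I : Ideal (𝓞 K)) : FractionalIdeal (𝓞 K)⁰ K) *
        (𝔞 : FractionalIdeal (𝓞 K)⁰ K) = FractionalIdeal.spanSingleton (𝓞 K)⁰ x → Ψ x = ψ I) :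
    ∃ W : ℂ → ℂ, Differentiable ℂ W ∧ ∀ s : ℂ, 1 < s.re →
      HasSum (fun I : (Ideal (𝓞 K))⁰ => archGamma K s * (s * (1 - s)) *
        (ψ I * (Ideal.absNorm (I : Ideal (𝓞 K)) : ℂ) ^ (-s))) (W s) := by
  have key : ∀ C : ClassGroup (𝓞 K), ∃ W : ℂ → ℂ, Differentiable ℂ W ∧ ∀ s : ℂ, 1 < s.re →
      HasSum (fun I : {I : (Ideal (𝓞 K))⁰ // ClassGroup.mk0 I = Equiv.inv _ C} =>
        archGamma K s * (s * (1 - s)) *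
        (ψ I * (Ideal.absNorm (I.1 : Ideal (𝓞 K)) : ℂ) ^ (-s))) (W s) := by
    intro C
    obtain ⟨𝔞, rfl⟩ := exists_mk_eq C
    obtain ⟨Ψ, hB, hper, hΨ⟩ := h 𝔞
    set b := basisOfFractionalIdeal K 𝔞
    have hb : IsIdealBasis b 𝔞 := isIdealBasis_basisOfFractionalIdeal 𝔞
    have hmem : ∀ m : _ → ℤ, ∑ i, m i • b i ∈ (𝔞 : FractionalIdeal (𝓞 K)⁰ K) := fun m =>
      (hb _).mpr ⟨m, rfl⟩
    obtain ⟨W, -, hW, -, -, hW1, -⟩ := (heckePair b b.traceDual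
      (fun i j => b.trace_mul_traceDual i j) M (fun m => Ψ (∑ i, m i • b i)) (fun m l => by
        have h1 : ∑ i, (m + (M : ℤ) • l) i • b i =
            ∑ i, m i • b i + (M : K) * ∑ i, l i • b i := by
          rw [Finset.mul_sum, ← Finset.sum_add_distrib]
          refine Finset.sum_congr rfl fun i _ => ?_
          have h2 : (m + (M : ℤ) • l) i = m i + (M : ℤ) * l i := rfl
          rw [h2]
          simp only [zsmul_eq_mul]
          push_cast
          ring
        rw [h1, hper _ (hmem m) _ (hmem l)]) B (fun m => hB _)).exists_entire
    refine ⟨_, ?_, fun s hs => hasSum_class_of_mellin b 𝔞 hb (Or.inl rfl) _ B (fun m => hB _) ψ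
      (fun m I hm hI => hΨ _ I ?_ hI) W hW1 hs⟩
    · have hN : ((((FractionalIdeal.absNorm (𝔞 : FractionalIdeal (𝓞 K)⁰ K) : ℚ) : ℝ) : ℂ)) ≠ 0 :=
        ofReal_ne_zero.mpr (absNorm_unit_pos 𝔞).ne'
      have h1 : Differentiable ℂ fun s : ℂ =>
          (((FractionalIdeal.absNorm (𝔞 : FractionalIdeal (𝓞 K)⁰ K) : ℚ) : ℝ) : ℂ) ^ s :=
        fun s => (differentiableAt_id.const_cpow (Or.inl hN))
      exact ((h1.const_mul _)).mul (hW.comp (by fun_prop))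
    · intro h0
      exact hm (sum_zsmul_basis_injective b (by simpa using h0))
  choose W hW hsum using key
  exact ⟨fun s => ∑ C, W C s, Differentiable.fun_sum fun C _ => hW C, fun s hs =>
    hasSum_of_hasSum_class (Equiv.inv _) fun C => hsum C s hs⟩

end IdealSeries

section ZetaFunctionalEquation

open NumberField NumberField.Units NumberField.Units.dirichletUnitTheorem MeasureTheory Set
open scoped nonZeroDivisors

variable {K : Type*} [Field K] [NumberField K]

theorem exists_entire_class_pair (𝔞 : (FractionalIdeal (𝓞 K)⁰ K)ˣ) :
    ∃ W W' : ℂ → ℂ, Differentiable ℂ W ∧ Differentiable ℂ W' ∧ (∀ s, W (1 - s) = W' s) ∧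
      (∀ s : ℂ, 1 < s.re →
        HasSum (fun I : {I : (Ideal (𝓞 K))⁰ // ClassGroup.mk0 I = (ClassGroup.mk K 𝔞)⁻¹} =>
          ((|(discr K : ℝ)| : ℝ) : ℂ) ^ (s / 2) * (archGamma K s * (s * (1 - s)) *
            (1 * (Ideal.absNorm (I.1 : Ideal (𝓞 K)) : ℂ) ^ (-s)))) (W s)) ∧
      (∀ s : ℂ, 1 < s.re →
        HasSum (fun I : {I : (Ideal (𝓞 K))⁰ //
            ClassGroup.mk0 I = (ClassGroup.mk K (dualUnit 𝔞))⁻¹} =>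
          ((|(discr K : ℝ)| : ℝ) : ℂ) ^ (s / 2) * (archGamma K s * (s * (1 - s)) *
            (1 * (Ideal.absNorm (I.1 : Ideal (𝓞 K)) : ℂ) ^ (-s)))) (W' s)) := by
  set b := basisOfFractionalIdeal K 𝔞 with hbdef
  have hb : IsIdealBasis b 𝔞 := isIdealBasis_basisOfFractionalIdeal 𝔞
  obtain ⟨W, W', hWd, hWd', hfe, hW, hW'⟩ := (heckePair b b.traceDual
      (fun i j => b.trace_mul_traceDual i j) 1 (fun _ => 1) (fun _ _ => rfl) 1
      (fun _ => by simp)).exists_entire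
  simp only [heckePair] at hfe hW hW'
  have hF : finFourier 1 (fun _ : _ → ℤ => (1 : ℂ)) =
      fun _ : Module.Free.ChooseBasisIndex ℤ (𝔞 : FractionalIdeal (𝓞 K)⁰ K) → ℤ => (1 : ℂ) := by
    funext k
    rw [finFourier_one]
  rw [hF] at hW'
  rw [Nat.cast_one, one_pow, inv_one] at hW'
  have hcard : Fintype.card (Module.Free.ChooseBasisIndex ℤ (𝔞 : FractionalIdeal (𝓞 K)⁰ K)) =
    Module.finrank ℚ K := (Module.finrank_eq_card_basis b).symm
  set N : ℝ := ((FractionalIdeal.absNorm (𝔞 : FractionalIdeal (𝓞 K)⁰ K) : ℚ) : ℝ) with hN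
  set N' : ℝ := ((FractionalIdeal.absNorm (dualUnit 𝔞 : FractionalIdeal (𝓞 K)⁰ K) : ℚ) : ℝ)
    with hN'
  have hNpos : 0 < N := absNorm_unit_pos 𝔞
  have hNpos' : 0 < N' := absNorm_unit_pos _
  set D : ℝ := |(discr K : ℝ)| with hD
  have hDpos : 0 < D := abs_pos.mpr (by exact_mod_cast discr_ne_zero K)
  have hNN : N * N' * D = 1 := by
    have := absNorm_dualUnit 𝔞
    rw [hN, hN', hD]
    exact_mod_cast this
  have hdisc : |((Algebra.discr ℚ b : ℚ) : ℝ)| = N ^ 2 * D := by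
    have := discr_basisOfFractionalIdeal 𝔞
    rw [hN, hD]
    exact_mod_cast this
  have hNc : (N : ℂ) ≠ 0 := ofReal_ne_zero.mpr hNpos.ne'
  have hNc' : (N' : ℂ) ≠ 0 := ofReal_ne_zero.mpr hNpos'.ne'
  have hDc : (D : ℂ) ≠ 0 := ofReal_ne_zero.mpr hDpos.ne'
  have hdp : ∀ x : ℂ, x ≠ 0 → Differentiable ℂ fun s : ℂ => x ^ s := fun x hx s =>
    differentiableAt_id.const_cpow (Or.inl hx)
  refine ⟨fun s => (D : ℂ) ^ (s / 2) * ((torsionOrder K : ℂ)⁻¹ *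
    ((Module.finrank ℚ K : ℂ) / 2)⁻¹ ^ 2 * (N : ℂ) ^ s * W (Module.finrank ℚ K * s / 2)),
    fun s => (D : ℂ) ^ (s / 2) * ((torsionOrder K : ℂ)⁻¹ *
    ((Module.finrank ℚ K : ℂ) / 2)⁻¹ ^ 2 * (N' : ℂ) ^ s * W' (Module.finrank ℚ K * s / 2)),
    ?_, ?_, ?_, ?_, ?_⟩
  · exact ((hdp _ hDc).comp (by fun_prop)).mul
      (((hdp _ hNc).const_mul _).mul (hWd.comp (by fun_prop)))
  · exact ((hdp _ hDc).comp (by fun_prop)).mul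
      (((hdp _ hNc').const_mul _).mul (hWd'.comp (by fun_prop)))
  · intro s
    have h1 : (Module.finrank ℚ K : ℂ) * (1 - s) / 2 =
        (((Fintype.card (Module.Free.ChooseBasisIndex ℤ (𝔞 : FractionalIdeal (𝓞 K)⁰ K)) : ℕ) : ℝ)
          / 2 : ℝ) - Module.finrank ℚ K * s / 2 := by
      rw [hcard]
      push_cast
      ring
    have h2 : Real.sqrt (N ^ 2 * D) = N * D ^ (1 / 2 : ℝ) := by
      rw [Real.sqrt_mul (sq_nonneg N), Real.sqrt_sq hNpos.le, Real.sqrt_eq_rpow]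
    have h3 : (N' : ℂ) = (N : ℂ)⁻¹ * (D : ℂ)⁻¹ := by
      have : (N : ℂ) * N' * D = 1 := by exact_mod_cast hNN
      field_simp
      linear_combination this
    have h4 : (N' : ℂ) ^ s = (N : ℂ) ^ (-s) * (D : ℂ) ^ (-s) := by
      rw [h3, ← ofReal_inv, ← ofReal_inv, mul_cpow_ofReal_nonneg (inv_pos.mpr hNpos).le
        (inv_pos.mpr hDpos).le, ofReal_inv, ofReal_inv, inv_cpow, inv_cpow, cpow_neg, cpow_neg]
      · rw [arg_ofReal_of_nonneg hDpos.le]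
        exact Real.pi_pos.ne
      · rw [arg_ofReal_of_nonneg hNpos.le]
        exact Real.pi_pos.ne
    beta_reduce
    rw [h1, hfe, hdisc, Nat.cast_one, one_pow, one_mul, h2, h4, ofReal_inv, ofReal_mul,
      ofReal_cpow hDpos.le]
    have h5 : (N : ℂ) ^ (1 - s) = N * (N : ℂ) ^ (-s) := by
      rw [sub_eq_add_neg, cpow_add _ _ hNc, cpow_one]
    have h6 : (D : ℂ) ^ ((1 - s) / 2) = (D : ℂ) ^ (((1 / 2 : ℝ)) : ℂ) *
        ((D : ℂ) ^ (s / 2) * (D : ℂ) ^ (-s)) := by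
      rw [← cpow_add _ _ hDc, ← cpow_add _ _ hDc]
      congr 1
      push_cast
      ring
    rw [h5, h6]
    have h7 : (D : ℂ) ^ (((1 / 2 : ℝ)) : ℂ) ≠ 0 := by
      rw [Ne, cpow_eq_zero_iff]
      tauto
    field_simp
  · intro s hs
    exact (hasSum_class_of_mellin b 𝔞 hb (Or.inl rfl) (fun _ => 1) 1 (fun _ => by simp)
      (fun _ => 1) (fun _ _ _ _ => rfl) W hW hs).mul_left _
  · intro s hs
    exact (hasSum_class_of_mellin b.traceDual _ (isIdealBasis_traceDual hb) (Or.inr rfl)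
      (fun _ => 1) 1 (fun _ => by simp) (fun _ => 1) (fun _ _ _ _ => rfl) W' hW' hs).mul_left _

theorem eq_of_eq_of_one_lt_re {W W' : ℂ → ℂ} (hW : Differentiable ℂ W)
    (hW' : Differentiable ℂ W') (h : ∀ s : ℂ, 1 < s.re → W s = W' s) : W = W' := by
  refine AnalyticOnNhd.eq_of_eventuallyEq (z₀ := 2) (fun z _ => hW.analyticAt z)
    (fun z _ => hW'.analyticAt z) ?_
  have h1 : {s : ℂ | 1 < s.re} ∈ nhds (2 : ℂ) :=
    (isOpen_lt continuous_const continuous_re).mem_nhds (by norm_num)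
  filter_upwards [h1] with s hs using h s hs

/-- Hecke's functional equation for the Dedekind zeta function. -/
theorem exists_entire_zeta (K : Type*) [Field K] [NumberField K] :
    ∃ W : ℂ → ℂ, Differentiable ℂ W ∧ (∀ s, W (1 - s) = W s) ∧ ∀ s : ℂ, 1 < s.re →
      HasSum (fun I : (Ideal (𝓞 K))⁰ => ((|(discr K : ℝ)| : ℝ) : ℂ) ^ (s / 2) *
        (archGamma K s * (s * (1 - s)) *
          (1 * (Ideal.absNorm (I : Ideal (𝓞 K)) : ℂ) ^ (-s)))) (W s) := by
  have key : ∀ C : ClassGroup (𝓞 K), ∃ W W' : ℂ → ℂ, Differentiable ℂ W ∧ Differentiable ℂ W' ∧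
      (∀ s, W (1 - s) = W' s) ∧
      (∀ s : ℂ, 1 < s.re →
        HasSum (fun I : {I : (Ideal (𝓞 K))⁰ // ClassGroup.mk0 I = Equiv.inv _ C} =>
          ((|(discr K : ℝ)| : ℝ) : ℂ) ^ (s / 2) * (archGamma K s * (s * (1 - s)) *
            (1 * (Ideal.absNorm (I.1 : Ideal (𝓞 K)) : ℂ) ^ (-s)))) (W s)) ∧
      (∀ s : ℂ, 1 < s.re →
        HasSum (fun I : {I : (Ideal (𝓞 K))⁰ // ClassGroup.mk0 I =
            Equiv.mulRight (ClassGroup.mk K (dualUnit 1))⁻¹ C} =>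
          ((|(discr K : ℝ)| : ℝ) : ℂ) ^ (s / 2) * (archGamma K s * (s * (1 - s)) *
            (1 * (Ideal.absNorm (I.1 : Ideal (𝓞 K)) : ℂ) ^ (-s)))) (W' s)) := by
    intro C
    obtain ⟨𝔞, rfl⟩ := exists_mk_eq C
    have h1 : Equiv.mulRight (ClassGroup.mk K (dualUnit (1 : (FractionalIdeal (𝓞 K)⁰ K)ˣ)))⁻¹
        (ClassGroup.mk K 𝔞) = (ClassGroup.mk K (dualUnit 𝔞))⁻¹ := by
      rw [Equiv.coe_mulRight, ← mk_mul_mk_dualUnit 𝔞, mul_inv]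
      exact mul_inv_cancel_left _ _
    rw [h1]
    exact exists_entire_class_pair 𝔞
  choose W W' hW hW' hfe hsum hsum' using key
  have hd : Differentiable ℂ fun s => ∑ C, W C s := Differentiable.fun_sum fun C _ => hW C
  have hd' : Differentiable ℂ fun s => ∑ C, W' C s := Differentiable.fun_sum fun C _ => hW' C
  have h1 : ∀ s : ℂ, 1 < s.re → HasSum _ (∑ C, W C s) := fun s hs =>
    hasSum_of_hasSum_class (f := fun I : (Ideal (𝓞 K))⁰ => ((|(discr K : ℝ)| : ℝ) : ℂ) ^ (s / 2) *
        (archGamma K s * (s * (1 - s)) *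
          (1 * (Ideal.absNorm (I : Ideal (𝓞 K)) : ℂ) ^ (-s)))) (Equiv.inv _) fun C => hsum C s hs
  have h2 : ∀ s : ℂ, 1 < s.re → HasSum _ (∑ C, W' C s) := fun s hs =>
    hasSum_of_hasSum_class (f := fun I : (Ideal (𝓞 K))⁰ => ((|(discr K : ℝ)| : ℝ) : ℂ) ^ (s / 2) *
        (archGamma K s * (s * (1 - s)) *
          (1 * (Ideal.absNorm (I : Ideal (𝓞 K)) : ℂ) ^ (-s)))) (Equiv.mulRight _)
      fun C => hsum' C s hs
  have h3 := eq_of_eq_of_one_lt_re hd hd' fun s hs => (h1 s hs).unique (h2 s hs)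
  refine ⟨fun s => ∑ C, W C s, hd, fun s => ?_, h1⟩
  simp only [hfe]
  exact (congrFun h3 s).symm

end ZetaFunctionalEquation

section RayClassCharacter

open NumberField
open scoped nonZeroDivisors

variable {F : Type*} [Field F] [NumberField F]

theorem exists_ideal_mul_eq_spanSingleton {𝔞 : (FractionalIdeal (𝓞 F)⁰ F)ˣ} {x : F}
    (hx : x ∈ (𝔞 : FractionalIdeal (𝓞 F)⁰ F)) :
    ∃ I : Ideal (𝓞 F), (I : FractionalIdeal (𝓞 F)⁰ F) * (𝔞 : FractionalIdeal (𝓞 F)⁰ F) =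
      FractionalIdeal.spanSingleton (𝓞 F)⁰ x := by
  rcases eq_or_ne x 0 with rfl | h0
  · exact ⟨⊥, by simp⟩
  · obtain ⟨I, -, hI⟩ := exists_mk0_of_mem h0 hx
    exact ⟨I, hI⟩

theorem le_sup_of_mul_eq_spanSingleton {𝔞 : (FractionalIdeal (𝓞 F)⁰ F)ˣ} {x y : F} {m : ℤ}
    (hy : y ∈ (𝔞 : FractionalIdeal (𝓞 F)⁰ F)) {I I' : Ideal (𝓞 F)}
    (hI : (I : FractionalIdeal (𝓞 F)⁰ F) * (𝔞 : FractionalIdeal (𝓞 F)⁰ F) =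
      FractionalIdeal.spanSingleton (𝓞 F)⁰ x)
    (hI' : (I' : FractionalIdeal (𝓞 F)⁰ F) * (𝔞 : FractionalIdeal (𝓞 F)⁰ F) =
      FractionalIdeal.spanSingleton (𝓞 F)⁰ (x + m * y)) :
    I' ≤ I ⊔ Ideal.span {(m : 𝓞 F)} := by
  have h1 : (I' : FractionalIdeal (𝓞 F)⁰ F) * (𝔞 : FractionalIdeal (𝓞 F)⁰ F) ≤
      ((I ⊔ Ideal.span {(m : 𝓞 F)} : Ideal (𝓞 F)) : FractionalIdeal (𝓞 F)⁰ F) *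
        (𝔞 : FractionalIdeal (𝓞 F)⁰ F) := by
    rw [hI', FractionalIdeal.coeIdeal_sup, add_mul, hI, FractionalIdeal.spanSingleton_le_iff_mem,
      ← FractionalIdeal.mem_coe, FractionalIdeal.coe_add]
    refine Submodule.add_mem_sup ?_ ?_
    · exact FractionalIdeal.mem_spanSingleton_self _ _
    · refine FractionalIdeal.mul_mem_mul ?_ hy
      rw [FractionalIdeal.mem_coeIdeal]
      exact ⟨m, Ideal.mem_span_singleton_self _, by simp⟩
  have h2 := mul_le_mul_left h1 ((𝔞⁻¹ : (FractionalIdeal (𝓞 F)⁰ F)ˣ) : FractionalIdeal (𝓞 F)⁰ F)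
  rw [mul_assoc, mul_assoc, Units.mul_inv, mul_one, mul_one] at h2
  exact (FractionalIdeal.coeIdeal_le_coeIdeal F).mp h2

/-- A completely multiplicative function that is trivial on the ray modulo `m` is periodic modulo
`m` on each ideal class. -/
theorem map_eq_of_mul_eq_spanSingleton {χ : Ideal (𝓞 F) →* ℂ} {m : ℕ}
    (hbot : χ ⊥ = 0) (h1 : ∀ I, χ I ≠ 0 ↔ I ⊔ Ideal.span {(m : 𝓞 F)} = ⊤)
    (h2 : ∀ x : 𝓞 F, (m : 𝓞 F) ∣ x - 1 → χ (Ideal.span {x}) = 1)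
    {𝔞 : (FractionalIdeal (𝓞 F)⁰ F)ˣ} {x y : F}
    (hy : y ∈ (𝔞 : FractionalIdeal (𝓞 F)⁰ F)) {I I' : Ideal (𝓞 F)}
    (hI : (I : FractionalIdeal (𝓞 F)⁰ F) * (𝔞 : FractionalIdeal (𝓞 F)⁰ F) =
      FractionalIdeal.spanSingleton (𝓞 F)⁰ x)
    (hI' : (I' : FractionalIdeal (𝓞 F)⁰ F) * (𝔞 : FractionalIdeal (𝓞 F)⁰ F) =
      FractionalIdeal.spanSingleton (𝓞 F)⁰ (x + m * y)) :
    χ I' = χ I := by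
  have hsup : I ⊔ Ideal.span {(m : 𝓞 F)} = I' ⊔ Ideal.span {(m : 𝓞 F)} := by
    refine le_antisymm (sup_le ?_ le_sup_right) (sup_le ?_ le_sup_right)
    · have := le_sup_of_mul_eq_spanSingleton (x := x + m * y) (m := -(m : ℤ)) hy hI'
        (I' := I) (by rw [hI]; push_cast; congr 1; ring)
      simpa [Ideal.span_singleton_neg] using this
    · simpa using le_sup_of_mul_eq_spanSingleton (m := (m : ℤ)) hy hI (by simpa using hI')
  by_cases h0 : χ I = 0
  · rw [h0]
    by_contra h
    exact (h1 I).mpr (hsup.trans ((h1 I').mp h)) h0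
  have hI0 : I ≠ ⊥ := by
    rintro rfl
    exact h0 hbot
  have hx0 : x ≠ 0 := by
    rintro rfl
    rw [FractionalIdeal.spanSingleton_zero, mul_eq_zero] at hI
    rcases hI with h | h
    · exact hI0 (FractionalIdeal.coeIdeal_eq_zero.mp h)
    · exact 𝔞.ne_zero h
  obtain ⟨Y, hY⟩ := exists_ideal_mul_eq_spanSingleton hy
  -- a power of `I` is principal
  set h := Fintype.card (ClassGroup (𝓞 F)) with hh
  have hpos : 0 < h := Fintype.card_pos
  set J : Ideal (𝓞 F) := I ^ (h - 1) with hJ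
  have hIJ : I * J = I ^ h := by
    rw [hJ, ← pow_succ', Nat.sub_add_cancel hpos]
  have hprin : (I ^ h).IsPrincipal := by
    have h3 : ClassGroup.mk0 (⟨I, mem_nonZeroDivisors_of_ne_zero hI0⟩ ^ h : (Ideal (𝓞 F))⁰) = 1 := by
      rw [map_pow, hh, pow_card_eq_one]
    exact (ClassGroup.mk0_eq_one_iff _).mp h3
  obtain ⟨z, hz⟩ := hprin
  rw [Ideal.submodule_span_eq] at hz
  have hIJz : (I : FractionalIdeal (𝓞 F)⁰ F) * (J : FractionalIdeal (𝓞 F)⁰ F) =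
      FractionalIdeal.spanSingleton (𝓞 F)⁰ (z : F) := by
    rw [← FractionalIdeal.coeIdeal_mul, hIJ, hz, FractionalIdeal.coeIdeal_span_singleton]
  have hquot : ∀ (A : Ideal (𝓞 F)) (u : F), (A : FractionalIdeal (𝓞 F)⁰ F) *
      (𝔞 : FractionalIdeal (𝓞 F)⁰ F) = FractionalIdeal.spanSingleton (𝓞 F)⁰ u →
      ((A * J : Ideal (𝓞 F)) : FractionalIdeal (𝓞 F)⁰ F) =
        FractionalIdeal.spanSingleton (𝓞 F)⁰ (u * z / x) := by
    intro A u hA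
    have h3 : FractionalIdeal.spanSingleton (𝓞 F)⁰ x ≠ 0 := by
      rwa [Ne, FractionalIdeal.spanSingleton_eq_zero_iff]
    refine mul_right_cancel₀ h3 ?_
    rw [FractionalIdeal.spanSingleton_mul_spanSingleton, div_mul_cancel₀ _ hx0,
      ← FractionalIdeal.spanSingleton_mul_spanSingleton, ← hA, ← hIJz, ← hI,
      FractionalIdeal.coeIdeal_mul]
    ring
  obtain ⟨v, hv⟩ : ∃ v : 𝓞 F, (v : F) = y * z / x := by
    have h3 : y * z / x ∈ ((Y * J : Ideal (𝓞 F)) : FractionalIdeal (𝓞 F)⁰ F) := by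
      rw [hquot Y y hY]
      exact FractionalIdeal.mem_spanSingleton_self _ _
    obtain ⟨v, -, hv⟩ := (FractionalIdeal.mem_coeIdeal _).mp h3
    exact ⟨v, hv⟩
  have hI'J : I' * J = Ideal.span {z + m * v} := by
    rw [← FractionalIdeal.coeIdeal_inj (K := F), hquot I' _ hI',
      FractionalIdeal.coeIdeal_span_singleton]
    congr 1
    have hv' : algebraMap (𝓞 F) F v = y * algebraMap (𝓞 F) F z / x := hv
    have h3 : algebraMap (𝓞 F) F (z + m * v) = algebraMap (𝓞 F) F z + m * algebraMap (𝓞 F) F v := by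
      rw [map_add, map_mul, map_natCast]
    refine Eq.trans ?_ h3.symm
    rw [hv']
    field_simp
  have hχJ : χ J ≠ 0 := by
    rw [hJ, map_pow]
    exact pow_ne_zero _ h0
  have hzc : Ideal.span {z} ⊔ Ideal.span {(m : 𝓞 F)} = ⊤ := by
    rw [← h1, ← hz, map_pow]
    exact pow_ne_zero _ h0
  obtain ⟨z', hz'⟩ : ∃ z', (m : 𝓞 F) ∣ z * z' - 1 := by
    have h3 : (1 : 𝓞 F) ∈ Ideal.span {z} ⊔ Ideal.span {(m : 𝓞 F)} := by rw [hzc]; trivial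
    obtain ⟨p, hp, q, hq, hpq⟩ := Submodule.mem_sup.mp h3
    obtain ⟨p', rfl⟩ := Ideal.mem_span_singleton.mp hp
    obtain ⟨q', rfl⟩ := Ideal.mem_span_singleton.mp hq
    exact ⟨p', -q', by linear_combination hpq⟩
  have h4 := h2 _ hz'
  have h5 := h2 ((z + m * v) * z') (by
    obtain ⟨c, hc⟩ := hz'
    exact ⟨c + v * z', by linear_combination hc⟩)
  rw [← Ideal.span_singleton_mul_span_singleton, map_mul] at h4 h5
  have h6 : χ (Ideal.span {z'}) ≠ 0 := right_ne_zero_of_mul (h4.trans_ne one_ne_zero)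
  have h7 := mul_right_cancel₀ h6 (h5.trans h4.symm)
  rw [← hI'J, ← hz, ← hIJ, map_mul, map_mul] at h7
  exact mul_right_cancel₀ hχJ h7

/-- Analytic continuation of the `L`-function of a ray class character. -/
theorem exists_entire_of_rayClassCharacter {χ : Ideal (𝓞 F) →* ℂ} {m : ℕ} (hm : m ≠ 0)
    (hχ : ∀ I, ‖χ I‖ ≤ 1)
    (hbot : χ ⊥ = 0) (h1 : ∀ I, χ I ≠ 0 ↔ I ⊔ Ideal.span {(m : 𝓞 F)} = ⊤)
    (h2 : ∀ x : 𝓞 F, (m : 𝓞 F) ∣ x - 1 → χ (Ideal.span {x}) = 1) :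
    ∃ W : ℂ → ℂ, Differentiable ℂ W ∧ ∀ s : ℂ, 1 < s.re →
      HasSum (fun I : (Ideal (𝓞 F))⁰ => archGamma F s * (s * (1 - s)) *
        (χ I * (Ideal.absNorm (I : Ideal (𝓞 F)) : ℂ) ^ (-s))) (W s) := by
  have : NeZero m := ⟨hm⟩
  refine exists_entire_of_periodic (fun I : (Ideal (𝓞 F))⁰ => χ (I : Ideal (𝓞 F))) m 1 ?_
  intro 𝔞
  choose! J hJ using fun (x : F) (hx : x ∈ (𝔞 : FractionalIdeal (𝓞 F)⁰ F)) =>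
    exists_ideal_mul_eq_spanSingleton hx
  have hΨ : ∃ Ψ : F → ℂ, ∀ x, Ψ x = χ (J x) := ⟨fun x => χ (J x), fun _ => rfl⟩
  obtain ⟨Ψ, hΨ⟩ := hΨ
  refine ⟨Ψ, ?_, ?_, ?_⟩
  · intro x
    rw [hΨ]
    exact hχ _
  · intro x hx y hy
    rw [hΨ, hΨ]
    have h3 : (m : F) * y ∈ ((𝔞 : FractionalIdeal (𝓞 F)⁰ F) : Submodule (𝓞 F) F) := by
      rw [← nsmul_eq_mul]
      exact Submodule.smul_of_tower_mem _ m hy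
    have h4 : x + (m : F) * y ∈ (𝔞 : FractionalIdeal (𝓞 F)⁰ F) :=
      Submodule.add_mem ((𝔞 : FractionalIdeal (𝓞 F)⁰ F) : Submodule (𝓞 F) F) hx h3
    exact map_eq_of_mul_eq_spanSingleton (x := x) (y := y) hbot h1 h2 hy (hJ x hx)
      (hJ (x + (m : F) * y) h4)
  · intro x I hx hI
    rw [hΨ]
    have hxa : x ∈ (𝔞 : FractionalIdeal (𝓞 F)⁰ F) := by
      rw [← FractionalIdeal.spanSingleton_le_iff_mem, ← hI]
      calc _ ≤ 1 * (𝔞 : FractionalIdeal (𝓞 F)⁰ F) :=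
            mul_le_mul_left FractionalIdeal.coeIdeal_le_one _
        _ = _ := one_mul _
    have h3 := (hJ x hxa).trans hI.symm
    have h4 := FractionalIdeal.coeIdeal_injective (K := F) (mul_right_cancel₀ 𝔞.ne_zero h3)
    rw [h4]

end RayClassCharacter

section EulerProduct

open NumberField IsDedekindDomain
open scoped nonZeroDivisors

variable {K : Type*} [Field K] [NumberField K]

theorem tsum_coprime_eq_prod_mul {g : Ideal (𝓞 K) →* ℂ} (hg : Summable fun I => ‖g I‖)
    (S : Finset (HeightOneSpectrum (𝓞 K))) :
    ∑' I, (if ∀ P ∈ S, ¬ P.asIdeal ∣ I then g I else 0) =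
      (∏ P ∈ S, (1 - g P.asIdeal)) * ∑' I, g I := by
  induction S using Finset.induction_on with
  | empty => simp
  | insert P S hP ih =>
    have hsum : ∀ (p : Ideal (𝓞 K) → Prop) [DecidablePred p], Summable fun I => if p I then g I else 0 := by
      intro p _
      refine Summable.of_norm_bounded hg fun I => ?_
      split_ifs <;> simp
    have hinj : Function.Injective fun J : Ideal (𝓞 K) => P.asIdeal * J :=
      fun I J h => mul_left_cancel₀ P.ne_bot h
    have key : ∑' I, (if P.asIdeal ∣ I ∧ ∀ Q ∈ S, ¬ Q.asIdeal ∣ I then g I else 0) =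
        g P.asIdeal * ∑' I, (if ∀ P ∈ S, ¬ P.asIdeal ∣ I then g I else 0) := by
      rw [← hinj.tsum_eq, ← tsum_mul_left]
      · refine tsum_congr fun J => ?_
        have hiff : (∀ Q ∈ S, ¬ Q.asIdeal ∣ P.asIdeal * J) ↔ ∀ Q ∈ S, ¬ Q.asIdeal ∣ J := by
          refine forall₂_congr fun Q hQ => not_congr ⟨fun h => ?_, fun h => h.mul_left _⟩
          refine (Q.prime.dvd_or_dvd h).resolve_left fun h' => hP ?_
          have : Q.asIdeal = P.asIdeal :=
            (P.isMaximal.eq_of_le Q.isPrime.ne_top (Ideal.le_of_dvd h')).symm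
          rwa [← HeightOneSpectrum.ext this]
        simp only [dvd_mul_right, true_and, hiff, map_mul]
        split_ifs <;> simp
      · intro I hI
        by_contra h
        refine hI (if_neg fun h' => h ?_)
        obtain ⟨J, rfl⟩ := h'.1
        exact ⟨J, rfl⟩
    have hsplit := (hsum fun I => P.asIdeal ∣ I ∧ ∀ Q ∈ S, ¬ Q.asIdeal ∣ I).tsum_add
      (hsum fun I => ∀ Q ∈ insert P S, ¬ Q.asIdeal ∣ I)
    rw [Finset.prod_insert hP, mul_assoc, ← ih, sub_mul, one_mul, ← key, eq_sub_iff_add_eq', ← hsplit]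
    refine tsum_congr fun I => ?_
    by_cases h1 : P.asIdeal ∣ I <;> by_cases h2 : ∀ Q ∈ S, ¬ Q.asIdeal ∣ I <;>
      simp only [Finset.forall_mem_insert, h1, h2] <;> simp

theorem tendsto_prod_mul_tsum {g : Ideal (𝓞 K) →* ℂ} (h0 : g ⊥ = 0)
    (hg : Summable fun I => ‖g I‖) :
    Filter.Tendsto (fun S : Finset (HeightOneSpectrum (𝓞 K)) =>
      (∏ P ∈ S, (1 - g P.asIdeal)) * ∑' I, g I) Filter.atTop (nhds 1) := by
  simp only [← tsum_coprime_eq_prod_mul hg]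
  have h1 : ∑' I : Ideal (𝓞 K), (if I = 1 then (1 : ℂ) else 0) = 1 := tsum_ite_eq _ _
  rw [← h1]
  refine tendsto_tsum_of_dominated_convergence hg (fun I => ?_) (Filter.Eventually.of_forall
    fun S I => by split_ifs <;> simp)
  by_cases hI : I = 1
  · subst hI
    refine tendsto_const_nhds.congr fun S => ?_
    rw [if_pos rfl, if_pos (fun P _ h => P.isPrime.ne_top
      (Ideal.isUnit_iff.mp (isUnit_iff_dvd_one.mpr h))), map_one]
  · rw [if_neg hI]
    refine tendsto_const_nhds.congr' ?_
    by_cases hb : I = ⊥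
    · subst hb
      exact Filter.Eventually.of_forall fun S => by simp [h0]
    · obtain ⟨M, hM, hIM⟩ := Ideal.exists_le_maximal I (by rwa [← Ideal.one_eq_top])
      filter_upwards [Filter.eventually_ge_atTop
        {(⟨M, hM.isPrime, fun h => hb (le_bot_iff.mp (h ▸ hIM))⟩ : HeightOneSpectrum (𝓞 K))}]
        with S hS
      rw [if_neg]
      intro h
      exact h _ (hS (Finset.mem_singleton_self _)) (Ideal.dvd_iff_le.mpr hIM)

theorem hasProd_one_sub_heightOne {g : Ideal (𝓞 K) →* ℂ} (h0 : g ⊥ = 0)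
    (hg : Summable fun I => ‖g I‖) :
    ∑' I, g I ≠ 0 ∧ HasProd (fun P : HeightOneSpectrum (𝓞 K) => 1 - g P.asIdeal)
      (∑' I, g I)⁻¹ := by
  have h := tendsto_prod_mul_tsum h0 hg
  have hne : ∑' I, g I ≠ 0 := fun hz => by
    simp only [hz, mul_zero] at h
    exact zero_ne_one (tendsto_nhds_unique tendsto_const_nhds h)
  refine ⟨hne, ?_⟩
  have h2 := h.mul_const (∑' I, g I)⁻¹
  simp only [mul_assoc, mul_inv_cancel₀ hne, mul_one, one_mul] at h2
  rwa [HasProd, SummationFilter.unconditional_filter]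

/-- The ideal of `ℤ` generated by a natural number. -/
abbrev intSpan (p : ℕ) : Ideal ℤ := Ideal.span {(p : ℤ)}

theorem intSpan_ne_bot {p : ℕ} (hp : p.Prime) : intSpan p ≠ ⊥ := by
  simpa [Ideal.span_singleton_eq_bot] using hp.ne_zero

instance intSpan_isMaximal (p : Nat.Primes) : (intSpan p).IsMaximal :=
  ((Ideal.span_singleton_prime (by exact_mod_cast p.2.ne_zero)).mpr
    (Nat.prime_iff_prime_int.mp p.2)).isMaximal (intSpan_ne_bot p.2)

variable (K) in
/-- The finite set of prime ideals of `𝓞 K` above the rational prime `p`. -/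
def primesAbove (p : ℕ) : Finset (Ideal (𝓞 K)) := IsDedekindDomain.primesOverFinset (intSpan p) (𝓞 K)

theorem mem_primesAbove {p : ℕ} (hp : p.Prime) {P : Ideal (𝓞 K)} :
    P ∈ primesAbove K p ↔ P ∈ (intSpan p).primesOver (𝓞 K) := by
  have := intSpan_isMaximal ⟨p, hp⟩
  exact IsDedekindDomain.mem_primesOverFinset_iff (intSpan_ne_bot hp) _

theorem ne_bot_of_mem_primesAbove {p : ℕ} (hp : p.Prime) {P : Ideal (𝓞 K)}
    (hP : P ∈ primesAbove K p) : P ≠ ⊥ := by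
  obtain ⟨-, hP⟩ := (mem_primesAbove hp).mp hP
  exact Ideal.ne_bot_of_liesOver_of_ne_bot (intSpan_ne_bot hp) P

theorem exists_prime_mem_primesAbove (P : HeightOneSpectrum (𝓞 K)) :
    ∃ p : Nat.Primes, P.asIdeal ∈ primesAbove K p := by
  have hprime := P.isPrime
  have h1 : (P.asIdeal.under ℤ).IsPrime := Ideal.IsPrime.under ℤ P.asIdeal
  have h2 : P.asIdeal.under ℤ ≠ ⊥ := Ideal.under_ne_bot ℤ P.ne_bot
  obtain ⟨n, hn⟩ := IsPrincipalIdealRing.principal (P.asIdeal.under ℤ)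
  have hn' : P.asIdeal.under ℤ = Ideal.span {(n.natAbs : ℤ)} := by
    rw [Int.span_natAbs]; exact hn
  have hp : n.natAbs.Prime := by
    rw [Nat.prime_iff_prime_int, ← Ideal.span_singleton_prime, ← hn']
    · exact h1
    · rintro h
      rw [hn', h] at h2
      simp at h2
  refine ⟨⟨n.natAbs, hp⟩, (mem_primesAbove hp).mpr ⟨P.isPrime, ⟨?_⟩⟩⟩
  exact hn'.symm

variable (K) in
/-- Height one primes of `𝓞 K`, sorted by residue characteristic. -/
def sigmaPrimesAbove : (Σ p : Nat.Primes, (primesAbove K p : Set (Ideal (𝓞 K)))) ≃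
    HeightOneSpectrum (𝓞 K) :=
  Equiv.ofBijective (fun x => ⟨x.2.1, ((mem_primesAbove x.1.2).mp x.2.2).1,
    ne_bot_of_mem_primesAbove x.1.2 x.2.2⟩) (by
    constructor
    · rintro ⟨p, P, hP⟩ ⟨q, Q, hQ⟩ h
      obtain rfl : P = Q := congrArg HeightOneSpectrum.asIdeal h
      have h1 := ((mem_primesAbove p.2).mp hP).2.over
      have h2 := ((mem_primesAbove q.2).mp hQ).2.over
      have h3 : intSpan p = intSpan q := h1.trans h2.symm
      have h4 : (p : ℕ) = q := by
        have := Ideal.span_singleton_eq_span_singleton.mp h3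
        rw [Int.associated_iff_natAbs] at this
        simpa using this
      obtain rfl : p = q := Subtype.ext h4
      rfl
    · intro P
      obtain ⟨p, hp⟩ := exists_prime_mem_primesAbove P
      exact ⟨⟨p, P.asIdeal, hp⟩, rfl⟩)

theorem hasProd_one_sub_primesAbove {g : Ideal (𝓞 K) →* ℂ} (h0 : g ⊥ = 0)
    (hg : Summable fun I => ‖g I‖) :
    ∑' I, g I ≠ 0 ∧ HasProd (fun p : Nat.Primes => ∏ P ∈ primesAbove K p, (1 - g P))
      (∑' I, g I)⁻¹ := by
  obtain ⟨h1, h2⟩ := hasProd_one_sub_heightOne h0 hg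
  refine ⟨h1, ?_⟩
  rw [← (sigmaPrimesAbove K).hasProd_iff] at h2
  exact h2.sigma fun p => Finset.hasProd (primesAbove K p) (fun P => 1 - g P)

/-- The twist of a multiplicative function on ideals by `N(I)^{-s}`. -/
def normTwist (χ : Ideal (𝓞 K) →* ℂ) (s : ℂ) : Ideal (𝓞 K) →* ℂ where
  toFun I := χ I * (Ideal.absNorm I : ℂ) ^ (-s)
  map_one' := by rw [map_one χ]; simp
  map_mul' I J := by
    rw [map_mul, map_mul, Nat.cast_mul, natCast_mul_natCast_cpow]
    ring

theorem archGamma_ne_zero {s : ℂ} (hs : 0 < s.re) : archGamma K s ≠ 0 := by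
  unfold archGamma
  refine mul_ne_zero (by exact_mod_cast (meanScale_pos (K := K)).ne') (Finset.prod_ne_zero_iff.mpr
    fun w _ => mul_ne_zero (Gamma_ne_zero_of_re_pos ?_) ?_)
  · have hw : (0 : ℝ) < w.mult := by exact_mod_cast w.mult_pos
    have : ((w.mult : ℂ) * s / 2).re = w.mult * s.re / 2 := by
      simp
    rw [this]
    positivity
  · rw [Ne, cpow_eq_zero_iff, not_and_or]
    left
    have hw : (0 : ℝ) < w.mult := by exact_mod_cast w.mult_pos
    have : (0 : ℝ) < w.mult * Real.pi := mul_pos hw Real.pi_pos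
    exact_mod_cast this.ne'

variable (K) in
theorem summable_absNorm_cpow {s : ℂ} (hs : 1 < s.re) :
    Summable fun I : Ideal (𝓞 K) => ‖(Ideal.absNorm I : ℂ) ^ (-s)‖ := by
  obtain ⟨W, -, -, hW⟩ := exists_entire_zeta K
  have h := (hW s hs).summable
  have hs0 : s ≠ 0 := by rintro rfl; simp at hs; linarith
  have hs1 : 1 - s ≠ 0 := by
    intro h
    rw [← sub_eq_zero.mp h] at hs
    simp at hs
  have hd : ((|(discr K : ℝ)| : ℝ) : ℂ) ^ (s / 2) ≠ 0 := by
    rw [Ne, cpow_eq_zero_iff, not_and_or]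
    left
    have : (|(discr K : ℝ)| : ℝ) ≠ 0 := abs_ne_zero.mpr (by exact_mod_cast discr_ne_zero K)
    exact_mod_cast this
  have hc := archGamma_ne_zero (K := K) (s := s) (by linarith)
  rw [summable_mul_left_iff hd, summable_mul_left_iff (mul_ne_zero hc (mul_ne_zero hs0 hs1))] at h
  simp only [one_mul] at h
  have h' := h.norm
  refine (Function.Injective.summable_iff (Subtype.val_injective (p := (· ∈ (Ideal (𝓞 K))⁰))) ?_).mp h'
  intro I hI
  have : I = ⊥ := by
    by_contra h
    exact hI ⟨⟨I, mem_nonZeroDivisors_of_ne_zero h⟩, rfl⟩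
  subst this
  simp [hs0]

theorem summable_normTwist {χ : Ideal (𝓞 K) →* ℂ} (hχ : ∀ I, ‖χ I‖ ≤ 1) {s : ℂ}
    (hs : 1 < s.re) : Summable fun I => ‖normTwist χ s I‖ := by
  refine Summable.of_nonneg_of_le (fun _ => norm_nonneg _) (fun I => ?_) (summable_absNorm_cpow K hs)
  change ‖χ I * _‖ ≤ _
  rw [norm_mul]
  exact mul_le_of_le_one_left (norm_nonneg _) (hχ I)

theorem eulerProduct_normTwist {χ : Ideal (𝓞 K) →* ℂ} (hχ : ∀ I, ‖χ I‖ ≤ 1) {s : ℂ}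
    (hs : 1 < s.re) :
    ∑' I : (Ideal (𝓞 K))⁰, χ (I : Ideal (𝓞 K)) * (Ideal.absNorm (I : Ideal (𝓞 K)) : ℂ) ^ (-s) ≠ 0 ∧
      HasProd (fun p : Nat.Primes =>
        ∏ P ∈ primesAbove K p, (1 - χ P * (Ideal.absNorm P : ℂ) ^ (-s)))
      (∑' I : (Ideal (𝓞 K))⁰,
        χ (I : Ideal (𝓞 K)) * (Ideal.absNorm (I : Ideal (𝓞 K)) : ℂ) ^ (-s))⁻¹ := by
  have hs0 : s ≠ 0 := by rintro rfl; simp at hs; linarith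
  have h0 : normTwist χ s ⊥ = 0 := by
    change χ ⊥ * (Ideal.absNorm (⊥ : Ideal (𝓞 K)) : ℂ) ^ (-s) = 0
    simp [hs0]
  have h := hasProd_one_sub_primesAbove h0 (summable_normTwist hχ hs)
  have heq : ∑' I : (Ideal (𝓞 K))⁰,
      χ (I : Ideal (𝓞 K)) * (Ideal.absNorm (I : Ideal (𝓞 K)) : ℂ) ^ (-s) =
      ∑' I, normTwist χ s I := by
    refine Function.Injective.tsum_eq (f := fun I => normTwist χ s I)
      (Subtype.val_injective (p := (· ∈ (Ideal (𝓞 K))⁰))) fun I hI => ?_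
    refine ⟨⟨I, mem_nonZeroDivisors_of_ne_zero ?_⟩, rfl⟩
    rintro rfl
    exact hI h0
  rw [heq]
  exact h

end EulerProduct

section Assembly

open NumberField NumberField.InfinitePlace
open scoped nonZeroDivisors

variable (K : Type*) [Field K] [NumberField K]

theorem isReal_or_isComplex_counts (hK : Module.finrank ℚ K = 3) :
    (0 < discr K ∧ nrRealPlaces K = 3 ∧ nrComplexPlaces K = 0) ∨
      (¬ 0 < discr K ∧ nrRealPlaces K = 1 ∧ nrComplexPlaces K = 1) := by
  have h1 := card_add_two_mul_card_eq_rank K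
  have h2 := sign_discr K
  rw [hK] at h1
  have h3 : nrComplexPlaces K = 0 ∨ nrComplexPlaces K = 1 := by omega
  rcases h3 with h3 | h3
  · left
    rw [h3, pow_zero, Int.sign_eq_one_iff_pos] at h2
    exact ⟨h2, by omega, h3⟩
  · right
    rw [h3, pow_one, Int.sign_eq_neg_one_iff_neg] at h2
    exact ⟨by omega, by omega, h3⟩

theorem archGamma_eq_mul_LInfty (hK : Module.finrank ℚ K = 3) :
    ∃ κ : ℂ, κ ≠ 0 ∧ ∀ s, archGamma K s = κ * LInfty K s * Gammaℝ s := by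
  have hms : (meanScale K : ℂ) ≠ 0 := by exact_mod_cast (meanScale_pos (K := K)).ne'
  have hprod : ∀ s : ℂ, archGamma K s = meanScale K * ((Gammaℝ s) ^ nrRealPlaces K *
      ((2 * (Real.pi : ℂ)) ^ (-s) * Complex.Gamma s) ^ nrComplexPlaces K) := by
    intro s
    have hR : ∏ w : {w : InfinitePlace K // IsReal w},
        (Complex.Gamma (w.1.mult * s / 2) *
          ((w.1.mult * Real.pi : ℝ) : ℂ) ^ (-(w.1.mult * s / 2))) = Gammaℝ s ^ nrRealPlaces K := by
      rw [nrRealPlaces, ← Finset.card_univ, ← Finset.prod_const]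
      refine Finset.prod_congr rfl fun w _ => ?_
      rw [mult_isReal, Gammaℝ_def, mul_comm]
      simp [neg_div]
    have hC : ∏ w : {w : InfinitePlace K // IsComplex w},
        (Complex.Gamma (w.1.mult * s / 2) *
          ((w.1.mult * Real.pi : ℝ) : ℂ) ^ (-(w.1.mult * s / 2))) =
        ((2 * (Real.pi : ℂ)) ^ (-s) * Complex.Gamma s) ^ nrComplexPlaces K := by
      rw [nrComplexPlaces, ← Finset.card_univ, ← Finset.prod_const]
      refine Finset.prod_congr rfl fun w _ => ?_
      rw [mult_isComplex, mul_comm]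
      simp
    rw [archGamma, ← Fintype.prod_subtype_mul_prod_subtype (fun w : InfinitePlace K => IsReal w),
      hR, ← hC]
    congr 2
    exact Fintype.prod_equiv (Equiv.subtypeEquivRight fun w => not_isReal_iff_isComplex) _ _
      fun w => rfl
  rcases isReal_or_isComplex_counts K hK with ⟨h, h1, h2⟩ | ⟨h, h1, h2⟩
  · refine ⟨meanScale K, hms, fun s => ?_⟩
    rw [hprod, LInfty, if_pos h, h1, h2, Gammaℝ_def]
    ring
  · refine ⟨meanScale K / 2, by simpa using hms, fun s => ?_⟩
    rw [hprod, LInfty, if_neg h, h1, h2]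
    ring

theorem inv_LInfty_differentiable : Differentiable ℂ fun s => (LInfty K s)⁻¹ := by
  have hpi : (Real.pi : ℂ) ≠ 0 := by exact_mod_cast Real.pi_ne_zero
  by_cases h : 0 < discr K
  · have e : (fun s => (LInfty K s)⁻¹) =
        fun s => ((Real.pi : ℂ) ^ (s / 2) * (Complex.Gamma (s / 2))⁻¹) ^ 2 := by
      funext s
      rw [LInfty, if_pos h, ← inv_pow, mul_inv, neg_div, cpow_neg, inv_inv]
    rw [e]
    refine Differentiable.pow (Differentiable.mul ?_ ?_) 2
    · exact (differentiable_id.div_const 2).const_cpow (Or.inl hpi)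
    · exact differentiable_one_div_Gamma.comp (differentiable_id.div_const 2)
  · have e : (fun s => (LInfty K s)⁻¹) =
        fun s => (2 : ℂ)⁻¹ * (2 * (Real.pi : ℂ)) ^ s * (Complex.Gamma s)⁻¹ := by
      funext s
      rw [LInfty, if_neg h, mul_inv, mul_inv, cpow_neg, inv_inv]
    rw [e]
    refine Differentiable.mul (Differentiable.const_mul ?_ _) differentiable_one_div_Gamma
    exact differentiable_id.const_cpow (Or.inl (mul_ne_zero two_ne_zero hpi))

theorem LInfty_ne_zero {s : ℂ} (hs : 0 < s.re) : LInfty K s ≠ 0 := by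
  have hpi : (Real.pi : ℂ) ≠ 0 := by exact_mod_cast Real.pi_ne_zero
  have h2 : 0 < (s / 2).re := by simpa using hs
  rw [LInfty]
  split_ifs
  · exact pow_ne_zero _ (mul_ne_zero (by simp [cpow_eq_zero_iff, hpi]) (Gamma_ne_zero_of_re_pos h2))
  · exact mul_ne_zero (mul_ne_zero two_ne_zero (by simp [cpow_eq_zero_iff, hpi]))
      (Gamma_ne_zero_of_re_pos hs)

theorem dedekindSeries_eq (s : ℂ) : dedekindSeries K s =
    ∑' I : (Ideal (𝓞 K))⁰, (Ideal.absNorm (I : Ideal (𝓞 K)) : ℂ) ^ (-s) := by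
  rw [dedekindSeries]
  exact ((Equiv.subtypeEquivRight fun I : Ideal (𝓞 K) =>
    (mem_nonZeroDivisors_iff_ne_zero (M₀ := Ideal (𝓞 K)) (x := I))).tsum_eq
      (fun I : {I : Ideal (𝓞 K) // I ≠ ⊥} => (Ideal.absNorm I.1 : ℂ) ^ (-s))).symm

/-- The entire function `s (1 - s) Λ(s)`, with `Λ` the completed Riemann zeta function. -/
def xiEntire (s : ℂ) : ℂ := s * (1 - s) * completedRiemannZeta₀ s - 1

theorem xiEntire_differentiable : Differentiable ℂ xiEntire := by
  refine Differentiable.sub_const (Differentiable.mul ?_ differentiable_completedZeta₀) 1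
  exact differentiable_id.mul (differentiable_id.const_sub 1)

theorem xiEntire_one_sub (s : ℂ) : xiEntire (1 - s) = xiEntire s := by
  rw [xiEntire, xiEntire, completedRiemannZeta₀_one_sub]
  ring

theorem xiEntire_eq {s : ℂ} (hs : 1 < s.re) :
    xiEntire s = s * (1 - s) * (Gammaℝ s * riemannZeta s) := by
  have hs0 : s ≠ 0 := by rintro rfl; simp at hs; linarith
  have hs1 : 1 - s ≠ 0 := by
    intro h
    rw [← sub_eq_zero.mp h] at hs
    simp at hs
  rw [riemannZeta_def_of_ne_zero hs0, mul_div_cancel₀ _ (Gammaℝ_ne_zero_of_re_pos (by linarith)),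
    completedRiemannZeta_eq, xiEntire]
  field_simp
  ring

variable {K}

theorem exists_symmetric_entire {W X Q : ℂ → ℂ} (hW : Differentiable ℂ W)
    (hX : Differentiable ℂ X) (hWs : ∀ s, W (1 - s) = W s) (hXs : ∀ s, X (1 - s) = X s)
    (hX1 : X 1 ≠ 0) (k : ℕ) (hQ : ∀ s : ℂ, 0 < s.re → DifferentiableAt ℂ Q s)
    (hQX : ∀ s : ℂ, 1 < s.re → Q s * X s = (1 - s) ^ k * W s) :
    ∃ H : ℂ → ℂ, Differentiable ℂ H ∧ (∀ s, H (1 - s) = H s) ∧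
      ∀ s : ℂ, 1 < s.re → (1 - s) ^ k * H s = Q s := by
  have ho : IsOpen {s : ℂ | 0 < s.re} := isOpen_lt continuous_const continuous_re
  have ho1 : IsOpen {s : ℂ | s.re < 1} := isOpen_lt continuous_re continuous_const
  have hone : ∀ s : ℂ, 1 < s.re → 1 - s ≠ 0 := by
    intro s hs h
    rw [← sub_eq_zero.mp h] at hs
    simp at hs
  have hext : ∀ s : ℂ, 0 < s.re → Q s * X s = (1 - s) ^ k * W s := by
    have h1 : AnalyticOnNhd ℂ (fun s => Q s * X s) {s : ℂ | 0 < s.re} :=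
      DifferentiableOn.analyticOnNhd
        (fun s hs => ((hQ s hs).mul (hX s)).differentiableWithinAt) ho
    have h2 : AnalyticOnNhd ℂ (fun s => (1 - s) ^ k * W s) {s : ℂ | 0 < s.re} :=
      DifferentiableOn.analyticOnNhd (fun s _ =>
        (((differentiableAt_id.const_sub 1).pow k).mul (hW s)).differentiableWithinAt) ho
    refine h1.eqOn_of_preconnected_of_eventuallyEq h2 (convex_halfSpace_re_gt 0).isPreconnected
      (z₀ := 2) (by simp) ?_
    have h1 : {s : ℂ | 1 < s.re} ∈ nhds (2 : ℂ) :=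
      (isOpen_lt continuous_const continuous_re).mem_nhds (by norm_num)
    filter_upwards [h1] with s hs using hQX s hs
  let h : ℂ → ℂ := fun s => if s = 1 then W s / X s else Q s / (1 - s) ^ k
  have hhX : ∀ s : ℂ, 0 < s.re → h s * X s = W s := by
    intro s hs
    by_cases h1 : s = 1
    · subst h1
      simp only [h, if_pos]
      exact div_mul_cancel₀ _ hX1
    · simp only [h, if_neg h1]
      rw [div_mul_eq_mul_div, hext s hs,
        mul_div_cancel_left₀ _ (pow_ne_zero _ (sub_ne_zero.mpr (Ne.symm h1)))]
  have hhd : ∀ s : ℂ, 0 < s.re → DifferentiableAt ℂ h s := by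
    intro s hs
    by_cases h1 : s = 1
    · subst h1
      have hd : DifferentiableAt ℂ (fun s => W s / X s) 1 := (hW 1).div (hX 1) hX1
      refine hd.congr_of_eventuallyEq ?_
      filter_upwards [(hX 1).continuousAt.eventually_ne hX1, ho.mem_nhds hs] with t ht ht'
      rw [eq_div_iff ht, hhX t ht']
    · have hd : DifferentiableAt ℂ (fun s => Q s / (1 - s) ^ k) s :=
        (hQ s hs).div ((differentiableAt_id.const_sub 1).pow k)
          (pow_ne_zero _ (sub_ne_zero.mpr (Ne.symm h1)))
      refine hd.congr_of_eventuallyEq ?_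
      filter_upwards [isOpen_compl_singleton.mem_nhds (show s ∈ ({1}ᶜ : Set ℂ) from h1)] with t ht
      exact if_neg ht
  have hsymm : ∀ s : ℂ, 0 < s.re → s.re < 1 → h s = h (1 - s) := by
    have hU : IsOpen ({s : ℂ | 0 < s.re} ∩ {s : ℂ | s.re < 1}) := ho.inter ho1
    have hpre : IsPreconnected ({s : ℂ | 0 < s.re} ∩ {s : ℂ | s.re < 1}) :=
      ((convex_halfSpace_re_gt 0).inter (convex_halfSpace_re_lt 1)).isPreconnected
    have hdiff : DifferentiableOn ℂ (fun s => h s - h (1 - s))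
        ({s : ℂ | 0 < s.re} ∩ {s : ℂ | s.re < 1}) := by
      intro s hs
      refine DifferentiableAt.differentiableWithinAt ((hhd s hs.1).sub ?_)
      have := hhd (1 - s) (by simpa using hs.2)
      exact this.comp s (differentiableAt_id.const_sub 1)
    have hmul : ∀ s ∈ {s : ℂ | 0 < s.re} ∩ {s : ℂ | s.re < 1}, X s * (h s - h (1 - s)) = 0 := by
      intro s hs
      have e1 := hhX s hs.1
      have e2 := hhX (1 - s) (by simpa using hs.2)
      rw [hXs, hWs] at e2
      linear_combination e1 - e2
    rcases (hX.differentiableOn.analyticOnNhd hU).eq_zero_or_eq_zero_of_mul_eq_zero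
      (hdiff.analyticOnNhd hU) hmul hpre with h0 | h0
    · exfalso
      have hX0 : X = 0 := by
        refine AnalyticOnNhd.eq_of_eventuallyEq (z₀ := 1 / 2) (fun z _ => hX.analyticAt z)
          (fun z _ => analyticAt_const) ?_
        filter_upwards [hU.mem_nhds (show (1 / 2 : ℂ) ∈ _ from ⟨by simp, by
          simp only [Set.mem_ofPred_eq]; norm_num⟩)]
          with s hs using h0 s hs
      exact hX1 (by rw [hX0]; rfl)
    · exact fun s hs hs' => sub_eq_zero.mp (h0 s ⟨hs, hs'⟩)
  refine ⟨fun s => if 0 < s.re then h s else h (1 - s), fun s => ?_, fun s => ?_, fun s hs => ?_⟩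
  · by_cases hs : 0 < s.re
    · refine (hhd s hs).congr_of_eventuallyEq ?_
      filter_upwards [ho.mem_nhds hs] with t ht using if_pos ht
    · have hs1 : s.re < 1 := by linarith
      have hd : DifferentiableAt ℂ (fun s => h (1 - s)) s :=
        (hhd (1 - s) (by simpa using hs1)).comp s (differentiableAt_id.const_sub 1)
      refine hd.congr_of_eventuallyEq ?_
      filter_upwards [ho1.mem_nhds hs1] with t ht
      split_ifs with h0
      · exact hsymm t h0 ht
      · rfl
  · by_cases hs : 0 < s.re
    · by_cases hs1 : s.re < 1
      · simp only [sub_re, one_re, sub_pos, hs, hs1, if_true]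
        exact (hsymm s hs hs1).symm
      · simp only [sub_re, one_re, sub_pos, hs, hs1, if_true, if_false, sub_sub_cancel]
    · have hs1 : s.re < 1 := by linarith
      simp only [sub_re, one_re, sub_pos, hs, hs1, if_true, if_false]
  · have h0 : 0 < s.re := by linarith
    have h1 : s ≠ 1 := by rintro rfl; simp at hs
    simp only [h0, if_true, h, if_neg h1]
    exact mul_div_cancel₀ _ (pow_ne_zero _ (hone s hs))

theorem exists_entire_of_mul_riemannZeta_eq (hK : Module.finrank ℚ K = 3) {Q : ℂ → ℂ} {k : ℕ}
    (hQ : ∀ s : ℂ, 0 < s.re → DifferentiableAt ℂ Q s)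
    (hQζ : ∀ s : ℂ, 1 < s.re → Q s * riemannZeta s = (1 - s) ^ k * dedekindSeries K s) :
    ∃ L : ℂ → ℂ, Differentiable ℂ L ∧
      (∀ s : ℂ, 1 < s.re → L s * riemannZeta s = dedekindSeries K s) ∧
      ∀ s : ℂ, 0 < s.re → s.re < 1 →
        ((|NumberField.discr K| : ℤ) : ℂ) ^ (s / 2) * LInfty K s * L s =
          ((|NumberField.discr K| : ℤ) : ℂ) ^ ((1 - s) / 2) * LInfty K (1 - s) *
            L (1 - s) := by
  obtain ⟨κ, hκ, hgam⟩ := archGamma_eq_mul_LInfty K hK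
  obtain ⟨W, hWd, hWs, hW⟩ := exists_entire_zeta K
  have hΔ : ((|discr K| : ℤ) : ℂ) ≠ 0 := by
    exact_mod_cast abs_ne_zero.mpr (discr_ne_zero K)
  have hΔ' : ((|(discr K : ℝ)| : ℝ) : ℂ) = ((|discr K| : ℤ) : ℂ) := by
    rw [← Int.cast_abs, ofReal_intCast]
  set Δ : ℂ := ((|discr K| : ℤ) : ℂ) with hΔdef
  have hpow : ∀ z : ℂ, Δ ^ z ≠ 0 := fun z => by simp [cpow_eq_zero_iff, hΔ]
  have hone : ∀ s : ℂ, 1 < s.re → 1 - s ≠ 0 := by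
    intro s hs h
    rw [← sub_eq_zero.mp h] at hs
    simp at hs
  have hWval : ∀ s : ℂ, 1 < s.re →
      W s = Δ ^ (s / 2) * (κ * LInfty K s * Gammaℝ s * (s * (1 - s)) * dedekindSeries K s) := by
    intro s hs
    have h := (hW s hs).tsum_eq
    rw [tsum_mul_left, tsum_mul_left] at h
    simp only [one_mul] at h
    rw [← h, hgam, dedekindSeries_eq, hΔ']
  have hLd : ∀ s : ℂ, 0 < s.re → DifferentiableAt ℂ (LInfty K) s := fun s hs => by
    have := (inv_LInfty_differentiable K s).inv (inv_ne_zero (LInfty_ne_zero K hs))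
    exact this.congr_of_eventuallyEq (Filter.Eventually.of_forall fun t => by simp)
  obtain ⟨H, hHd, hHs, hH⟩ := exists_symmetric_entire (W := W) (X := xiEntire)
    (Q := fun s => κ * (Δ ^ (s / 2) * LInfty K s) * Q s) hWd
    xiEntire_differentiable hWs xiEntire_one_sub (by simp [xiEntire]) k
    (fun s hs => (((differentiableAt_id.div_const 2).const_cpow (Or.inl hΔ)).mul
      (hLd s hs) |>.const_mul κ).mul (hQ s hs))
    (fun s hs => by
      rw [xiEntire_eq hs, hWval s hs]
      linear_combination (κ * (Δ ^ (s / 2) * LInfty K s) * (s * (1 - s)) * Gammaℝ s) * hQζ s hs)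
  refine ⟨fun s => κ⁻¹ * Δ ^ (-(s / 2)) * (LInfty K s)⁻¹ * H s, ?_, fun s hs => ?_, fun s h0 h1 => ?_⟩
  · refine ((Differentiable.const_mul ?_ _).mul (inv_LInfty_differentiable K)).mul hHd
    exact ((differentiable_id.div_const 2).neg).const_cpow (Or.inl hΔ)
  · have h1 := hH s hs
    have h2 := hQζ s hs
    have h3 := LInfty_ne_zero K (s := s) (by linarith)
    have h4 := pow_ne_zero k (hone s hs)
    beta_reduce
    rw [← mul_right_inj' h4, ← h2, cpow_neg]
    have h5 := hpow (s / 2)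
    field_simp
    linear_combination (riemannZeta s) * h1
  · have e : ∀ z : ℂ, 0 < z.re →
        Δ ^ (z / 2) * LInfty K z * (κ⁻¹ * Δ ^ (-(z / 2)) * (LInfty K z)⁻¹ * H z) = κ⁻¹ * H z := by
      intro z hz
      have h3 := LInfty_ne_zero K hz
      have h5 := hpow (z / 2)
      rw [cpow_neg]
      field_simp
    beta_reduce
    rw [e s h0, e (1 - s) (by simpa using h1), hHs]

theorem one_sub_absNorm_cpow_ne_zero {P : Ideal (𝓞 K)} (h0 : P ≠ ⊥) (h1 : P ≠ ⊤) {s : ℂ}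
    (hs : 0 < s.re) : 1 - (Ideal.absNorm P : ℂ) ^ (-s) ≠ 0 := by
  have hpos : 0 < Ideal.absNorm P := Nat.pos_of_ne_zero (Ideal.absNorm_eq_zero_iff.not.mpr h0)
  have hne : Ideal.absNorm P ≠ 1 := Ideal.absNorm_eq_one_iff.not.mpr h1
  intro h
  have h2 := norm_natCast_cpow_of_pos hpos (-s)
  rw [← sub_eq_zero.mp h, norm_one] at h2
  have h3 : (Ideal.absNorm P : ℝ) ^ (-s).re < 1 :=
    Real.rpow_lt_one_of_one_lt_of_neg (by exact_mod_cast (by omega : 1 < Ideal.absNorm P))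
      (by simpa using hs)
  linarith

variable (K) in
/-- The inverse Euler factor at `p` of the Dedekind zeta function. -/
def localZeta (p : ℕ) (s : ℂ) : ℂ := ∏ P ∈ primesAbove K p, (1 - (Ideal.absNorm P : ℂ) ^ (-s))

theorem localZeta_ne_zero {p : ℕ} (hp : p.Prime) {s : ℂ} (hs : 0 < s.re) :
    localZeta K p s ≠ 0 :=
  Finset.prod_ne_zero_iff.mpr fun _ hP => one_sub_absNorm_cpow_ne_zero
    (ne_bot_of_mem_primesAbove hp hP) ((mem_primesAbove hp).mp hP).1.ne_top hs

theorem one_sub_prime_cpow_ne_zero {p : ℕ} (hp : p.Prime) {s : ℂ} (hs : 0 < s.re) :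
    1 - (p : ℂ) ^ (-s) ≠ 0 := by
  intro h
  have h2 := norm_natCast_cpow_of_pos hp.pos (-s)
  rw [← sub_eq_zero.mp h, norm_one] at h2
  have h3 : (p : ℝ) ^ (-s).re < 1 :=
    Real.rpow_lt_one_of_one_lt_of_neg (by exact_mod_cast hp.one_lt) (by simpa using hs)
  linarith

theorem exists_entire_of_local_factors (hK : Module.finrank ℚ K = 3) {D₀ D : ℂ → ℂ} {k : ℕ}
    (hD₀ : ∀ s : ℂ, 0 < s.re → DifferentiableAt ℂ D₀ s)
    (hD : ∀ s : ℂ, 1 < s.re → D s ≠ 0 ∧ D₀ s = (1 - s) ^ k * D s)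
    (E : Nat.Primes → ℂ → ℂ)
    (hE : ∀ s : ℂ, 1 < s.re → HasProd (fun p => E p s) (D s)⁻¹) (bad : Finset Nat.Primes)
    (hbad : ∀ p ∈ bad, ∀ s : ℂ, 1 < s.re → E p s = 1)
    (hgood : ∀ p ∉ bad, ∀ s : ℂ, 1 < s.re → (1 - (p : ℂ) ^ (-s)) * E p s = localZeta K p s) :
    ∃ L : ℂ → ℂ, Differentiable ℂ L ∧
      (∀ s : ℂ, 1 < s.re → L s * riemannZeta s = dedekindSeries K s) ∧
      ∀ s : ℂ, 0 < s.re → s.re < 1 →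
        ((|NumberField.discr K| : ℤ) : ℂ) ^ (s / 2) * LInfty K s * L s =
          ((|NumberField.discr K| : ℤ) : ℂ) ^ ((1 - s) / 2) * LInfty K (1 - s) *
            L (1 - s) := by
  refine exists_entire_of_mul_riemannZeta_eq hK (k := k)
    (Q := fun s => D₀ s * ∏ p ∈ bad, ((1 - ((p : ℕ) : ℂ) ^ (-s)) / localZeta K p s))
    (fun s hs => (hD₀ s hs).mul ?_) fun s hs => ?_
  · refine DifferentiableAt.fun_finsetProd fun p _ => DifferentiableAt.div ?_ ?_
      (localZeta_ne_zero p.2 hs)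
    · exact (differentiableAt_id.neg.const_cpow
        (Or.inl (by exact_mod_cast p.2.ne_zero))).const_sub 1
    · refine DifferentiableAt.fun_finsetProd fun P hP => ?_
      refine (differentiableAt_id.neg.const_cpow (Or.inl ?_)).const_sub 1
      exact_mod_cast Ideal.absNorm_eq_zero_iff.not.mpr (ne_bot_of_mem_primesAbove p.2 hP)
  · have hs0 : 0 < s.re := by linarith
    obtain ⟨hDne, hD₀s⟩ := hD s hs
    have hζ := (riemannZeta_eulerProduct_hasProd hs).inv₀ (riemannZeta_ne_zero_of_one_lt_re hs)
    simp only [inv_inv] at hζ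
    obtain ⟨hKne, hKprod⟩ := eulerProduct_normTwist (K := K) (χ := 1) (by simp) hs
    simp only [MonoidHom.one_apply, one_mul, ← dedekindSeries_eq] at hKne hKprod
    let C : Nat.Primes → ℂ := fun p =>
      if p ∈ bad then localZeta K p s / (1 - ((p : ℕ) : ℂ) ^ (-s)) else 1
    have hC : HasProd C (∏ p ∈ bad, C p) := hasProd_prod_of_ne_finset_one fun p hp => if_neg hp
    have hall := ((hζ.mul (hE s hs)).mul hC)
    have hall' : HasProd (fun p : Nat.Primes =>
        ∏ P ∈ primesAbove K p, (1 - (Ideal.absNorm P : ℂ) ^ (-s)))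
        ((riemannZeta s)⁻¹ * (D s)⁻¹ * ∏ p ∈ bad, C p) := by
      refine (congrArg (HasProd · _) (funext fun p => ?_)).mp hall
      by_cases hp : p ∈ bad
      · simp only [C, if_pos hp, hbad p hp s hs, mul_one]
        exact mul_div_cancel₀ _ (one_sub_prime_cpow_ne_zero p.2 hs0)
      · simp only [C, if_neg hp, mul_one]
        exact hgood p hp s hs
    have huniq := hKprod.unique hall'
    have hCinv : ∏ p ∈ bad, ((1 - ((p : ℕ) : ℂ) ^ (-s)) / localZeta K p s) =
        (∏ p ∈ bad, C p)⁻¹ := by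
      rw [← Finset.prod_inv_distrib]
      refine Finset.prod_congr rfl fun p hp => ?_
      simp only [C, if_pos hp, inv_div]
    have hCne : ∏ p ∈ bad, C p ≠ 0 := by
      intro h0
      rw [h0, mul_zero] at huniq
      exact inv_ne_zero hKne huniq
    have hζne := riemannZeta_ne_zero_of_one_lt_re hs
    rw [hCinv, hD₀s, ← inv_inv (dedekindSeries K s), huniq]
    field_simp

end Assembly

section Eisenstein

/-- The ring of Eisenstein integers `ℤ[ω]`, `ω ^ 2 = -1 - ω`. -/
abbrev Eis := QuadraticAlgebra ℤ (-1) (-1)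

namespace Eis

/-- The primitive cube root of unity `ω` of `ℤ[ω]`. -/
def w : Eis := ⟨0, 1⟩

theorem norm_eq (z : Eis) : z.norm = z.re ^ 2 - z.re * z.im + z.im ^ 2 := by
  rw [QuadraticAlgebra.norm_def]; ring

theorem norm_nonneg (z : Eis) : 0 ≤ z.norm := by
  rw [norm_eq]; nlinarith [sq_nonneg (z.re - z.im), sq_nonneg z.re, sq_nonneg z.im]

theorem norm_eq_zero {z : Eis} : z.norm = 0 ↔ z = 0 := by
  constructor
  · intro h
    rw [norm_eq] at h
    have h1 : z.re ^ 2 + z.im ^ 2 + (z.re - z.im) ^ 2 = 0 := by linarith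
    have h2 : z.re = 0 := by
      apply pow_eq_zero_iff two_ne_zero |>.mp
      nlinarith [sq_nonneg (z.re - z.im), sq_nonneg z.re, sq_nonneg z.im]
    have h3 : z.im = 0 := by
      apply pow_eq_zero_iff two_ne_zero |>.mp
      nlinarith [sq_nonneg (z.re - z.im), sq_nonneg z.re, sq_nonneg z.im]
    ext <;> simp [h2, h3]
  · rintro rfl; simp

theorem mul_star_eq (z : Eis) : z * star z = ((z.norm : ℤ) : Eis) := by
  have h := QuadraticAlgebra.algebraMap_norm_eq_mul_star z
  rw [← h]; rfl

instance : NoZeroDivisors Eis where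
  eq_zero_or_eq_zero_of_mul_eq_zero {x y} h := by
    have h1 : x.norm * y.norm = 0 := by rw [← map_mul, h]; simp
    rcases mul_eq_zero.mp h1 with h2 | h2
    · exact Or.inl (norm_eq_zero.mp h2)
    · exact Or.inr (norm_eq_zero.mp h2)

instance : IsDomain Eis := NoZeroDivisors.to_isDomain _

theorem exists_two_mul_abs_le (A n : ℤ) (hn : 0 < n) : ∃ q r : ℤ, A = n * q + r ∧ |2 * r| ≤ n := by
  refine ⟨(2 * A + n) / (2 * n), A - n * ((2 * A + n) / (2 * n)), by ring, ?_⟩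
  have h1 := Int.mul_ediv_add_emod (2 * A + n) (2 * n)
  have h2 := Int.emod_nonneg (2 * A + n) (b := 2 * n) (by omega)
  have h3 := Int.emod_lt_of_pos (2 * A + n) (b := 2 * n) (by omega)
  rw [abs_le]
  constructor <;> linarith

theorem exists_norm_sub_mul_lt (x y : Eis) (hy : y ≠ 0) :
    ∃ q : Eis, (x - y * q).norm < y.norm := by
  have hn : 0 < y.norm := lt_of_le_of_ne (norm_nonneg y) (Ne.symm (mt norm_eq_zero.mp hy))
  obtain ⟨q₁, r₁, h₁, hr₁⟩ := exists_two_mul_abs_le (x * star y).re y.norm hn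
  obtain ⟨q₂, r₂, h₂, hr₂⟩ := exists_two_mul_abs_le (x * star y).im y.norm hn
  refine ⟨⟨q₁, q₂⟩, ?_⟩
  have h3 : (x - y * ⟨q₁, q₂⟩) * star y = ⟨r₁, r₂⟩ := by
    have : (x - y * ⟨q₁, q₂⟩) * star y = x * star y - ((y.norm : ℤ) : Eis) * ⟨q₁, q₂⟩ := by
      rw [← mul_star_eq]; ring
    rw [this]
    ext
    · rw [QuadraticAlgebra.re_sub, h₁]; simp
    · rw [QuadraticAlgebra.im_sub, h₂]; simp
  have h4 : (x - y * ⟨q₁, q₂⟩).norm * y.norm = r₁ ^ 2 - r₁ * r₂ + r₂ ^ 2 := by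
    have := congrArg QuadraticAlgebra.norm h3
    rw [map_mul, QuadraticAlgebra.norm_star, norm_eq ⟨r₁, r₂⟩] at this
    exact this
  rw [abs_le] at hr₁ hr₂
  by_contra! hcon
  nlinarith [mul_le_mul_of_nonneg_right hcon hn.le, mul_nonneg (sub_nonneg.2 hr₁.2) (sub_nonneg.2 hr₂.1),
    mul_nonneg (sub_nonneg.2 hr₁.1) (sub_nonneg.2 hr₂.2), mul_nonneg (sub_nonneg.2 hr₁.1) (sub_nonneg.2 hr₁.2),
    mul_nonneg (sub_nonneg.2 hr₂.1) (sub_nonneg.2 hr₂.2), mul_pos hn hn]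

instance : IsPrincipalIdealRing Eis where
  principal I := by
    by_cases hI : I = ⊥
    · rw [hI]; exact ⟨0, by simp⟩
    obtain ⟨y₀, hy₀, hy₀'⟩ := Submodule.exists_mem_ne_zero_of_ne_bot hI
    let s : Set ℕ := {n | ∃ y ∈ I, y ≠ 0 ∧ y.norm.natAbs = n}
    have hs : s.Nonempty := ⟨_, y₀, hy₀, hy₀', rfl⟩
    obtain ⟨y, hy, hy', hyn⟩ := Nat.sInf_mem hs
    refine ⟨y, le_antisymm (fun x hx => ?_) ?_⟩
    · obtain ⟨q, hq⟩ := exists_norm_sub_mul_lt x y hy'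
      have h1 : x - y * q = 0 := by
        by_contra h
        have h2 : sInf s ≤ (x - y * q).norm.natAbs :=
          Nat.sInf_le ⟨_, I.sub_mem hx (I.mul_mem_right q hy), h, rfl⟩
        have := norm_nonneg (x - y * q)
        omega
      rw [sub_eq_zero] at h1
      exact Ideal.mem_span_singleton.mpr ⟨q, h1⟩
    · rw [Submodule.span_singleton_le_iff_mem]; exact hy

theorem card_quotient (z : Eis) : Nat.card (Eis ⧸ Ideal.span {z}) = z.norm.natAbs := by
  have h := Ideal.absNorm_span_singleton z
  rw [Algebra.norm_apply] at h
  have h2 := QuadraticAlgebra.det_toLinearMap_eq_norm z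
  rw [← Submodule.cardQuot_apply, ← Ideal.absNorm_apply, h, ← h2]
  rfl

theorem w_sq : w ^ 2 = -1 - w := by
  rw [sq]; ext <;> simp [w, QuadraticAlgebra.re_one, QuadraticAlgebra.im_one]

theorem w_cube : w ^ 3 = 1 := by
  rw [pow_succ, w_sq]; linear_combination (-1 : Eis) * w_sq

theorem star_w : star w = w ^ 2 := by
  rw [w_sq]; ext <;> simp [w, QuadraticAlgebra.re_one, QuadraticAlgebra.im_one]

theorem eq_re_add (z : Eis) : z = (z.re : Eis) + (z.im : Eis) * w := by
  ext <;> simp [w]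

theorem pow_three_eq_one_iff {z : Eis} : z ^ 3 = 1 ↔ z = 1 ∨ z = w ∨ z = w ^ 2 := by
  constructor
  · intro h
    have h1 : (z - 1) * ((z - w) * (z - w ^ 2)) = 0 := by
      rw [w_sq]; linear_combination h + (1-z) * w_sq
    rcases mul_eq_zero.mp h1 with h | h
    · exact Or.inl (sub_eq_zero.mp h)
    rcases mul_eq_zero.mp h with h | h
    · exact Or.inr (Or.inl (sub_eq_zero.mp h))
    · exact Or.inr (Or.inr (sub_eq_zero.mp h))
  · rintro (rfl | rfl | rfl)
    · simp
    · exact w_cube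
    · rw [← pow_mul, mul_comm, pow_mul, w_cube, one_pow]

theorem star_of_pow_three {z : Eis} (hz : z ^ 3 = 1) : star z = z ^ 2 := by
  rcases pow_three_eq_one_iff.mp hz with rfl | rfl | rfl
  · simp
  · exact star_w
  · rw [star_pow, star_w]

/-- An Eisenstein integer is primary if it is congruent to a nonzero rational residue mod `3`. -/
def IsPrimary (z : Eis) : Prop := ¬ (3 : ℤ) ∣ z.re ∧ (3 : ℤ) ∣ z.im

theorem isPrimary_one : IsPrimary 1 := by
  simp [IsPrimary, QuadraticAlgebra.re_one, QuadraticAlgebra.im_one]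

theorem IsPrimary.mul {x y : Eis} (hx : IsPrimary x) (hy : IsPrimary y) : IsPrimary (x * y) := by
  obtain ⟨h1, c, hc⟩ := hx
  obtain ⟨h2, d, hd⟩ := hy
  refine ⟨?_, ?_⟩
  · rw [QuadraticAlgebra.re_mul, hc]
    intro h
    have h3 : (3 : ℤ) ∣ x.re * y.re := by
      have : x.re * y.re = (x.re * y.re + -1 * (3 * c) * y.im) + 3 * (c * y.im) := by ring
      rw [this]; exact dvd_add h (dvd_mul_right _ _)
    rcases Int.prime_three.dvd_mul.mp h3 with h | h
    · exact h1 h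
    · exact h2 h
  · rw [QuadraticAlgebra.im_mul, hc, hd]
    exact ⟨x.re * d + c * y.re - 3 * c * d, by ring⟩

theorem norm_add_eq (z : Eis) : (z.re + z.im) ^ 2 = z.norm + 3 * (z.re * z.im) := by
  rw [norm_eq]; ring

theorem IsPrimary.not_dvd_norm {z : Eis} (hz : IsPrimary z) : ¬ (3 : ℤ) ∣ z.norm := by
  intro h
  have h1 : (3 : ℤ) ∣ (z.re + z.im) ^ 2 := by
    rw [norm_add_eq]; exact dvd_add h (dvd_mul_right _ _)
  have h2 := Int.prime_three.dvd_of_dvd_pow h1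
  exact hz.1 ((Int.dvd_add_left hz.2).mp h2)

theorem IsPrimary.eq_one_or_neg_one {u e : Eis} (hu : IsUnit u) (he : IsPrimary e)
    (hue : IsPrimary (u * e)) : u = 1 ∨ u = -1 := by
  have hn : u.norm = 1 := by
    have := (QuadraticAlgebra.isUnit_iff_norm_isUnit (x := u)).mp hu
    rcases Int.isUnit_iff.mp this with h | h
    · exact h
    · have := norm_nonneg u; omega
  rw [norm_eq] at hn
  obtain ⟨h1, c, hc⟩ := he
  have h2 := hue.2
  rw [QuadraticAlgebra.im_mul, hc] at h2
  have h3 : (3 : ℤ) ∣ u.im * e.re := by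
    have : u.im * e.re = (u.re * (3 * c) + u.im * e.re + -1 * u.im * (3 * c))
      + 3 * (c * u.im - c * u.re) := by ring
    rw [this]; exact dvd_add h2 (dvd_mul_right _ _)
  have h4 : (3 : ℤ) ∣ u.im := (Int.prime_three.dvd_mul.mp h3).resolve_right h1
  have h5 : u.im ^ 2 ≤ 1 := by nlinarith [sq_nonneg (2 * u.re - u.im)]
  have h6 : u.im = 0 := by
    obtain ⟨k, hk⟩ := h4
    have : k ^ 2 = 0 := by rw [hk] at h5; nlinarith [sq_nonneg k]
    rw [hk, pow_eq_zero_iff two_ne_zero |>.mp this]; rfl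
  rw [h6] at hn
  have h7 : u.re ^ 2 = 1 := by linarith
  rcases sq_eq_one_iff.mp h7 with h | h
  · left; ext <;> simp [h, h6, QuadraticAlgebra.re_one, QuadraticAlgebra.im_one]
  · right; ext <;> simp [h, h6, QuadraticAlgebra.re_one, QuadraticAlgebra.im_one]

end Eis

end Eisenstein

section CubicSymbol

namespace Eis

section Hom

variable {R : Type*} [Field R] {p : ℕ} [Fact p.Prime] [CharP R p] (φ : Eis →+* R)

theorem map_eq_re_add (z : Eis) : φ z = (z.re : R) + (z.im : R) * φ w := by
  conv_lhs => rw [eq_re_add z]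
  simp

theorem map_mul_map_star (z : Eis) : φ z * φ (star z) = ((z.norm : ℤ) : R) := by
  rw [← map_mul, mul_star_eq, map_intCast]

omit [Fact p.Prime] in
theorem not_dvd_norm_iff (z : Eis) : ¬ (p : ℤ) ∣ z.norm ↔ φ z ≠ 0 ∧ φ (star z) ≠ 0 := by
  rw [← CharP.intCast_eq_zero_iff R p, ← map_mul_map_star φ, ← mul_ne_zero_iff]

theorem three_ne_zero_of_charP (hp : p ≠ 3) : (3 : R) ≠ 0 := by
  intro h
  have h1 : ((3 : ℕ) : R) = 0 := by exact_mod_cast h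
  rw [CharP.cast_eq_zero_iff R p] at h1
  exact hp ((Nat.prime_dvd_prime_iff_eq (Fact.out) Nat.prime_three).mp h1)

include p in
theorem map_w_ne_one (hp : p ≠ 3) : φ w ≠ 1 := by
  intro h
  have h1 := congrArg φ w_sq
  rw [map_pow, map_sub, map_neg, map_one, h] at h1
  exact three_ne_zero_of_charP (R := R) hp (by linear_combination h1)

include p in
theorem eq_one_of_map_eq_one (hp : p ≠ 3) {z : Eis} (hz : z ^ 3 = 1) (h : φ z = 1) : z = 1 := by
  have hw := map_w_ne_one φ (p := p) hp
  rcases pow_three_eq_one_iff.mp hz with rfl | rfl | rfl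
  · rfl
  · exact absurd h hw
  · exfalso
    apply hw
    have h3 := congrArg φ w_cube
    rw [pow_succ, map_mul, h, one_mul, map_one] at h3
    exact h3

include p in
theorem eq_of_map_eq (hp : p ≠ 3) {z z' : Eis} (hz : z ^ 3 = 1) (hz' : z' ^ 3 = 1)
    (h : φ z = φ z') : z = z' := by
  have h1 : z * z' ^ 2 = 1 := by
    apply eq_one_of_map_eq_one φ (p := p) hp
    · rw [mul_pow, hz, ← pow_mul, mul_comm 2 3, pow_mul, hz', one_pow, one_mul]
    · rw [map_mul, h, ← map_mul, ← pow_succ', hz', map_one]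
  calc z = z * z' ^ 2 * z' := by rw [mul_assoc, ← pow_succ, hz', mul_one]
    _ = z' := by rw [h1, one_mul]

theorem dvd_iff_map_eq_zero (hp : p ≠ 3) (z : Eis) :
    (p : Eis) ∣ z ↔ φ z = 0 ∧ φ (star z) = 0 := by
  constructor
  · rintro ⟨y, rfl⟩
    simp
  · rintro ⟨h1, h2⟩
    rw [map_eq_re_add] at h1 h2
    have hw2 : φ w ^ 2 = -1 - φ w := by rw [← map_pow, w_sq]; simp
    rw [QuadraticAlgebra.re_star, QuadraticAlgebra.im_star] at h2
    push_cast at h2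
    have h3 : (3 : R) * (z.im : R) = 0 := by
      linear_combination -(1 + 2 * φ w) * (h1 - h2) + 4 * (z.im : R) * hw2
    have h4 : (z.im : R) = 0 := (mul_eq_zero.mp h3).resolve_left (three_ne_zero_of_charP hp)
    rw [h4, zero_mul, add_zero] at h1
    obtain ⟨a, ha⟩ := (CharP.intCast_eq_zero_iff R p _).mp h1
    obtain ⟨b, hb⟩ := (CharP.intCast_eq_zero_iff R p _).mp h4
    exact ⟨⟨a, b⟩, by ext <;> simp [ha, hb]⟩

omit [Fact p.Prime] [CharP R p] in
theorem exists_map_eq_of_pow_three {y : R} (hy3 : y ^ 3 = 1) : ∃ z : Eis, z ^ 3 = 1 ∧ φ z = y := by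
  have hw2 : φ w ^ 2 = -1 - φ w := by rw [← map_pow, w_sq]; simp
  have h5 : (y - 1) * ((y - φ w) * (y - φ w ^ 2)) = 0 := by
    rw [hw2]; linear_combination hy3 + (1-y) * hw2
  rcases mul_eq_zero.mp h5 with h | h
  · exact ⟨1, by simp, by rw [sub_eq_zero.mp h, map_one]⟩
  rcases mul_eq_zero.mp h with h | h
  · exact ⟨w, w_cube, by rw [sub_eq_zero.mp h]⟩
  · exact ⟨w ^ 2, pow_three_eq_one_iff.mpr (by simp), by rw [sub_eq_zero.mp h, map_pow]⟩

theorem map_pow_sq (hp : p ≠ 3) (z : Eis) : φ z ^ (p ^ 2) = φ z := by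
  have h0 : p % 3 ≠ 0 := by
    intro h
    exact hp ((Nat.prime_dvd_prime_iff_eq Nat.prime_three Fact.out).mp
      (Nat.dvd_of_mod_eq_zero h)).symm
  have h1 : φ w ^ (p ^ 2) = φ w := by
    have h2 : p ^ 2 % 3 = 1 := by
      rw [Nat.pow_mod]
      have : p % 3 = 1 ∨ p % 3 = 2 := by omega
      rcases this with h | h <;> rw [h]
    rw [← Nat.div_add_mod (p ^ 2) 3, h2, pow_succ, pow_mul, ← map_pow φ w 3, w_cube]
    simp
  have h2 : iterateFrobenius R p 2 (φ z) = φ z := by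
    conv_lhs => rw [map_eq_re_add φ z]
    rw [map_add, map_mul, map_intCast, map_intCast, iterateFrobenius_def, h1, ← map_eq_re_add]
  rwa [iterateFrobenius_def] at h2

theorem three_mul_sq_sub_one_div (hp : p ≠ 3) : 3 * ((p ^ 2 - 1) / 3) = p ^ 2 - 1 := by
  have h0 : p % 3 ≠ 0 := by
    intro h
    exact hp ((Nat.prime_dvd_prime_iff_eq Nat.prime_three Fact.out).mp
      (Nat.dvd_of_mod_eq_zero h)).symm
  have h2 : p ^ 2 % 3 = 1 := by
    rw [Nat.pow_mod]
    have : p % 3 = 1 ∨ p % 3 = 2 := by omega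
    rcases this with h | h <;> rw [h]
  omega

theorem map_pow_sub_one (hp : p ≠ 3) {z : Eis} (hz : φ z ≠ 0) : φ z ^ (p ^ 2 - 1) = 1 := by
  have h1 := map_pow_sq φ hp z
  have hp1 : p ^ 2 = (p ^ 2 - 1) + 1 := by
    have : 0 < p ^ 2 := pow_pos (Fact.out (p := p.Prime)).pos 2
    omega
  rw [hp1, pow_succ] at h1
  exact mul_right_cancel₀ hz (by rw [h1, one_mul])

end Hom

theorem nonempty_hom_of_isAlgClosed (R : Type*) [Field R] [IsAlgClosed R] : Nonempty (Eis →+* R) := by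
  have hdeg : (Polynomial.X ^ 2 + Polynomial.X + 1 : Polynomial R).degree ≠ 0 := by
    have : (Polynomial.X ^ 2 + Polynomial.X + 1 : Polynomial R).degree = 2 := by compute_degree!
    rw [this]; norm_num
  obtain ⟨r, hr⟩ := IsAlgClosed.exists_root _ hdeg
  have hr' : r * r = (-1 : ℤ) • (1 : R) + (-1 : ℤ) • r := by
    simp only [Polynomial.IsRoot, Polynomial.eval_add, Polynomial.eval_pow, Polynomial.eval_X,
      Polynomial.eval_one] at hr
    simp only [neg_smul, one_smul]
    linear_combination hr
  exact ⟨(QuadraticAlgebra.lift ⟨r, hr'⟩ : Eis →ₐ[ℤ] R).toRingHom⟩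

/-- The cubic residue symbol of `e ∈ ℤ[ω]` modulo a rational prime `p ≠ 3`: the product of the cubic
residue symbols modulo the primes of `ℤ[ω]` above `p`. -/
def cubSym (p : ℕ) (e : Eis) : Eis :=
  if h : ¬ (p : ℤ) ∣ e.norm ∧ ∃ z : Eis, z ^ 3 = 1 ∧
    (p : Eis) ∣ star e ^ ((p ^ 2 - 1) / 3) - z * e ^ ((p ^ 2 - 1) / 3) then h.2.choose else 0

section Symbol

variable {p : ℕ} [Fact p.Prime]

section

variable {R : Type*} [Field R] [CharP R p] (φ : Eis →+* R)

theorem dvd_cubSym_iff (hp : p ≠ 3) {e z : Eis} (hz : z ^ 3 = 1) :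
    (p : Eis) ∣ star e ^ ((p ^ 2 - 1) / 3) - z * e ^ ((p ^ 2 - 1) / 3) ↔
      φ (star e) ^ ((p ^ 2 - 1) / 3) = φ z * φ e ^ ((p ^ 2 - 1) / 3) := by
  rw [dvd_iff_map_eq_zero φ hp]
  simp only [map_sub, map_mul, map_pow, star_sub, star_mul, star_pow, star_star, sub_eq_zero,
    star_of_pow_three hz]
  constructor
  · exact fun h => h.1
  · refine fun h => ⟨h, ?_⟩
    rw [h, mul_comm, ← mul_assoc, ← pow_succ, ← map_pow φ z, hz, map_one, one_mul]

theorem exists_cubSym (hp : p ≠ 3) {e : Eis} (he : ¬ (p : ℤ) ∣ e.norm) :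
    ∃ z : Eis, z ^ 3 = 1 ∧
      φ (star e) ^ ((p ^ 2 - 1) / 3) = φ z * φ e ^ ((p ^ 2 - 1) / 3) := by
  obtain ⟨h1, h2⟩ := (not_dvd_norm_iff φ e).mp he
  set M := (p ^ 2 - 1) / 3 with hM
  have h3 : ∀ x : Eis, φ x ≠ 0 → (φ x ^ M) ^ 3 = 1 := by
    intro x hx
    rw [← pow_mul, mul_comm, hM, three_mul_sq_sub_one_div hp, map_pow_sub_one φ hp hx]
  have h4 : φ e ^ M ≠ 0 := pow_ne_zero _ h1
  set y := φ (star e) ^ M * (φ e ^ M) ^ 2 with hy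
  have hy3 : y ^ 3 = 1 := by
    rw [hy, mul_pow, h3 _ h2, ← pow_mul, mul_comm 2 3, pow_mul, h3 _ h1]; simp
  have hy' : φ (star e) ^ M = y * φ e ^ M := by
    rw [hy, mul_assoc, ← pow_succ, h3 _ h1, mul_one]
  obtain ⟨z, hz, hzy⟩ := exists_map_eq_of_pow_three φ hy3
  exact ⟨z, hz, by rw [hy', hzy]⟩

theorem cubSym_spec (hp : p ≠ 3) {e : Eis} (he : ¬ (p : ℤ) ∣ e.norm) :
    cubSym p e ^ 3 = 1 ∧
      φ (star e) ^ ((p ^ 2 - 1) / 3) = φ (cubSym p e) * φ e ^ ((p ^ 2 - 1) / 3) := by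
  have h : ¬ (p : ℤ) ∣ e.norm ∧ ∃ z : Eis, z ^ 3 = 1 ∧
      (p : Eis) ∣ star e ^ ((p ^ 2 - 1) / 3) - z * e ^ ((p ^ 2 - 1) / 3) := by
    obtain ⟨z, hz, hz'⟩ := exists_cubSym φ hp he
    exact ⟨he, z, hz, (dvd_cubSym_iff φ hp hz).mpr hz'⟩
  rw [cubSym, dif_pos h]
  exact ⟨h.2.choose_spec.1, (dvd_cubSym_iff φ hp h.2.choose_spec.1).mp h.2.choose_spec.2⟩

theorem cubSym_eq_of (hp : p ≠ 3) {e z : Eis} (he : ¬ (p : ℤ) ∣ e.norm) (hz : z ^ 3 = 1)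
    (h : φ (star e) ^ ((p ^ 2 - 1) / 3) = φ z * φ e ^ ((p ^ 2 - 1) / 3)) : cubSym p e = z := by
  obtain ⟨h1, h2⟩ := cubSym_spec φ hp he
  apply eq_of_map_eq φ (p := p) hp h1 hz
  apply mul_right_cancel₀ (pow_ne_zero _ ((not_dvd_norm_iff φ e).mp he).1)
  rw [← h2, h]

end

theorem cubSym_pow_three (hp : p ≠ 3) {e : Eis} (he : ¬ (p : ℤ) ∣ e.norm) : cubSym p e ^ 3 = 1 := by
  obtain ⟨φ⟩ := nonempty_hom_of_isAlgClosed (AlgebraicClosure (ZMod p))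
  exact (cubSym_spec φ hp he).1

theorem cubSym_of_dvd {p : ℕ} {e : Eis} (he : (p : ℤ) ∣ e.norm) : cubSym p e = 0 :=
  dif_neg fun h => h.1 he

theorem cubSym_mul (hp : p ≠ 3) (e f : Eis) : cubSym p (e * f) = cubSym p e * cubSym p f := by
  have hpp : Prime (p : ℤ) := Nat.prime_iff_prime_int.mp Fact.out
  by_cases he : (p : ℤ) ∣ e.norm
  · rw [cubSym_of_dvd he, zero_mul, cubSym_of_dvd (by rw [map_mul]; exact he.mul_right _)]
  by_cases hf : (p : ℤ) ∣ f.norm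
  · rw [cubSym_of_dvd hf, mul_zero, cubSym_of_dvd (by rw [map_mul]; exact hf.mul_left _)]
  obtain ⟨φ⟩ := nonempty_hom_of_isAlgClosed (AlgebraicClosure (ZMod p))
  obtain ⟨h1, h2⟩ := cubSym_spec φ hp he
  obtain ⟨h3, h4⟩ := cubSym_spec φ hp hf
  apply cubSym_eq_of φ hp
  · rw [map_mul]
    intro h
    exact (hpp.dvd_mul.mp h).elim he hf
  · rw [mul_pow, h1, h3, one_mul]
  · rw [star_mul, map_mul, map_mul, map_mul, mul_pow, mul_pow, h2, h4]; ring

theorem cubSym_congr (hp : p ≠ 3) {e f : Eis} (h : (p : Eis) ∣ e - f) :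
    cubSym p e = cubSym p f := by
  obtain ⟨φ⟩ := nonempty_hom_of_isAlgClosed (AlgebraicClosure (ZMod p))
  obtain ⟨h1, h2⟩ := (dvd_iff_map_eq_zero φ hp _).mp h
  rw [map_sub, sub_eq_zero] at h1
  rw [star_sub, map_sub, sub_eq_zero] at h2
  by_cases he : (p : ℤ) ∣ e.norm
  · rw [cubSym_of_dvd he, cubSym_of_dvd]
    by_contra hf
    exact (not_dvd_norm_iff φ e).mpr (by rw [h1, h2]; exact (not_dvd_norm_iff φ f).mp hf) he
  · have hf : ¬ (p : ℤ) ∣ f.norm :=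
      (not_dvd_norm_iff φ f).mpr (by rw [← h1, ← h2]; exact (not_dvd_norm_iff φ e).mp he)
    obtain ⟨h3, h4⟩ := cubSym_spec φ hp hf
    apply cubSym_eq_of φ hp he h3
    rw [h1, h2, h4]

theorem cubSym_intCast (hp : p ≠ 3) {n : ℤ} (hn : ¬ (p : ℤ) ∣ n) : cubSym p (n : Eis) = 1 := by
  obtain ⟨φ⟩ := nonempty_hom_of_isAlgClosed (AlgebraicClosure (ZMod p))
  have hpp : Prime (p : ℤ) := Nat.prime_iff_prime_int.mp Fact.out
  apply cubSym_eq_of φ hp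
  · rw [QuadraticAlgebra.norm_intCast]
    exact fun h => hn (hpp.dvd_of_dvd_pow h)
  · simp
  · simp

theorem cubSym_neg (hp : p ≠ 3) (e : Eis) : cubSym p (-e) = cubSym p e := by
  have h : -e = ((-1 : ℤ) : Eis) * e := by push_cast; ring
  rw [h, cubSym_mul hp, cubSym_intCast hp, one_mul]
  intro h
  exact (Nat.prime_iff_prime_int.mp (Fact.out (p := p.Prime))).not_isUnit (isUnit_of_dvd_unit h (by simp))

end Symbol

end Eis

end CubicSymbol

section CubicReciprocity

namespace Eis

section JacobiSum

variable {F : Type*} [Field F] [Fintype F] (φ : Eis →+* F)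

theorem exists_cubic_mulChar (hF : 3 ∣ Fintype.card F - 1) :
    ∃ χ : MulChar F Eis, χ ^ 3 = 1 ∧ χ ≠ 1 ∧ ∀ x, φ (χ x) = x ^ ((Fintype.card F - 1) / 3) := by
  obtain ⟨ℓ, hℓ⟩ := CharP.exists F
  have : Fact ℓ.Prime := ⟨CharP.char_is_prime F ℓ⟩
  have hcard := Fintype.one_lt_card (α := F)
  have hℓ3 : ℓ ≠ 3 := by
    rintro rfl
    have h1 : 3 ∣ Fintype.card F := (CharP.cast_eq_zero_iff F 3 _).mp (Nat.cast_card_eq_zero F)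
    omega
  set N := (Fintype.card F - 1) / 3 with hN
  have hN3 : N * 3 = Fintype.card F - 1 := Nat.div_mul_cancel hF
  have hN0 : N ≠ 0 := by omega
  have hex : ∀ x : F, x ≠ 0 → ∃ z : Eis, z ^ 3 = 1 ∧ φ z = x ^ N := by
    intro x hx
    apply exists_map_eq_of_pow_three φ
    rw [← pow_mul, hN3, FiniteField.pow_card_sub_one_eq_one x hx]
  choose! f hf3 hf using hex
  have huniq : ∀ {x z}, x ≠ 0 → z ^ 3 = 1 → φ z = x ^ N → f x = z := fun {x z} hx hz h =>
    eq_of_map_eq φ (p := ℓ) hℓ3 (hf3 x hx) hz (by rw [hf x hx, h])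
  let χ : MulChar F Eis :=
    { toFun := fun x => if x = 0 then 0 else f x
      map_one' := by
        rw [if_neg one_ne_zero]
        exact huniq one_ne_zero (by simp) (by simp)
      map_mul' := fun x y => by
        by_cases hx : x = 0
        · simp [hx]
        by_cases hy : y = 0
        · simp [hy]
        rw [if_neg hx, if_neg hy, if_neg (mul_ne_zero hx hy)]
        apply huniq (mul_ne_zero hx hy)
        · rw [mul_pow, hf3 x hx, hf3 y hy, one_mul]
        · rw [map_mul, hf x hx, hf y hy, mul_pow]
      map_nonunit' := fun x hx => by
        rw [isUnit_iff_ne_zero, not_not] at hx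
        simp [hx] }
  have hχ : ∀ x, x ≠ 0 → χ x = f x := fun x hx => if_neg hx
  refine ⟨χ, ?_, ?_, ?_⟩
  · refine MulChar.ext fun x => ?_
    rw [MulChar.pow_apply_coe, hχ _ x.ne_zero, hf3 _ x.ne_zero, MulChar.one_apply_coe]
  · intro h
    have h1 : ∀ x : Fˣ, x ^ N = 1 := by
      intro x
      have h2 : χ (x : F) = 1 := by rw [h, MulChar.one_apply_coe]
      rw [hχ _ x.ne_zero] at h2
      ext
      rw [Units.val_pow_eq_pow_val, ← hf _ x.ne_zero, h2, map_one, Units.val_one]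
    rw [FiniteField.forall_pow_eq_one_iff] at h1
    have := Nat.le_of_dvd (Nat.pos_of_ne_zero hN0) h1
    omega
  · intro x
    by_cases hx : x = 0
    · rw [hx, MulChar.map_zero, map_zero, zero_pow hN0]
    · rw [hχ x hx, hf x hx]

variable {χ : MulChar F Eis}

theorem map_jacobiSum_eq_zero (hF : 3 ∣ Fintype.card F - 1)
    (hχ : ∀ x, φ (χ x) = x ^ ((Fintype.card F - 1) / 3)) : φ (jacobiSum χ χ) = 0 := by
  have hcard := Fintype.one_lt_card (α := F)
  set N := (Fintype.card F - 1) / 3 with hN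
  have hN3 : N * 3 = Fintype.card F - 1 := Nat.div_mul_cancel hF
  simp only [jacobiSum, map_sum, map_mul, hχ]
  let P : Polynomial F := Polynomial.X ^ N * (1 - Polynomial.X) ^ N
  have hP : ∀ x, P.eval x = x ^ N * (1 - x) ^ N := by intro x; simp [P]
  have hdeg : P.natDegree ≤ 2 * N := by
    have h1 : (1 - Polynomial.X : Polynomial F).natDegree ≤ 1 := by compute_degree
    have h2 : ((1 - Polynomial.X : Polynomial F) ^ N).natDegree ≤ N * 1 :=
      Polynomial.natDegree_pow_le_of_le N h1
    have h3 := Polynomial.natDegree_mul_le (p := (Polynomial.X ^ N : Polynomial F))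
      (q := (1 - Polynomial.X) ^ N)
    rw [Polynomial.natDegree_X_pow] at h3
    show (Polynomial.X ^ N * (1 - Polynomial.X) ^ N : Polynomial F).natDegree ≤ _
    omega
  simp only [← hP, Polynomial.eval_eq_sum_range]
  rw [Finset.sum_comm]
  apply Finset.sum_eq_zero
  intro i hi
  rw [Finset.mem_range] at hi
  rw [← Finset.mul_sum, FiniteField.sum_pow_lt_card_sub_one, mul_zero]
  omega

theorem isPrimitiveRoot_w : IsPrimitiveRoot w 3 := by
  apply IsPrimitiveRoot.iff_def _ _ |>.mpr
  refine ⟨w_cube, fun l hl => ?_⟩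
  have h1 : w ^ (l % 3) = 1 := by
    rw [← hl]
    conv_rhs => rw [← Nat.div_add_mod l 3, pow_add, pow_mul, w_cube, one_pow, one_mul]
  have h2 : l % 3 < 3 := Nat.mod_lt _ (by norm_num)
  interval_cases h : l % 3
  · exact Nat.dvd_of_mod_eq_zero h
  · have := congrArg QuadraticAlgebra.im h1
    simp [w, QuadraticAlgebra.im_one] at this
  · rw [w_sq] at h1
    have := congrArg QuadraticAlgebra.im h1
    simp [w, QuadraticAlgebra.im_one] at this

theorem isPrimary_jacobiSum (hF : 3 ∣ Fintype.card F - 1) (hχ : χ ^ 3 = 1) :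
    IsPrimary (jacobiSum χ χ) := by
  obtain ⟨z, -, hz⟩ := exists_jacobiSum_eq_neg_one_add (by norm_num) hχ hχ hF isPrimitiveRoot_w
  have h1 : jacobiSum χ χ = -1 + ((3 : ℤ) : Eis) * (-(z * w)) := by
    rw [hz]; push_cast; linear_combination z * w_sq
  rw [h1]
  constructor
  · rw [QuadraticAlgebra.re_add, ← QuadraticAlgebra.C_intCast, QuadraticAlgebra.re_mul]
    simp only [QuadraticAlgebra.re_neg, QuadraticAlgebra.re_one, QuadraticAlgebra.re_C,
      QuadraticAlgebra.im_C, Int.cast_id]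
    omega
  · rw [QuadraticAlgebra.im_add, ← QuadraticAlgebra.C_intCast, QuadraticAlgebra.im_mul]
    simp only [QuadraticAlgebra.im_neg, QuadraticAlgebra.im_one, QuadraticAlgebra.re_C,
      QuadraticAlgebra.im_C, Int.cast_id]
    omega

omit [Fintype F] in
theorem mulChar_inv_eq (hχ : χ ^ 3 = 1) : χ⁻¹ = χ ^ 2 := by
  rw [inv_eq_iff_mul_eq_one, ← pow_succ', hχ]

omit [Fintype F] in
theorem mulChar_sq_ne_one (hχ : χ ^ 3 = 1) (hχ1 : χ ≠ 1) : χ * χ ≠ 1 := by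
  intro h
  apply hχ1
  rw [pow_succ, sq, h, one_mul] at hχ
  exact hχ

omit [Fintype F] in
theorem mulChar_apply_pow_three (hχ : χ ^ 3 = 1) {x : F} (hx : x ≠ 0) : χ x ^ 3 = 1 := by
  rw [← MulChar.pow_apply' χ (by norm_num), hχ, MulChar.one_apply (isUnit_iff_ne_zero.mpr hx)]

theorem jacobiSum_mul_star (hχ : χ ^ 3 = 1) (hχ1 : χ ≠ 1) :
    jacobiSum χ χ * star (jacobiSum χ χ) = (Fintype.card F : Eis) := by
  have hinj : Function.Injective (algebraMap Eis (FractionRing Eis)) := IsFractionRing.injective _ _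
  have h1 : star (jacobiSum χ χ) = jacobiSum χ⁻¹ χ⁻¹ := by
    have h2 : χ.ringHomComp (starRingEnd Eis) = χ⁻¹ := by
      refine MulChar.ext fun x => ?_
      rw [MulChar.ringHomComp_apply, starRingEnd_apply, mulChar_inv_eq hχ, MulChar.pow_apply_coe,
        star_of_pow_three (mulChar_apply_pow_three hχ x.ne_zero)]
    rw [← h2, jacobiSum_ringHomComp, starRingEnd_apply]
  apply hinj
  rw [h1, map_mul, ← jacobiSum_ringHomComp, ← jacobiSum_ringHomComp, ← MulChar.ringHomComp_inv,
    jacobiSum_mul_jacobiSum_inv, map_natCast]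
  · have : ringChar (FractionRing Eis) = 0 := ringChar.eq_zero
    rw [this]
    exact (CharP.char_ne_zero_of_finite F (ringChar F)).symm
  · exact (MulChar.ringHomComp_ne_one_iff hinj).mpr hχ1
  · exact (MulChar.ringHomComp_ne_one_iff hinj).mpr hχ1
  · rw [← MulChar.ringHomComp_mul]
    exact (MulChar.ringHomComp_ne_one_iff hinj).mpr (mulChar_sq_ne_one hχ hχ1)

theorem norm_jacobiSum (hχ : χ ^ 3 = 1) (hχ1 : χ ≠ 1) :
    (jacobiSum χ χ).norm = (Fintype.card F : ℤ) := by
  have h := jacobiSum_mul_star hχ hχ1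
  rw [mul_star_eq] at h
  exact_mod_cast h

theorem cubSym_jacobiSum (hχ : χ ^ 3 = 1) (hχ1 : χ ≠ 1) {p : ℕ} [Fact p.Prime] (hp : p ≠ 3)
    (hpF : (p : F) ≠ 0) : cubSym p (jacobiSum χ χ) = χ (p : F) := by
  set J := jacobiSum χ χ with hJ
  have hchar : ringChar (AlgebraicClosure (ZMod p)) ≠ ringChar F := by
    intro h
    apply hpF
    have h1 : ringChar (AlgebraicClosure (ZMod p)) = p := (ringChar.eq _ p)
    rw [← h1, h]
    exact ringChar.Nat.cast_ringChar
  have hpQ : ¬ (p : ℤ) ∣ J.norm := by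
    rw [norm_jacobiSum hχ hχ1]
    intro h
    have h1 : p ∣ Fintype.card F := by exact_mod_cast h
    obtain ⟨n, hℓ, hn⟩ := FiniteField.card F (ringChar F)
    rw [hn] at h1
    have h2 := (Nat.prime_dvd_prime_iff_eq Fact.out hℓ).mp ((Fact.out : p.Prime).dvd_of_dvd_pow h1)
    apply hpF
    rw [h2]
    exact ringChar.Nat.cast_ringChar
  let P := AddChar.FiniteField.primitiveChar F (AlgebraicClosure (ZMod p)) hchar
  let R := CyclotomicField P.n (AlgebraicClosure (ZMod p))
  obtain ⟨φ₀⟩ := nonempty_hom_of_isAlgClosed (AlgebraicClosure (ZMod p))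
  let φ : Eis →+* R := (algebraMap (AlgebraicClosure (ZMod p)) R).comp φ₀
  have : CharP R p := charP_of_injective_algebraMap
    (algebraMap (AlgebraicClosure (ZMod p)) R).injective p
  let χ' : MulChar F R := χ.ringHomComp φ
  have hχ' : χ' ^ 3 = 1 := by
    rw [MulChar.ringHomComp_pow, hχ, MulChar.ringHomComp_one]
  have hval : ∀ x : F, χ' x = φ (χ x) := fun x => MulChar.ringHomComp_apply _ _ _
  have hχ'1 : χ' ≠ 1 := by
    intro h
    apply hχ1
    refine MulChar.ext fun x => ?_
    rw [MulChar.one_apply_coe]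
    apply eq_one_of_map_eq_one φ (p := p) hp (mulChar_apply_pow_three hχ x.ne_zero)
    rw [← hval, h, MulChar.one_apply_coe]
  have hord : orderOf χ' = 3 := orderOf_eq_prime hχ' hχ'1
  obtain ⟨hJ1, hJ2⟩ := (not_dvd_norm_iff φ J).mp hpQ
  have hcard : ((Fintype.card F : ℕ) : R) = φ J * φ (star J) := by
    rw [← map_mul, hJ, jacobiSum_mul_star hχ hχ1, map_natCast]
  set g := gaussSum χ' P.char with hg
  have hcube : g ^ 3 = φ J * φ (star J) * φ J := by
    have h1 := gaussSum_pow_eq_prod_jacobiSum (χ := χ') (ψ := P.char) (by rw [hord]; norm_num) P.prim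
    have h2 : χ' (-1) = 1 := by
      have h3 : χ' (-1) ^ 2 = 1 := by
        rw [← map_pow]; simp
      have h4 : χ' (-1) ^ 3 = 1 := by
        rw [← MulChar.pow_apply' χ' (by norm_num), hχ', MulChar.one_apply (by simp)]
      rw [pow_succ, h3, one_mul] at h4
      exact h4
    rw [hord, h2, one_mul, hcard] at h1
    rw [h1]
    congr 1
    show ∏ i ∈ Finset.Ico 1 2, jacobiSum χ' (χ' ^ i) = _
    rw [Finset.prod_Ico_succ_top (by norm_num)]
    simp only [Finset.Ico_self, Finset.prod_empty, one_mul, pow_one]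
    exact jacobiSum_ringHomComp χ χ φ
  have hg0 : g ≠ 0 := by
    intro h
    rw [h, zero_pow (by norm_num)] at hcube
    exact mul_ne_zero (mul_ne_zero hJ1 hJ2) hJ1 hcube.symm
  have hfrob : χ' ((p : F) ^ 2) * g ^ (p ^ 2) = g := by
    have hu : IsUnit ((p : F) ^ 2) := isUnit_iff_ne_zero.mpr (pow_ne_zero 2 hpF)
    have h1 : g ^ (p ^ 2) = gaussSum (χ' ^ (p ^ 2)) (P.char ^ (p ^ 2)) := by
      rw [sq p, pow_mul, hg, gaussSum_frob p, gaussSum_frob p, ← pow_mul, ← pow_mul]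
    have h2 : χ' ^ (p ^ 2) = χ' := by
      have h3 := three_mul_sq_sub_one_div (p := p) hp
      have h4 : 0 < p ^ 2 := pow_pos (Fact.out (p := p.Prime)).pos 2
      have h5 : p ^ 2 = 3 * ((p ^ 2 - 1) / 3) + 1 := by omega
      rw [h5, pow_succ, pow_mul, hχ', one_pow, one_mul]
    rw [h1, h2, AddChar.pow_mulShift]
    have h6 := gaussSum_mulShift χ' P.char hu.unit
    rw [IsUnit.unit_spec] at h6
    push_cast
    exact h6
  set M := (p ^ 2 - 1) / 3 with hM
  have hM3 : 3 * M = p ^ 2 - 1 := three_mul_sq_sub_one_div hp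
  have hc3 : φ (χ (p : F)) ^ 3 = 1 := by
    rw [← map_pow, mulChar_apply_pow_three hχ hpF, map_one]
  have hpow : g ^ (p ^ 2 - 1) = φ (χ (p : F)) := by
    have h4 : 0 < p ^ 2 := pow_pos (Fact.out (p := p.Prime)).pos 2
    have h5 : p ^ 2 = (p ^ 2 - 1) + 1 := by omega
    rw [map_pow, hval, h5, pow_succ g] at hfrob
    have h6 : φ (χ (p : F)) ^ 2 * g ^ (p ^ 2 - 1) = 1 :=
      mul_right_cancel₀ hg0 (by rw [mul_assoc, hfrob, one_mul])
    calc g ^ (p ^ 2 - 1) = φ (χ (p : F)) ^ 3 * g ^ (p ^ 2 - 1) := by rw [hc3, one_mul]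
      _ = φ (χ (p : F)) * (φ (χ (p : F)) ^ 2 * g ^ (p ^ 2 - 1)) := by ring
      _ = φ (χ (p : F)) := by rw [h6, mul_one]
  apply cubSym_eq_of φ hp hpQ (mulChar_apply_pow_three hχ hpF)
  rw [← hM, ← hpow, ← hM3, pow_mul, hcube]
  have h7 := map_pow_sub_one φ hp hJ1
  rw [← hM3] at h7
  calc φ (star J) ^ M = φ J ^ (3 * M) * φ (star J) ^ M := by rw [h7, one_mul]
    _ = (φ J * φ (star J) * φ J) ^ M * φ J ^ M := by ring

end JacobiSum

end Eis

end CubicReciprocity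

section RationalReciprocity

namespace Eis

/-- The symbols `cubSym p e` at rational primes `p` are given by a cubic character `ψ` modulo `e`. -/
def HasReciprocity (e : Eis) : Prop :=
  ∃ ψ : Eis →* Eis, (∀ x, IsCoprime x e → ψ x ^ 3 = 1) ∧ (∀ x y, e ∣ x - y → ψ x = ψ y) ∧
    ∀ p : ℕ, p.Prime → p ≠ 3 → IsCoprime (p : Eis) e → cubSym p e = ψ p

theorem HasReciprocity.mul {e f : Eis} (he : HasReciprocity e) (hf : HasReciprocity f) :
    HasReciprocity (e * f) := by
  obtain ⟨ψ, h1, h2, h3⟩ := he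
  obtain ⟨ψ', h1', h2', h3'⟩ := hf
  refine ⟨ψ * ψ', fun x hx => ?_, fun x y hxy => ?_, fun p hp hp3 hpe => ?_⟩
  · rw [MonoidHom.mul_apply, mul_pow, h1 x hx.of_mul_right_left, h1' x hx.of_mul_right_right, one_mul]
  · rw [MonoidHom.mul_apply, MonoidHom.mul_apply, h2 x y (dvd_of_mul_right_dvd hxy),
      h2' x y (dvd_of_mul_left_dvd hxy)]
  · have : Fact p.Prime := ⟨hp⟩
    rw [MonoidHom.mul_apply, cubSym_mul hp3, h3 p hp hp3 hpe.of_mul_right_left,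
      h3' p hp hp3 hpe.of_mul_right_right]

theorem HasReciprocity.neg {e : Eis} (he : HasReciprocity e) : HasReciprocity (-e) := by
  obtain ⟨ψ, h1, h2, h3⟩ := he
  refine ⟨ψ, fun x hx => h1 x ((IsCoprime.neg_right_iff _ _).mp hx), fun x y hxy => h2 x y (by simpa using hxy),
    fun p hp hp3 hpe => ?_⟩
  have : Fact p.Prime := ⟨hp⟩
  rw [cubSym_neg hp3, h3 p hp hp3 ((IsCoprime.neg_right_iff _ _).mp hpe)]

theorem hasReciprocity_one : HasReciprocity 1 := by
  refine ⟨1, by simp, by simp, fun p hp hp3 _ => ?_⟩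
  have : Fact p.Prime := ⟨hp⟩
  have h := cubSym_intCast hp3 (n := 1) (by
    intro h
    exact (Nat.prime_iff_prime_int.mp hp).not_isUnit (isUnit_of_dvd_unit h (by simp)))
  simpa using h

theorem exists_hasReciprocity_of_prime {π : Eis} (hπ : Prime π) (h3 : ¬ (3 : ℤ) ∣ π.norm) :
    ∃ u, IsUnit u ∧ IsPrimary (u * π) ∧ HasReciprocity (u * π) := by
  set I : Ideal Eis := Ideal.span {π} with hI
  have hprime : I.IsPrime := (Ideal.span_singleton_prime hπ.ne_zero).mpr hπ
  have hmax : I.IsMaximal := hprime.isMaximal (by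
    rw [hI, ne_eq, Ideal.span_singleton_eq_bot]; exact hπ.ne_zero)
  let := Ideal.Quotient.field I
  have hcard := card_quotient π
  have hN0 : π.norm.natAbs ≠ 0 := by
    rw [ne_eq, Int.natAbs_eq_zero, norm_eq_zero]; exact hπ.ne_zero
  have hfin : Finite (Eis ⧸ I) := Nat.finite_of_card_ne_zero (by rw [hcard]; exact hN0)
  let : Fintype (Eis ⧸ I) := Fintype.ofFinite _
  rw [← hI, Nat.card_eq_fintype_card] at hcard
  have hnn := norm_nonneg π
  have hnorm : π.norm = (Fintype.card (Eis ⧸ I) : ℤ) := by rw [hcard]; omega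
  have hmod : 3 ∣ Fintype.card (Eis ⧸ I) - 1 := by
    have h1 := norm_add_eq π
    have h2 : (π.re + π.im) % 3 = 0 ∨ (π.re + π.im) % 3 = 1 ∨ (π.re + π.im) % 3 = 2 := by omega
    have h5 : (π.re + π.im) ^ 2 % 3 = π.norm % 3 := by rw [h1]; omega
    rw [pow_two, Int.mul_emod] at h5
    rcases h2 with h | h | h <;> rw [h] at h5 <;> omega
  obtain ⟨χ, hχ3, hχ1, hχ⟩ := exists_cubic_mulChar (Ideal.Quotient.mk I) hmod
  set J := jacobiSum χ χ with hJ
  obtain ⟨y, hy⟩ : π ∣ J := by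
    rw [← Ideal.mem_span_singleton, ← hI, ← Ideal.Quotient.eq_zero_iff_mem]
    exact map_jacobiSum_eq_zero (Ideal.Quotient.mk I) hmod hχ
  have hJN := norm_jacobiSum hχ3 hχ1
  have hyu : IsUnit y := by
    rw [QuadraticAlgebra.isUnit_iff_norm_isUnit]
    rw [← hJ, hy, map_mul, ← hnorm] at hJN
    have h1 : π.norm ≠ 0 := by rw [ne_eq, norm_eq_zero]; exact hπ.ne_zero
    have h2 : y.norm = 1 := mul_left_cancel₀ h1 (by rw [hJN, mul_one])
    rw [h2]; exact isUnit_one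
  refine ⟨y, hyu, ?_⟩
  rw [mul_comm, ← hy]
  refine ⟨isPrimary_jacobiSum hmod hχ3, ?_⟩
  have hne : ∀ x, IsCoprime x J → Ideal.Quotient.mk I x ≠ 0 := by
    intro x hx h0
    rw [Ideal.Quotient.eq_zero_iff_mem, hI, Ideal.mem_span_singleton] at h0
    rw [hy] at hx
    exact hπ.not_isUnit (hx.isUnit_of_dvd' h0 (dvd_mul_right _ _))
  refine ⟨χ.toMonoidHom.comp (Ideal.Quotient.mk I : Eis →* Eis ⧸ I), fun x hx => ?_,
    fun x z hxz => ?_, fun p hp hp3 hpe => ?_⟩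
  · exact mulChar_apply_pow_three hχ3 (hne x hx)
  · have : Ideal.Quotient.mk I x = Ideal.Quotient.mk I z := by
      rw [Ideal.Quotient.eq, hI, Ideal.mem_span_singleton]
      exact (Dvd.intro y hy.symm).trans hxz
    show χ (Ideal.Quotient.mk I x) = χ (Ideal.Quotient.mk I z)
    rw [this]
  · have : Fact p.Prime := ⟨hp⟩
    have h1 := hne _ hpe
    rw [map_natCast] at h1
    rw [hJ, cubSym_jacobiSum hχ3 hχ1 hp3 h1]
    exact congrArg χ (map_natCast (Ideal.Quotient.mk I) p).symm

theorem exists_hasReciprocity_mul {e : Eis} (he : ¬ (3 : ℤ) ∣ e.norm) :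
    ∃ u, IsUnit u ∧ IsPrimary (u * e) ∧ HasReciprocity (u * e) := by
  induction e using UniqueFactorizationMonoid.induction_on_prime with
  | h₁ => simp at he
  | h₂ x hx =>
    obtain ⟨y, hy⟩ := hx.exists_left_inv
    refine ⟨y, IsUnit.of_mul_eq_one x hy, ?_⟩
    rw [hy]
    exact ⟨isPrimary_one, hasReciprocity_one⟩
  | h₃ a π ha hπ ih =>
    rw [map_mul] at he
    obtain ⟨u, hu, h1, h2⟩ := ih (fun h => he (h.mul_left _))
    obtain ⟨v, hv, h3, h4⟩ := exists_hasReciprocity_of_prime hπ (fun h => he (h.mul_right _))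
    refine ⟨v * u, hv.mul hu, ?_⟩
    rw [mul_mul_mul_comm]
    exact ⟨h3.mul h1, h4.mul h2⟩

/-- Rational cubic reciprocity: `(e / p)₃ = (p / e)₃` for primary `e` and rational primes `p`. -/
theorem IsPrimary.hasReciprocity {e : Eis} (he : IsPrimary e) : HasReciprocity e := by
  obtain ⟨u, hu, h1, h2⟩ := exists_hasReciprocity_mul he.not_dvd_norm
  rcases he.eq_one_or_neg_one hu h1 with rfl | rfl
  · simpa using h2
  · simpa using h2.neg

end Eis

end RationalReciprocity

section ProductFormula

namespace Eis

/-- The Eisenstein integer `√-3 · k · T`. -/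
def rt (k T : ℤ) : Eis := ⟨k * T, 2 * (k * T)⟩

/-- The integer `k ^ 2 * (k - 3 * T ^ 2)`, which is `rt k T ^ 2 + k ^ 3`. -/
def dsc (k T : ℤ) : ℤ := k ^ 2 * (k - 3 * T ^ 2)

theorem rt_sq (k T : ℤ) : rt k T ^ 2 = ((dsc k T - k ^ 3 : ℤ) : Eis) := by
  ext
  · simp only [sq, rt, dsc, QuadraticAlgebra.re_mul, QuadraticAlgebra.re_intCast, Int.cast_id]
    ring
  · simp only [sq, rt, dsc, QuadraticAlgebra.im_mul, QuadraticAlgebra.im_intCast]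
    ring

theorem star_rt (k T : ℤ) : star (rt k T) = - rt k T := by
  ext
  · simp [rt]; ring
  · simp [rt]

theorem norm_rt_mul_sub (k T c d : ℤ) :
    (rt k T * (d : Eis) - (c : Eis)).norm = (c ^ 2 - dsc k T * d ^ 2) + k ^ 3 * d ^ 2 := by
  rw [norm_eq, dsc]
  simp only [rt, QuadraticAlgebra.re_sub, QuadraticAlgebra.im_sub, QuadraticAlgebra.re_mul,
    QuadraticAlgebra.im_mul, QuadraticAlgebra.re_intCast, QuadraticAlgebra.im_intCast, Int.cast_id]
  ring

theorem isPrimary_rt_mul_sub {k T c : ℤ} (hk : 3 ∣ k) (hc : ¬ (3 : ℤ) ∣ c) (d : ℤ) :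
    IsPrimary (rt k T * (d : Eis) - (c : Eis)) := by
  obtain ⟨j, rfl⟩ := hk
  constructor
  · simp only [rt, QuadraticAlgebra.re_sub, QuadraticAlgebra.re_mul,
      QuadraticAlgebra.re_intCast, QuadraticAlgebra.im_intCast, Int.cast_id]
    intro h
    apply hc
    have := (dvd_mul_right (3 : ℤ) (j * T * d)).sub h
    ring_nf at this ⊢
    exact this
  · simp only [rt, QuadraticAlgebra.im_sub, QuadraticAlgebra.im_mul,
      QuadraticAlgebra.re_intCast, QuadraticAlgebra.im_intCast, Int.cast_id]
    exact ⟨2 * j * T * d, by ring⟩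

theorem isCoprime_of_norm {x : ℤ} {e : Eis} (h : IsCoprime x e.norm) : IsCoprime (x : Eis) e := by
  have h1 := h.map (Int.castRingHom Eis)
  simp only [eq_intCast, ← mul_star_eq] at h1
  exact h1.of_mul_right_left

theorem map_neg_one_of_pow_three {ψ : Eis →* Eis} (h : ψ (-1) ^ 3 = 1) : ψ (-1) = 1 := by
  have h1 : ψ (-1) ^ 2 = 1 := by rw [← map_pow]; simp
  rwa [pow_succ, h1, one_mul] at h

theorem map_prod_primes {e : Eis} {ψ : Eis →* Eis}
    (hψ : ∀ p : ℕ, p.Prime → p ≠ 3 → IsCoprime (p : Eis) e → cubSym p e = ψ p)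
    (M : Multiset ℕ) (hM : ∀ p ∈ M, p.Prime) (h3 : ¬ 3 ∣ M.prod)
    (he : IsCoprime ((M.prod : ℤ) : Eis) e) :
    (M.map fun p => cubSym p e).prod = ψ ((M.prod : ℤ) : Eis) := by
  have h1 : M.map (fun p => cubSym p e) = (M.map (fun p : ℕ => (p : Eis))).map ψ := by
    rw [Multiset.map_map]
    refine Multiset.map_congr rfl fun p hp => ?_
    have hdvd : p ∣ M.prod := Multiset.dvd_prod hp
    refine hψ p (hM p hp) (fun h => h3 (h ▸ hdvd)) ?_
    obtain ⟨j, hj⟩ := hdvd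
    rw [hj] at he
    push_cast at he
    exact he.of_mul_left_left
  have h2 : (M.map (fun p : ℕ => (p : Eis))).prod = ((M.prod : ℤ) : Eis) := by
    rw [Int.cast_natCast]
    exact (map_multiset_prod (Nat.castRingHom Eis) M).symm
  rw [h1, ← map_multiset_prod, h2]

theorem map_natAbs {ψ : Eis →* Eis} (h : ψ (-1) = 1) (n : ℤ) :
    ψ ((n.natAbs : ℤ) : Eis) = ψ (n : Eis) := by
  rcases Int.natAbs_eq n with h1 | h1
  · rw [← h1]
  · have h2 : (n : Eis) = -1 * ((n.natAbs : ℤ) : Eis) := by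
      have h3 := congrArg (Int.cast : ℤ → Eis) h1
      rw [Int.cast_neg] at h3
      rw [h3, neg_one_mul]
    rw [h2, map_mul, h, one_mul]

theorem prod_cubSym_eq_one {k T c d : ℤ} (hk : 3 ∣ k) (hc : IsCoprime c (dsc k T))
    (hcd : IsCoprime c d) (hd : ¬ 3 ∣ d) (M : Multiset ℕ) (hM : ∀ p ∈ M, p.Prime)
    (hMn : M.prod = (c ^ 2 - dsc k T * d ^ 2).natAbs) :
    (M.map fun p => cubSym p (rt k T * (d : Eis) - (c : Eis))).prod = 1 := by
  have hck : IsCoprime c k := by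
    rw [dsc, sq, mul_assoc] at hc
    exact hc.of_mul_right_left
  have hkΔ : (3 : ℤ) ∣ dsc k T := by
    rw [dsc, sq, mul_assoc]; exact hk.mul_right _
  have hc3 : ¬ (3 : ℤ) ∣ c := fun h => Int.prime_three.not_isUnit (hc.isUnit_of_dvd' h hkΔ)
  set e := rt k T * (d : Eis) - (c : Eis) with he
  set n := c ^ 2 - dsc k T * d ^ 2 with hn
  have hnorm : e.norm = n + k ^ 3 * d ^ 2 := norm_rt_mul_sub k T c d
  have hnk : IsCoprime n k := by
    have h1 : n = c ^ 2 + k * (-(k * (k - 3 * T ^ 2) * d ^ 2)) := by rw [hn, dsc]; ring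
    rw [h1]
    exact (hck.pow_left (m := 2)).add_mul_left_left _
  have hnd : IsCoprime n d := by
    have h1 : n = c ^ 2 + d * (-(dsc k T * d)) := by rw [hn]; ring
    rw [h1]
    exact (hcd.pow_left (m := 2)).add_mul_left_left _
  have hne : IsCoprime n e.norm := by
    rw [hnorm]
    have h1 : IsCoprime n (k ^ 3 * d ^ 2) := (hnk.pow_right).mul_right (hnd.pow_right)
    have h2 := h1.add_mul_left_right 1
    rwa [mul_one, add_comm] at h2
  have hke : IsCoprime k e.norm := by
    rw [hnorm]
    have h2 := hnk.symm.add_mul_left_right (k ^ 2 * d ^ 2)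
    have h3 : n + k ^ 3 * d ^ 2 = n + k * (k ^ 2 * d ^ 2) := by ring
    rw [h3]
    exact h2
  have hde : IsCoprime d e.norm := by
    rw [hnorm]
    have h2 := hnd.symm.add_mul_left_right (k ^ 3 * d)
    have h3 : n + k ^ 3 * d ^ 2 = n + d * (k ^ 3 * d) := by ring
    rw [h3]
    exact h2
  have hprim : IsPrimary e := isPrimary_rt_mul_sub hk hc3 d
  obtain ⟨ψ, h1, h2, h3⟩ := hprim.hasReciprocity
  have hneg : ψ (-1) = 1 := map_neg_one_of_pow_three (h1 _ isCoprime_one_left.neg_left)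
  have hn3 : ¬ (3 : ℤ) ∣ n := by
    intro h
    have : (3 : ℤ) ∣ c ^ 2 := by
      have h4 := h.add (hkΔ.mul_right (d ^ 2))
      rwa [hn, sub_add_cancel] at h4
    exact hc3 (Int.prime_three.dvd_of_dvd_pow this)
  have habs : ∀ x : ℤ, IsCoprime x e.norm → IsCoprime ((x.natAbs : ℤ) : Eis) e := fun x hx =>
    isCoprime_of_norm <| by
      rcases Int.natAbs_eq x with h | h
      · rwa [← h]
      · rw [← neg_neg ((x.natAbs : ℕ) : ℤ), ← h]
        exact hx.neg_left
  rw [map_prod_primes h3 M hM (by rw [hMn]; omega) (by rw [hMn]; exact habs n hne), hMn,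
    map_natAbs hneg]
  have hψd : ψ (d : Eis) = 1 := by
    have hd0 : d ≠ 0 := by rintro rfl; simp at hd
    rw [← map_natAbs hneg]
    have hprod : (d.natAbs.primeFactorsList : Multiset ℕ).prod = d.natAbs := by
      rw [Multiset.prod_coe, Nat.prod_primeFactorsList (by simpa using hd0)]
    have h4 := map_prod_primes h3 (d.natAbs.primeFactorsList : Multiset ℕ)
      (fun p hp => Nat.prime_of_mem_primeFactorsList (Multiset.mem_coe.mp hp))
      (by rw [hprod]; omega) (by rw [hprod]; exact habs d hde)
    rw [hprod] at h4
    rw [← h4]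
    apply Multiset.prod_eq_one
    intro z hz
    obtain ⟨p, hp, rfl⟩ := Multiset.mem_map.mp hz
    have hp' : p ∈ d.natAbs.primeFactorsList := Multiset.mem_coe.mp hp
    have hpp := Nat.prime_of_mem_primeFactorsList hp'
    have : Fact p.Prime := ⟨hpp⟩
    have hpd : (p : ℤ) ∣ d := Int.natCast_dvd.mpr (Nat.dvd_of_mem_primeFactorsList hp')
    have hp3 : p ≠ 3 := by rintro rfl; exact hd (by exact_mod_cast hpd)
    have hpc : ¬ (p : ℤ) ∣ -c := by
      rw [dvd_neg]
      exact fun h => (Nat.prime_iff_prime_int.mp hpp).not_isUnit (hcd.isUnit_of_dvd' h hpd)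
    rw [← cubSym_intCast hp3 hpc]
    apply cubSym_congr hp3
    obtain ⟨j, hj⟩ := hpd
    exact ⟨rt k T * (j : Eis), by rw [he, hj]; push_cast; ring⟩
  have h4 : ψ (n : Eis) = ψ ((-1) * (k : Eis) ^ 3 * (d : Eis) ^ 2) := by
    apply h2
    refine ⟨star e, ?_⟩
    rw [mul_star_eq, hnorm]
    push_cast
    ring
  rw [h4, map_mul, map_mul, hneg, one_mul, map_pow, map_pow, hψd, h1 _ (isCoprime_of_norm hke)]
  simp

end Eis

end ProductFormula

section KummerDedekind

open NumberField Polynomial RingOfIntegers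

variable {K : Type*} [Field K] [NumberField K]

theorem adjoin_eq_top_of_minpoly {θ : 𝓞 K} {f : ℤ[X]} (hf : minpoly ℤ θ = f)
    (hdeg : f.natDegree = Module.finrank ℚ K) :
    Algebra.adjoin ℚ {(algebraMap (𝓞 K) K θ)} = ⊤ := by
  have h_int : IsIntegral ℚ (algebraMap (𝓞 K) K θ) := IsIntegral.of_finite ℚ _
  rw [← IntermediateField.adjoin_simple_toSubalgebra_of_isAlgebraic h_int.isAlgebraic,
    (Field.primitive_element_iff_minpoly_natDegree_eq ℚ (algebraMap (𝓞 K) K θ)).mpr]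
  · rfl
  · have h1 : minpoly ℚ (algebraMap (𝓞 K) K θ) = (minpoly ℤ θ).map (algebraMap ℤ ℚ) := by
      rw [← minpoly.algebraMap_eq (B := 𝓞 K) (B' := K) RingOfIntegers.coe_injective]
      exact minpoly.isIntegrallyClosed_eq_field_fractions' ℚ (RingOfIntegers.isIntegral_coe θ)
    rw [h1, hf, natDegree_map_eq_of_injective (algebraMap ℤ ℚ).injective_int, hdeg]

theorem mem_conductor_of_bezout {θ : 𝓞 K} {f A B : ℤ[X]} {D : ℤ} (hf : minpoly ℤ θ = f)
    (hdeg : f.natDegree = Module.finrank ℚ K) (hD : A * f + B * derivative f = C D) :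
    (D : 𝓞 K) ∈ conductor ℤ θ := by
  have h1 : aeval θ (derivative f) ∈ conductor ℤ θ := by
    have h2 := conductor_mul_differentIdeal ℤ ℚ K θ (adjoin_eq_top_of_minpoly hf hdeg)
    rw [hf] at h2
    have h3 : aeval θ (derivative f) ∈ conductor ℤ θ * differentIdeal ℤ (𝓞 K) := by
      rw [h2]; exact Ideal.mem_span_singleton_self _
    exact (Ideal.mul_le_left : conductor ℤ θ * differentIdeal ℤ (𝓞 K) ≤ conductor ℤ θ) h3
  have h4 := congrArg (aeval θ) hD
  rw [map_add, map_mul, map_mul, ← hf, minpoly.aeval, mul_zero, zero_add, aeval_C, hf] at h4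
  have h5 := Ideal.mul_mem_left _ (aeval θ B) h1
  rw [h4] at h5
  simpa using h5

omit [NumberField K] in
theorem not_dvd_exponent_of_mem_conductor {θ : 𝓞 K} {D : ℤ} (hD : (D : 𝓞 K) ∈ conductor ℤ θ)
    {p : ℕ} (hp : p.Prime) (hpD : ¬ (p : ℤ) ∣ D) : ¬ p ∣ exponent θ := by
  have : Fact p.Prime := ⟨hp⟩
  rw [not_dvd_exponent_iff, codisjoint_iff, Ideal.eq_top_iff_one]
  obtain ⟨u, v, huv⟩ :=
    ((Nat.prime_iff_prime_int.mp hp).coprime_iff_not_dvd.mpr hpD)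
  rw [← huv, add_comm]
  refine Ideal.add_mem _ ?_ ?_
  · apply Ideal.mem_sup_left
    apply Ideal.mul_mem_left
    simpa [Ideal.mem_comap] using hD
  · exact Ideal.mem_sup_right (Ideal.mul_mem_left _ _ (Ideal.mem_span_singleton_self _))

omit [NumberField K] in
theorem monicFactorsMod_eq_image {θ : 𝓞 K} {p : ℕ} [Fact p.Prime] (S : Finset ℤ[X])
    (hS : (minpoly ℤ θ).map (Int.castRingHom (ZMod p)) =
      ∏ Q ∈ S, Q.map (Int.castRingHom (ZMod p)))
    (hmon : ∀ Q ∈ S, Q.Monic) (hirr : ∀ Q ∈ S, Irreducible (Q.map (Int.castRingHom (ZMod p)))) :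
    monicFactorsMod θ p = S.image (Polynomial.map (Int.castRingHom (ZMod p))) := by
  have h0 : (minpoly ℤ θ).map (Int.castRingHom (ZMod p)) ≠ 0 :=
    ((minpoly.monic (RingOfIntegers.isIntegral θ)).map _).ne_zero
  ext q
  rw [Multiset.mem_toFinset, Polynomial.mem_normalizedFactors_iff h0, hS, Finset.mem_image]
  constructor
  · rintro ⟨h1, h2, h3⟩
    obtain ⟨Q, hQ, hqQ⟩ := (h1.prime.dvd_finsetProd_iff _).mp h3
    exact ⟨Q, hQ, (eq_of_monic_of_associated h2 ((hmon Q hQ).map _)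
      (h1.associated_of_dvd (hirr Q hQ) hqQ)).symm⟩
  · rintro ⟨Q, hQ, rfl⟩
    exact ⟨hirr Q hQ, (hmon Q hQ).map _, Finset.dvd_prod_of_mem _ hQ⟩

/-- The ideal attached by Kummer–Dedekind to a lift `Q` of a factor of the minimal polynomial. -/
def factorIdeal (θ : 𝓞 K) (p : ℕ) (Q : ℤ[X]) : Ideal (𝓞 K) := Ideal.span {(p : 𝓞 K), aeval θ Q}

theorem primesAbove_eq_image {θ : 𝓞 K} {p : ℕ} (hp : p.Prime) (hexp : ¬ p ∣ exponent θ)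
    (S : Finset ℤ[X])
    (hS : (minpoly ℤ θ).map (Int.castRingHom (ZMod p)) =
      ∏ Q ∈ S, Q.map (Int.castRingHom (ZMod p)))
    (hmon : ∀ Q ∈ S, Q.Monic) (hirr : ∀ Q ∈ S, Irreducible (Q.map (Int.castRingHom (ZMod p))))
    (hinj : Set.InjOn (Polynomial.map (Int.castRingHom (ZMod p))) S) :
    primesAbove K p = S.image (factorIdeal θ p) ∧ Set.InjOn (factorIdeal θ p) S ∧
      ∀ Q ∈ S, Ideal.absNorm (factorIdeal θ p Q) = p ^ Q.natDegree := by
  have : Fact p.Prime := ⟨hp⟩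
  have hfac := monicFactorsMod_eq_image S hS hmon hirr
  have hmem : ∀ Q ∈ S, Q.map (Int.castRingHom (ZMod p)) ∈ monicFactorsMod θ p := fun Q hQ => by
    rw [hfac]; exact Finset.mem_image_of_mem _ hQ
  have heq : ∀ (Q : ℤ[X]) (hQ : Q ∈ S), ((Ideal.primesOverSpanEquivMonicFactorsMod hexp).symm
      ⟨Q.map (Int.castRingHom (ZMod p)), hmem Q hQ⟩ : Ideal (𝓞 K)) = factorIdeal θ p Q :=
    fun Q hQ => Ideal.primesOverSpanEquivMonicFactorsMod_symm_apply_eq_span hexp (hmem Q hQ)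
  refine ⟨?_, ?_, ?_⟩
  · ext P
    rw [mem_primesAbove hp, Finset.mem_image]
    constructor
    · intro hP
      have h1 := ((Ideal.primesOverSpanEquivMonicFactorsMod hexp) ⟨P, hP⟩).2
      obtain ⟨Q, hQ, hQe⟩ := Finset.mem_image.mp ((Finset.ext_iff.mp hfac _).mp h1)
      refine ⟨Q, hQ, ?_⟩
      rw [← heq Q hQ]
      have h2 : (⟨Q.map (Int.castRingHom (ZMod p)), hmem Q hQ⟩ : monicFactorsMod θ p) =
          (Ideal.primesOverSpanEquivMonicFactorsMod hexp) ⟨P, hP⟩ := Subtype.ext hQe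
      rw [h2, Equiv.symm_apply_apply]
    · rintro ⟨Q, hQ, rfl⟩
      rw [← heq Q hQ]
      exact ((Ideal.primesOverSpanEquivMonicFactorsMod hexp).symm _).2
  · intro Q hQ Q' hQ' h
    rw [← heq Q hQ, ← heq Q' hQ'] at h
    exact hinj hQ hQ' (congrArg Subtype.val
      ((Ideal.primesOverSpanEquivMonicFactorsMod hexp).symm.injective (Subtype.ext h)))
  · intro Q hQ
    have h1 := Ideal.inertiaDeg_primesOverSpanEquivMonicFactorsMod_symm_apply hexp (hmem Q hQ)
    have h2 := ((Ideal.primesOverSpanEquivMonicFactorsMod hexp).symm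
      ⟨Q.map (Int.castRingHom (ZMod p)), hmem Q hQ⟩).2
    rw [heq Q hQ] at h1 h2
    have := h2.1
    have := h2.2
    have h3 := Ideal.natAbs_pow_inertiaDeg (p : ℤ) (factorIdeal θ p Q)
    rw [← h3, h1, (hmon Q hQ).natDegree_map, Int.natAbs_natCast]

end KummerDedekind

section QuadraticField

open NumberField Polynomial RingOfIntegers

theorem irreducible_X_sq_sub_C {R : Type*} [CommRing R] [IsDomain R] {a : R}
    (ha : ∀ t : R, t ^ 2 ≠ a) : Irreducible (X ^ 2 - C a : R[X]) := by
  have hm : (X ^ 2 - C a : R[X]).Monic := monic_X_pow_sub_C a two_ne_zero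
  rw [hm.irreducible_iff_roots_eq_zero_of_degree_le_three (by rw [natDegree_X_pow_sub_C])
    (by rw [natDegree_X_pow_sub_C]; norm_num)]
  refine Multiset.eq_zero_of_forall_notMem fun t ht => ha t ?_
  have h := isRoot_of_mem_roots ht
  simpa [sub_eq_zero] using h

/-- The field `F` is quadratic and generated by a square root `δ` of the nonsquare integer `Δ`. -/
structure IsSqrtGen {F : Type*} [Field F] [NumberField F] (Δ : ℤ) (δ : 𝓞 F) : Prop where
  sq : δ ^ 2 = (Δ : 𝓞 F)
  nonsq : ∀ t : ℤ, t ^ 2 ≠ Δ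
  finrank : Module.finrank ℚ F = 2

namespace IsSqrtGen

variable {F : Type} [Field F] [NumberField F] {Δ : ℤ} {δ : 𝓞 F}

theorem minpoly_eq (h : IsSqrtGen Δ δ) : minpoly ℤ δ = X ^ 2 - C Δ := by
  have hm : (X ^ 2 - C Δ : ℤ[X]).Monic := monic_X_pow_sub_C Δ two_ne_zero
  have h1 : minpoly ℤ δ ∣ X ^ 2 - C Δ :=
    minpoly.isIntegrallyClosed_dvd (RingOfIntegers.isIntegral δ) (by simp [h.sq])
  exact eq_of_monic_of_associated (minpoly.monic (RingOfIntegers.isIntegral δ)) hm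
    ((minpoly.irreducible (RingOfIntegers.isIntegral δ)).associated_of_dvd
      (irreducible_X_sq_sub_C h.nonsq) h1)

theorem mem_conductor (h : IsSqrtGen Δ δ) : ((4 * Δ : ℤ) : 𝓞 F) ∈ conductor ℤ δ := by
  refine mem_conductor_of_bezout (A := C (-4)) (B := C 2 * X) h.minpoly_eq ?_ ?_
  · rw [natDegree_X_pow_sub_C, h.finrank]
  · simp only [derivative_sub, derivative_X_pow, derivative_C, map_mul, map_neg]
    simp
    ring

theorem exists_eq_add_mul (h : IsSqrtGen Δ δ) (y : 𝓞 F) :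
    ∃ c d : ℤ, ((4 * Δ : ℤ) : 𝓞 F) * y = (c : 𝓞 F) + (d : 𝓞 F) * δ := by
  have h1 := mem_conductor_iff.mp h.mem_conductor y
  refine Algebra.adjoin_induction (p := fun x _ => ∃ c d : ℤ, x = (c : 𝓞 F) + (d : 𝓞 F) * δ)
    ?_ ?_ ?_ ?_ h1
  · rintro x rfl
    exact ⟨0, 1, by simp⟩
  · intro r
    exact ⟨r, 0, by simp⟩
  · rintro _ _ _ _ ⟨c, d, rfl⟩ ⟨c', d', rfl⟩
    exact ⟨c + c', d + d', by push_cast; ring⟩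
  · rintro _ _ _ _ ⟨c, d, rfl⟩ ⟨c', d', rfl⟩
    refine ⟨c * c' + d * d' * Δ, c * d' + d * c', ?_⟩
    push_cast
    rw [← h.sq]
    ring

theorem absNorm_span (h : IsSqrtGen Δ δ) (c d : ℤ) :
    Ideal.absNorm (Ideal.span {(c : 𝓞 F) + (d : 𝓞 F) * δ}) = (c ^ 2 - Δ * d ^ 2).natAbs := by
  have hq : Algebra.IsQuadraticExtension ℚ F := { finrank_eq_two' := h.finrank }
  have hsq : (δ : F) ^ 2 = (Δ : F) := by
    have := congrArg (algebraMap (𝓞 F) F) h.sq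
    simpa using this
  have hirr : Irreducible (X ^ 2 - C (Δ : ℚ) : ℚ[X]) := by
    have h1 := h.minpoly_eq ▸ minpoly.irreducible (RingOfIntegers.isIntegral δ)
    have h2 := ((monic_X_pow_sub_C Δ two_ne_zero).irreducible_iff_irreducible_map_fraction_map
      (K := ℚ)).mp h1
    simpa using h2
  have hmin : minpoly ℚ (δ : F) = X ^ 2 - C (Δ : ℚ) :=
    (minpoly.eq_of_irreducible_of_monic hirr (by simp [hsq])
      (monic_X_pow_sub_C _ two_ne_zero)).symm
  obtain ⟨σ, hσ⟩ := minpoly.exists_algEquiv_of_root' (K := ℚ) (x := -(δ : F)) (y := (δ : F))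
    (Algebra.IsAlgebraic.isAlgebraic _) (by rw [hmin]; simp [hsq])
  have h1 : Algebra.norm ℤ ((c : 𝓞 F) + (d : 𝓞 F) * δ) ^ 2 = (c ^ 2 - Δ * d ^ 2) ^ 2 := by
    have h2 : ((Algebra.norm ℤ ((c : 𝓞 F) + (d : 𝓞 F) * δ) : ℤ) : ℚ) =
        Algebra.norm ℚ ((c : F) + (d : F) * δ) := by
      rw [Algebra.coe_norm_int]
      congr 1
    have h3 : Algebra.norm ℚ ((c : F) - (d : F) * δ) = Algebra.norm ℚ ((c : F) + (d : F) * δ) := by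
      rw [← Algebra.norm_eq_of_algEquiv σ ((c : F) + (d : F) * δ)]
      simp [hσ, sub_eq_add_neg]
    have h4 : Algebra.norm ℚ (((c : F) + (d : F) * δ) * ((c : F) - (d : F) * δ)) =
        ((c : ℚ) ^ 2 - Δ * d ^ 2) ^ 2 := by
      have h5 : ((c : F) + (d : F) * δ) * ((c : F) - (d : F) * δ) =
          algebraMap ℚ F ((c : ℚ) ^ 2 - Δ * d ^ 2) := by
        simp
        rw [← hsq]
        ring
      rw [h5, Algebra.norm_algebraMap, h.finrank]
    rw [map_mul, h3, ← h2] at h4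
    have : ((Algebra.norm ℤ ((c : 𝓞 F) + (d : 𝓞 F) * δ) ^ 2 : ℤ) : ℚ) =
      (((c ^ 2 - Δ * d ^ 2) ^ 2 : ℤ) : ℚ) := by
      push_cast
      rw [← h4]; ring
    exact_mod_cast this
  rw [Ideal.absNorm_span_singleton]
  exact Int.natAbs_eq_iff_sq_eq.mpr h1

theorem not_dvd_exponent (h : IsSqrtGen Δ δ) (h2 : 2 ∣ Δ) {p : ℕ} (hp : p.Prime)
    (hpΔ : ¬ (p : ℤ) ∣ Δ) : ¬ p ∣ exponent δ := by
  refine not_dvd_exponent_of_mem_conductor h.mem_conductor hp fun h4 => hpΔ ?_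
  rcases (Nat.prime_iff_prime_int.mp hp).dvd_or_dvd h4 with h5 | h5
  · have h6 : (p : ℤ) ∣ 2 ^ 2 := h5
    exact ((Nat.prime_iff_prime_int.mp hp).dvd_of_dvd_pow h6).trans h2
  · exact h5

theorem primesAbove_of_sq (h : IsSqrtGen Δ δ) (h2 : 2 ∣ Δ) {p : ℕ} (hp : p.Prime)
    (hpΔ : ¬ (p : ℤ) ∣ Δ) {t : ℤ} (ht : (p : ℤ) ∣ t ^ 2 - Δ) :
    primesAbove F p = {Ideal.span {(p : 𝓞 F), δ - (t : 𝓞 F)},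
      Ideal.span {(p : 𝓞 F), δ - ((-t : ℤ) : 𝓞 F)}} ∧
      Ideal.span {(p : 𝓞 F), δ - (t : 𝓞 F)} ≠ Ideal.span {(p : 𝓞 F), δ - ((-t : ℤ) : 𝓞 F)} ∧
      Ideal.absNorm (Ideal.span {(p : 𝓞 F), δ - (t : 𝓞 F)}) = p ∧
      Ideal.absNorm (Ideal.span {(p : 𝓞 F), δ - ((-t : ℤ) : 𝓞 F)}) = p := by
  have : Fact p.Prime := ⟨hp⟩
  have hpi := Nat.prime_iff_prime_int.mp hp
  have hp2 : ¬ (p : ℤ) ∣ 2 := fun h3 => hpΔ (h3.trans h2)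
  have hpt : ¬ (p : ℤ) ∣ t := fun h3 => hpΔ (by
    have := (h3.mul_left t).sub ht
    rwa [pow_two, sub_sub_cancel] at this)
  have hne : ((t : ℤ) : ZMod p) ≠ ((-t : ℤ) : ZMod p) := by
    intro h3
    rw [← sub_eq_zero, ← Int.cast_sub, ZMod.intCast_zmod_eq_zero_iff_dvd] at h3
    have h4 : t - -t = 2 * t := by ring
    rw [h4] at h3
    exact (hpi.dvd_or_dvd h3).elim hp2 hpt
  have hmap : ∀ u : ℤ, (X - C u : ℤ[X]).map (Int.castRingHom (ZMod p)) = X - C (u : ZMod p) := by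
    intro u; simp
  have hmapne : (X - C t : ℤ[X]).map (Int.castRingHom (ZMod p)) ≠
      (X - C (-t) : ℤ[X]).map (Int.castRingHom (ZMod p)) := by
    rw [hmap, hmap]
    intro h3
    exact hne (C_injective (sub_right_injective h3))
  have hXne : (X - C t : ℤ[X]) ≠ X - C (-t) := fun h3 => hmapne (congrArg _ h3)
  have hΔt : ((Δ : ℤ) : ZMod p) = (t : ZMod p) ^ 2 := by
    have h3 := (ZMod.intCast_zmod_eq_zero_iff_dvd _ p).mpr ht
    push_cast at h3
    exact (sub_eq_zero.mp h3).symm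
  obtain ⟨h3, h4, h5⟩ := primesAbove_eq_image (θ := δ) hp (h.not_dvd_exponent h2 hp hpΔ)
    {X - C t, X - C (-t)}
    (by
      rw [h.minpoly_eq, Finset.prod_pair hXne, hmap, hmap]
      have h6 : (X ^ 2 - C Δ : ℤ[X]).map (Int.castRingHom (ZMod p)) = X ^ 2 - C (Δ : ZMod p) := by
        simp
      rw [h6, hΔt, Int.cast_neg, C_neg, C_pow]
      ring)
    (by
      intro Q hQ
      rw [Finset.mem_insert, Finset.mem_singleton] at hQ
      rcases hQ with rfl | rfl <;> exact monic_X_sub_C _)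
    (by
      intro Q hQ
      rw [Finset.mem_insert, Finset.mem_singleton] at hQ
      rcases hQ with rfl | rfl <;> rw [hmap] <;> exact irreducible_X_sub_C _)
    (by
      rw [Finset.coe_pair, Set.injOn_pair]
      exact fun h3 => absurd h3 hmapne)
  have hfac : ∀ u : ℤ, factorIdeal δ p (X - C u) = Ideal.span {(p : 𝓞 F), δ - (u : 𝓞 F)} := by
    intro u; simp [factorIdeal]
  rw [← hfac, ← hfac]
  refine ⟨by rw [h3, Finset.image_insert, Finset.image_singleton], ?_, ?_, ?_⟩
  · intro h6
    exact hXne (h4 (by simp) (by simp) h6)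
  · rw [h5 _ (by simp), natDegree_X_sub_C, pow_one]
  · rw [h5 _ (by simp), natDegree_X_sub_C, pow_one]

theorem primesAbove_of_not_sq (h : IsSqrtGen Δ δ) (h2 : 2 ∣ Δ) {p : ℕ} (hp : p.Prime)
    (hpΔ : ¬ (p : ℤ) ∣ Δ) (ht : ∀ t : ℤ, ¬ (p : ℤ) ∣ t ^ 2 - Δ) :
    primesAbove F p = {Ideal.span {(p : 𝓞 F)}} ∧
      Ideal.absNorm (Ideal.span {(p : 𝓞 F)}) = p ^ 2 := by
  have : Fact p.Prime := ⟨hp⟩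
  have hmap : (X ^ 2 - C Δ : ℤ[X]).map (Int.castRingHom (ZMod p)) = X ^ 2 - C (Δ : ZMod p) := by
    simp
  obtain ⟨h3, h4, h5⟩ := primesAbove_eq_image (θ := δ) hp (h.not_dvd_exponent h2 hp hpΔ)
    {X ^ 2 - C Δ}
    (by rw [h.minpoly_eq, Finset.prod_singleton])
    (by
      intro Q hQ
      rw [Finset.mem_singleton] at hQ
      rw [hQ]
      exact monic_X_pow_sub_C _ two_ne_zero)
    (by
      intro Q hQ
      rw [Finset.mem_singleton] at hQ
      rw [hQ, hmap]
      refine irreducible_X_sq_sub_C fun u hu => ?_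
      obtain ⟨t, rfl⟩ := ZMod.intCast_surjective u
      apply ht t
      rw [← ZMod.intCast_zmod_eq_zero_iff_dvd]
      push_cast
      rw [hu, sub_self])
    (by rw [Finset.coe_singleton]; exact Set.injOn_singleton _ _)
  have hfac : factorIdeal δ p (X ^ 2 - C Δ) = Ideal.span {(p : 𝓞 F)} := by
    simp [factorIdeal, h.sq, Ideal.span_insert]
  rw [← hfac]
  refine ⟨by rw [h3, Finset.image_singleton], ?_⟩
  rw [h5 _ (by simp), natDegree_X_pow_sub_C]

end IsSqrtGen

theorem exists_isSqrtGen {Δ : ℤ} (hΔ : ∀ t : ℤ, t ^ 2 ≠ Δ) :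
    ∃ (F : Type) (_ : Field F) (_ : NumberField F) (δ : 𝓞 F), IsSqrtGen Δ δ := by
  obtain ⟨z, hz⟩ := IsAlgClosed.exists_pow_nat_eq (Δ : ℂ) two_pos
  have hirr : Irreducible (X ^ 2 - C (Δ : ℚ) : ℚ[X]) := by
    have h2 := ((monic_X_pow_sub_C Δ two_ne_zero).irreducible_iff_irreducible_map_fraction_map
      (K := ℚ)).mp (irreducible_X_sq_sub_C hΔ)
    simpa using h2
  have hmin : minpoly ℚ z = X ^ 2 - C (Δ : ℚ) :=
    (minpoly.eq_of_irreducible_of_monic hirr (by simp [hz])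
      (monic_X_pow_sub_C _ two_ne_zero)).symm
  have h_int : IsIntegral ℚ z := ⟨X ^ 2 - C (Δ : ℚ), monic_X_pow_sub_C _ two_ne_zero, by
    simp only [eval₂_sub, eval₂_pow, eval₂_X, eval₂_C]; simp [hz]⟩
  have hfr := IntermediateField.adjoin.finrank h_int
  rw [hmin, natDegree_X_pow_sub_C] at hfr
  have hfin : FiniteDimensional ℚ (IntermediateField.adjoin ℚ {z}) :=
    IntermediateField.adjoin.finiteDimensional h_int
  have hnf : NumberField (IntermediateField.adjoin ℚ {z}) := { to_finiteDimensional := hfin }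
  have hg : (IntermediateField.AdjoinSimple.gen ℚ z) ^ 2 =
      ((Δ : ℤ) : IntermediateField.adjoin ℚ {z}) := by
    apply Subtype.ext
    push_cast
    simpa using hz
  refine ⟨IntermediateField.adjoin ℚ {z}, inferInstance, hnf,
    ⟨IntermediateField.AdjoinSimple.gen ℚ z, ⟨X ^ 2 - C Δ, monic_X_pow_sub_C _ two_ne_zero, ?_⟩⟩,
    ?_, hΔ, ?_⟩
  · simp only [eval₂_sub, eval₂_pow, eval₂_X, eval₂_C]; simp [hg]
  · apply RingOfIntegers.ext
    simp only [map_intCast]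
    exact hg
  · exact hfr

end QuadraticField

section PrimeHom

open NumberField IsDedekindDomain UniqueFactorizationMonoid
open scoped nonZeroDivisors

variable {F : Type*} [Field F] [NumberField F]

/-- The completely multiplicative function on ideals with prescribed values at the primes. -/
def primeHom (g : Ideal (𝓞 F) → ℂ) : Ideal (𝓞 F) →* ℂ where
  toFun I := if I = ⊥ then 0 else ((normalizedFactors I).map g).prod
  map_one' := by
    rw [if_neg (by rw [Ideal.one_eq_top]; exact top_ne_bot), normalizedFactors_one]
    simp
  map_mul' I J := by
    by_cases hI : I = ⊥
    · simp [hI]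
    by_cases hJ : J = ⊥
    · simp [hJ]
    have hIJ : I * J ≠ ⊥ := mul_ne_zero hI hJ
    rw [if_neg hIJ, if_neg hI, if_neg hJ, normalizedFactors_mul hI hJ,
      Multiset.map_add, Multiset.prod_add]

theorem primeHom_bot (g : Ideal (𝓞 F) → ℂ) : primeHom g ⊥ = 0 := if_pos rfl

theorem primeHom_apply (g : Ideal (𝓞 F) → ℂ) {I : Ideal (𝓞 F)} (hI : I ≠ ⊥) :
    primeHom g I = ((normalizedFactors I).map g).prod := if_neg hI

theorem primeHom_prime (g : Ideal (𝓞 F) → ℂ) {P : Ideal (𝓞 F)} (hP : P.IsPrime) (h0 : P ≠ ⊥) :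
    primeHom g P = g P := by
  rw [primeHom_apply g h0,
    normalizedFactors_irreducible ((Ideal.prime_iff_isPrime h0).mpr hP).irreducible]
  simp

theorem norm_primeHom_le {g : Ideal (𝓞 F) → ℂ} (hg : ∀ P : Ideal (𝓞 F), P.IsPrime → P ≠ ⊥ → ‖g P‖ ≤ 1)
    (I : Ideal (𝓞 F)) : ‖primeHom g I‖ ≤ 1 := by
  by_cases hI : I = ⊥
  · rw [hI, primeHom_bot]; simp
  rw [primeHom_apply g hI]
  have h : ∀ P ∈ normalizedFactors I, ‖g P‖ ≤ 1 := fun P hP =>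
    hg P ((Ideal.mem_normalizedFactors_iff hI).mp hP).1
      (irreducible_of_normalized_factor P hP).ne_zero
  generalize normalizedFactors I = M at h
  induction M using Multiset.induction_on with
  | empty => simp
  | cons P M ih =>
    rw [Multiset.map_cons, Multiset.prod_cons, norm_mul]
    exact mul_le_one₀ (h P (by simp)) (norm_nonneg _)
      (ih fun Q hQ => h Q (Multiset.mem_cons_of_mem hQ))

theorem primeHom_ne_zero_iff (g : Ideal (𝓞 F) → ℂ) {m : 𝓞 F} (hm0 : m ≠ 0) (hm1 : ¬ IsUnit m)
    (hg : ∀ P : Ideal (𝓞 F), P.IsPrime → P ≠ ⊥ → (g P = 0 ↔ m ∈ P)) (I : Ideal (𝓞 F)) :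
    primeHom g I ≠ 0 ↔ I ⊔ Ideal.span {m} = ⊤ := by
  by_cases hI : I = ⊥
  · simp [hI, primeHom_bot, Ideal.span_singleton_eq_top, hm1]
  rw [primeHom_apply g hI, Ne, Multiset.prod_eq_zero_iff, Multiset.mem_map]
  constructor
  · intro h
    by_contra hne
    obtain ⟨P, hP, hle⟩ := Ideal.exists_le_maximal _ hne
    have hmP : m ∈ P := (le_sup_right.trans hle) (Ideal.mem_span_singleton_self m)
    have hP0 : P ≠ ⊥ := by
      rintro rfl
      exact hm0 (by simpa using hmP)
    exact h ⟨P, (Ideal.mem_normalizedFactors_iff hI).mpr ⟨hP.isPrime, le_sup_left.trans hle⟩,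
      (hg P hP.isPrime hP0).mpr hmP⟩
  · rintro h ⟨P, hP, hP0⟩
    obtain ⟨h1, h2⟩ := (Ideal.mem_normalizedFactors_iff hI).mp hP
    have hmP := (hg P h1 (irreducible_of_normalized_factor P hP).ne_zero).mp hP0
    apply h1.ne_top
    rw [eq_top_iff, ← h]
    exact sup_le h2 ((Ideal.span_singleton_le_iff_mem P).mpr hmP)

theorem differentiableAt_archGamma {s : ℂ} (hs : 0 < s.re) :
    DifferentiableAt ℂ (archGamma F) s := by
  unfold archGamma
  refine DifferentiableAt.const_mul (DifferentiableAt.fun_finsetProd fun w _ =>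
    DifferentiableAt.mul ?_ ?_) _
  · have hw : (0 : ℝ) < w.mult := by exact_mod_cast w.mult_pos
    have hre : 0 < ((w.mult : ℂ) * s / 2).re := by
      have : ((w.mult : ℂ) * s / 2).re = w.mult * s.re / 2 := by
        simp
      rw [this]
      positivity
    refine DifferentiableAt.comp s (g := Complex.Gamma) (differentiableAt_Gamma _ fun n h => ?_)
      (by fun_prop)
    rw [h] at hre
    simp at hre
    linarith [n.cast_nonneg (α := ℝ)]
  · refine DifferentiableAt.const_cpow (by fun_prop) (Or.inl ?_)
    have hw : (0 : ℝ) < w.mult := by exact_mod_cast w.mult_pos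
    have : (0 : ℝ) < w.mult * Real.pi := mul_pos hw Real.pi_pos
    exact_mod_cast this.ne'

/-- The Dirichlet series of a ray class character, together with its continuation to `0 < re s`
up to a possible simple pole at `s = 1`, and its Euler product. -/
theorem exists_dirichlet_of_rayClassCharacter {χ : Ideal (𝓞 F) →* ℂ} {m : ℕ} (hm : m ≠ 0)
    (hχ : ∀ I, ‖χ I‖ ≤ 1)
    (hbot : χ ⊥ = 0) (h1 : ∀ I, χ I ≠ 0 ↔ I ⊔ Ideal.span {(m : 𝓞 F)} = ⊤)
    (h2 : ∀ x : 𝓞 F, (m : 𝓞 F) ∣ x - 1 → χ (Ideal.span {x}) = 1) :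
    ∃ D₀ D : ℂ → ℂ, (∀ s : ℂ, 0 < s.re → DifferentiableAt ℂ D₀ s) ∧
      (∀ s : ℂ, 1 < s.re → D s ≠ 0 ∧ D₀ s = (1 - s) * D s) ∧
      ∀ s : ℂ, 1 < s.re → HasProd (fun p : Nat.Primes =>
        ∏ P ∈ primesAbove F p, (1 - χ P * (Ideal.absNorm P : ℂ) ^ (-s))) (D s)⁻¹ := by
  obtain ⟨W, hW, hWs⟩ := exists_entire_of_rayClassCharacter hm hχ hbot h1 h2
  refine ⟨fun s => W s / (archGamma F s * s), fun s => ∑' I : (Ideal (𝓞 F))⁰,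
    χ (I : Ideal (𝓞 F)) * (Ideal.absNorm (I : Ideal (𝓞 F)) : ℂ) ^ (-s), fun s hs => ?_,
    fun s hs => ⟨(eulerProduct_normTwist hχ hs).1, ?_⟩, fun s hs => (eulerProduct_normTwist hχ hs).2⟩
  · have hs0 : s ≠ 0 := by rintro rfl; simp at hs
    exact hW.differentiableAt.div ((differentiableAt_archGamma hs).mul differentiableAt_id)
      (mul_ne_zero (archGamma_ne_zero hs) hs0)
  · have hs0 : s ≠ 0 := by rintro rfl; simp at hs; linarith
    have hg : archGamma F s ≠ 0 := archGamma_ne_zero (by linarith)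
    have h3 := (hWs s hs).tsum_eq
    rw [tsum_mul_left] at h3
    simp only
    rw [← h3]
    field_simp

theorem intCast_mem_iff_of_mem_primesAbove {p : ℕ} (hp : p.Prime) {P : Ideal (𝓞 F)}
    (hP : P ∈ primesAbove F p) (n : ℤ) : (n : 𝓞 F) ∈ P ↔ (p : ℤ) ∣ n := by
  obtain ⟨-, ⟨h⟩⟩ := (mem_primesAbove hp).mp hP
  have h1 : n ∈ P.under ℤ ↔ n ∈ intSpan p := by rw [← h]
  rw [intSpan, Ideal.mem_span_singleton] at h1
  rw [← h1, Ideal.mem_comap]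
  simp

theorem exists_mem_primesAbove {P : Ideal (𝓞 F)} (hP : P.IsPrime) (h0 : P ≠ ⊥) :
    ∃ p : ℕ, p.Prime ∧ P ∈ primesAbove F p := by
  obtain ⟨p, h⟩ := exists_prime_mem_primesAbove (K := F) ⟨P, hP, h0⟩
  exact ⟨p, p.2, h⟩

theorem isPrime_of_mem_primesAbove {p : ℕ} (hp : p.Prime) {P : Ideal (𝓞 F)}
    (hP : P ∈ primesAbove F p) : P.IsPrime := ((mem_primesAbove hp).mp hP).1

end PrimeHom

section QuadraticCharacter

open NumberField IsDedekindDomain UniqueFactorizationMonoid Eis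
open scoped nonZeroDivisors

/-- The Euler product data attached to the parameters `k, T`: a Dirichlet series whose local factors
at the primes not dividing `Δ = dsc k T` are governed by the splitting of `X ^ 2 - Δ` and by the
cubic symbol of `rt k T + √Δ`. -/
def HasCubicFactors (k T : ℤ) : Prop :=
  ∃ (D₀ D : ℂ → ℂ) (n : ℕ) (E : Nat.Primes → ℂ → ℂ),
    (∀ s : ℂ, 0 < s.re → DifferentiableAt ℂ D₀ s) ∧
    (∀ s : ℂ, 1 < s.re → D s ≠ 0 ∧ D₀ s = (1 - s) ^ n * D s) ∧
    (∀ s : ℂ, 1 < s.re → HasProd (fun p => E p s) (D s)⁻¹) ∧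
    ∀ p : Nat.Primes, ∀ s : ℂ, 1 < s.re →
      ((((p : ℕ) : ℤ) ∣ dsc k T → E p s = 1) ∧
      (¬ ((p : ℕ) : ℤ) ∣ dsc k T → (∀ t : ℤ, ¬ ((p : ℕ) : ℤ) ∣ t ^ 2 - dsc k T) →
        E p s = 1 - (((p : ℕ) : ℂ) ^ (-s)) ^ 2) ∧
      ∀ t : ℤ, ¬ ((p : ℕ) : ℤ) ∣ dsc k T → ((p : ℕ) : ℤ) ∣ t ^ 2 - dsc k T →
        E p s = if cubSym p (rt k T + (t : Eis)) = 1 then (1 - ((p : ℕ) : ℂ) ^ (-s)) ^ 2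
          else 1 + ((p : ℕ) : ℂ) ^ (-s) + (((p : ℕ) : ℂ) ^ (-s)) ^ 2)

theorem not_dvd_of_not_dvd_dsc {k T : ℤ} {p : ℕ} (h : ¬ (p : ℤ) ∣ dsc k T) : ¬ (p : ℤ) ∣ k :=
  fun h1 => h (by rw [dsc, pow_two, mul_assoc]; exact h1.mul_right _)

theorem ne_three_of_not_dvd_dsc {k T : ℤ} (hk3 : 3 ∣ k) {p : ℕ} (h : ¬ (p : ℤ) ∣ dsc k T) :
    p ≠ 3 := by
  rintro rfl
  exact not_dvd_of_not_dvd_dsc h hk3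

theorem not_dvd_norm_rt_add {k T t : ℤ} {p : ℕ} (hp : p.Prime) (h : ¬ (p : ℤ) ∣ dsc k T)
    (ht : (p : ℤ) ∣ t ^ 2 - dsc k T) : ¬ (p : ℤ) ∣ (rt k T + (t : Eis)).norm := by
  intro h1
  have h2 : rt k T + (t : Eis) = rt k T * ((1 : ℤ) : Eis) - ((-t : ℤ) : Eis) := by push_cast; ring
  rw [h2, norm_rt_mul_sub] at h1
  have h3 : (p : ℤ) ∣ k ^ 3 := by
    have := h1.sub ht
    have h4 : (-t) ^ 2 - dsc k T * 1 ^ 2 + k ^ 3 * 1 ^ 2 - (t ^ 2 - dsc k T) = k ^ 3 := by ring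
    rwa [h4] at this
  exact not_dvd_of_not_dvd_dsc h ((Nat.prime_iff_prime_int.mp hp).dvd_of_dvd_pow h3)

theorem cubSym_rt_mul_cubSym_rt {k T t : ℤ} (hk3 : 3 ∣ k) {p : ℕ} (hp : p.Prime)
    (h : ¬ (p : ℤ) ∣ dsc k T) (ht : (p : ℤ) ∣ t ^ 2 - dsc k T) :
    cubSym p (rt k T + (t : Eis)) * cubSym p (rt k T + ((-t : ℤ) : Eis)) = 1 := by
  have : Fact p.Prime := ⟨hp⟩
  have hp3 := ne_three_of_not_dvd_dsc hk3 h
  have h1 : ¬ (p : ℤ) ∣ -k ^ 3 := by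
    rw [dvd_neg]
    exact fun h2 => not_dvd_of_not_dvd_dsc h ((Nat.prime_iff_prime_int.mp hp).dvd_of_dvd_pow h2)
  rw [← cubSym_mul hp3, ← cubSym_intCast hp3 h1]
  apply cubSym_congr hp3
  obtain ⟨u, hu⟩ := ht
  refine ⟨((-u : ℤ) : Eis), ?_⟩
  have h2 : (rt k T + (t : Eis)) * (rt k T + ((-t : ℤ) : Eis)) - ((-k ^ 3 : ℤ) : Eis) =
      rt k T ^ 2 - ((t ^ 2 - k ^ 3 : ℤ) : Eis) := by
    push_cast; ring
  rw [h2, rt_sq, ← Int.cast_sub]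
  have h3 : dsc k T - k ^ 3 - (t ^ 2 - k ^ 3) = p * -u := by linarith
  rw [h3]
  push_cast
  ring

theorem map_sq_add_map_add_one (ι : Eis →+* ℂ) {z : Eis} (hz : z ^ 3 = 1) (hz1 : z ≠ 1) :
    ι z ^ 2 + ι z + 1 = 0 := by
  have h : z ^ 2 + z + 1 = 0 := by
    rcases pow_three_eq_one_iff.mp hz with h | h | h
    · exact absurd h hz1
    · rw [h, w_sq]; ring
    · have h4 : z ^ 2 = w := by
        rw [h, ← pow_mul, show 2 * 2 = 3 + 1 from rfl, pow_add, w_cube, one_mul, pow_one]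
      rw [h4, h, w_sq]; ring
  rw [← map_pow, ← map_add, ← map_one ι, ← map_add, h, map_zero]

theorem norm_map_of_pow_three (ι : Eis →+* ℂ) {z : Eis} (hz : z ^ 3 = 1) : ‖ι z‖ = 1 := by
  have h : ‖ι z‖ ^ 3 = 1 := by rw [← norm_pow, ← map_pow, hz, map_one, norm_one]
  exact (pow_eq_one_iff_of_nonneg (_root_.norm_nonneg _) three_ne_zero).mp h

theorem one_sub_mul_one_sub (ι : Eis →+* ℂ) {z z' : Eis} (hz : z ^ 3 = 1) (hzz : z * z' = 1) (x : ℂ) :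
    (1 - ι z * x) * (1 - ι z' * x) = if z = 1 then (1 - x) ^ 2 else 1 + x + x ^ 2 := by
  have hz' : z' = z ^ 2 := by
    calc z' = z ^ 3 * z' := by rw [hz, one_mul]
      _ = z ^ 2 * (z * z') := by ring
      _ = z ^ 2 := by rw [hzz, mul_one]
  have h3 : ι z ^ 3 = 1 := by rw [← map_pow, hz, map_one]
  rw [hz', map_pow]
  split_ifs with h
  · rw [h, map_one]; ring
  · have h1 := map_sq_add_map_add_one ι hz h
    linear_combination (-x) * h1 + x ^ 2 * h3

variable {F : Type} [Field F] [NumberField F] {k T : ℤ} {δ : 𝓞 F}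

/-- The value of the cubic character at a prime ideal. -/
def quadPrime (ι : Eis →+* ℂ) (k T : ℤ) (δ : 𝓞 F) (P : Ideal (𝓞 F)) : ℂ :=
  if ((dsc k T : ℤ) : 𝓞 F) ∈ P then 0
  else if h : ∃ t : ℤ, δ - (t : 𝓞 F) ∈ P then
    ι (cubSym (Ideal.absNorm P) (rt k T + (h.choose : Eis)))
  else 1

namespace IsSqrtGen

theorem dvd_of_sub_mem (h : IsSqrtGen (dsc k T) δ) {p : ℕ} (hp : p.Prime) {P : Ideal (𝓞 F)}
    (hP : P ∈ primesAbove F p) {t : ℤ} (ht : δ - (t : 𝓞 F) ∈ P) : (p : ℤ) ∣ t ^ 2 - dsc k T := by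
  rw [← intCast_mem_iff_of_mem_primesAbove hp hP]
  have h1 : ((t ^ 2 - dsc k T : ℤ) : 𝓞 F) = -(δ + (t : 𝓞 F)) * (δ - (t : 𝓞 F)) := by
    push_cast
    rw [← h.sq]
    ring
  rw [h1]
  exact P.mul_mem_left _ ht

theorem eq_span_of_sub_mem (h : IsSqrtGen (dsc k T) δ) (h2 : 2 ∣ dsc k T) {p : ℕ} (hp : p.Prime)
    (hpΔ : ¬ (p : ℤ) ∣ dsc k T) {P : Ideal (𝓞 F)} (hP : P ∈ primesAbove F p) {t : ℤ}
    (ht : δ - (t : 𝓞 F) ∈ P) : P = Ideal.span {(p : 𝓞 F), δ - (t : 𝓞 F)} := by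
  obtain ⟨h3, h4, -, -⟩ := h.primesAbove_of_sq h2 hp hpΔ (h.dvd_of_sub_mem hp hP ht)
  have hP' := hP
  rw [h3, Finset.mem_insert, Finset.mem_singleton] at hP
  rcases hP with h5 | h5
  · exact h5
  · exfalso
    have h6 : δ - ((-t : ℤ) : 𝓞 F) ∈ P := by
      rw [h5]; exact Ideal.subset_span (by simp)
    have h7 := P.sub_mem h6 ht
    have h8 : δ - ((-t : ℤ) : 𝓞 F) - (δ - (t : 𝓞 F)) = ((2 * t : ℤ) : 𝓞 F) := by push_cast; ring
    rw [h8, intCast_mem_iff_of_mem_primesAbove hp hP'] at h7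
    rcases (Nat.prime_iff_prime_int.mp hp).dvd_or_dvd h7 with h9 | h9
    · exact hpΔ (h9.trans h2)
    · have := (h9.mul_left t).sub (h.dvd_of_sub_mem hp hP' ht)
      rw [pow_two, sub_sub_cancel] at this
      exact hpΔ this

theorem absNorm_of_sub_mem (h : IsSqrtGen (dsc k T) δ) (h2 : 2 ∣ dsc k T) {p : ℕ} (hp : p.Prime)
    (hpΔ : ¬ (p : ℤ) ∣ dsc k T) {P : Ideal (𝓞 F)} (hP : P ∈ primesAbove F p) {t : ℤ}
    (ht : δ - (t : 𝓞 F) ∈ P) : Ideal.absNorm P = p := by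
  obtain ⟨-, -, h5, -⟩ := h.primesAbove_of_sq h2 hp hpΔ (h.dvd_of_sub_mem hp hP ht)
  rwa [← h.eq_span_of_sub_mem h2 hp hpΔ hP ht] at h5

theorem quadPrime_of_dvd (ι : Eis →+* ℂ) {p : ℕ} (hp : p.Prime)
    {P : Ideal (𝓞 F)} (hP : P ∈ primesAbove F p) (hpΔ : (p : ℤ) ∣ dsc k T) :
    quadPrime ι k T δ P = 0 :=
  if_pos ((intCast_mem_iff_of_mem_primesAbove hp hP _).mpr hpΔ)

theorem quadPrime_of_sub_mem (ι : Eis →+* ℂ) (hk3 : 3 ∣ k) (h : IsSqrtGen (dsc k T) δ)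
    (h2 : 2 ∣ dsc k T) {p : ℕ} (hp : p.Prime)
    (hpΔ : ¬ (p : ℤ) ∣ dsc k T) {P : Ideal (𝓞 F)} (hP : P ∈ primesAbove F p) {t : ℤ}
    (ht : δ - (t : 𝓞 F) ∈ P) : quadPrime ι k T δ P = ι (cubSym p (rt k T + (t : Eis))) := by
  have hex : ∃ t : ℤ, δ - (t : 𝓞 F) ∈ P := ⟨t, ht⟩
  have : Fact p.Prime := ⟨hp⟩
  rw [quadPrime, if_neg (by rwa [intCast_mem_iff_of_mem_primesAbove hp hP]), dif_pos hex,
    h.absNorm_of_sub_mem h2 hp hpΔ hP ht]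
  congr 1
  apply cubSym_congr (ne_three_of_not_dvd_dsc hk3 hpΔ)
  have h3 := P.sub_mem ht hex.choose_spec
  have h4 : δ - (t : 𝓞 F) - (δ - (hex.choose : 𝓞 F)) = ((hex.choose - t : ℤ) : 𝓞 F) := by
    push_cast; ring
  rw [h4, intCast_mem_iff_of_mem_primesAbove hp hP] at h3
  obtain ⟨u, hu⟩ := h3
  refine ⟨(u : Eis), ?_⟩
  rw [add_sub_add_left_eq_sub, ← Int.cast_sub, hu]
  push_cast
  rfl

theorem quadPrime_of_not_sq (ι : Eis →+* ℂ) (h : IsSqrtGen (dsc k T) δ) {p : ℕ} (hp : p.Prime)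
    (hpΔ : ¬ (p : ℤ) ∣ dsc k T) {P : Ideal (𝓞 F)} (hP : P ∈ primesAbove F p)
    (ht : ∀ t : ℤ, ¬ (p : ℤ) ∣ t ^ 2 - dsc k T) : quadPrime ι k T δ P = 1 := by
  rw [quadPrime, if_neg (by rwa [intCast_mem_iff_of_mem_primesAbove hp hP]), dif_neg]
  rintro ⟨t, h1⟩
  exact ht t (h.dvd_of_sub_mem hp hP h1)

theorem norm_quadPrime (ι : Eis →+* ℂ) (hk3 : 3 ∣ k) (h : IsSqrtGen (dsc k T) δ)
    (h2 : 2 ∣ dsc k T) {p : ℕ} (hp : p.Prime) (hpΔ : ¬ (p : ℤ) ∣ dsc k T) {P : Ideal (𝓞 F)}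
    (hP : P ∈ primesAbove F p) : ‖quadPrime ι k T δ P‖ = 1 := by
  have : Fact p.Prime := ⟨hp⟩
  by_cases ht : ∃ t : ℤ, (p : ℤ) ∣ t ^ 2 - dsc k T
  · obtain ⟨t, ht⟩ := ht
    obtain ⟨u, hu, hu'⟩ : ∃ u : ℤ, (p : ℤ) ∣ u ^ 2 - dsc k T ∧ δ - (u : 𝓞 F) ∈ P := by
      have hP' := hP
      rw [(h.primesAbove_of_sq h2 hp hpΔ ht).1, Finset.mem_insert, Finset.mem_singleton] at hP'
      rcases hP' with h5 | h5
      · exact ⟨t, ht, by rw [h5]; exact Ideal.subset_span (by simp)⟩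
      · exact ⟨-t, by rwa [neg_sq], by rw [h5]; exact Ideal.subset_span (by simp)⟩
    rw [h.quadPrime_of_sub_mem ι hk3 h2 hp hpΔ hP hu']
    exact norm_map_of_pow_three ι (cubSym_pow_three (ne_three_of_not_dvd_dsc hk3 hpΔ)
      (not_dvd_norm_rt_add hp hpΔ hu))
  · push Not at ht
    rw [h.quadPrime_of_not_sq ι hp hpΔ hP ht, norm_one]

theorem quadPrime_eq_zero_iff (ι : Eis →+* ℂ) (hk3 : 3 ∣ k) (h : IsSqrtGen (dsc k T) δ)
    (h2 : 2 ∣ dsc k T) {P : Ideal (𝓞 F)} (hP : P.IsPrime) (h0 : P ≠ ⊥) :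
    quadPrime ι k T δ P = 0 ↔ ((dsc k T : ℤ) : 𝓞 F) ∈ P := by
  refine ⟨fun h3 => ?_, fun h3 => if_pos h3⟩
  obtain ⟨p, hp, hpP⟩ := exists_mem_primesAbove hP h0
  rw [intCast_mem_iff_of_mem_primesAbove hp hpP]
  by_contra hpΔ
  have h4 := h.norm_quadPrime ι hk3 h2 hp hpΔ hpP
  rw [h3, norm_zero] at h4
  exact zero_ne_one h4

theorem norm_quadPrime_le (ι : Eis →+* ℂ) (hk3 : 3 ∣ k) (h : IsSqrtGen (dsc k T) δ)
    (h2 : 2 ∣ dsc k T) {P : Ideal (𝓞 F)} (hP : P.IsPrime) (h0 : P ≠ ⊥) :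
    ‖quadPrime ι k T δ P‖ ≤ 1 := by
  obtain ⟨p, hp, hpP⟩ := exists_mem_primesAbove hP h0
  by_cases hpΔ : (p : ℤ) ∣ dsc k T
  · rw [quadPrime_of_dvd ι hp hpP hpΔ]; simp
  · exact (h.norm_quadPrime ι hk3 h2 hp hpΔ hpP).le

theorem primeHom_span_of_isCoprime (ι : Eis →+* ℂ) (hk3 : 3 ∣ k) (h : IsSqrtGen (dsc k T) δ)
    (h2 : 2 ∣ dsc k T) {c d : ℤ} (hc : IsCoprime c (dsc k T)) (hcd : IsCoprime c d)
    (hd : ¬ 3 ∣ d) :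
    primeHom (quadPrime ι k T δ) (Ideal.span {(c : 𝓞 F) + (d : 𝓞 F) * δ}) = 1 := by
  set I := Ideal.span {(c : 𝓞 F) + (d : 𝓞 F) * δ} with hI
  have h3Δ : (3 : ℤ) ∣ dsc k T := by
    rw [dsc, pow_two, mul_assoc]; exact hk3.mul_right _
  have hI0 : I ≠ ⊥ := by
    intro h0
    have h4 := h.absNorm_span c d
    rw [← hI, h0, Ideal.absNorm_bot, eq_comm, Int.natAbs_eq_zero] at h4
    have h5 : (3 : ℤ) ∣ c ^ 2 := by
      rw [sub_eq_zero.mp h4]; exact h3Δ.mul_right _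
    exact Int.prime_three.not_isUnit (hc.isUnit_of_dvd' (Int.prime_three.dvd_of_dvd_pow h5) h3Δ)
  have key : ∀ P ∈ normalizedFactors I, (Ideal.absNorm P).Prime ∧ quadPrime ι k T δ P =
      ι (cubSym (Ideal.absNorm P) (rt k T * (d : Eis) - (c : Eis))) := by
    intro P hP
    obtain ⟨hPp, hle⟩ := (Ideal.mem_normalizedFactors_iff hI0).mp hP
    have hmem : (c : 𝓞 F) + (d : 𝓞 F) * δ ∈ P := hle (Ideal.mem_span_singleton_self _)
    obtain ⟨p, hp, hpP⟩ := exists_mem_primesAbove hPp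
      (irreducible_of_normalized_factor P hP).ne_zero
    have : Fact p.Prime := ⟨hp⟩
    have hpi := Nat.prime_iff_prime_int.mp hp
    have hmemZ := intCast_mem_iff_of_mem_primesAbove hp hpP
    have hpΔ : ¬ (p : ℤ) ∣ dsc k T := by
      intro h4
      have h5 : δ ∈ P := by
        apply hPp.mem_of_pow_mem 2
        rw [h.sq]
        exact (hmemZ _).mpr h4
      have h6 : (c : 𝓞 F) ∈ P := by
        have := P.sub_mem hmem (P.mul_mem_left (d : 𝓞 F) h5)
        rwa [add_sub_cancel_right] at this
      exact hpi.not_isUnit (hc.isUnit_of_dvd' ((hmemZ c).mp h6) h4)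
    have hpd : ¬ (p : ℤ) ∣ d := by
      intro h4
      have h6 : (c : 𝓞 F) ∈ P := by
        have := P.sub_mem hmem (P.mul_mem_right δ ((hmemZ d).mpr h4))
        rwa [add_sub_cancel_right] at this
      exact hpi.not_isUnit (hcd.isUnit_of_dvd' ((hmemZ c).mp h6) h4)
    obtain ⟨u, v, huv⟩ : IsCoprime (p : ℤ) d := (hpi.coprime_iff_not_dvd).mpr hpd
    have ht : δ - ((-(c * v) : ℤ) : 𝓞 F) ∈ P := by
      have h5 : δ - ((-(c * v) : ℤ) : 𝓞 F) =
          (v : 𝓞 F) * ((c : 𝓞 F) + (d : 𝓞 F) * δ) + ((u : 𝓞 F) * δ) * ((p : ℤ) : 𝓞 F) := by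
        have h6 : ((u * p + v * d : ℤ) : 𝓞 F) = 1 := by rw [huv, Int.cast_one]
        push_cast at h6 ⊢
        linear_combination (-δ) * h6
      rw [h5]
      exact P.add_mem (P.mul_mem_left _ hmem) (P.mul_mem_left _ ((hmemZ p).mpr dvd_rfl))
    have hN := h.absNorm_of_sub_mem h2 hp hpΔ hpP ht
    have hp3 := ne_three_of_not_dvd_dsc hk3 hpΔ
    rw [hN]
    refine ⟨hp, ?_⟩
    rw [h.quadPrime_of_sub_mem ι hk3 h2 hp hpΔ hpP ht,
      ← one_mul (cubSym p (rt k T + ((-(c * v) : ℤ) : Eis))), ← cubSym_intCast hp3 hpd,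
      ← cubSym_mul hp3]
    congr 1
    apply cubSym_congr hp3
    refine ⟨((c * u : ℤ) : Eis), ?_⟩
    have h6 : ((u * p + v * d : ℤ) : Eis) = 1 := by rw [huv, Int.cast_one]
    push_cast at h6 ⊢
    linear_combination (-(c : Eis)) * h6
  rw [primeHom_apply _ hI0]
  have h4 := prod_cubSym_eq_one hk3 hc hcd hd ((normalizedFactors I).map Ideal.absNorm)
    (by
      intro p hp
      obtain ⟨P, hP, rfl⟩ := Multiset.mem_map.mp hp
      exact (key P hP).1)
    (by
      rw [← map_multiset_prod, Ideal.prod_normalizedFactors_eq_self hI0, hI, h.absNorm_span])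
  rw [Multiset.map_congr rfl fun P hP => (key P hP).2, ← map_one ι, ← h4, map_multiset_prod,
    Multiset.map_map, Multiset.map_map]
  rfl

end IsSqrtGen

end QuadraticCharacter

section QuadraticDirichlet

open NumberField IsDedekindDomain UniqueFactorizationMonoid Eis
open scoped nonZeroDivisors

variable {F : Type} [Field F] [NumberField F] {k T : ℤ} {δ : 𝓞 F}

namespace IsSqrtGen

theorem absNorm_span_intCast {Δ : ℤ} (h : IsSqrtGen Δ δ) (n : ℤ) :
    Ideal.absNorm (Ideal.span {(n : 𝓞 F)}) = n.natAbs ^ 2 := by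
  have := h.absNorm_span n 0
  simpa [Int.natAbs_pow] using this

theorem span_eq_mul {Δ : ℤ} (h : IsSqrtGen Δ δ) (h2 : 2 ∣ Δ) {p : ℕ} (hp : p.Prime)
    (hpΔ : ¬ (p : ℤ) ∣ Δ) {t : ℤ} (ht : (p : ℤ) ∣ t ^ 2 - Δ) :
    Ideal.span {(p : 𝓞 F)} = Ideal.span {(p : 𝓞 F), δ - (t : 𝓞 F)} *
      Ideal.span {(p : 𝓞 F), δ - ((-t : ℤ) : 𝓞 F)} := by
  obtain ⟨h3, h4, h5, h6⟩ := h.primesAbove_of_sq h2 hp hpΔ ht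
  set P := Ideal.span {(p : 𝓞 F), δ - (t : 𝓞 F)} with hP
  set Q := Ideal.span {(p : 𝓞 F), δ - ((-t : ℤ) : 𝓞 F)} with hQ
  have hPm : P ∈ primesAbove F p := by rw [h3]; simp
  have hQm : Q ∈ primesAbove F p := by rw [h3]; simp
  have hP0 := ne_bot_of_mem_primesAbove hp hPm
  have hQ0 := ne_bot_of_mem_primesAbove hp hQm
  have hPM := (isPrime_of_mem_primesAbove hp hPm).isMaximal hP0
  have hQM := (isPrime_of_mem_primesAbove hp hQm).isMaximal hQ0
  have hcop : IsCoprime P Q := Ideal.isCoprime_iff_sup_eq.mpr (hPM.coprime_of_ne hQM h4)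
  obtain ⟨J, hJ⟩ := hcop.mul_dvd (z := Ideal.span {(p : 𝓞 F)})
    (Ideal.dvd_span_singleton.mpr (Ideal.subset_span (by simp)))
    (Ideal.dvd_span_singleton.mpr (Ideal.subset_span (by simp)))
  have h7 := congrArg Ideal.absNorm hJ
  have h8 := h.absNorm_span_intCast (p : ℤ)
  rw [Int.cast_natCast, Int.natAbs_natCast] at h8
  rw [map_mul, map_mul, h5, h6, h8, ← pow_two] at h7
  have h9 : Ideal.absNorm J = 1 := by
    have hpp : 0 < p ^ 2 := pow_pos hp.pos 2
    exact (Nat.mul_eq_left hpp.ne').mp h7.symm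
  rw [hJ, Ideal.absNorm_eq_one_iff.mp h9, Ideal.mul_top]

theorem primeHom_span_prime (ι : Eis →+* ℂ) (hk3 : 3 ∣ k) (h : IsSqrtGen (dsc k T) δ)
    (h2 : 2 ∣ dsc k T) {p : ℕ} (hp : p.Prime) (hpΔ : ¬ (p : ℤ) ∣ dsc k T) :
    primeHom (quadPrime ι k T δ) (Ideal.span {(p : 𝓞 F)}) = 1 := by
  by_cases ht : ∃ t : ℤ, (p : ℤ) ∣ t ^ 2 - dsc k T
  · obtain ⟨t, ht⟩ := ht
    have h3 := (h.primesAbove_of_sq h2 hp hpΔ ht).1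
    have hPm : Ideal.span {(p : 𝓞 F), δ - (t : 𝓞 F)} ∈ primesAbove F p := by rw [h3]; simp
    have hQm : Ideal.span {(p : 𝓞 F), δ - ((-t : ℤ) : 𝓞 F)} ∈ primesAbove F p := by rw [h3]; simp
    rw [h.span_eq_mul h2 hp hpΔ ht, map_mul,
      primeHom_prime _ (isPrime_of_mem_primesAbove hp hPm) (ne_bot_of_mem_primesAbove hp hPm),
      primeHom_prime _ (isPrime_of_mem_primesAbove hp hQm) (ne_bot_of_mem_primesAbove hp hQm),
      h.quadPrime_of_sub_mem ι hk3 h2 hp hpΔ (t := t) hPm (Ideal.subset_span (by simp)),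
      h.quadPrime_of_sub_mem ι hk3 h2 hp hpΔ (t := -t) hQm (Ideal.subset_span (by simp)),
      ← map_mul, cubSym_rt_mul_cubSym_rt hk3 hp hpΔ ht, map_one]
  · push Not at ht
    have hPm : Ideal.span {(p : 𝓞 F)} ∈ primesAbove F p := by
      rw [(h.primesAbove_of_not_sq h2 hp hpΔ ht).1]; simp
    rw [primeHom_prime _ (isPrime_of_mem_primesAbove hp hPm) (ne_bot_of_mem_primesAbove hp hPm),
      h.quadPrime_of_not_sq ι hp hpΔ hPm ht]

theorem primeHom_span_intCast (ι : Eis →+* ℂ) (hk3 : 3 ∣ k) (h : IsSqrtGen (dsc k T) δ)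
    (h2 : 2 ∣ dsc k T) {g : ℤ} (hg : IsCoprime g (dsc k T)) :
    primeHom (quadPrime ι k T δ) (Ideal.span {(g : 𝓞 F)}) = 1 := by
  have key : ∀ n : ℕ, IsCoprime (n : ℤ) (dsc k T) →
      primeHom (quadPrime ι k T δ) (Ideal.span {(n : 𝓞 F)}) = 1 := by
    intro n
    induction n using induction_on_primes with
    | zero =>
      intro h0
      rw [Nat.cast_zero, isCoprime_zero_left] at h0
      exact absurd (isUnit_of_dvd_unit h2 h0) (by decide)
    | one =>
      intro _
      rw [Nat.cast_one, Ideal.span_singleton_one, ← Ideal.one_eq_top, map_one]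
    | prime_mul p a hp ih =>
      intro hpa
      rw [Nat.cast_mul] at hpa
      rw [Nat.cast_mul, ← Ideal.span_singleton_mul_span_singleton, map_mul,
        ih hpa.of_mul_left_right, mul_one]
      exact h.primeHom_span_prime ι hk3 h2 hp fun h3 =>
        (Nat.prime_iff_prime_int.mp hp).not_isUnit (hpa.of_mul_left_left.isUnit_of_dvd' dvd_rfl h3)
  rcases Int.natAbs_eq g with h3 | h3
  · rw [h3] at hg ⊢
    rw [Int.cast_natCast]
    exact key _ hg
  · rw [h3] at hg ⊢
    rw [Int.cast_neg, Ideal.span_singleton_neg, Int.cast_natCast]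
    exact key _ ((IsCoprime.neg_left_iff _ _).mp hg)

theorem primeHom_span (ι : Eis →+* ℂ) (hk3 : 3 ∣ k) (h : IsSqrtGen (dsc k T) δ)
    (h2 : 2 ∣ dsc k T) {c d : ℤ} (hc : IsCoprime c (dsc k T)) (hd : ¬ 3 ∣ d) :
    primeHom (quadPrime ι k T δ) (Ideal.span {(c : 𝓞 F) + (d : 𝓞 F) * δ}) = 1 := by
  have hd0 : d ≠ 0 := by rintro rfl; exact hd (dvd_zero 3)
  obtain ⟨g, c', d', hcop, rfl, rfl⟩ : ∃ g c' d' : ℤ, IsCoprime c' d' ∧ c = g * c' ∧ d = g * d' := by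
    have hg : 0 < Int.gcd c d := Int.gcd_pos_of_ne_zero_right _ hd0
    obtain ⟨c', d', h3, h4, h5⟩ := Int.exists_gcd_one hg
    exact ⟨Int.gcd c d, c', d', Int.isCoprime_iff_gcd_eq_one.mpr h3, by rw [mul_comm]; exact h4,
      by rw [mul_comm]; exact h5⟩
  have h3 : ((g * c' : ℤ) : 𝓞 F) + ((g * d' : ℤ) : 𝓞 F) * δ =
      (g : 𝓞 F) * ((c' : 𝓞 F) + (d' : 𝓞 F) * δ) := by
    push_cast; ring
  rw [h3, ← Ideal.span_singleton_mul_span_singleton, map_mul,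
    h.primeHom_span_intCast ι hk3 h2 hc.of_mul_left_left,
    h.primeHom_span_of_isCoprime ι hk3 h2 hc.of_mul_left_right hcop fun h4 => hd (h4.mul_left g),
    mul_one]

theorem primeHom_span_of_dvd (ι : Eis →+* ℂ) (hk3 : 3 ∣ k) (h : IsSqrtGen (dsc k T) δ)
    (h2 : 2 ∣ dsc k T) {x : 𝓞 F} (hx : ((dsc k T ^ 4 : ℤ) : 𝓞 F) ∣ x - 1) :
    primeHom (quadPrime ι k T δ) (Ideal.span {x}) = 1 := by
  set Δ := dsc k T with hΔ
  have h3Δ : (3 : ℤ) ∣ Δ := by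
    rw [hΔ, dsc, pow_two, mul_assoc]; exact hk3.mul_right _
  obtain ⟨y, hy⟩ := hx
  obtain ⟨c, d, hcd⟩ := h.exists_eq_add_mul y
  obtain ⟨e, he⟩ := h2
  have hx : x = ((1 + Δ * (e ^ 2 * c) : ℤ) : 𝓞 F) + ((Δ * (e ^ 2 * d) : ℤ) : 𝓞 F) * δ := by
    have h4 : (Δ ^ 4 : ℤ) = Δ * e ^ 2 * (4 * Δ) := by rw [he]; ring
    rw [h4] at hy
    push_cast at hy hcd ⊢
    linear_combination hy + (Δ : 𝓞 F) * (e : 𝓞 F) ^ 2 * hcd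
  have h1 : primeHom (quadPrime ι k T δ) (Ideal.span {((1 : ℤ) : 𝓞 F) + ((1 : ℤ) : 𝓞 F) * δ}) = 1 :=
    h.primeHom_span ι hk3 ⟨e, he⟩ isCoprime_one_left (by decide)
  have hmul : x * (((1 : ℤ) : 𝓞 F) + ((1 : ℤ) : 𝓞 F) * δ) =
      ((1 + Δ * (e ^ 2 * c + Δ * (e ^ 2 * d)) : ℤ) : 𝓞 F) +
        ((1 + Δ * (e ^ 2 * c + e ^ 2 * d) : ℤ) : 𝓞 F) * δ := by
    rw [hx]
    push_cast
    linear_combination (Δ : 𝓞 F) * ((e : 𝓞 F) ^ 2 * d) * h.sq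
  rw [← mul_one (primeHom _ (Ideal.span {x})), ← h1, ← map_mul,
    Ideal.span_singleton_mul_span_singleton, hmul, h1]
  refine h.primeHom_span ι hk3 ⟨e, he⟩ ?_ ?_
  · exact ⟨1, -(e ^ 2 * c + Δ * (e ^ 2 * d)), by ring⟩
  · intro h4
    have h5 := (Int.dvd_add_left (h3Δ.mul_right (e ^ 2 * c + e ^ 2 * d))).mp h4
    exact absurd h5 (by decide)

theorem hasCubicFactors (hk3 : 3 ∣ k) (h : IsSqrtGen (dsc k T) δ) (h2 : 2 ∣ dsc k T) :
    HasCubicFactors k T := by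
  obtain ⟨ι⟩ := nonempty_hom_of_isAlgClosed ℂ
  set Δ := dsc k T with hΔ
  have hΔ0 : Δ ≠ 0 := fun h0 => h.nonsq 0 (by rw [h0]; rfl)
  have hcast : (((Δ.natAbs ^ 4 : ℕ) : 𝓞 F)) = ((Δ ^ 4 : ℤ) : 𝓞 F) := by
    have h1 : ((Δ.natAbs ^ 4 : ℕ) : ℤ) = Δ ^ 4 := by
      rw [Nat.cast_pow, Int.natCast_natAbs, Even.pow_abs (by decide)]
    rw [← h1, Int.cast_natCast]
  have hm0 : ((Δ ^ 4 : ℤ) : 𝓞 F) ≠ 0 := by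
    rw [Int.cast_ne_zero]; exact pow_ne_zero 4 hΔ0
  have hm1 : ¬ IsUnit ((Δ ^ 4 : ℤ) : 𝓞 F) := by
    rw [← Ideal.span_singleton_eq_top, ← Ideal.absNorm_eq_one_iff, h.absNorm_span_intCast]
    intro h1
    have h4 := Int.isUnit_iff_natAbs_eq.mpr (Nat.pow_eq_one.mp h1 |>.resolve_right two_ne_zero)
    exact absurd (isUnit_of_dvd_unit h2 ((isUnit_pow_iff four_ne_zero).mp h4)) (by decide)
  obtain ⟨D₀, D, hD₀, hD, hE⟩ := exists_dirichlet_of_rayClassCharacter (F := F)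
    (χ := primeHom (quadPrime ι k T δ)) (m := Δ.natAbs ^ 4)
    (pow_ne_zero 4 (Int.natAbs_ne_zero.mpr hΔ0))
    (norm_primeHom_le fun P hP h0 => h.norm_quadPrime_le ι hk3 h2 hP h0) (primeHom_bot _)
    (by
      rw [hcast]
      refine primeHom_ne_zero_iff _ hm0 hm1 fun P hP h0 => ?_
      rw [h.quadPrime_eq_zero_iff ι hk3 h2 hP h0, Int.cast_pow]
      exact (hP.pow_mem_iff_mem 4 (by norm_num)).symm)
    (by
      intro x hx
      rw [hcast] at hx
      exact h.primeHom_span_of_dvd ι hk3 h2 hx)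
  refine ⟨D₀, D, 1, fun p s => ∏ P ∈ primesAbove F p,
    (1 - primeHom (quadPrime ι k T δ) P * (Ideal.absNorm P : ℂ) ^ (-s)), hD₀,
    fun s hs => ⟨(hD s hs).1, by rw [pow_one]; exact (hD s hs).2⟩, hE, ?_⟩
  rintro ⟨p, hp⟩ s hs
  dsimp only
  have hval : ∀ P ∈ primesAbove F p, primeHom (quadPrime ι k T δ) P = quadPrime ι k T δ P :=
    fun P hP => primeHom_prime _ (isPrime_of_mem_primesAbove hp hP) (ne_bot_of_mem_primesAbove hp hP)
  have : Fact p.Prime := ⟨hp⟩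
  refine ⟨fun hpΔ => ?_, fun hpΔ ht => ?_, fun t hpΔ ht => ?_⟩
  · refine Finset.prod_eq_one fun P hP => ?_
    rw [hval P hP, quadPrime_of_dvd ι hp hP hpΔ, zero_mul, sub_zero]
  · obtain ⟨h3, h4⟩ := h.primesAbove_of_not_sq h2 hp hpΔ ht
    have hPm : Ideal.span {(p : 𝓞 F)} ∈ primesAbove F p := by rw [h3]; simp
    rw [h3, Finset.prod_singleton, hval _ hPm, h.quadPrime_of_not_sq ι hp hpΔ hPm ht, h4, pow_two,
      Nat.cast_mul, natCast_mul_natCast_cpow, one_mul, pow_two]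
  · obtain ⟨h3, h4, h5, h6⟩ := h.primesAbove_of_sq h2 hp hpΔ ht
    have hPm : Ideal.span {(p : 𝓞 F), δ - (t : 𝓞 F)} ∈ primesAbove F p := by rw [h3]; simp
    have hQm : Ideal.span {(p : 𝓞 F), δ - ((-t : ℤ) : 𝓞 F)} ∈ primesAbove F p := by
      rw [h3]; simp
    rw [h3, Finset.prod_pair h4, hval _ hPm, hval _ hQm, h5, h6,
      h.quadPrime_of_sub_mem ι hk3 h2 hp hpΔ (t := t) hPm (Ideal.subset_span (by simp)),
      h.quadPrime_of_sub_mem ι hk3 h2 hp hpΔ (t := -t) hQm (Ideal.subset_span (by simp))]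
    exact one_sub_mul_one_sub ι (cubSym_pow_three (ne_three_of_not_dvd_dsc hk3 hpΔ)
      (not_dvd_norm_rt_add hp hpΔ ht)) (cubSym_rt_mul_cubSym_rt hk3 hp hpΔ ht) _

end IsSqrtGen

end QuadraticDirichlet

section CyclicDirichlet

open NumberField IsDedekindDomain UniqueFactorizationMonoid Eis
open scoped nonZeroDivisors

theorem exists_intCast_eq (x : 𝓞 ℚ) : ∃ n : ℤ, (n : 𝓞 ℚ) = x :=
  ⟨Rat.ringOfIntegersEquiv x, Rat.ringOfIntegersEquiv.injective (by simp)⟩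

theorem absNorm_span_intCast_rat (n : ℤ) :
    Ideal.absNorm (Ideal.span {(n : 𝓞 ℚ)}) = n.natAbs := by
  have h := Algebra.norm_algebraMap (R := ℤ) (S := 𝓞 ℚ) n
  rw [RingOfIntegers.rank, Module.finrank_self, pow_one] at h
  rw [Ideal.absNorm_span_singleton]
  exact congrArg Int.natAbs h

theorem primesAbove_rat {p : ℕ} (hp : p.Prime) : primesAbove ℚ p = {Ideal.span {(p : 𝓞 ℚ)}} := by
  have h1 := absNorm_span_intCast_rat (p : ℤ)
  rw [Int.cast_natCast, Int.natAbs_natCast] at h1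
  have h2 : (Ideal.span {(p : 𝓞 ℚ)}).IsPrime :=
    Ideal.isPrime_of_irreducible_absNorm (by rw [h1]; exact hp)
  have h3 : Ideal.span {(p : 𝓞 ℚ)} ≠ ⊥ := by
    intro h
    rw [h, Ideal.absNorm_bot] at h1
    exact hp.ne_zero h1.symm
  have h4 : ∀ P ∈ primesAbove ℚ p, P = Ideal.span {(p : 𝓞 ℚ)} := by
    intro P hP
    have h5 : ((p : ℤ) : 𝓞 ℚ) ∈ P := (intCast_mem_iff_of_mem_primesAbove hp hP _).mpr dvd_rfl
    rw [Int.cast_natCast] at h5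
    exact ((h2.isMaximal h3).eq_of_le (isPrime_of_mem_primesAbove hp hP).ne_top
      ((Ideal.span_singleton_le_iff_mem P).mpr h5)).symm
  obtain ⟨q, hq, hqP⟩ := exists_mem_primesAbove h2 h3
  have h5 : ((p : ℤ) : 𝓞 ℚ) ∈ Ideal.span {(p : 𝓞 ℚ)} := by
    rw [Int.cast_natCast]; exact Ideal.mem_span_singleton_self _
  rw [intCast_mem_iff_of_mem_primesAbove hq hqP, Int.natCast_dvd_natCast] at h5
  obtain rfl := (Nat.prime_dvd_prime_iff_eq hq hp).mp h5
  ext P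
  rw [Finset.mem_singleton]
  exact ⟨h4 P, fun h => h ▸ hqP⟩

theorem absNorm_of_mem_primesAbove_rat {p : ℕ} (hp : p.Prime) {P : Ideal (𝓞 ℚ)}
    (hP : P ∈ primesAbove ℚ p) : Ideal.absNorm P = p := by
  rw [primesAbove_rat hp, Finset.mem_singleton] at hP
  rw [hP, ← Int.cast_natCast, absNorm_span_intCast_rat, Int.natAbs_natCast]

/-- The value of the cubic character at a prime of `ℚ`, for `t ^ 2 = dsc k T`. -/
def ratPrime (ι : Eis →+* ℂ) (k T t : ℤ) (P : Ideal (𝓞 ℚ)) : ℂ :=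
  if ((dsc k T : ℤ) : 𝓞 ℚ) ∈ P then 0 else ι (cubSym (Ideal.absNorm P) (rt k T + (t : Eis)))

variable {k T t : ℤ}

theorem ratPrime_of_dvd (ι : Eis →+* ℂ) {p : ℕ} (hp : p.Prime)
    {P : Ideal (𝓞 ℚ)} (hP : P ∈ primesAbove ℚ p) (hpΔ : (p : ℤ) ∣ dsc k T) :
    ratPrime ι k T t P = 0 :=
  if_pos ((intCast_mem_iff_of_mem_primesAbove hp hP _).mpr hpΔ)

theorem ratPrime_of_not_dvd (ι : Eis →+* ℂ) {p : ℕ} (hp : p.Prime)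
    {P : Ideal (𝓞 ℚ)} (hP : P ∈ primesAbove ℚ p) (hpΔ : ¬ (p : ℤ) ∣ dsc k T) :
    ratPrime ι k T t P = ι (cubSym p (rt k T + (t : Eis))) := by
  rw [ratPrime, if_neg (by rwa [intCast_mem_iff_of_mem_primesAbove hp hP]),
    absNorm_of_mem_primesAbove_rat hp hP]

theorem norm_ratPrime (ι : Eis →+* ℂ) (hk3 : 3 ∣ k) (ht : t ^ 2 = dsc k T) {p : ℕ} (hp : p.Prime)
    (hpΔ : ¬ (p : ℤ) ∣ dsc k T) {P : Ideal (𝓞 ℚ)} (hP : P ∈ primesAbove ℚ p) :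
    ‖ratPrime ι k T t P‖ = 1 := by
  have : Fact p.Prime := ⟨hp⟩
  rw [ratPrime_of_not_dvd ι hp hP hpΔ]
  exact norm_map_of_pow_three ι (cubSym_pow_three (ne_three_of_not_dvd_dsc hk3 hpΔ)
      (not_dvd_norm_rt_add hp hpΔ (by rw [ht, sub_self]; exact dvd_zero _)))

theorem ratPrime_eq_zero_iff (ι : Eis →+* ℂ) (hk3 : 3 ∣ k) (ht : t ^ 2 = dsc k T)
    {P : Ideal (𝓞 ℚ)} (hP : P.IsPrime) (h0 : P ≠ ⊥) :
    ratPrime ι k T t P = 0 ↔ ((dsc k T : ℤ) : 𝓞 ℚ) ∈ P := by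
  refine ⟨fun h3 => ?_, fun h3 => if_pos h3⟩
  obtain ⟨p, hp, hpP⟩ := exists_mem_primesAbove hP h0
  rw [intCast_mem_iff_of_mem_primesAbove hp hpP]
  by_contra hpΔ
  have h4 := norm_ratPrime ι hk3 ht hp hpΔ hpP
  rw [h3, norm_zero] at h4
  exact zero_ne_one h4

theorem norm_ratPrime_le (ι : Eis →+* ℂ) (hk3 : 3 ∣ k) (ht : t ^ 2 = dsc k T)
    {P : Ideal (𝓞 ℚ)} (hP : P.IsPrime) (h0 : P ≠ ⊥) : ‖ratPrime ι k T t P‖ ≤ 1 := by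
  obtain ⟨p, hp, hpP⟩ := exists_mem_primesAbove hP h0
  by_cases hpΔ : (p : ℤ) ∣ dsc k T
  · rw [ratPrime_of_dvd ι hp hpP hpΔ]; simp
  · exact (norm_ratPrime ι hk3 ht hp hpΔ hpP).le

theorem ratPrime_eq_cubSym (ι : Eis →+* ℂ) (hk3 : 3 ∣ k) (ht : t ^ 2 = dsc k T) {c d : ℤ}
    (hc : IsCoprime c (dsc k T)) (hcd : IsCoprime c d) (h0 : Ideal.span {((c + d * t : ℤ) : 𝓞 ℚ)} ≠ ⊥)
    {P : Ideal (𝓞 ℚ)} (hP : P ∈ normalizedFactors (Ideal.span {((c + d * t : ℤ) : 𝓞 ℚ)})) :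
    (Ideal.absNorm P).Prime ∧ ratPrime ι k T t P =
      ι (cubSym (Ideal.absNorm P) (rt k T * (d : Eis) - (c : Eis))) := by
  obtain ⟨hPp, hle⟩ := (Ideal.mem_normalizedFactors_iff h0).mp hP
  have hmem := hle (Ideal.mem_span_singleton_self _)
  obtain ⟨p, hp, hpP⟩ := exists_mem_primesAbove hPp (irreducible_of_normalized_factor P hP).ne_zero
  have : Fact p.Prime := ⟨hp⟩
  have hpi := Nat.prime_iff_prime_int.mp hp
  rw [intCast_mem_iff_of_mem_primesAbove hp hpP] at hmem
  have hpΔ : ¬ (p : ℤ) ∣ dsc k T := by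
    intro h4
    have h5 : (p : ℤ) ∣ t := hpi.dvd_of_dvd_pow (ht ▸ h4)
    exact hpi.not_isUnit (hc.isUnit_of_dvd' ((Int.dvd_add_left (h5.mul_left d)).mp hmem) h4)
  have hpd : ¬ (p : ℤ) ∣ d := fun h4 =>
    hpi.not_isUnit (hcd.isUnit_of_dvd' ((Int.dvd_add_left (h4.mul_right t)).mp hmem) h4)
  have hp3 := ne_three_of_not_dvd_dsc hk3 hpΔ
  rw [absNorm_of_mem_primesAbove_rat hp hpP, ratPrime_of_not_dvd ι hp hpP hpΔ]
  refine ⟨hp, ?_⟩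
  rw [← one_mul (cubSym p (rt k T + (t : Eis))), ← cubSym_intCast hp3 hpd, ← cubSym_mul hp3]
  congr 1
  apply cubSym_congr hp3
  obtain ⟨u, hu⟩ := hmem
  refine ⟨(u : Eis), ?_⟩
  have h6 : ((c + d * t : ℤ) : Eis) = ((p * u : ℤ) : Eis) := by rw [hu]
  push_cast at h6
  linear_combination h6

/-- The value of the cubic character attached to `t` at an integer. -/
def ratChar (ι : Eis →+* ℂ) (k T t n : ℤ) : ℂ :=
  primeHom (ratPrime ι k T t) (Ideal.span {(n : 𝓞 ℚ)})

theorem ratChar_mul (ι : Eis →+* ℂ) (m n : ℤ) :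
    ratChar ι k T t (m * n) = ratChar ι k T t m * ratChar ι k T t n := by
  rw [ratChar, Int.cast_mul, ← Ideal.span_singleton_mul_span_singleton, map_mul]
  rfl

theorem ratChar_one (ι : Eis →+* ℂ) : ratChar ι k T t 1 = 1 := by
  rw [ratChar, Int.cast_one, Ideal.span_singleton_one, ← Ideal.one_eq_top, map_one]

theorem ratChar_neg (ι : Eis →+* ℂ) (n : ℤ) : ratChar ι k T t (-n) = ratChar ι k T t n := by
  rw [ratChar, Int.cast_neg, Ideal.span_singleton_neg]
  rfl

theorem ratChar_mul_ratChar_of_isCoprime (ι : Eis →+* ℂ) (hk3 : 3 ∣ k) (ht : t ^ 2 = dsc k T)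
    {c d : ℤ} (hc : IsCoprime c (dsc k T)) (hcd : IsCoprime c d) (hd : ¬ 3 ∣ d) :
    ratChar ι k T t (c + d * t) * ratChar ι k T (-t) (c + d * -t) = 1 := by
  have ht' : (-t) ^ 2 = dsc k T := by rw [neg_sq, ht]
  have h3Δ : (3 : ℤ) ∣ dsc k T := by
    rw [dsc, pow_two, mul_assoc]; exact hk3.mul_right _
  have h0 : ∀ u : ℤ, u ^ 2 = dsc k T → Ideal.span {((c + d * u : ℤ) : 𝓞 ℚ)} ≠ ⊥ := by
    intro u hu h1
    rw [Ideal.span_singleton_eq_bot, Int.cast_eq_zero] at h1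
    have h3 : (3 : ℤ) ∣ u := Int.prime_three.dvd_of_dvd_pow (hu ▸ h3Δ)
    have h4 : (3 : ℤ) ∣ c := (Int.dvd_add_left (h3.mul_left d)).mp (h1 ▸ dvd_zero 3)
    exact Int.prime_three.not_isUnit (hc.isUnit_of_dvd' h4 h3Δ)
  have h4 := prod_cubSym_eq_one hk3 hc hcd hd
    ((normalizedFactors (Ideal.span {((c + d * t : ℤ) : 𝓞 ℚ)})).map Ideal.absNorm +
      (normalizedFactors (Ideal.span {((c + d * -t : ℤ) : 𝓞 ℚ)})).map Ideal.absNorm)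
    (by
      intro p hp
      rw [Multiset.mem_add, Multiset.mem_map, Multiset.mem_map] at hp
      rcases hp with ⟨P, hP, rfl⟩ | ⟨P, hP, rfl⟩
      · exact (ratPrime_eq_cubSym ι hk3 ht hc hcd (h0 _ ht) hP).1
      · exact (ratPrime_eq_cubSym ι hk3 ht' hc hcd (h0 _ ht') hP).1)
    (by
      rw [Multiset.prod_add, ← map_multiset_prod, ← map_multiset_prod,
        Ideal.prod_normalizedFactors_eq_self (h0 _ ht),
        Ideal.prod_normalizedFactors_eq_self (h0 _ ht'), absNorm_span_intCast_rat,
        absNorm_span_intCast_rat, ← Int.natAbs_mul, ← ht]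
      congr 1
      ring)
  rw [ratChar, ratChar, primeHom_apply _ (h0 _ ht), primeHom_apply _ (h0 _ ht'),
    Multiset.map_congr rfl fun P hP => (ratPrime_eq_cubSym ι hk3 ht hc hcd (h0 _ ht) hP).2,
    Multiset.map_congr rfl fun P hP => (ratPrime_eq_cubSym ι hk3 ht' hc hcd (h0 _ ht') hP).2,
    ← Multiset.prod_add, ← Multiset.map_add, ← map_one ι, ← h4, map_multiset_prod, ← Multiset.map_add,
    Multiset.map_map, Multiset.map_map]
  rfl

theorem ratChar_mul_ratChar_self (ι : Eis →+* ℂ) (hk3 : 3 ∣ k) (ht : t ^ 2 = dsc k T)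
    (h2 : 2 ∣ dsc k T) {g : ℤ} (hg : IsCoprime g (dsc k T)) :
    ratChar ι k T t g * ratChar ι k T (-t) g = 1 := by
  have key : ∀ n : ℕ, IsCoprime (n : ℤ) (dsc k T) →
      ratChar ι k T t n * ratChar ι k T (-t) n = 1 := by
    intro n
    induction n using induction_on_primes with
    | zero =>
      intro h0
      rw [Nat.cast_zero, isCoprime_zero_left] at h0
      exact absurd (isUnit_of_dvd_unit h2 h0) (by decide)
    | one =>
      intro _
      rw [Nat.cast_one, ratChar_one, ratChar_one, one_mul]
    | prime_mul p a hp ih =>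
      intro hpa
      rw [Nat.cast_mul] at hpa
      rw [Nat.cast_mul, ratChar_mul, ratChar_mul, mul_mul_mul_comm, ih hpa.of_mul_left_right, mul_one]
      have hpΔ : ¬ (p : ℤ) ∣ dsc k T := fun h3 =>
        (Nat.prime_iff_prime_int.mp hp).not_isUnit (hpa.of_mul_left_left.isUnit_of_dvd' dvd_rfl h3)
      have hP : Ideal.span {(p : 𝓞 ℚ)} ∈ primesAbove ℚ p := by rw [primesAbove_rat hp]; simp
      rw [ratChar, ratChar, Int.cast_natCast,
        primeHom_prime _ (isPrime_of_mem_primesAbove hp hP) (ne_bot_of_mem_primesAbove hp hP),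
        primeHom_prime _ (isPrime_of_mem_primesAbove hp hP) (ne_bot_of_mem_primesAbove hp hP),
        ratPrime_of_not_dvd ι hp hP hpΔ, ratPrime_of_not_dvd ι hp hP hpΔ, ← map_mul,
        cubSym_rt_mul_cubSym_rt hk3 hp hpΔ (by rw [ht, sub_self]; exact dvd_zero _), map_one]
  rcases Int.natAbs_eq g with h3 | h3
  · rw [h3] at hg ⊢
    exact key _ hg
  · rw [h3] at hg ⊢
    rw [ratChar_neg, ratChar_neg]
    exact key _ ((IsCoprime.neg_left_iff _ _).mp hg)

theorem ratChar_mul_ratChar (ι : Eis →+* ℂ) (hk3 : 3 ∣ k) (ht : t ^ 2 = dsc k T)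
    (h2 : 2 ∣ dsc k T) {c d : ℤ} (hc : IsCoprime c (dsc k T)) (hd : ¬ 3 ∣ d) :
    ratChar ι k T t (c + d * t) * ratChar ι k T (-t) (c + d * -t) = 1 := by
  have hd0 : d ≠ 0 := by rintro rfl; exact hd (dvd_zero 3)
  obtain ⟨g, c', d', hcop, rfl, rfl⟩ : ∃ g c' d' : ℤ, IsCoprime c' d' ∧ c = g * c' ∧ d = g * d' := by
    have hg : 0 < Int.gcd c d := Int.gcd_pos_of_ne_zero_right _ hd0
    obtain ⟨c', d', h3, h4, h5⟩ := Int.exists_gcd_one hg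
    exact ⟨Int.gcd c d, c', d', Int.isCoprime_iff_gcd_eq_one.mpr h3, by rw [mul_comm]; exact h4,
      by rw [mul_comm]; exact h5⟩
  rw [mul_assoc g d' t, ← mul_add, mul_assoc g d' (-t), ← mul_add, ratChar_mul, ratChar_mul,
    mul_mul_mul_comm, ratChar_mul_ratChar_self ι hk3 ht h2 hc.of_mul_left_left, one_mul]
  exact ratChar_mul_ratChar_of_isCoprime ι hk3 ht hc.of_mul_left_right hcop
    fun h4 => hd (h4.mul_left g)

theorem ratChar_eq_one (ι : Eis →+* ℂ) (hk3 : 3 ∣ k) (ht : t ^ 2 = dsc k T)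
    (h2 : 2 ∣ dsc k T) (y : ℤ) : ratChar ι k T t (1 + dsc k T ^ 4 * y) = 1 := by
  have h3Δ : (3 : ℤ) ∣ dsc k T := by
    rw [dsc, pow_two, mul_assoc]; exact hk3.mul_right _
  have h3t : (3 : ℤ) ∣ t := Int.prime_three.dvd_of_dvd_pow (ht ▸ h3Δ)
  obtain ⟨e, he⟩ : (2 : ℤ) ∣ t := Int.prime_two.dvd_of_dvd_pow (ht ▸ h2)
  set w := e * t ^ 6 * y with hw
  have hn : 1 + dsc k T ^ 4 * y = 1 + 2 * t * w := by
    rw [hw, ← ht, he]; ring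
  have h1 := ratChar_mul_ratChar ι hk3 ht h2 (c := 1) (d := 1) isCoprime_one_left (by decide)
  have h4 := ratChar_mul_ratChar ι hk3 ht h2 (c := 1 + t * w + w * dsc k T) (d := 1 + t * w + w)
    (by
      rw [← ht]
      exact IsCoprime.pow_right ⟨1, -(w + w * t), by ring⟩)
    (by
      intro h5
      have h6 : (3 : ℤ) ∣ t * w + w := by
        refine dvd_add (h3t.mul_right w) ?_
        exact ((h3t.pow (n := 6) (by norm_num)).mul_left e).mul_right y
      rw [add_assoc] at h5
      exact absurd ((Int.dvd_add_left h6).mp h5) (by decide))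
  have h5 : 1 + t * w + w * dsc k T + (1 + t * w + w) * t =
      (1 + dsc k T ^ 4 * y) * (1 + 1 * t) := by
    rw [hn, ← ht]; ring
  have h6 : 1 + t * w + w * dsc k T + (1 + t * w + w) * -t = 1 + 1 * -t := by
    rw [← ht]; ring
  rw [h5, h6, ratChar_mul, mul_assoc, h1, mul_one] at h4
  exact h4

theorem exists_dirichlet_ratPrime (ι : Eis →+* ℂ) (hk3 : 3 ∣ k) (h0 : dsc k T ≠ 0)
    (ht : t ^ 2 = dsc k T) (h2 : 2 ∣ dsc k T) :
    ∃ D₀ D : ℂ → ℂ, (∀ s : ℂ, 0 < s.re → DifferentiableAt ℂ D₀ s) ∧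
      (∀ s : ℂ, 1 < s.re → D s ≠ 0 ∧ D₀ s = (1 - s) * D s) ∧
      ∀ s : ℂ, 1 < s.re → HasProd (fun p : Nat.Primes =>
        1 - (if ((p : ℕ) : ℤ) ∣ dsc k T then 0 else ι (cubSym p (rt k T + (t : Eis)))) *
          ((p : ℕ) : ℂ) ^ (-s)) (D s)⁻¹ := by
  have hcast : ((((dsc k T).natAbs ^ 4 : ℕ) : 𝓞 ℚ)) = ((dsc k T ^ 4 : ℤ) : 𝓞 ℚ) := by
    have h1 : (((dsc k T).natAbs ^ 4 : ℕ) : ℤ) = dsc k T ^ 4 := by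
      rw [Nat.cast_pow, Int.natCast_natAbs, Even.pow_abs (by decide)]
    rw [← h1, Int.cast_natCast]
  have hm0 : ((dsc k T ^ 4 : ℤ) : 𝓞 ℚ) ≠ 0 := by
    rw [Int.cast_ne_zero]; exact pow_ne_zero 4 h0
  have hm1 : ¬ IsUnit ((dsc k T ^ 4 : ℤ) : 𝓞 ℚ) := by
    rw [← Ideal.span_singleton_eq_top, ← Ideal.absNorm_eq_one_iff, absNorm_span_intCast_rat]
    intro h1
    have h4 := Int.isUnit_iff_natAbs_eq.mpr h1
    exact absurd (isUnit_of_dvd_unit h2 ((isUnit_pow_iff four_ne_zero).mp h4)) (by decide)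
  obtain ⟨D₀, D, hD₀, hD, hE⟩ := exists_dirichlet_of_rayClassCharacter (F := ℚ)
    (χ := primeHom (ratPrime ι k T t)) (m := (dsc k T).natAbs ^ 4)
    (pow_ne_zero 4 (Int.natAbs_ne_zero.mpr h0))
    (norm_primeHom_le fun P hP h0 => norm_ratPrime_le ι hk3 ht hP h0) (primeHom_bot _)
    (by
      rw [hcast]
      refine primeHom_ne_zero_iff _ hm0 hm1 fun P hP h0 => ?_
      rw [ratPrime_eq_zero_iff ι hk3 ht hP h0, Int.cast_pow]
      exact (hP.pow_mem_iff_mem 4 (by norm_num)).symm)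
    (by
      intro x hx
      rw [hcast] at hx
      obtain ⟨y, hy⟩ := hx
      obtain ⟨y, rfl⟩ := exists_intCast_eq y
      have hx : x = ((1 + dsc k T ^ 4 * y : ℤ) : 𝓞 ℚ) := by
        rw [sub_eq_iff_eq_add.mp hy]; push_cast; ring
      rw [hx]
      exact ratChar_eq_one ι hk3 ht h2 y)
  refine ⟨D₀, D, hD₀, hD, fun s hs => (congrArg (HasProd · _) (funext ?_)).mp (hE s hs)⟩
  rintro ⟨p, hp⟩
  dsimp only
  have hP : Ideal.span {(p : 𝓞 ℚ)} ∈ primesAbove ℚ p := by rw [primesAbove_rat hp]; simp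
  rw [primesAbove_rat hp, Finset.prod_singleton,
    primeHom_prime _ (isPrime_of_mem_primesAbove hp hP) (ne_bot_of_mem_primesAbove hp hP),
    absNorm_of_mem_primesAbove_rat hp hP]
  split_ifs with hpΔ
  · rw [ratPrime_of_dvd ι hp hP hpΔ]
  · rw [ratPrime_of_not_dvd ι hp hP hpΔ]

theorem hasCubicFactors_of_sq (hk3 : 3 ∣ k) (h0 : dsc k T ≠ 0) (ht : t ^ 2 = dsc k T)
    (h2 : 2 ∣ dsc k T) : HasCubicFactors k T := by
  obtain ⟨ι⟩ := nonempty_hom_of_isAlgClosed ℂ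
  obtain ⟨A₀, A, hA₀, hA, hAE⟩ := exists_dirichlet_ratPrime ι hk3 h0 ht h2
  obtain ⟨B₀, B, hB₀, hB, hBE⟩ := exists_dirichlet_ratPrime ι hk3 h0 (t := -t) (by rw [neg_sq, ht]) h2
  refine ⟨fun s => A₀ s * B₀ s, fun s => A s * B s, 2, _,
    fun s hs => (hA₀ s hs).mul (hB₀ s hs),
    fun s hs => ⟨mul_ne_zero (hA s hs).1 (hB s hs).1, ?_⟩,
    fun s hs => (mul_inv (A s) (B s)) ▸ (hAE s hs).mul (hBE s hs), ?_⟩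
  · simp only
    rw [(hA s hs).2, (hB s hs).2]
    ring
  rintro ⟨p, hp⟩ s hs
  have : Fact p.Prime := ⟨hp⟩
  dsimp only
  refine ⟨fun hpΔ => ?_, fun hpΔ h => ?_, fun u hpΔ hu => ?_⟩
  · simp [hpΔ]
  · exact absurd (by rw [ht, sub_self]; exact dvd_zero _) (h t)
  · have hp3 := ne_three_of_not_dvd_dsc hk3 hpΔ
    have hcongr : ∀ x y : ℤ, (p : ℤ) ∣ x - y →
        cubSym p (rt k T + (x : Eis)) = cubSym p (rt k T + (y : Eis)) := by
      rintro x y ⟨v, hv⟩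
      apply cubSym_congr hp3
      refine ⟨(v : Eis), ?_⟩
      rw [add_sub_add_left_eq_sub, ← Int.cast_sub, hv]
      push_cast
      rfl
    have key := one_sub_mul_one_sub ι (cubSym_pow_three hp3 (not_dvd_norm_rt_add hp hpΔ hu))
      (cubSym_rt_mul_cubSym_rt hk3 hp hpΔ hu) ((p : ℂ) ^ (-s))
    rw [if_neg hpΔ, if_neg hpΔ, ← key]
    have h5 : (p : ℤ) ∣ (u - t) * (u + t) := by
      rw [← ht] at hu
      rwa [show (u - t) * (u + t) = u ^ 2 - t ^ 2 by ring]
    rcases (Nat.prime_iff_prime_int.mp hp).dvd_or_dvd h5 with h6 | h6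
    · rw [hcongr u t h6, hcongr (-u) (-t) (by rw [← neg_sub', dvd_neg]; exact h6)]
    · rw [hcongr u (-t) (by rwa [sub_neg_eq_add]), hcongr (-u) t (by
        rw [← neg_add', dvd_neg]; exact h6), mul_comm]

end CyclicDirichlet

section DepressedCubic

open Eis

theorem exists_roots_of_root {F : Type*} [Field F] {a c T t : F} (ha : a ^ 3 = 3 * c * a + T)
    (ht : t ^ 2 = (12 * c ^ 3) ^ 2 * (12 * c ^ 3 - 3 * T ^ 2)) (ht0 : t ≠ 0) :
    ∃ x y : F, (a ≠ x ∧ a ≠ y ∧ x ≠ y) ∧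
      a + x + y = 0 ∧ a * x + a * y + x * y = -(3 * c) ∧ a * x * y = T := by
  have hk : (12 * c ^ 3 : F) ≠ 0 := by
    intro h
    rw [h] at ht
    exact ht0 (by simpa using ht)
  have h12 : (12 : F) ≠ 0 := left_ne_zero_of_mul hk
  have hc : c ≠ 0 := fun h => hk (by simp [h])
  have h2 : (2 : F) ≠ 0 := fun h => h12 (by linear_combination 6 * h)
  have h4 : (4 : F) ≠ 0 := fun h => h12 (by linear_combination 3 * h)
  have hT : T = a ^ 3 - 3 * c * a := by linear_combination -ha
  have hq' : t ^ 2 = (4 * c ^ 3) ^ 2 * (12 * c - 3 * a ^ 2) * (3 * a ^ 2 - 3 * c) ^ 2 := by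
    rw [ht, hT]; ring
  have hq : 3 * a ^ 2 - 3 * c ≠ 0 := by
    intro h
    rw [h] at hq'
    exact ht0 (by simpa using hq')
  have hd : 4 * c ^ 3 * (3 * a ^ 2 - 3 * c) ≠ 0 := mul_ne_zero (mul_ne_zero h4 (pow_ne_zero _ hc)) hq
  obtain ⟨v, hv⟩ : ∃ v, v * (4 * c ^ 3 * (3 * a ^ 2 - 3 * c)) = t :=
    ⟨t / _, div_mul_cancel₀ _ hd⟩
  have hv0 : v ≠ 0 := by
    rintro rfl
    exact ht0 (by rw [← hv, zero_mul])
  have hv2 : v ^ 2 = 12 * c - 3 * a ^ 2 := by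
    apply mul_right_cancel₀ (pow_ne_zero 2 hd)
    rw [← mul_pow, hv, hq']; ring
  obtain ⟨x, hx⟩ : ∃ x, x * 2 = -a + v := ⟨_ / _, div_mul_cancel₀ _ h2⟩
  have hy : ∀ y, y = -a - x → y * 2 = -a - v := by
    rintro y rfl
    linear_combination -hx
  have hvx : v = 2 * x + a := by linear_combination -hx
  have hxx : x ^ 2 + a * x + a ^ 2 = 3 * c := by
    apply mul_left_cancel₀ h4
    rw [hvx] at hv2
    linear_combination hv2
  refine ⟨x, -a - x, ⟨?_, ?_, ?_⟩, by ring, by linear_combination -hxx, ?_⟩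
  · rintro rfl
    exact hq (by linear_combination hxx)
  · intro h
    apply hq
    have h5 : x = -2 * a := by linear_combination h
    rw [h5] at hxx
    linear_combination hxx
  · intro h
    exact hv0 (by rw [hvx]; linear_combination h)
  · rw [hT]
    linear_combination -a * hxx

variable {R : Type*} [Field R] {p : ℕ} [Fact p.Prime] [CharP R p] {c T : ℤ}

theorem exists_intCast_eq_of_pow_eq {x : R} (h : x ^ p = x) : ∃ n : ℤ, (n : R) = x :=
  (mem_bot_iff_intCast p R).mp ((Subfield.mem_bot_iff_pow_eq_self R p).mpr h)

include p in
theorem intCast_pow_card (n : ℤ) : (n : R) ^ p = n :=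
  (Subfield.mem_bot_iff_pow_eq_self R p).mp ((mem_bot_iff_intCast p R).mpr ⟨n, rfl⟩)

theorem pow_card_root {x : R} (h : x ^ 3 = 3 * c * x + T) :
    (x ^ p) ^ 3 = 3 * c * x ^ p + T := by
  have h1 := congrArg (frobenius R p) h
  rw [map_add, map_mul, map_mul, map_pow, map_ofNat, map_intCast, map_intCast] at h1
  simpa only [frobenius_def] using h1

theorem exists_int_root_of_pow_sq {x : R} (h : x ^ 3 = 3 * c * x + T) (hx : (x ^ p) ^ p = x) :
    ∃ n : ℤ, (n : R) ^ 3 = 3 * c * n + T := by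
  by_cases h0 : x ^ p = x
  · obtain ⟨n, rfl⟩ := exists_intCast_eq_of_pow_eq h0
    exact ⟨n, h⟩
  · have hy := pow_card_root (p := p) h
    set y := x ^ p with hydef
    have h1 : x ^ 2 + x * y + y ^ 2 = 3 * c := by
      apply mul_left_cancel₀ (sub_ne_zero.mpr h0)
      linear_combination hy - h
    have h2 : (-(x + y)) ^ p = -(x + y) := by
      have h3 : frobenius R p (-(x + y)) = -(x + y) := by
        rw [map_neg, map_add, frobenius_def, frobenius_def, hx, ← hydef, add_comm]
      exact h3
    obtain ⟨n, hn⟩ := exists_intCast_eq_of_pow_eq h2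
    refine ⟨n, ?_⟩
    rw [hn]
    linear_combination h - (2 * x + y) * h1

include p in
theorem exists_sq_eq_of_no_int_root [IsAlgClosed R]
    (h : ∀ n : ℤ, (n : R) ^ 3 ≠ 3 * c * n + T) :
    ∃ t : ℤ, (t : R) ^ 2 = ((dsc (12 * c ^ 3) T : ℤ) : R) := by
  obtain ⟨x, hx⟩ : ∃ x : R, x ^ 3 = 3 * c * x + T := by
    have hdeg : (Polynomial.X ^ 3 - Polynomial.C (3 * (c : R)) * Polynomial.X -
        Polynomial.C (T : R)).degree ≠ 0 := by
      have : (Polynomial.X ^ 3 - Polynomial.C (3 * (c : R)) * Polynomial.X -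
        Polynomial.C (T : R)).degree = 3 := by compute_degree!
      rw [this]; norm_num
    obtain ⟨x, hx⟩ := IsAlgClosed.exists_root _ hdeg
    refine ⟨x, ?_⟩
    simp only [Polynomial.IsRoot, Polynomial.eval_sub, Polynomial.eval_pow, Polynomial.eval_X,
      Polynomial.eval_mul, Polynomial.eval_C] at hx
    linear_combination hx
  have hy := pow_card_root (p := p) hx
  have hz := pow_card_root (p := p) hy
  have hxy : x ^ p ≠ x := by
    intro h0
    obtain ⟨n, rfl⟩ := exists_intCast_eq_of_pow_eq h0
    exact h n hx
  have hxz : (x ^ p) ^ p ≠ x := by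
    intro h0
    obtain ⟨n, hn⟩ := exists_int_root_of_pow_sq hx h0
    exact h n hn
  have hyz : (x ^ p) ^ p ≠ x ^ p := fun h0 => hxy (frobenius_inj R p h0)
  set y := x ^ p with hydef
  set z := y ^ p with hzdef
  have h1 : x ^ 2 + x * y + y ^ 2 = 3 * c := by
    apply mul_left_cancel₀ (sub_ne_zero.mpr hxy)
    linear_combination hy - hx
  have h2 : x ^ 2 + x * z + z ^ 2 = 3 * c := by
    apply mul_left_cancel₀ (sub_ne_zero.mpr hxz)
    linear_combination hz - hx
  have h3 : z = -(x + y) := by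
    have : x + y + z = 0 := by
      apply mul_left_cancel₀ (sub_ne_zero.mpr hyz)
      linear_combination h2 - h1
    linear_combination this
  have h4 : z ^ p = x := by
    have h5 : frobenius R p z = -(y + z) := by
      rw [h3, map_neg, map_add, frobenius_def, frobenius_def, ← hydef, ← hzdef, h3]
    rw [← frobenius_def, h5, h3]; ring
  have h6 : ((4 * c ^ 3 : ℤ) * ((x - y) * (y - z) * (z - x))) ^ p =
      (4 * c ^ 3 : ℤ) * ((x - y) * (y - z) * (z - x)) := by
    have h7 : frobenius R p ((4 * c ^ 3 : ℤ) * ((x - y) * (y - z) * (z - x))) =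
        (4 * c ^ 3 : ℤ) * ((y - z) * (z - x) * (x - y)) := by
      rw [map_mul, map_mul, map_mul, map_sub, map_sub, map_sub, map_intCast]
      simp only [frobenius_def]
      rw [← hydef, ← hzdef, h4]
    rw [← frobenius_def, h7]; ring
  obtain ⟨t, ht⟩ := exists_intCast_eq_of_pow_eq h6
  refine ⟨t, ?_⟩
  have hT : (T : R) = x ^ 3 - 3 * c * x := by linear_combination -hx
  rw [ht, dsc]
  push_cast
  rw [hT, h3]
  have h8 : ((x - y) * (y - -(x + y)) * (-(x + y) - x)) ^ 2 =
      4 * (x ^ 2 + x * y + y ^ 2) ^ 3 -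
      27 * (x ^ 3 - (x ^ 2 + x * y + y ^ 2) * x) ^ 2 := by ring
  rw [mul_pow, h8, h1]
  ring

variable (φ : Eis →+* R)

include φ in
theorem cubSym_eq_one_iff [IsAlgClosed R] {t : ℤ} (hp : ¬ (p : ℤ) ∣ dsc (12 * c ^ 3) T)
    (ht : (p : ℤ) ∣ t ^ 2 - dsc (12 * c ^ 3) T) :
    cubSym p (rt (12 * c ^ 3) T + (t : Eis)) = 1 ↔ ∃ n : ℤ, (n : R) ^ 3 = 3 * c * n + T := by
  have hpp : p.Prime := Fact.out
  have hk3 : (3 : ℤ) ∣ 12 * c ^ 3 := ⟨4 * c ^ 3, by ring⟩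
  have hp3 := ne_three_of_not_dvd_dsc hk3 hp
  have hpk := not_dvd_of_not_dvd_dsc hp
  obtain ⟨hz3, hz⟩ := cubSym_spec φ hp3 (not_dvd_norm_rt_add hpp hp ht)
  set e := rt (12 * c ^ 3) T + (t : Eis) with hedef
  set z := cubSym p e
  have hkR : (12 * (c : R) ^ 3) ≠ 0 := by
    intro h
    apply hpk
    rw [← CharP.intCast_eq_zero_iff R p]
    push_cast
    exact h
  have hcR : (c : R) ≠ 0 := fun h => hkR (by simp [h])
  have h12 : (12 : R) ≠ 0 := left_ne_zero_of_mul hkR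
  have h2 : (2 : R) ≠ 0 := fun h => h12 (by linear_combination 6 * h)
  have h3 : (3 : R) ≠ 0 := fun h => h12 (by linear_combination 4 * h)
  set η := φ (1 + 2 * w) with hη
  have hη2 : η ^ 2 = -3 := by
    rw [hη, ← map_pow]
    have : (1 + 2 * w) ^ 2 = (-3 : Eis) := by linear_combination 4 * w_sq
    rw [this, map_neg, map_ofNat]
  have hη0 : η ≠ 0 := by
    intro h
    rw [h] at hη2
    exact h3 (by linear_combination hη2)
  have hη' : η = 1 + 2 * φ w := by rw [hη, map_add, map_mul, map_one, map_ofNat]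
  have hrt : φ (rt (12 * c ^ 3) T) = 12 * c ^ 3 * T * η := by
    rw [map_eq_re_add, rt, hη']; push_cast; ring
  have he : φ e = 12 * c ^ 3 * T * η + t := by rw [hedef, map_add, hrt, map_intCast]
  have hse : φ (star e) = -(12 * c ^ 3 * T * η) + t := by
    rw [hedef, star_add, star_rt, map_add, map_neg, hrt, star_intCast, map_intCast]
  have htR : (t : R) ^ 2 = (12 * c ^ 3) ^ 2 * (12 * c ^ 3 - 3 * T ^ 2) := by
    have h := (CharP.intCast_eq_zero_iff R p _).mpr ht
    rw [dsc] at h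
    push_cast at h
    linear_combination h
  have hm : 2 * η * (12 * c ^ 3) ≠ 0 := mul_ne_zero (mul_ne_zero h2 hη0) hkR
  obtain ⟨β, hβ⟩ := IsAlgClosed.exists_pow_nat_eq (φ e / (2 * η * (12 * c ^ 3))) (n := 3) (by norm_num)
  rw [eq_div_iff hm] at hβ
  have hprod : φ e * φ (star e) = (12 * c ^ 3) ^ 3 := by
    rw [he, hse]
    linear_combination htR - (12 * c ^ 3 * T) ^ 2 * hη2
  have hβ0 : β ≠ 0 := by
    rintro rfl
    apply pow_ne_zero 3 hkR
    rw [← hprod, ← hβ]; ring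
  obtain ⟨γ, hγ⟩ : ∃ γ, γ * β = c := ⟨_ / _, div_mul_cancel₀ _ hβ0⟩
  have hγ3 : γ ^ 3 * (2 * η * (12 * c ^ 3)) = - φ (star e) := by
    apply mul_right_cancel₀ (mul_ne_zero (pow_ne_zero 3 hβ0) hm)
    have h5 : γ ^ 3 * (2 * η * (12 * c ^ 3)) * (β ^ 3 * (2 * η * (12 * c ^ 3))) =
      (γ * β) ^ 3 * (2 * η * (12 * c ^ 3)) ^ 2 := by ring
    rw [h5, hγ, hβ, neg_mul, mul_comm (φ (star e)), hprod]
    linear_combination (4 * c ^ 3 * (12 * c ^ 3) ^ 2 : R) * hη2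
  have hsum : β ^ 3 + γ ^ 3 = T := by
    apply mul_right_cancel₀ hm
    rw [add_mul, hβ, hγ3, he, hse]; ring
  have hroot : ∀ ζ : R, ζ ^ 3 = 1 →
      (ζ * β + ζ ^ 2 * γ) ^ 3 = 3 * c * (ζ * β + ζ ^ 2 * γ) + T := by
    intro ζ hζ
    rw [← hsum, ← hγ]
    linear_combination (β ^ 3 + (ζ ^ 3 + 1) * γ ^ 3 + 3 * β * γ * (ζ * β + ζ ^ 2 * γ)) * hζ
  have hG : ∀ n : ℤ, (n : R) ^ p ^ 2 = n := by
    intro n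
    rw [pow_two p, pow_mul, intCast_pow_card, intCast_pow_card]
  have hG' : ∀ x : R, x ≠ 0 → x ^ p ^ 2 = x → x ^ (p ^ 2 - 1) = 1 := by
    intro x hx h
    apply mul_right_cancel₀ hx
    rw [← pow_succ, Nat.sub_add_cancel (Nat.one_le_pow _ _ hpp.pos), h, one_mul]
  have hη1 : η ^ p ^ 2 = η := map_pow_sq φ hp3 _
  have he1 : φ e ^ p ^ 2 = φ e := map_pow_sq φ hp3 _
  have hm1 : (2 * η * (12 * c ^ 3)) ^ p ^ 2 = 2 * η * (12 * c ^ 3) := by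
    have h5 := hG (2 * (12 * c ^ 3))
    push_cast at h5
    have h6 : 2 * η * (12 * c ^ 3) = 2 * (12 * c ^ 3) * η := by ring
    rw [h6, mul_pow, h5, hη1]
  have hβ3 : (β ^ 3) ^ p ^ 2 = β ^ 3 := by
    apply mul_right_cancel₀ hm
    rw [hβ]
    rw [← hm1, ← mul_pow, hβ, he1]
  have hN3 : (p ^ 2 - 1) / 3 * 3 = p ^ 2 - 1 := by
    apply Nat.div_mul_cancel
    have h0 : p % 3 ≠ 0 := by
      intro h
      exact hp3 ((Nat.prime_dvd_prime_iff_eq Nat.prime_three hpp).mp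
        (Nat.dvd_of_mod_eq_zero h)).symm
    have h5 : p ^ 2 % 3 = 1 := by
      rw [Nat.pow_mod]
      have : p % 3 = 1 ∨ p % 3 = 2 := by omega
      rcases this with h | h <;> rw [h]
    omega
  have hN2 : Even ((p ^ 2 - 1) / 3) := by
    have hp2 : p ≠ 2 := by
      rintro rfl
      exact h2 (by exact_mod_cast CharP.cast_eq_zero R 2)
    have h5 : Odd (p ^ 2) := (hpp.odd_of_ne_two hp2).pow
    obtain ⟨j, hj⟩ := h5
    rw [Nat.even_iff]
    omega
  set N := (p ^ 2 - 1) / 3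
  have key : γ ^ (p ^ 2 - 1) = φ z * β ^ (p ^ 2 - 1) := by
    apply mul_right_cancel₀ (pow_ne_zero N hm)
    rw [← hN3, mul_comm N 3, pow_mul, pow_mul, ← mul_pow, hγ3, mul_assoc, ← mul_pow, hβ,
      hN2.neg_pow, hz]
  have hc1 : γ ^ (p ^ 2 - 1) * β ^ (p ^ 2 - 1) = 1 := by
    rw [← mul_pow, hγ]; exact hG' _ hcR (hG c)
  have hb3 : (β ^ (p ^ 2 - 1)) ^ 3 = 1 := by
    rw [← pow_mul, mul_comm, pow_mul]; exact hG' _ (pow_ne_zero 3 hβ0) hβ3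
  have hzb : φ z = β ^ (p ^ 2 - 1) := by
    rw [key] at hc1
    linear_combination β ^ (p ^ 2 - 1) * hc1 - φ z * hb3
  have hiff : z = 1 ↔ β ^ p ^ 2 = β := by
    constructor
    · intro h
      rw [h, map_one] at hzb
      rw [← Nat.sub_add_cancel (Nat.one_le_pow 2 p hpp.pos), pow_succ, ← hzb, one_mul]
    · intro h
      exact eq_one_of_map_eq_one φ hp3 hz3 (hzb.trans (hG' β hβ0 h))
  rw [hiff]
  constructor
  · intro h
    have hγ2 : γ ^ p ^ 2 = γ := by
      apply mul_right_cancel₀ hβ0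
      nth_rewrite 1 [← h]
      rw [← mul_pow, hγ, hG]
    have h6 : ((β + γ) ^ p) ^ p = β + γ := by
      rw [← pow_mul, ← pow_two]
      have : iterateFrobenius R p 2 (β + γ) = β + γ := by
        rw [map_add, iterateFrobenius_def, iterateFrobenius_def, h, hγ2]
      rwa [iterateFrobenius_def] at this
    exact exists_int_root_of_pow_sq (by simpa using hroot 1 (one_pow 3)) h6
  · rintro ⟨n, hn⟩
    have ht0 : (t : R) ≠ 0 := by
      intro h
      apply hp
      rw [← CharP.intCast_eq_zero_iff R p, dsc]
      rw [h] at htR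
      push_cast
      linear_combination -htR
    have hF : ((n : ZMod p)) ^ 3 = 3 * (c : ZMod p) * n + T := by
      have h6 : ((n ^ 3 - (3 * c * n + T) : ℤ) : R) = 0 := by push_cast; rw [hn]; ring
      rw [CharP.intCast_eq_zero_iff R p, ← CharP.intCast_eq_zero_iff (ZMod p) p] at h6
      push_cast at h6
      linear_combination h6
    have htF : (t : ZMod p) ^ 2 = (12 * (c : ZMod p) ^ 3) ^ 2 * (12 * c ^ 3 - 3 * T ^ 2) := by
      have h := (CharP.intCast_eq_zero_iff (ZMod p) p _).mpr ht
      rw [dsc] at h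
      push_cast at h
      linear_combination h
    have htF0 : (t : ZMod p) ≠ 0 := by
      intro h
      apply ht0
      rw [CharP.intCast_eq_zero_iff (ZMod p) p] at h
      exact (CharP.intCast_eq_zero_iff R p t).mpr h
    obtain ⟨x, y, -, hs1, hs2, hs3⟩ := exists_roots_of_root hF htF htF0
    let ι : ZMod p →+* R := ZMod.castHom (dvd_refl p) R
    have hι : ∀ u : ZMod p, ι u ^ p = ι u := by
      intro u
      rw [← map_pow, ZMod.pow_card]
    have hall : ∀ x₀ : R, x₀ ^ 3 = 3 * c * x₀ + T → x₀ ^ p ^ 2 = x₀ := by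
      intro x₀ hx₀
      have h1' := congrArg ι hs1
      have h2' := congrArg ι hs2
      have h3' := congrArg ι hs3
      simp only [map_add, map_mul, map_neg, map_ofNat, map_intCast, map_zero] at h1' h2' h3'
      have h7 : (x₀ - n) * ((x₀ - ι x) * (x₀ - ι y)) = 0 := by
        linear_combination hx₀ - x₀ ^ 2 * h1' + x₀ * h2' - h3'
      have h8 : x₀ ^ p = x₀ := by
        rcases mul_eq_zero.mp h7 with h9 | h9
        · rw [sub_eq_zero.mp h9, intCast_pow_card]
        · rcases mul_eq_zero.mp h9 with h9 | h9 <;> rw [sub_eq_zero.mp h9, hι]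
      rw [pow_two, pow_mul, h8, h8]
    have hw3 : φ w ^ 3 = 1 := by rw [← map_pow, w_cube, map_one]
    have hx₀ := hall _ (hroot 1 (one_pow 3))
    have hx₁ := hall _ (hroot (φ w) hw3)
    have hw1 : φ w ^ p ^ 2 = φ w := map_pow_sq φ hp3 _
    have hw2 := congrArg φ w_sq
    rw [map_pow, map_sub, map_neg, map_one] at hw2
    let G := iterateFrobenius R p 2
    have hGd : ∀ u : R, G u = u ^ p ^ 2 := fun u => iterateFrobenius_def p 2 u
    rw [← hGd, map_add, map_mul, map_mul, map_pow, hGd, hGd, hGd] at hx₀ hx₁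
    rw [hw1] at hx₁
    simp only [one_pow, one_mul] at hx₀
    have hne : φ w - φ w ^ 2 ≠ 0 := by
      rw [hw2]
      intro h
      apply hη0
      rw [hη']; linear_combination h
    apply mul_left_cancel₀ hne
    linear_combination hx₁ - φ w ^ 2 * hx₀

end DepressedCubic

section CubicField

open NumberField Polynomial RingOfIntegers Eis

variable {K : Type} [Field K] [NumberField K]

theorem natDegree_minpoly_eq_three (hK : Module.finrank ℚ K = 3) {x : 𝓞 K}
    (hx : ∀ n : ℤ, x ≠ (n : 𝓞 K)) : (minpoly ℤ x).natDegree = 3 := by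
  have hm := minpoly.monic (RingOfIntegers.isIntegral x)
  have h1 : minpoly ℚ (algebraMap (𝓞 K) K x) = (minpoly ℤ x).map (algebraMap ℤ ℚ) := by
    rw [← minpoly.algebraMap_eq (B := 𝓞 K) (B' := K) RingOfIntegers.coe_injective]
    exact minpoly.isIntegrallyClosed_eq_field_fractions' ℚ (RingOfIntegers.isIntegral_coe x)
  have h2 := minpoly.degree_dvd (K := ℚ) (x := algebraMap (𝓞 K) K x) (IsIntegral.of_finite ℚ _)
  rw [h1, natDegree_map_eq_of_injective (algebraMap ℤ ℚ).injective_int, hK,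
    Nat.dvd_prime Nat.prime_three] at h2
  refine h2.resolve_left fun h3 => ?_
  have h4 := hm.eq_X_add_C h3
  have h5 := minpoly.aeval ℤ x
  rw [h4] at h5
  apply hx (-(minpoly ℤ x).coeff 0)
  simp only [map_add, aeval_X, aeval_C] at h5
  rw [eq_intCast] at h5
  rw [Int.cast_neg]
  exact eq_neg_of_add_eq_zero_left h5

theorem eq_zero_of_aeval_eq_zero (hK : Module.finrank ℚ K = 3) {x : 𝓞 K}
    (hx : ∀ n : ℤ, x ≠ (n : 𝓞 K)) {q : ℤ[X]} (hq : q.natDegree < 3) (h : aeval x q = 0) :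
    q = 0 := by
  by_contra h0
  have h1 := natDegree_le_of_dvd
    (minpoly.isIntegrallyClosed_dvd (RingOfIntegers.isIntegral x) h) h0
  rw [natDegree_minpoly_eq_three hK hx] at h1
  omega

theorem eq_zero_of_quadratic_relation (hK : Module.finrank ℚ K = 3) {x : 𝓞 K}
    (hx : ∀ n : ℤ, x ≠ (n : 𝓞 K)) {a b d : ℤ}
    (h : (a : 𝓞 K) * x ^ 2 + (b : 𝓞 K) * x + (d : 𝓞 K) = 0) : a = 0 ∧ b = 0 := by
  have h1 := eq_zero_of_aeval_eq_zero hK hx (q := C a * X ^ 2 + C b * X + C d)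
    ((natDegree_quadratic_le).trans_lt (by norm_num)) (by
      simp only [map_add, map_mul, map_pow, aeval_X, aeval_C]
      simpa using h)
  have h2 := congrArg (fun q => coeff q 2) h1
  have h3 := congrArg (fun q => coeff q 1) h1
  simp only [coeff_add, coeff_C_mul, coeff_X_pow, coeff_X, coeff_C, coeff_zero] at h2 h3
  exact ⟨by simpa using h2, by simpa using h3⟩

theorem exists_ne_intCast (hK : Module.finrank ℚ K = 3) : ∃ x : 𝓞 K, ∀ n : ℤ, x ≠ (n : 𝓞 K) := by
  by_contra! h
  have h1 : Module.finrank ℤ (𝓞 K) ≤ 1 := finrank_le_one (1 : 𝓞 K) fun x => by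
    obtain ⟨n, hn⟩ := h x
    exact ⟨n, by rw [hn]; simp⟩
  rw [RingOfIntegers.rank, hK] at h1
  omega

/-- The cubic field `K` is generated by a root `θ` of the irreducible `X ^ 3 - 3 * c * X - T`. -/
structure IsCubicGen (c T : ℤ) (θ : 𝓞 K) : Prop where
  finrank : Module.finrank ℚ K = 3
  root : θ ^ 3 = 3 * (c : 𝓞 K) * θ + (T : 𝓞 K)
  ne_intCast : ∀ n : ℤ, θ ≠ (n : 𝓞 K)
  ne_zero : c ≠ 0

theorem exists_isCubicGen (hK : Module.finrank ℚ K = 3) :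
    ∃ (c T : ℤ) (θ : 𝓞 K), IsCubicGen c T θ := by
  obtain ⟨x, hx⟩ := exists_ne_intCast hK
  have hm := minpoly.monic (RingOfIntegers.isIntegral x)
  have hd := natDegree_minpoly_eq_three hK hx
  have h0 := minpoly.aeval ℤ x
  rw [aeval_eq_sum_range, hd] at h0
  have h3 : (minpoly ℤ x).coeff 3 = 1 := by rw [← hd]; exact hm.coeff_natDegree
  simp only [Finset.sum_range_succ, Finset.sum_range_zero, h3, zsmul_eq_mul] at h0
  generalize (minpoly ℤ x).coeff 0 = c₀ at h0
  generalize (minpoly ℤ x).coeff 1 = c₁ at h0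
  generalize (minpoly ℤ x).coeff 2 = c₂ at h0
  have hy : ∀ n : ℤ, 3 * x + (c₂ : 𝓞 K) ≠ n := by
    intro n hn
    have h1 := eq_zero_of_quadratic_relation hK hx (a := 0) (b := 3) (d := c₂ - n)
      (by push_cast; linear_combination hn)
    exact absurd h1.2 (by norm_num)
  have hroot : (3 * x + (c₂ : 𝓞 K)) ^ 3 =
      3 * ((c₂ ^ 2 - 3 * c₁ : ℤ) : 𝓞 K) * (3 * x + (c₂ : 𝓞 K)) +
      ((c₂ ^ 3 - 27 * c₀ - 3 * c₂ * (c₂ ^ 2 - 3 * c₁) : ℤ) : 𝓞 K) := by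
    push_cast at h0 ⊢
    linear_combination 27 * h0
  generalize 3 * x + (c₂ : 𝓞 K) = y at hy hroot
  generalize c₂ ^ 2 - 3 * c₁ = c at hroot
  generalize c₂ ^ 3 - 27 * c₀ - 3 * c₂ * c = T at hroot
  by_cases hc : c = 0
  · rw [hc] at hroot
    refine ⟨T, T + T ^ 2, y + y ^ 2, hK, ?_, ?_, ?_⟩
    · push_cast at hroot ⊢
      linear_combination (1 + 3 * y + 3 * y ^ 2 + y ^ 3 + T) * hroot
    · intro n hn
      have h1 := eq_zero_of_quadratic_relation hK hy (a := 1) (b := 1) (d := -n)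
        (by push_cast; linear_combination hn)
      exact absurd h1.1 one_ne_zero
    · rintro rfl
      apply hy 0
      simpa using hroot
  · exact ⟨c, T, y, hK, hroot, hy, hc⟩

namespace IsCubicGen

variable {c T : ℤ} {θ : 𝓞 K}

theorem discr_ne_zero (h : IsCubicGen c T θ) : T ^ 2 - 4 * c ^ 3 ≠ 0 := by
  intro h0
  have h1 : (2 * (c : 𝓞 K) * θ + T) ^ 2 * (c * θ - T) = 0 := by
    have h2 : (T : 𝓞 K) ^ 2 - 4 * (c : 𝓞 K) ^ 3 = 0 := by exact_mod_cast congrArg (Int.cast : ℤ → 𝓞 K) h0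
    linear_combination 4 * (c : 𝓞 K) ^ 3 * h.root - (3 * c * θ + T) * h2
  have h2 : ∀ a b : ℤ, (a : 𝓞 K) * θ + b = 0 → a = 0 := by
    intro a b hab
    exact (eq_zero_of_quadratic_relation h.finrank h.ne_intCast (a := 0) (b := a) (d := b)
      (by push_cast; linear_combination hab)).2
  rcases mul_eq_zero.mp h1 with h3 | h3
  · have := h2 (2 * c) T (by push_cast; exact pow_eq_zero_iff (two_ne_zero) |>.mp h3)
    exact h.ne_zero (by omega)
  · exact h.ne_zero (h2 c (-T) (by push_cast; linear_combination h3))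

theorem dsc_ne_zero (h : IsCubicGen c T θ) : dsc (12 * c ^ 3) T ≠ 0 := by
  have h1 : dsc (12 * c ^ 3) T = (12 * c ^ 3) ^ 2 * (-3 * (T ^ 2 - 4 * c ^ 3)) := by
    rw [dsc]; ring
  rw [h1]
  have := h.discr_ne_zero
  have := h.ne_zero
  positivity

theorem monic_cubic (c T : ℤ) : (X ^ 3 - C (3 * c) * X - C T : ℤ[X]).Monic := by monicity!

theorem natDegree_cubic (c T : ℤ) : (X ^ 3 - C (3 * c) * X - C T : ℤ[X]).natDegree = 3 := by
  compute_degree!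

theorem minpoly_eq (h : IsCubicGen c T θ) : minpoly ℤ θ = X ^ 3 - C (3 * c) * X - C T := by
  have h1 : minpoly ℤ θ ∣ X ^ 3 - C (3 * c) * X - C T :=
    minpoly.isIntegrallyClosed_dvd (RingOfIntegers.isIntegral θ) (by
      simp only [map_sub, map_mul, map_pow, aeval_X, aeval_C]
      simp only [algebraMap_int_eq, eq_intCast, Int.cast_ofNat]
      linear_combination h.root)
  have h2 := natDegree_minpoly_eq_three h.finrank h.ne_intCast
  exact (eq_of_monic_of_dvd_of_natDegree_le (minpoly.monic (RingOfIntegers.isIntegral θ))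
    (monic_cubic c T) h1 (by rw [h2, natDegree_cubic])).symm

theorem mem_conductor (h : IsCubicGen c T θ) :
    ((3 * (T ^ 2 - 4 * c ^ 3) : ℤ) : 𝓞 K) ∈ conductor ℤ θ := by
  refine mem_conductor_of_bezout (A := C 3 * (C (2 * c) * X - C T))
    (B := C (4 * c ^ 2) + C T * X - C (2 * c) * X ^ 2) h.minpoly_eq ?_ ?_
  · rw [natDegree_cubic, h.finrank]
  · simp only [derivative_X_pow, derivative_C, derivative_mul, derivative_X,
      map_mul, map_sub, map_pow, map_ofNat]
    simp
    ring

theorem not_dvd_exponent (h : IsCubicGen c T θ) {p : ℕ} (hp : p.Prime)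
    (hpΔ : ¬ (p : ℤ) ∣ dsc (12 * c ^ 3) T) : ¬ p ∣ exponent θ := by
  refine not_dvd_exponent_of_mem_conductor h.mem_conductor hp fun h4 => hpΔ ?_
  have h1 : dsc (12 * c ^ 3) T = 3 * (T ^ 2 - 4 * c ^ 3) * -(12 * c ^ 3) ^ 2 := by
    rw [dsc]; ring
  rw [h1]
  exact h4.mul_right _

theorem localZeta_eq (h : IsCubicGen c T θ) {p : ℕ} (hp : p.Prime)
    (hpΔ : ¬ (p : ℤ) ∣ dsc (12 * c ^ 3) T) (S : Finset ℤ[X])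
    (hS : X ^ 3 - C (3 * (c : ZMod p)) * X - C (T : ZMod p) =
      ∏ Q ∈ S, Q.map (Int.castRingHom (ZMod p)))
    (hmon : ∀ Q ∈ S, Q.Monic) (hirr : ∀ Q ∈ S, Irreducible (Q.map (Int.castRingHom (ZMod p))))
    (hinj : Set.InjOn (Polynomial.map (Int.castRingHom (ZMod p))) S) (s : ℂ) :
    localZeta K p s = ∏ Q ∈ S, (1 - ((p : ℂ) ^ (-s)) ^ Q.natDegree) := by
  have hmap : (minpoly ℤ θ).map (Int.castRingHom (ZMod p)) =
      X ^ 3 - C (3 * (c : ZMod p)) * X - C (T : ZMod p) := by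
    rw [h.minpoly_eq]
    have h1 : (X ^ 3 - C (3 * c) * X - C T : ℤ[X]).map (Int.castRingHom (ZMod p)) =
        X ^ 3 - C (Int.castRingHom (ZMod p) (3 * c)) * X - C (Int.castRingHom (ZMod p) T) := by
      simp only [Polynomial.map_sub, Polynomial.map_mul, Polynomial.map_pow, map_X, map_C]
    rw [h1, map_mul, map_ofNat, eq_intCast, eq_intCast]
  obtain ⟨h3, h4, h5⟩ := primesAbove_eq_image (θ := θ) hp (h.not_dvd_exponent hp hpΔ) S
    (hmap.trans hS) hmon hirr hinj
  rw [localZeta, h3, Finset.prod_image h4]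
  refine Finset.prod_congr rfl fun Q hQ => ?_
  rw [h5 Q hQ, Nat.cast_pow, ← natCast_cpow_natCast_mul, cpow_nat_mul]

end IsCubicGen

end CubicField

section CubicSplitting

open NumberField Polynomial RingOfIntegers Eis

theorem intCast_root_iff (R : Type*) [Field R] (p : ℕ) [Fact p.Prime] [CharP R p] (c T n : ℤ) :
    (n : R) ^ 3 = 3 * c * n + T ↔ (n : ZMod p) ^ 3 = 3 * (c : ZMod p) * n + T := by
  have h1 := CharP.intCast_eq_zero_iff R p (n ^ 3 - (3 * c * n + T))
  have h2 := CharP.intCast_eq_zero_iff (ZMod p) p (n ^ 3 - (3 * c * n + T))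
  push_cast at h1 h2
  rw [← sub_eq_zero, h1, ← h2, sub_eq_zero]

theorem intCast_sq_iff (R : Type*) [Field R] (p : ℕ) [CharP R p] (a t : ℤ) :
    (t : R) ^ 2 = (a : R) ↔ (p : ℤ) ∣ t ^ 2 - a := by
  rw [← CharP.intCast_eq_zero_iff R p, Int.cast_sub, Int.cast_pow, sub_eq_zero]

namespace IsCubicGen

variable {K : Type} [Field K] [NumberField K] {c T : ℤ} {θ : 𝓞 K}

theorem localZeta_of_not_sq (h : IsCubicGen c T θ) {p : ℕ} (hp : p.Prime)
    (hpΔ : ¬ (p : ℤ) ∣ dsc (12 * c ^ 3) T)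
    (ht : ∀ t : ℤ, ¬ (p : ℤ) ∣ t ^ 2 - dsc (12 * c ^ 3) T) (s : ℂ) :
    localZeta K p s = (1 - (p : ℂ) ^ (-s)) * (1 - ((p : ℂ) ^ (-s)) ^ 2) := by
  have : Fact p.Prime := ⟨hp⟩
  obtain ⟨n, hn⟩ : ∃ n : ℤ, (n : AlgebraicClosure (ZMod p)) ^ 3 = 3 * c * n + T := by
    by_contra! hno
    obtain ⟨t, ht'⟩ := exists_sq_eq_of_no_int_root (p := p) hno
    exact ht t ((intCast_sq_iff _ p _ t).mp ht')
  rw [intCast_root_iff _ p] at hn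
  have hd1 : (X - C n : ℤ[X]).natDegree = 1 := natDegree_X_sub_C n
  have hd2 : (X ^ 2 + C n * X + C (n ^ 2 - 3 * c) : ℤ[X]).natDegree = 2 := by compute_degree!
  have hm2 : (X ^ 2 + C n * X + C (n ^ 2 - 3 * c) : ℤ[X]).Monic := by monicity!
  have hne : (X - C n : ℤ[X]) ≠ X ^ 2 + C n * X + C (n ^ 2 - 3 * c) := by
    intro h0
    rw [h0, hd2] at hd1
    norm_num at hd1
  have hmap1 : (X - C n : ℤ[X]).map (Int.castRingHom (ZMod p)) = X - C (n : ZMod p) := by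
    simp only [Polynomial.map_sub, map_X, map_C]
    rw [eq_intCast]
  have hmap2 : (X ^ 2 + C n * X + C (n ^ 2 - 3 * c) : ℤ[X]).map (Int.castRingHom (ZMod p)) =
      X ^ 2 + C (n : ZMod p) * X + C ((n : ZMod p) ^ 2 - 3 * c) := by
    simp only [Polynomial.map_add, Polynomial.map_mul, Polynomial.map_pow, map_X, map_C]
    simp only [eq_intCast, Int.cast_sub, Int.cast_mul, Int.cast_pow, Int.cast_ofNat]
  have hM2 := hm2.map (Int.castRingHom (ZMod p))
  have hD2 := hm2.natDegree_map (Int.castRingHom (ZMod p))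
  rw [h.localZeta_eq hp hpΔ {X - C n, X ^ 2 + C n * X + C (n ^ 2 - 3 * c)} ?_ ?_ ?_ ?_,
    Finset.prod_pair hne, hd1, hd2, pow_one]
  · rw [Finset.prod_pair hne, hmap1, hmap2]
    have hT : (T : ZMod p) = (n : ZMod p) ^ 3 - 3 * c * n := by linear_combination -hn
    rw [hT]
    simp only [C_sub, C_mul, C_pow]
    ring
  · intro Q hQ
    rw [Finset.mem_insert, Finset.mem_singleton] at hQ
    rcases hQ with rfl | rfl
    · exact monic_X_sub_C n
    · exact hm2
  · intro Q hQ
    rw [Finset.mem_insert, Finset.mem_singleton] at hQ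
    rcases hQ with rfl | rfl
    · rw [hmap1]
      exact irreducible_X_sub_C _
    · rw [hM2.irreducible_iff_roots_eq_zero_of_degree_le_three (by rw [hD2, hd2])
        (by rw [hD2, hd2]; norm_num)]
      refine Multiset.eq_zero_of_forall_notMem fun u hu => ?_
      have hu := isRoot_of_mem_roots hu
      rw [hmap2] at hu
      simp only [IsRoot, eval_add, eval_mul, eval_pow, eval_X, eval_C] at hu
      obtain ⟨t, ht'⟩ := ZMod.intCast_surjective
        (4 * (c : ZMod p) ^ 3 * (3 * (n : ZMod p) ^ 2 - 3 * (c : ZMod p)) * (2 * u + (n : ZMod p)))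
      apply ht t
      rw [← intCast_sq_iff (ZMod p) p, ht', dsc]
      have hT : (T : ZMod p) = (n : ZMod p) ^ 3 - 3 * c * n := by linear_combination -hn
      push_cast
      rw [hT]
      linear_combination 64 * (c : ZMod p) ^ 6 * (3 * n ^ 2 - 3 * c) ^ 2 * hu
  · rw [Finset.coe_pair, Set.injOn_pair]
    intro h0
    have h1 := congrArg natDegree h0
    rw [hD2, hd2, hmap1, natDegree_X_sub_C] at h1
    norm_num at h1

theorem localZeta_of_sq (h : IsCubicGen c T θ) {p : ℕ} (hp : p.Prime) {t : ℤ}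
    (hpΔ : ¬ (p : ℤ) ∣ dsc (12 * c ^ 3) T)
    (ht : (p : ℤ) ∣ t ^ 2 - dsc (12 * c ^ 3) T) (s : ℂ) :
    localZeta K p s = if cubSym p (rt (12 * c ^ 3) T + (t : Eis)) = 1 then
      (1 - (p : ℂ) ^ (-s)) ^ 3 else 1 - ((p : ℂ) ^ (-s)) ^ 3 := by
  have : Fact p.Prime := ⟨hp⟩
  obtain ⟨φ⟩ := nonempty_hom_of_isAlgClosed (AlgebraicClosure (ZMod p))
  have hiff := cubSym_eq_one_iff φ hpΔ ht
  simp only [intCast_root_iff _ p] at hiff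
  split_ifs with hz
  · obtain ⟨a, ha⟩ := hiff.mp hz
    have htF : (t : ZMod p) ^ 2 = (12 * (c : ZMod p) ^ 3) ^ 2 * (12 * c ^ 3 - 3 * T ^ 2) := by
      rw [(intCast_sq_iff (ZMod p) p _ t).mpr ht, dsc]
      push_cast
      rfl
    have ht0 : (t : ZMod p) ≠ 0 := by
      intro h0
      apply hpΔ
      rw [← CharP.intCast_eq_zero_iff (ZMod p) p, ← (intCast_sq_iff (ZMod p) p _ t).mpr ht, h0]
      ring
    obtain ⟨x, y, ⟨hax, hay, hxy⟩, h1, h2, h3⟩ := exists_roots_of_root ha htF ht0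
    obtain ⟨b, rfl⟩ := ZMod.intCast_surjective x
    obtain ⟨d, rfl⟩ := ZMod.intCast_surjective y
    have hmap : ∀ n : ℤ, (X - C n : ℤ[X]).map (Int.castRingHom (ZMod p)) = X - C (n : ZMod p) := by
      intro n
      simp only [Polynomial.map_sub, map_X, map_C]
      rw [eq_intCast]
    have hinj : ∀ n m : ℤ, (X - C n : ℤ[X]).map (Int.castRingHom (ZMod p)) =
        (X - C m : ℤ[X]).map (Int.castRingHom (ZMod p)) → (n : ZMod p) = (m : ZMod p) := by
      intro n m h0
      rw [hmap, hmap] at h0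
      exact C_injective (sub_right_injective h0)
    have hne : ∀ {n m : ℤ}, (n : ZMod p) ≠ m → (X - C n : ℤ[X]) ≠ X - C m :=
      fun h0 h4 => h0 (hinj _ _ (congrArg _ h4))
    have hS : ∀ Q ∈ ({X - C a, X - C b, X - C d} : Finset ℤ[X]), ∃ n : ℤ, Q = X - C n := by
      intro Q hQ
      simp only [Finset.mem_insert, Finset.mem_singleton] at hQ
      rcases hQ with rfl | rfl | rfl
      exacts [⟨_, rfl⟩, ⟨_, rfl⟩, ⟨_, rfl⟩]
    have hprod : ∀ {M : Type} [CommMonoid M] (f : ℤ[X] → M),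
        ∏ Q ∈ ({X - C a, X - C b, X - C d} : Finset ℤ[X]), f Q =
          f (X - C a) * (f (X - C b) * f (X - C d)) := by
      intro M _ f
      rw [Finset.prod_insert, Finset.prod_pair (hne hxy)]
      simp only [Finset.mem_insert, Finset.mem_singleton, not_or]
      exact ⟨hne hax, hne hay⟩
    rw [h.localZeta_eq hp hpΔ {X - C a, X - C b, X - C d} ?_ ?_ ?_ ?_, hprod]
    · simp only [natDegree_X_sub_C]
      ring
    · rw [hprod, hmap, hmap, hmap]
      have h1' := congrArg C h1
      have h2' := congrArg C h2
      have h3' := congrArg C h3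
      simp only [C_add, C_mul, C_neg, C_0] at h1' h2' h3'
      rw [C_mul]
      linear_combination X ^ 2 * h1' - X * h2' + h3'
    · intro Q hQ
      obtain ⟨n, rfl⟩ := hS Q hQ
      exact monic_X_sub_C n
    · intro Q hQ
      obtain ⟨n, rfl⟩ := hS Q hQ
      rw [hmap]
      exact irreducible_X_sub_C _
    · intro Q hQ Q' hQ' hQQ
      simp only [Finset.coe_insert, Finset.coe_singleton, Set.mem_insert_iff,
        Set.mem_singleton_iff] at hQ hQ'
      rcases hQ with rfl | rfl | rfl <;> rcases hQ' with rfl | rfl | rfl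
      · rfl
      · exact absurd (hinj _ _ hQQ) hax
      · exact absurd (hinj _ _ hQQ) hay
      · exact absurd (hinj _ _ hQQ).symm hax
      · rfl
      · exact absurd (hinj _ _ hQQ) hxy
      · exact absurd (hinj _ _ hQQ).symm hay
      · exact absurd (hinj _ _ hQQ).symm hxy
      · rfl
  · have hno : ∀ n : ℤ, (n : ZMod p) ^ 3 ≠ 3 * (c : ZMod p) * n + T :=
      fun n hn => hz (hiff.mpr ⟨n, hn⟩)
    have hmap : (X ^ 3 - C (3 * c) * X - C T : ℤ[X]).map (Int.castRingHom (ZMod p)) =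
        X ^ 3 - C (3 * (c : ZMod p)) * X - C (T : ZMod p) := by
      simp only [Polynomial.map_sub, Polynomial.map_mul, Polynomial.map_pow, map_X, map_C]
      simp only [eq_intCast, Int.cast_mul, Int.cast_ofNat]
    have hM := (monic_cubic c T).map (Int.castRingHom (ZMod p))
    have hD := (monic_cubic c T).natDegree_map (Int.castRingHom (ZMod p))
    rw [natDegree_cubic] at hD
    rw [h.localZeta_eq hp hpΔ {X ^ 3 - C (3 * c) * X - C T} ?_ ?_ ?_ ?_, Finset.prod_singleton,
      natDegree_cubic]
    · rw [Finset.prod_singleton, hmap]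
    · intro Q hQ
      rw [Finset.mem_singleton] at hQ
      rw [hQ]
      exact monic_cubic c T
    · intro Q hQ
      rw [Finset.mem_singleton] at hQ
      rw [hQ]
      rw [hM.irreducible_iff_roots_eq_zero_of_degree_le_three (by rw [hD]; norm_num) (by rw [hD])]
      refine Multiset.eq_zero_of_forall_notMem fun u hu => ?_
      have hu := isRoot_of_mem_roots hu
      rw [hmap] at hu
      simp only [IsRoot, eval_sub, eval_mul, eval_pow, eval_X, eval_C] at hu
      obtain ⟨n, rfl⟩ := ZMod.intCast_surjective u
      exact hno n (by linear_combination hu)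
    · rw [Finset.coe_singleton]
      exact Set.injOn_singleton _ _

end IsCubicGen

end CubicSplitting

theorem hasCubicFactors_of_dsc_ne_zero {k T : ℤ} (hk3 : 3 ∣ k) (h2 : 2 ∣ Eis.dsc k T)
    (h0 : Eis.dsc k T ≠ 0) : HasCubicFactors k T := by
  by_cases h : ∃ t : ℤ, t ^ 2 = Eis.dsc k T
  · obtain ⟨t, ht⟩ := h
    exact hasCubicFactors_of_sq hk3 h0 ht h2
  · push Not at h
    obtain ⟨F, _, _, δ, hδ⟩ := exists_isSqrtGen h
    exact hδ.hasCubicFactors hk3 h2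

theorem finite_primes_dvd {n : ℤ} (hn : n ≠ 0) : {p : Nat.Primes | ((p : ℕ) : ℤ) ∣ n}.Finite := by
  refine Set.Finite.of_injOn (f := fun p : Nat.Primes => (p : ℕ)) (t := n.natAbs.divisors)
    ?_ Subtype.val_injective.injOn (Finset.finite_toSet _)
  intro p hp
  simpa [hn] using Int.natCast_dvd.mp hp

/-- Hecke: for a cubic field `K`, `ζ_K(s)/ζ(s)` has an entire continuation `L`, and the
completed function `|Δ(K)|^{s/2}·L_∞(s)·L(s)` is invariant under `s ↦ 1−s` in the
critical strip. -/
theorem artinL_entire_and_functional_equation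
    (K : Type) [Field K] [NumberField K] (hK : Module.finrank ℚ K = 3) :
    ∃ L : ℂ → ℂ, Differentiable ℂ L ∧
      (∀ s : ℂ, 1 < s.re → L s * riemannZeta s = dedekindSeries K s) ∧
      ∀ s : ℂ, 0 < s.re → s.re < 1 →
        ((|NumberField.discr K| : ℤ) : ℂ) ^ (s / 2) * LInfty K s * L s =
          ((|NumberField.discr K| : ℤ) : ℂ) ^ ((1 - s) / 2) * LInfty K (1 - s) *
            L (1 - s) := by
  obtain ⟨c, T, θ, hθ⟩ := exists_isCubicGen hK
  have h3 : (3 : ℤ) ∣ 12 * c ^ 3 := ⟨4 * c ^ 3, by ring⟩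
  have h2 : (2 : ℤ) ∣ Eis.dsc (12 * c ^ 3) T :=
    ⟨72 * c ^ 6 * (12 * c ^ 3 - 3 * T ^ 2), by rw [Eis.dsc]; ring⟩
  obtain ⟨D₀, D, n, E, hD₀, hD, hE, hloc⟩ := hasCubicFactors_of_dsc_ne_zero h3 h2 hθ.dsc_ne_zero
  refine exists_entire_of_local_factors hK hD₀ hD E hE (finite_primes_dvd hθ.dsc_ne_zero).toFinset
    ?_ ?_
  · intro p hp s hs
    rw [Set.Finite.mem_toFinset] at hp
    exact (hloc p s hs).1 hp
  · intro p hp s hs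
    rw [Set.Finite.mem_toFinset] at hp
    have hp' : ¬ ((p : ℕ) : ℤ) ∣ Eis.dsc (12 * c ^ 3) T := hp
    by_cases ht : ∃ t : ℤ, ((p : ℕ) : ℤ) ∣ t ^ 2 - Eis.dsc (12 * c ^ 3) T
    · obtain ⟨t, ht⟩ := ht
      rw [(hloc p s hs).2.2 t hp' ht, hθ.localZeta_of_sq p.2 hp' ht]
      split_ifs <;> ring
    · push Not at ht
      rw [(hloc p s hs).2.1 hp' ht, hθ.localZeta_of_not_sq p.2 hp' ht]
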